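/- Let M and N be closed connected topological n-manifolds. Let e : B(0,2) → M and e' : B(0,2) → N be open embeddings of the open ball of radius 2 in ℝⁿ, let D = e(\bar{B}(0,1)) and D' = e'(\bar{B}(0,1)) be the images of the closed unit ball, and let P be the adjunction space obtained from the disjoint union (M ∖ int D) ⊔ (N ∖ int D') by identifying e(x) with e'(x) for every x ∈ ℝⁿ with ‖x‖ = 1 (a model of the connected sum M # N). Then cat(P) ≤ max{cat M, cat N}. -/

import Mathlib

open scoped Topology

/-- The Lusternik–Schnirelmann category of a space (normalized so that contractible spaces
have category 0): the least `k` such that `X` admits an open cover by `k+1` sets, each of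
which has nullhomotopic inclusion into `X` (i.e. is contractible in `X`). -/
noncomputable def lsCat (X : Type*) [TopologicalSpace X] : ℕ :=
  sInf {k : ℕ | ∃ U : Fin (k + 1) → Set X,
    (∀ i, IsOpen (U i)) ∧ (⋃ i, U i) = Set.univ ∧
    ∀ i, ContinuousMap.Nullhomotopic
      (⟨Subtype.val, continuous_subtype_val⟩ : C(U i, X))}

/-- The image, under an embedding of the open ball `B(0,2) ⊆ ℝⁿ`, of the closed unit ball. -/
def imageClosedUnitBall {n : ℕ} {M : Type*}
    (e : ↥(Metric.ball (0 : EuclideanSpace ℝ (Fin n)) 2) → M) : Set M :=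
  e '' {x : ↥(Metric.ball (0 : EuclideanSpace ℝ (Fin n)) 2) |
    ‖(x : EuclideanSpace ℝ (Fin n))‖ ≤ 1}

/-- The gluing relation on the disjoint union `(M ∖ int D) ⊔ (N ∖ int D')` identifying
`e x` with `e' x` for every `x` with `‖x‖ = 1`. -/
def connectedSumRel {n : ℕ} {M N : Type*} [TopologicalSpace M] [TopologicalSpace N]
    (e : ↥(Metric.ball (0 : EuclideanSpace ℝ (Fin n)) 2) → M)
    (e' : ↥(Metric.ball (0 : EuclideanSpace ℝ (Fin n)) 2) → N) :
    ({ m : M // m ∉ interior (imageClosedUnitBall e) } ⊕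
        { m : N // m ∉ interior (imageClosedUnitBall e') }) →
      ({ m : M // m ∉ interior (imageClosedUnitBall e) } ⊕
        { m : N // m ∉ interior (imageClosedUnitBall e') }) → Prop :=
  fun a b => ∃ x : ↥(Metric.ball (0 : EuclideanSpace ℝ (Fin n)) 2),
    ‖(x : EuclideanSpace ℝ (Fin n))‖ = 1 ∧
    match a, b with
    | Sum.inl m, Sum.inr m' => m.1 = e x ∧ m'.1 = e' x
    | _, _ => False

/-- The adjunction space `(M ∖ int D) ∪_h (N ∖ int D')`: a model of the connected sum
`M # N`, with the quotient topology. -/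
def ConnectedSum {n : ℕ} {M N : Type*} [TopologicalSpace M] [TopologicalSpace N]
    (e : ↥(Metric.ball (0 : EuclideanSpace ℝ (Fin n)) 2) → M)
    (e' : ↥(Metric.ball (0 : EuclideanSpace ℝ (Fin n)) 2) → N) : Type _ :=
  Quot (connectedSumRel e e')

instance {n : ℕ} {M N : Type*} [TopologicalSpace M] [TopologicalSpace N]
    (e : ↥(Metric.ball (0 : EuclideanSpace ℝ (Fin n)) 2) → M)
    (e' : ↥(Metric.ball (0 : EuclideanSpace ℝ (Fin n)) 2) → N) :
    TopologicalSpace (ConnectedSum e e') :=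
  inferInstanceAs (TopologicalSpace (Quot (connectedSumRel e e')))

open scoped Topology
namespace CS
set_option linter.all false
open Set

/-! ### Alexander–Spanier cochains mod 2 -/

/-- mod 2 cochains on lists -/
abbrev Co (X : Type*) := List X → ZMod 2

/-- the coboundary -/
def dd {X : Type*} (f : Co X) : Co X := fun l => 
  List.rec (motive := fun _ => Co X → ZMod 2) (fun _ => 0)
    (fun x v ih f => f v + ih (fun w => f (x :: w))) l f

section basic
variable {X Y : Type*}

@[simp] theorem dd_nil (f : Co X) : dd f [] = 0 := rfl
theorem dd_cons (f : Co X) (x : X) (v : List X) :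
    dd f (x :: v) = f v + dd (fun w => f (x :: w)) v := rfl

theorem z2 (a : ZMod 2) : a + a = 0 := CharTwo.add_self_eq_zero a
theorem co2 (a : Co X) : a + a = 0 := funext fun _ => z2 _
theorem z2_eq {a b : ZMod 2} (h : a + b = 0) : a = b := by
  rwa [CharTwo.add_eq_zero] at h
theorem z2_cases (a : ZMod 2) : a = 0 ∨ a = 1 := by
  revert a; decide

theorem dd_add (f g : Co X) : dd (f + g) = dd f + dd g := by
  funext v
  induction v generalizing f g with
  | nil => simp
  | cons x v ih =>
    have := ih (fun w => f (x :: w)) (fun w => g (x :: w))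
    simp only [dd_cons, Pi.add_apply] at this ⊢
    have h2 : (fun w => f (x :: w) + g (x :: w)) = (fun w => f (x :: w)) + (fun w => g (x :: w)) := rfl
    rw [h2, this]; ring

theorem dd_zero : dd (0 : Co X) = 0 := by
  have := dd_add (0 : Co X) 0
  rw [add_zero] at this
  rw [this]; exact co2 _

theorem dd_dd (f : Co X) : dd (dd f) = 0 := by
  funext v
  induction v generalizing f with
  | nil => simp
  | cons x v ih =>
    rw [dd_cons]
    have : (fun w => dd f (x :: w)) = f + dd (fun w => f (x :: w)) := by
      funext w; rw [dd_cons]; rfl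
    rw [this, dd_add, Pi.add_apply, ih, ← add_assoc, z2]; rfl

/-- `dd` as a linear map -/
def dL (X : Type*) : Co X →ₗ[ZMod 2] Co X where
  toFun := dd
  map_add' := dd_add
  map_smul' c f := by
    rcases z2_cases c with rfl | rfl
    · simp [dd_zero]
    · simp
@[simp] theorem dL_apply (f : Co X) : dL X f = dd f := rfl

theorem dd_sum {ι : Type*} (s : Finset ι) (f : ι → Co X) :
    dd (∑ i ∈ s, f i) = ∑ i ∈ s, dd (f i) := map_sum (dL X) f s

/-- pullback -/
def pb (g : X → Y) (f : Co Y) : Co X := fun v => f (v.map g)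
theorem pb_apply (g : X → Y) (f : Co Y) (v : List X) : pb g f v = f (v.map g) := rfl
theorem pb_add (g : X → Y) (f f' : Co Y) : pb g (f + f') = pb g f + pb g f' := rfl
theorem dd_pb (g : X → Y) (f : Co Y) : dd (pb g f) = pb g (dd f) := by
  funext v
  induction v generalizing f with
  | nil => simp [pb]
  | cons x v ih =>
    have := ih (fun w => f (g x :: w))
    simp only [pb_apply, List.map_cons, dd_cons] at this ⊢
    rw [← this]; rfl

theorem dd_const (c : ZMod 2) (v : List X) : dd (fun _ => c) v = v.length * c := by
  induction v with
  | nil => simp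
  | cons x v ih => rw [dd_cons, ih]; push_cast [List.length_cons]; ring

/-- the prism operator -/
def prism (g0 g1 : X → Y) (f : Co Y) : Co X := fun l =>
  List.rec (motive := fun _ => Co Y → ZMod 2) (fun _ => 0)
    (fun x v ih f => f (g0 x :: g1 x :: v.map g1) + ih (fun w => f (g0 x :: w))) l f
theorem prism_nil (g0 g1 : X → Y) (f : Co Y) : prism g0 g1 f [] = 0 := rfl
theorem prism_cons (g0 g1 : X → Y) (f : Co Y) (x : X) (v : List X) :
    prism g0 g1 f (x :: v) = f (g0 x :: g1 x :: v.map g1) +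
      prism g0 g1 (fun w => f (g0 x :: w)) v := rfl
theorem prism_add (g0 g1 : X → Y) (f g : Co Y) :
    prism g0 g1 (f + g) = prism g0 g1 f + prism g0 g1 g := by
  funext v
  induction v generalizing f g with
  | nil => simp [prism_nil]
  | cons x v ih =>
    have := ih (fun w => f (g0 x :: w)) (fun w => g (g0 x :: w))
    simp only [prism_cons, Pi.add_apply] at this ⊢
    have h2 : (fun w => f (g0 x :: w) + g (g0 x :: w)) = (fun w => f (g0 x :: w)) + (fun w => g (g0 x :: w)) := rfl
    rw [h2, this]; ring

theorem prism_formula (g0 g1 : X → Y) (f : Co Y) :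
    dd (prism g0 g1 f) + prism g0 g1 (dd f) = pb g1 f + pb g0 f := by
  funext v
  induction v generalizing f with
  | nil => simp [prism_nil, pb, z2]
  | cons x v ih =>
    have ih1 := ih (fun w => f (g0 x :: w))
    have e1 : (fun w => prism g0 g1 f (x :: w)) =
      pb g1 (fun w => f (g0 x :: g1 x :: w)) + prism g0 g1 (fun w => f (g0 x :: w)) := rfl
    have e2 : (fun w => dd f (g0 x :: w)) = f + dd (fun w => f (g0 x :: w)) := rfl
    simp only [Pi.add_apply] at ih1 ⊢
    rw [dd_cons, e1, dd_add, prism_cons, e2, prism_add, dd_pb, dd_cons, dd_cons]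
    simp only [Pi.add_apply, pb_apply, List.map_cons] at ih1 ⊢
    have := z2 (prism g0 g1 f v)
    have h2 := z2 (dd (fun w => f (g0 x :: g1 x :: w)) (v.map g1))
    have h3 := z2 (f (g0 x :: v.map g1))
    linear_combination this + h2 + ih1 + h3

theorem prism_zero_of (g0 g1 : X → Y) (O : Set Y) (m : ℕ) (f : Co Y)
    (hf : ∀ w : List Y, w.length = m + 1 → (∀ y ∈ w, y ∈ O) → f w = 0) (v : List X)
    (hv : v.length = m) (h0 : ∀ x ∈ v, g0 x ∈ O) (h1 : ∀ x ∈ v, g1 x ∈ O) :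
    prism g0 g1 f v = 0 := by
  induction v generalizing m f with
  | nil => rfl
  | cons x v ih =>
    rw [prism_cons, hf, zero_add]
    · obtain ⟨m, rfl⟩ : ∃ k, m = k + 1 := ⟨v.length, by simpa using hv.symm⟩
      apply ih m
      · intro w hw hwO
        apply hf _ (by simp [hw])
        intro y hy
        rcases List.mem_cons.1 hy with rfl | hy
        · exact h0 x (by simp)
        · exact hwO y hy
      · simpa using hv
      · intro y hy; exact h0 y (by simp [hy])
      · intro y hy; exact h1 y (by simp [hy])
    · simpa using hv
    · intro y hy
      rcases List.mem_cons.1 hy with rfl | hy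
      · exact h0 x (by simp)
      rcases List.mem_cons.1 hy with rfl | hy
      · exact h1 x (by simp)
      obtain ⟨z, hz, rfl⟩ := List.mem_map.1 hy
      exact h1 z (by simp [hz])
end basic

section supp
variable {X Y : Type*} [TopologicalSpace X] [TopologicalSpace Y]

/-- cochains of length `m` that are locally zero at all points outside `W` -/
def Sp (m : ℕ) (W : Set X) : Submodule (ZMod 2) (Co X) where
  carrier := {f | ∀ x, x ∉ W → ∃ O ∈ 𝓝 x, ∀ v : List X, v.length = m → (∀ y ∈ v, y ∈ O) → f v = 0}
  zero_mem' := fun _ _ => ⟨univ, Filter.univ_mem, fun _ _ _ => rfl⟩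
  add_mem' := by
    intro f g hf hg x hx
    obtain ⟨O, hO, h⟩ := hf x hx
    obtain ⟨O', hO', h'⟩ := hg x hx
    refine ⟨O ∩ O', Filter.inter_mem hO hO', fun v hv hy => ?_⟩
    simp only [Pi.add_apply]
    rw [h v hv fun y hy' => (hy y hy').1, h' v hv fun y hy' => (hy y hy').2, add_zero]
  smul_mem' := by
    intro c f hf x hx
    obtain ⟨O, hO, h⟩ := hf x hx
    exact ⟨O, hO, fun v hv hy => by simp [h v hv hy]⟩

theorem mem_Sp {m : ℕ} {W : Set X} {f : Co X} : f ∈ Sp m W ↔ ∀ x, x ∉ W → ∃ O ∈ 𝓝 x,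
    ∀ v : List X, v.length = m → (∀ y ∈ v, y ∈ O) → f v = 0 := Iff.rfl

theorem mem_Sp_open {m : ℕ} {W : Set X} {f : Co X} : f ∈ Sp m W ↔ ∀ x, x ∉ W → ∃ O, IsOpen O ∧ x ∈ O ∧
    ∀ v : List X, v.length = m → (∀ y ∈ v, y ∈ O) → f v = 0 := by
  rw [mem_Sp]
  refine forall₂_congr fun x _ => ⟨?_, ?_⟩
  · rintro ⟨O, hO, h⟩
    obtain ⟨O', h1, h2, h3⟩ := mem_nhds_iff.1 hO
    exact ⟨O', h2, h3, fun v hv hy => h v hv fun y hy' => h1 (hy y hy')⟩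
  · rintro ⟨O, hO, hx, h⟩
    exact ⟨O, hO.mem_nhds hx, h⟩

theorem Sp_mono {m : ℕ} {W W' : Set X} (h : W ⊆ W') : Sp m W ≤ (Sp m W' : Submodule _ (Co X)) :=
  fun _ hf x hx => hf x fun h' => hx (h h')

theorem Sp_univ {m : ℕ} (f : Co X) : f ∈ Sp m (univ : Set X) := fun x hx => (hx trivial).elim

theorem Sp_null_le {m : ℕ} {W : Set X} : Sp m ∅ ≤ (Sp m W : Submodule _ (Co X)) :=
  Sp_mono (empty_subset _)

/-- the support is closed -/
def supp (m : ℕ) (f : Co X) : Set X := {x | ¬ ∃ O ∈ 𝓝 x,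
    ∀ v : List X, v.length = m → (∀ y ∈ v, y ∈ O) → f v = 0}
theorem isClosed_supp (m : ℕ) (f : Co X) : IsClosed (supp m f) := by
  rw [← isOpen_compl_iff, isOpen_iff_mem_nhds]
  intro x hx
  simp only [supp, mem_compl_iff, mem_ofPred_eq, not_not] at hx
  obtain ⟨O, hO, h⟩ := hx
  obtain ⟨O', h1, h2, h3⟩ := mem_nhds_iff.1 hO
  refine Filter.mem_of_superset (h2.mem_nhds h3) fun y hy => ?_
  simp only [supp, mem_compl_iff, mem_ofPred_eq, not_not]
  exact ⟨O', h2.mem_nhds hy, fun v hv hy => h v hv fun z hz => h1 (hy z hz)⟩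
theorem supp_subset {m : ℕ} {W : Set X} {f : Co X} : f ∈ Sp m W ↔ supp m f ⊆ W := by
  constructor
  · intro h x hx
    by_contra h'
    exact hx (h x h')
  · intro h x hx
    by_contra h'
    exact hx (h h')

theorem Sp_inter {m : ℕ} {W W' : Set X} {f : Co X} (h : f ∈ Sp m W) (h' : f ∈ Sp m W') :
    f ∈ Sp m (W ∩ W') := by
  rw [supp_subset] at *; exact subset_inter h h'

theorem dd_eq_zero_of {X : Type*} (O : Set X) (m : ℕ) (f : Co X)
    (hf : ∀ w : List X, w.length = m → (∀ y ∈ w, y ∈ O) → f w = 0) (v : List X)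
    (hv : v.length = m + 1) (h0 : ∀ x ∈ v, x ∈ O) : dd f v = 0 := by
  induction v generalizing m f with
  | nil => rfl
  | cons x v ih =>
    have hv' : v.length = m := by simpa using hv
    rw [dd_cons, hf v hv' fun y hy => h0 y (by simp [hy]), zero_add]
    rcases v with _ | ⟨y, v⟩
    · rfl
    obtain ⟨m, rfl⟩ : ∃ k, m = k + 1 := ⟨v.length, by simpa using hv'.symm⟩
    apply ih m _ _ hv' fun y hy => h0 y (by simp [hy])
    intro w hw hwO
    apply hf _ (by simp [hw])
    intro z hz
    rcases List.mem_cons.1 hz with rfl | hz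
    · exact h0 _ (by simp)
    · exact hwO _ hz

theorem dd_mem {m : ℕ} {W : Set X} {f : Co X} (hf : f ∈ Sp m W) : dd f ∈ Sp (m + 1) W := by
  intro x hx
  obtain ⟨O, hO, h⟩ := hf x hx
  exact ⟨O, hO, fun v hv hy => dd_eq_zero_of O m f h v hv hy⟩

theorem pb_mem {m : ℕ} {W : Set Y} {f : Co Y} (hf : f ∈ Sp m W) {g : X → Y} (hg : Continuous g) :
    pb g f ∈ Sp m (g ⁻¹' W) := by
  intro x hx
  obtain ⟨O, hO, h⟩ := hf (g x) hx
  refine ⟨g ⁻¹' O, hg.continuousAt hO, fun v hv hy => h _ (by simpa using hv) ?_⟩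
  intro y hy'
  obtain ⟨z, hz, rfl⟩ := List.mem_map.1 hy'
  exact hy z hz

end supp

section hom
variable {X Y : Type*} [TopologicalSpace X] [TopologicalSpace Y] [CompactSpace X] [T2Space X]

/-- time slices -/
noncomputable def slice (H : X × ℝ → Y) (N i : ℕ) : X → Y := fun x => H (x, (i : ℝ) / N)

theorem exists_fine {H : X × ℝ → Y} (hH : Continuous H) {m : ℕ} {W : Set Y} (hW : IsOpen W)
    {f : Co Y} (hf : f ∈ Sp (m + 1) W) : ∃ N0 : ℕ, ∀ N ≥ N0, ∀ i < N,
      prism (slice H N i) (slice H N (i + 1)) f ∈ Sp m {x | ∃ t ∈ Icc (0 : ℝ) 1, H (x, t) ∈ W} := by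
  let _ := uniformSpaceOfCompactR1 (γ := X)
  set C : Set X := {x | ∀ t ∈ Icc (0 : ℝ) 1, H (x, t) ∉ W}
  have hC : IsClosed C := by
    have : C = ⋂ t ∈ Icc (0 : ℝ) 1, {x | H (x, t) ∈ Wᶜ} := by
      ext x; simp [C]
    rw [this]
    exact isClosed_biInter fun t _ => hW.isClosed_compl.preimage (by fun_prop)
  rw [mem_Sp_open] at hf
  choose! O hO hxO hfO using hf
  have hK : IsCompact (C ×ˢ Icc (0 : ℝ) 1) := hC.isCompact.prod isCompact_Icc
  obtain ⟨V, hV, hVK⟩ := lebesgue_number_lemma (ι := {y : Y // y ∉ W}) (U := fun y => H ⁻¹' (O y)) hK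
    (fun y => (hO y y.2).preimage hH) (by
      rintro ⟨x, t⟩ ⟨hx, ht⟩
      exact mem_iUnion.2 ⟨⟨H (x, t), hx t ht⟩, hxO _ (hx t ht)⟩)
  rw [uniformity_prod_eq_comap_prod, Filter.mem_comap] at hV
  obtain ⟨V', hV', hVV⟩ := hV
  obtain ⟨A, hA, B, hB, hAB⟩ := Filter.mem_prod_iff.1 hV'
  obtain ⟨ε, hε, hεB⟩ := Metric.mem_uniformity_dist.1 hB
  obtain ⟨N0, hN0⟩ := exists_nat_gt (1 / ε)
  refine ⟨N0, fun N hN i hi x hx => ?_⟩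
  have hNpos : (0 : ℝ) < N := by
    have : 0 < N := by omega
    exact_mod_cast this
  have hxC : x ∈ C := fun t ht h => hx ⟨t, ht, h⟩
  have hti : (i : ℝ) / N ∈ Icc (0 : ℝ) 1 := by
    have : (i : ℝ) ≤ N := by exact_mod_cast hi.le
    exact ⟨by positivity, by rw [div_le_one hNpos]; exact this⟩
  obtain ⟨y, hy⟩ := hVK (x, (i : ℝ) / N) ⟨hxC, hti⟩
  have key : ∀ z, (x, z) ∈ A → ∀ t : ℝ, |(i : ℝ) / N - t| < ε → H (z, t) ∈ O y := by
    intro z hz t ht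
    apply hy
    apply hVV
    exact hAB ⟨hz, hεB (by rwa [Real.dist_eq])⟩
  refine ⟨UniformSpace.ball x A, UniformSpace.ball_mem_nhds x hA, fun v hv hvA => ?_⟩
  refine prism_zero_of _ _ (O y) m f (hfO y y.2) v hv ?_ ?_
  · intro z hz
    exact key z (hvA z hz) _ (by simpa using hε)
  · intro z hz
    refine key z (hvA z hz) _ ?_
    have : (i : ℝ) / N - ((i + 1 : ℕ) : ℝ) / N = -(1 / N) := by
      push_cast; field_simp; ring
    rw [this, abs_neg, abs_of_pos (by positivity)]
    have h2 : (N0 : ℝ) ≤ N := by exact_mod_cast hN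
    rw [div_lt_iff₀ hNpos]
    rw [div_lt_iff₀ hε] at hN0
    nlinarith

/-- homotopy invariance with support control -/
theorem homotopy {H : X × ℝ → Y} (hH : Continuous H) {m : ℕ} {W W' : Set Y} (hW : IsOpen W) (hW' : IsOpen W')
    {f : Co Y} (hf : f ∈ Sp (m + 1) W) (hdf : dd f ∈ Sp (m + 2) W') :
    ∃ g ∈ Sp m {x | ∃ t ∈ Icc (0 : ℝ) 1, H (x, t) ∈ W}, g [] = 0 ∧
      pb (fun x => H (x, 1)) f + pb (fun x => H (x, 0)) f + dd g ∈
        Sp (m + 1) {x | ∃ t ∈ Icc (0 : ℝ) 1, H (x, t) ∈ W'} := by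
  obtain ⟨N0, h0⟩ := exists_fine hH hW hf
  obtain ⟨N1, h1⟩ := exists_fine hH hW' hdf
  set N := max (max N0 N1) 1
  have hN : 1 ≤ N := le_max_right _ _
  refine ⟨∑ i ∈ Finset.range N, prism (slice H N i) (slice H N (i + 1)) f,
    Submodule.sum_mem _ fun i hi => h0 N (by simp [N]) i (Finset.mem_range.1 hi),
    by simp [Finset.sum_apply, prism_nil], ?_⟩
  have key : ∀ n, pb (slice H N n) f + pb (slice H N 0) f +
      dd (∑ i ∈ Finset.range n, prism (slice H N i) (slice H N (i + 1)) f) =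
      ∑ i ∈ Finset.range n, prism (slice H N i) (slice H N (i + 1)) (dd f) := by
    intro n
    induction n with
    | zero => simp [dd_zero, co2]
    | succ n ih =>
      rw [Finset.sum_range_succ, Finset.sum_range_succ, ← ih, dd_add]
      have h3 := prism_formula (slice H N n) (slice H N (n + 1)) f
      have h4 := co2 (dd (prism (slice H N n) (slice H N (n + 1)) f))
      have h5 := co2 (pb (slice H N n) f)
      linear_combination h4 - h3 - h5
  have := key N
  have e1 : slice H N N = fun x => H (x, 1) := by
    funext x; simp only [slice]; rw [div_self]; positivity
  have e0 : slice H N 0 = fun x => H (x, 0) := by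
    funext x; simp only [slice]; simp
  rw [e1, e0] at this
  rw [this]
  exact Submodule.sum_mem _ fun i hi => h1 N (by simp [N]) i (Finset.mem_range.1 hi)
end hom
end CS

open scoped Topology
namespace CS
set_option linter.all false
open Set

section
variable {X Y : Type*} [TopologicalSpace X] [TopologicalSpace Y]

/-- cocycles of degree `k` supported in `W` -/
def Cy (k : ℕ) (W : Set X) (f : Co X) : Prop := f ∈ Sp (k + 1) W ∧ dd f ∈ Sp (k + 2) ∅
/-- coboundaries of degree `k` with primitive supported in `W` -/
def Ex (k : ℕ) (W : Set X) (f : Co X) : Prop :=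
  ∃ g, g ∈ Sp k W ∧ g [] = 0 ∧ f + dd g ∈ Sp (k + 1) ∅

theorem Cy.add {k : ℕ} {W : Set X} {f g : Co X} (hf : Cy k W f) (hg : Cy k W g) : Cy k W (f + g) :=
  ⟨add_mem hf.1 hg.1, by rw [dd_add]; exact add_mem hf.2 hg.2⟩
theorem Ex.add {k : ℕ} {W : Set X} {f g : Co X} (hf : Ex k W f) (hg : Ex k W g) : Ex k W (f + g) := by
  obtain ⟨a, h1, h2, h3⟩ := hf
  obtain ⟨b, h4, h5, h6⟩ := hg
  refine ⟨a + b, add_mem h1 h4, by simp [h2, h5], ?_⟩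
  rw [dd_add]
  have := add_mem h3 h6
  convert this using 1; abel
theorem Cy.mono {k : ℕ} {W W' : Set X} {f : Co X} (hf : Cy k W f) (h : W ⊆ W') : Cy k W' f :=
  ⟨Sp_mono h hf.1, hf.2⟩
theorem Ex.mono {k : ℕ} {W W' : Set X} {f : Co X} (hf : Ex k W f) (h : W ⊆ W') : Ex k W' f := by
  obtain ⟨a, h1, h2, h3⟩ := hf
  exact ⟨a, Sp_mono h h1, h2, h3⟩
theorem Ex.of_null {k : ℕ} {W : Set X} {f : Co X} (hf : f ∈ Sp (k + 1) ∅) : Ex k W f :=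
  ⟨0, zero_mem _, rfl, by rw [dd_zero, add_zero]; exact hf⟩
theorem Cy.of_null {k : ℕ} {W : Set X} {f : Co X} (hf : f ∈ Sp (k + 1) ∅) : Cy k W f :=
  ⟨Sp_null_le hf, dd_mem hf⟩
theorem Cy.dd {k : ℕ} {W : Set X} {f : Co X} (hf : f ∈ Sp k W) : Cy k W (dd f) :=
  ⟨dd_mem hf, by rw [dd_dd]; exact zero_mem _⟩
theorem Ex.dd {k : ℕ} {W : Set X} {f : Co X} (hf : f ∈ Sp k W) (h : f [] = 0) : Ex k W (dd f) :=
  ⟨f, hf, h, by rw [co2]; exact zero_mem _⟩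
/-- move along a coboundary and null germ -/
theorem add_add_cancel' (a b : Co X) : a + b + b = a := by rw [add_assoc, co2, add_zero]
theorem Ex.congr {k : ℕ} {W : Set X} {f g : Co X} (hf : Ex k W f) (h : Ex k W (f + g)) : Ex k W g := by
  have := hf.add h
  rwa [← add_assoc, co2, zero_add] at this
theorem Ex.Cy {k : ℕ} {W : Set X} {f : Co X} (hf : Ex k W f) : Cy k W f := by
  obtain ⟨a, h1, h2, h3⟩ := hf
  have := (Cy.of_null (W := W) h3).add (Cy.dd h1)
  rwa [add_add_cancel'] at this

theorem Cy.pb {k : ℕ} {W : Set Y} {f : Co Y} (hf : Cy k W f) {g : X → Y} (hg : Continuous g) :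
    Cy k (g ⁻¹' W) (pb g f) :=
  ⟨pb_mem hf.1 hg, by rw [dd_pb]; exact pb_mem hf.2 hg⟩
theorem Ex.pb {k : ℕ} {W : Set Y} {f : Co Y} (hf : Ex k W f) {g : X → Y} (hg : Continuous g) :
    Ex k (g ⁻¹' W) (pb g f) := by
  obtain ⟨a, h1, h2, h3⟩ := hf
  refine ⟨CS.pb g a, pb_mem h1 hg, by simpa [pb_apply] using h2, ?_⟩
  rw [dd_pb, ← pb_add]; exact pb_mem h3 hg

open Classical in
/-- cut off a cochain by the position of its first vertex -/
noncomputable def cut (O : Set X) (f : Co X) : Co X := fun v =>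
  match v with
  | [] => 0
  | x :: w => if x ∈ O then f (x :: w) else 0
theorem cut_nil (O : Set X) (f : Co X) : cut O f [] = 0 := rfl
open Classical in
theorem cut_cons (O : Set X) (f : Co X) (x : X) (w : List X) :
    cut O f (x :: w) = if x ∈ O then f (x :: w) else 0 := rfl

theorem cut_mem_of {m : ℕ} {O : Set X} {f : Co X} {W : Set X} (hf : f ∈ Sp m W) : cut O f ∈ Sp m W := by
  intro x hx
  obtain ⟨P, hP, h⟩ := hf x hx
  refine ⟨P, hP, fun v hv hy => ?_⟩
  rcases v with _ | ⟨y, v⟩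
  · rfl
  rw [cut_cons, h _ hv hy, ite_self]

theorem cut_mem_closure {m : ℕ} {O : Set X} {f : Co X} : cut O f ∈ Sp m (closure O) := by
  intro x hx
  refine ⟨(closure O)ᶜ, isClosed_closure.isOpen_compl.mem_nhds hx, fun v hv hy => ?_⟩
  rcases v with _ | ⟨y, v⟩
  · rfl
  rw [cut_cons, if_neg]
  exact fun h => hy y (by simp) (subset_closure h)

/-- where `O` is a neighbourhood, the cut is the identity -/
theorem cut_add_mem {m : ℕ} {O : Set X} {f : Co X} (hO : IsOpen O) (h0 : m ≠ 0) : cut O f + f ∈ Sp m Oᶜ := by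
  intro x hx
  rw [notMem_compl_iff] at hx
  refine ⟨O, hO.mem_nhds hx, fun v hv hy => ?_⟩
  rcases v with _ | ⟨y, v⟩
  · simp at hv; omega
  rw [Pi.add_apply, cut_cons, if_pos (hy y (by simp)), z2]

/-- Mayer–Vietoris splitting -/
theorem split [NormalSpace X] {m : ℕ} (hm : m ≠ 0) {U V : Set X} (hU : IsOpen U) (hV : IsOpen V) {f : Co X}
    (hf : f ∈ Sp m (U ∪ V)) : ∃ f1 ∈ Sp m U, ∃ f2 ∈ Sp m V, f = f1 + f2 ∧ f1 [] = 0 ∧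
      f2 [] = f [] := by
  have hK : IsClosed (supp m f \ V) := (isClosed_supp m f).sdiff hV
  have hKU : supp m f \ V ⊆ U := by
    rintro x ⟨hx, hxV⟩
    exact ((supp_subset.1 hf) hx).resolve_right hxV
  obtain ⟨O, hO, h1, h2⟩ := normal_exists_closure_subset hK hU hKU
  refine ⟨cut O f, Sp_mono h2 cut_mem_closure, cut O f + f, ?_, ?_, rfl, ?_⟩
  · have h3 := cut_add_mem (f := f) hO hm
    have h4 : cut O f + f ∈ Sp m (supp m f) := by
      have : f ∈ Sp m (supp m f) := supp_subset.2 subset_rfl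
      exact add_mem (cut_mem_of this) this
    refine Sp_mono ?_ (Sp_inter h3 h4)
    rintro x ⟨hx1, hx2⟩
    by_contra hx
    exact hx1 (h1 ⟨hx2, hx⟩)
  · rw [← add_assoc, co2, zero_add]
  · simp [cut_nil]

theorem dd_congr_len {f g : Co X} {m : ℕ} (h : ∀ v : List X, v.length = m → f v = g v) (v : List X)
    (hv : v.length = m + 1) : dd f v = dd g v := by
  have : dd (f + g) v = 0 := dd_eq_zero_of univ m _ (fun w hw _ => by
    rw [Pi.add_apply, h w hw, z2]) v hv (fun _ _ => trivial)
  rw [dd_add] at this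
  exact z2_eq this

/-- a cochain depending only on length and satisfying the cocycle condition at one constant list -/
theorem const_exact {k : ℕ} (hk : 1 ≤ k) (c : ZMod 2) (h : Odd (k + 2) → c = 0) {f : Co X}
    (hf : ∀ v : List X, v.length = k + 1 → f v = c) : Ex k univ f := by
  classical
  by_cases hc : c = 0
  · exact Ex.of_null fun x _ => ⟨univ, Filter.univ_mem, fun v hv _ => by rw [hf v hv, hc]⟩
  have hodd : ¬ Odd (k + 2) := fun h' => hc (h h')
  refine ⟨fun v => if v = [] then 0 else c, Sp_univ _, by simp, fun x _ => ⟨univ, Filter.univ_mem, fun v hv _ => ?_⟩⟩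
  rw [Pi.add_apply, hf v hv, dd_congr_len (g := fun _ => c) (m := k) _ v hv, dd_const, hv]
  · have : ((k + 1 : ℕ) : ZMod 2) = 1 := by
      rw [ZMod.natCast_eq_one_iff_odd]
      rw [Nat.not_odd_iff_even] at hodd
      rcases hodd with ⟨r, hr⟩
      exact ⟨r - 1, by omega⟩
    rw [this, one_mul, z2]
  · intro w hw
    rw [if_neg]
    rintro rfl
    simp at hw; omega

theorem dd_replicate (f : Co X) (q : X) (m : ℕ) : dd f (List.replicate (m + 1) q) =
    (m + 1 : ℕ) * f (List.replicate m q) := by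
  induction m generalizing f with
  | zero => simp [dd_cons]
  | succ m ih =>
    rw [List.replicate_succ, dd_cons, ih]
    push_cast
    rw [← List.replicate_succ]; ring

theorem cocycle_replicate {k : ℕ} {f : Co X} (q : X) (hf : dd f ∈ Sp (k + 2) ∅) (h : Odd (k + 2)) :
    f (List.replicate (k + 1) q) = 0 := by
  obtain ⟨O, hO, h2⟩ := hf q (by simp)
  have := h2 (List.replicate (k + 2) q) (by simp) (by
    intro y hy; rw [List.eq_of_mem_replicate hy]; exact mem_of_mem_nhds hO)
  rw [dd_replicate, (ZMod.natCast_eq_one_iff_odd (n := k + 1 + 1)).2 h, one_mul] at this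
  exact this

/-- if the compact space `X` maps to `Y` by a nullhomotopic map, cocycles become exact -/
theorem null_exact [CompactSpace X] [T2Space X] {H : X × ℝ → Y} (hH : Continuous H) {q : Y}
    (h1 : ∀ x, H (x, 1) = q) {k : ℕ} (hk : 1 ≤ k) {f : Co Y} (hf : dd f ∈ Sp (k + 2) ∅) :
    Ex k univ (pb (fun x => H (x, 0)) f) := by
  obtain ⟨g, hg, hg0, hgf⟩ := homotopy hH (m := k) isOpen_univ isOpen_empty (Sp_univ f) hf
  have hc : Ex k univ (pb (fun x => H (x, 1)) f) := by
    apply const_exact hk (f (List.replicate (k + 1) q)) (cocycle_replicate q hf)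
    intro v hv
    simp only [h1, pb_apply, List.map_const', hv]
  refine hc.congr ⟨g, Sp_univ _, hg0, ?_⟩
  simpa using hgf

/-- `W` has the compactly supported cohomology of an open `n`-cell -/
structure CellLike (n : ℕ) (W : Set X) : Prop where
  van : ∀ k, k ≠ n → ∀ f, Cy k W f → Ex k W f
  gen : ∃ z, Cy n W z ∧ ¬ Ex n W z
  uniq : ∀ f g, Cy n W f → Cy n W g → ¬ Ex n W f → ¬ Ex n W g → Ex n W (f + g)
end

section susp
variable {Y : Type*} [TopologicalSpace Y] [CompactSpace Y] [T2Space Y]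
open unitInterval

/-- push down -/
noncomputable def Hdn : (Y × I) × ℝ → Y × I := fun p => (p.1.1, p.1.2 * projIcc 0 1 zero_le_one (1 - p.2))
/-- push up -/
noncomputable def Hup : (Y × I) × ℝ → Y × I := fun p => (p.1.1, σ (σ p.1.2 * projIcc 0 1 zero_le_one (1 - p.2)))
theorem continuous_Hdn : Continuous (Hdn (Y := Y)) := by
  unfold Hdn
  have : Continuous fun p : (Y × I) × ℝ => projIcc (0:ℝ) 1 zero_le_one (1 - p.2) :=
    continuous_projIcc.comp (by fun_prop)
  fun_prop
theorem continuous_Hup : Continuous (Hup (Y := Y)) := by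
  unfold Hup
  have : Continuous fun p : (Y × I) × ℝ => projIcc (0:ℝ) 1 zero_le_one (1 - p.2) :=
    continuous_projIcc.comp (by fun_prop)
  have h2 : Continuous unitInterval.symm := unitInterval.continuous_symm
  fun_prop
theorem Hdn_zero : (fun x => Hdn (Y := Y) (x, 0)) = id := by
  funext x; ext1
  · simp [Hdn]
  · simp [Hdn]
theorem Hup_zero : (fun x => Hup (Y := Y) (x, 0)) = id := by
  funext x; ext1
  · simp [Hup]
  · simp [Hup]
theorem Hdn_one (x : Y × I) : Hdn (x, 1) = (x.1, 0) := by
  ext1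
  · simp [Hdn]
  · simp [Hdn]
theorem Hup_one (x : Y × I) : Hup (x, 1) = (x.1, 1) := by
  ext1
  · simp [Hup]
  · simp [Hup]

/-- a cocycle vanishing near the bottom is exact -/
theorem dn_exact {k : ℕ} {A : Set Y} (hA : IsOpen A) {f : Co (Y × I)} (hf : Cy k (A ×ˢ Ioi 0) f) :
    Ex k (A ×ˢ Ioi 0) f := by
  obtain ⟨g, hg, hg0, h⟩ := homotopy continuous_Hdn (m := k) (hA.prod isOpen_Ioi) isOpen_empty hf.1 hf.2
  refine ⟨g, Sp_mono ?_ hg, hg0, ?_⟩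
  · rintro ⟨y, s⟩ ⟨t, ht, h1, h2⟩
    refine ⟨h1, ?_⟩
    simp only [Hdn, mem_Ioi] at h2 ⊢
    rcases eq_or_lt_of_le (show 0 ≤ s from s.2.1) with h | h
    · rw [← h, zero_mul] at h2; exact absurd h2 (lt_irrefl _)
    · exact h
  · rw [Hdn_zero] at h
    have h2 : CS.pb (fun x => Hdn (x, 1)) f ∈ Sp (k + 1) ∅ := by
      refine Sp_mono ?_ (pb_mem hf.1 (continuous_Hdn.comp (by fun_prop)))
      rintro x ⟨_, hx⟩
      simp [Hdn_one] at hx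
    have h3 := add_mem h2 (Sp_mono (by rintro x ⟨t, _, ht⟩; exact ht) h)
    rw [← add_assoc, ← add_assoc, co2, zero_add] at h3
    have e : CS.pb id f = f := by funext v; simp [pb_apply]
    rwa [e] at h3

/-- the relation realizing the suspension isomorphism -/
def SRel (k : ℕ) (A : Set Y) (f : Co (Y × I)) (u : Co Y) : Prop :=
  ∃ g, g ∈ Sp (k + 1) (A ×ˢ Ioi (0 : I)) ∧ f + dd g ∈ Sp (k + 2) ∅ ∧ g [] = 0 ∧
    u + CS.pb (fun y => (y, (1 : I))) g ∈ Sp (k + 1) ∅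

theorem SRel.add {k : ℕ} {A : Set Y} {f f' : Co (Y × I)} {u u' : Co Y} (h : SRel k A f u)
    (h' : SRel k A f' u') : SRel k A (f + f') (u + u') := by
  obtain ⟨g, h1, h2, h3, h4⟩ := h
  obtain ⟨g', h1', h2', h3', h4'⟩ := h'
  refine ⟨g + g', add_mem h1 h1', ?_, by simp [h3, h3'], ?_⟩
  · rw [dd_add]
    convert add_mem h2 h2' using 1; abel
  · rw [pb_add]
    convert add_mem h4 h4' using 1; abel

theorem exists_SRel {k : ℕ} {A : Set Y} (hA : IsOpen A) {f : Co (Y × I)}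
    (hf : Cy (k + 1) (A ×ˢ Ioo 0 1) f) : ∃ u, SRel k A f u := by
  obtain ⟨g, h1, h2, h3⟩ := dn_exact hA (hf.mono (prod_mono subset_rfl Ioo_subset_Ioi_self))
  exact ⟨_, g, h1, h3, h2, by rw [co2]; exact zero_mem _⟩

theorem SRel.cy {k : ℕ} {A : Set Y} {f : Co (Y × I)} {u : Co Y}
    (hf : Cy (k + 1) (A ×ˢ Ioo 0 1) f) (h : SRel k A f u) : Cy k A u := by
  obtain ⟨g, h1, h2, h3, h5⟩ := h
  suffices h : Cy k A (CS.pb (fun y => (y, (1 : I))) g) by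
    have := (Cy.of_null h5).add h
    rwa [add_add_cancel'] at this
  have hc : Continuous (fun y : Y => (y, (1 : I))) := by fun_prop
  refine ⟨Sp_mono ?_ (pb_mem h1 hc), ?_⟩
  · rintro y hy; exact hy.1
  · rw [dd_pb]
    have h4 := add_mem (Sp_null_le h2) hf.1
    rw [add_comm f, add_add_cancel'] at h4
    refine Sp_mono ?_ (pb_mem h4 hc)
    rintro y hy; exact absurd hy.2.2 (lt_irrefl _)

theorem SRel.ex_of {k : ℕ} {A : Set Y} (hA : IsOpen A) {f : Co (Y × I)} {u : Co Y}
    (hf : Cy (k + 1) (A ×ˢ Ioo 0 1) f) (h : SRel k A f u) (hu : Ex k A u) : Ex (k + 1) (A ×ˢ Ioo 0 1) f := by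
  obtain ⟨g, h1, h2, h3, h5⟩ := h
  replace hu := hu.congr (Ex.of_null h5)
  obtain ⟨w, hw1, hw2, hw3⟩ := hu
  have hdg : dd g ∈ Sp (k + 2) (A ×ˢ Ioo 0 1) := by
    have := add_mem (Sp_null_le h2) hf.1
    rwa [add_comm f, add_add_cancel'] at this
  -- homotopy up
  obtain ⟨p, hp, hp0, hpg⟩ := homotopy continuous_Hup (m := k) (hA.prod isOpen_univ)
    (hA.prod isOpen_Ioo) (Sp_mono (prod_mono subset_rfl (subset_univ _)) h1) hdg
  set g' := p + CS.pb Prod.fst w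
  have hg' : g' ∈ Sp k (A ×ˢ univ) := by
    apply add_mem
    · refine Sp_mono ?_ hp
      rintro x ⟨t, _, ht⟩; exact ⟨ht.1, trivial⟩
    · refine Sp_mono ?_ (pb_mem hw1 continuous_fst)
      rintro x hx; exact ⟨hx, trivial⟩
  have hg'0 : g' [] = 0 := by simp [g', hp0, pb_apply, hw2]
  have hsum : g + dd g' ∈ Sp (k + 1) (univ ×ˢ Iio 1) := by
    have a1 : CS.pb (fun x => Hup (x, 1)) g + CS.pb (fun x => Hup (x, 0)) g + dd p ∈
        Sp (k + 1) (univ ×ˢ Iio (1 : I)) := by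
      refine Sp_mono ?_ hpg
      rintro ⟨y, s⟩ ⟨t, _, ht⟩
      refine ⟨trivial, ?_⟩
      rcases eq_or_lt_of_le (show s ≤ 1 from s.2.2) with h | h
      · have := ht.2.2
        simp only [Hup, h] at this
        simp at this
      · exact h
    have a2 := pb_mem hw3 (continuous_fst : Continuous (Prod.fst : Y × I → Y))
    have e1 : CS.pb Prod.fst (CS.pb (fun y : Y => (y, (1 : I))) g) = CS.pb (fun x => Hup (x, 1)) g := by
      funext v
      simp only [pb_apply, List.map_map]
      congr 2; funext x; simp [Hup_one]
    have e : CS.pb id g = g := by funext v; simp [pb_apply]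
    rw [Hup_zero, e] at a1
    rw [pb_add, e1, ← dd_pb] at a2
    have := add_mem a1 (Sp_null_le a2)
    convert this using 1
    rw [show g' = p + CS.pb Prod.fst w from rfl, dd_add]
    have := co2 (CS.pb (fun x => Hup (x, 1)) g)
    linear_combination -this
  -- cut near the top
  obtain ⟨O, hO1, hO2, hO3⟩ : ∃ O : Set (Y × I), IsOpen O ∧ univ ×ˢ {1} ⊆ O ∧ closure O ⊆ univ ×ˢ Ioi 0 := by
    apply normal_exists_closure_subset
    · exact isClosed_univ.prod isClosed_singleton
    · exact isOpen_univ.prod isOpen_Ioi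
    · rintro ⟨y, s⟩ ⟨_, rfl⟩; exact ⟨trivial, by simp⟩
  have hcut : cut O g' + g' ∈ Sp k (univ ×ˢ Iio 1) := by
    by_cases hk : k = 0
    · subst hk
      intro x _
      refine ⟨univ, Filter.univ_mem, fun v hv _ => ?_⟩
      rw [List.length_eq_zero_iff.1 hv]
      simp [cut_nil, hg'0]
    refine Sp_mono ?_ (cut_add_mem hO1 hk)
    rintro ⟨y, s⟩ h
    refine ⟨trivial, ?_⟩
    rcases eq_or_lt_of_le (show s ≤ 1 from s.2.2) with h' | h'
    · exact absurd (hO2 ⟨trivial, mem_singleton_iff.2 h'⟩) h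
    · exact h'
  refine ⟨g + dd (cut O g'), ?_, ?_, ?_⟩
  · have b1 : g + dd (cut O g') ∈ Sp (k + 1) (A ×ˢ Ioi 0) := by
      refine add_mem h1 (dd_mem ?_)
      refine Sp_mono ?_ (Sp_inter (cut_mem_of (O := O) hg') (cut_mem_closure (O := O)))
      rintro x ⟨hx1, hx2⟩; exact ⟨hx1.1, (hO3 hx2).2⟩
    have b2 : g + dd (cut O g') ∈ Sp (k + 1) (univ ×ˢ Iio 1) := by
      have := add_mem hsum (dd_mem hcut)
      rw [dd_add (cut O g')] at this
      convert this using 1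
      have := co2 (dd g')
      linear_combination -this
    refine Sp_mono ?_ (Sp_inter b1 b2)
    rintro x ⟨hx1, hx2⟩; exact ⟨hx1.1, hx1.2, hx2.2⟩
  · simp [h3]
  · rw [dd_add, dd_dd, add_zero]; exact h2

theorem SRel.of_ex {k : ℕ} {A : Set Y} (hA : IsOpen A) {f : Co (Y × I)} {u : Co Y}
    (h : SRel k A f u) (hu : Ex (k + 1) (A ×ˢ Ioo 0 1) f) : Ex k A u := by
  obtain ⟨g, h1, h2, h3, h55⟩ := h
  suffices h : Ex k A (CS.pb (fun y => (y, (1 : I))) g) by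
    have := (Ex.of_null h55).add h
    rwa [add_add_cancel'] at this
  obtain ⟨w, hw1, hw2, hw3⟩ := hu
  have hc : Continuous (fun y : Y => (y, (1 : I))) := by fun_prop
  have hcy : Cy k (A ×ˢ Ioi (0 : I)) (g + w) := by
    refine ⟨add_mem h1 (Sp_mono (prod_mono subset_rfl Ioo_subset_Ioi_self) hw1), ?_⟩
    have := add_mem h2 hw3
    rw [dd_add]
    convert this using 1
    have := co2 f
    linear_combination -this
  have h5 := (dn_exact hA hcy).pb hc
  have h6 : CS.pb (fun y : Y => (y, (1 : I))) w ∈ Sp (k + 1) ∅ := by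
    refine Sp_mono ?_ (pb_mem hw1 hc)
    rintro y hy; exact absurd hy.2.2 (lt_irrefl _)
  rw [pb_add] at h5
  have := (h5.mono (by rintro y hy; exact hy.1)).add (Ex.of_null (W := A) h6)
  rwa [add_add_cancel'] at this

theorem SRel.exists_of {k : ℕ} {A : Set Y} (hA : IsOpen A) {u : Co Y} (hu : Cy k A u) :
    ∃ f, Cy (k + 1) (A ×ˢ Ioo 0 1) f ∧ SRel k A f u := by
  obtain ⟨O, hO1, hO2, hO3⟩ : ∃ O : Set (Y × I), IsOpen O ∧ univ ×ˢ {1} ⊆ O ∧ closure O ⊆ univ ×ˢ Ioi 0 := by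
    apply normal_exists_closure_subset
    · exact isClosed_univ.prod isClosed_singleton
    · exact isOpen_univ.prod isOpen_Ioi
    · rintro ⟨y, s⟩ ⟨_, rfl⟩; exact ⟨trivial, by simp⟩
  set w : Co (Y × I) := CS.pb Prod.fst u
  have hw : w ∈ Sp (k + 1) (A ×ˢ univ) := by
    refine Sp_mono ?_ (pb_mem hu.1 continuous_fst)
    rintro x hx; exact ⟨hx, trivial⟩
  have hdw : dd w ∈ Sp (k + 2) ∅ := by rw [dd_pb]; exact pb_mem hu.2 continuous_fst
  have hg : cut O w ∈ Sp (k + 1) (A ×ˢ Ioi 0) := by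
    refine Sp_mono ?_ (Sp_inter (cut_mem_of (O := O) hw) (cut_mem_closure (O := O)))
    rintro x ⟨hx1, hx2⟩; exact ⟨hx1.1, (hO3 hx2).2⟩
  have hdg : dd (cut O w) ∈ Sp (k + 2) (A ×ˢ Ioo 0 1) := by
    have b : dd (cut O w) ∈ Sp (k + 2) Oᶜ := by
      have := add_mem (dd_mem (cut_add_mem (f := w) hO1 (Nat.succ_ne_zero k))) (Sp_null_le hdw)
      rwa [dd_add, add_add_cancel'] at this
    refine Sp_mono ?_ (Sp_inter (dd_mem hg) b)
    rintro ⟨y, s⟩ ⟨hx1, hx2⟩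
    refine ⟨hx1.1, hx1.2, ?_⟩
    rcases eq_or_lt_of_le (show s ≤ 1 from s.2.2) with h' | h'
    · exact absurd (hO2 ⟨trivial, mem_singleton_iff.2 h'⟩) hx2
    · exact h'
  refine ⟨dd (cut O w), ⟨hdg, by rw [dd_dd]; exact zero_mem _⟩, cut O w, hg, ?_, cut_nil _ _, ?_⟩
  · rw [co2]; exact zero_mem _
  · intro x _
    refine ⟨univ, Filter.univ_mem, fun v hv _ => ?_⟩
    rcases v with _ | ⟨y, v⟩
    · simp at hv
    rw [Pi.add_apply, pb_apply, List.map_cons, cut_cons, if_pos (hO2 ⟨trivial, mem_singleton_iff.2 rfl⟩)]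
    simp [w, pb_apply, Function.comp_def, z2]

theorem CellLike.susp {n : ℕ} {A : Set Y} (hA : IsOpen A) (h : CellLike n A) :
    CellLike (n + 1) (A ×ˢ Ioo (0 : I) 1) := by
  refine ⟨?_, ?_, ?_⟩
  · intro k hk f hf
    rcases k with _ | k
    · obtain ⟨g, h1, h2, h3⟩ := dn_exact hA (hf.mono (prod_mono subset_rfl Ioo_subset_Ioi_self))
      refine Ex.of_null ?_
      have : dd g ∈ Sp 1 ∅ := by
        intro x _
        refine ⟨univ, Filter.univ_mem, fun v hv _ => ?_⟩
        obtain ⟨a, rfl⟩ := List.length_eq_one_iff.1 hv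
        simp [dd_cons, h2]
      have := add_mem h3 this
      rwa [add_add_cancel'] at this
    · obtain ⟨u, hu⟩ := exists_SRel hA hf
      exact hu.ex_of hA hf (h.van k (by omega) u (hu.cy hf))
  · obtain ⟨u, hu, hu'⟩ := h.gen
    obtain ⟨f, hf, hfu⟩ := SRel.exists_of hA hu
    exact ⟨f, hf, fun he => hu' (hfu.of_ex hA he)⟩
  · intro f g hf hg hf' hg'
    obtain ⟨u, hu⟩ := exists_SRel hA hf
    obtain ⟨w, hw⟩ := exists_SRel hA hg
    exact (hu.add hw).ex_of hA (hf.add hg) (h.uniq u w (hu.cy hf) (hw.cy hg)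
      (fun h' => hf' (hu.ex_of hA hf h')) (fun h' => hg' (hw.ex_of hA hg h')))
end susp
end CS

open scoped Topology
namespace CS
set_option linter.all false
open Set

section transport
variable {X Y : Type*} [TopologicalSpace X] [TopologicalSpace Y] 

open Classical in
/-- push forward along an injective map -/
noncomputable def pf (φ : X → Y) (f : Co X) : Co Y := fun v =>
  if h : ∃ w : List X, w.map φ = v then f h.choose else 0

theorem pf_map {φ : X → Y} (hi : Function.Injective φ) (f : Co X) (w : List X) : pf φ f (w.map φ) = f w := by
  have h : ∃ w' : List X, w'.map φ = w.map φ := ⟨w, rfl⟩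
  rw [pf, dif_pos h]
  congr 1
  exact (List.map_injective_iff.2 hi) h.choose_spec

theorem pb_pf {φ : X → Y} (hi : Function.Injective φ) (f : Co X) : pb φ (pf φ f) = f := by
  funext v; rw [pb_apply, pf_map hi]

theorem pf_add {φ : X → Y} (f g : Co X) : pf φ (f + g) = pf φ f + pf φ g := by
  funext v
  simp only [pf, Pi.add_apply]
  split_ifs <;> simp

theorem exists_list_map {φ : X → Y} {v : List Y} (h : ∀ y ∈ v, y ∈ range φ) : ∃ w : List X, w.map φ = v := by
  induction v with
  | nil => exact ⟨[], rfl⟩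
  | cons a v ih =>
    obtain ⟨w, rfl⟩ := ih fun y hy => h y (List.mem_cons_of_mem _ hy)
    obtain ⟨b, rfl⟩ := h a (by simp)
    exact ⟨b :: w, rfl⟩

theorem pf_nil {φ : X → Y} (f : Co X) : pf φ f [] = f [] := by
  have h : ∃ w : List X, w.map φ = [] := ⟨[], rfl⟩
  rw [pf, dif_pos h]
  congr 1
  simpa using h.choose_spec

variable [CompactSpace X] [T2Space Y] {φ : X → Y}

theorem pf_mem (hφ : Continuous φ) (hi : Function.Injective φ) {m : ℕ} (hm : m ≠ 0) {W : Set X} {f : Co X} (hf : f ∈ Sp m W) : pf φ f ∈ Sp m (φ '' W) := by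
  intro y hy
  by_cases hyr : y ∈ range φ
  · obtain ⟨x, rfl⟩ := hyr
    obtain ⟨O, hO, hx, h⟩ := (mem_Sp_open.1 hf) x (fun h => hy ⟨x, h, rfl⟩)
    have hc : IsClosed (φ '' Oᶜ) := (hO.isClosed_compl.isCompact.image hφ).isClosed
    refine ⟨(φ '' Oᶜ)ᶜ, hc.isOpen_compl.mem_nhds ?_, fun v hv hvO => ?_⟩
    · rintro ⟨x', hx', h'⟩
      rw [hi h'] at hx'
      exact hx' hx
    · rw [pf]
      split_ifs with h1
      · have h2 := h1.choose_spec
        set w := h1.choose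
        refine h w (by rw [← h2] at hv; simpa using hv) fun z hz => ?_
        by_contra hzO
        exact hvO (φ z) (by rw [← h2]; exact List.mem_map_of_mem hz) ⟨z, hzO, rfl⟩
      · rfl
  · refine ⟨(range φ)ᶜ, (isCompact_range hφ).isClosed.isOpen_compl.mem_nhds hyr, fun v hv hvO => ?_⟩
    rw [pf, dif_neg]
    rintro ⟨w, rfl⟩
    rcases w with _ | ⟨a, w⟩
    · simp at hv; omega
    · exact hvO (φ a) (by simp) ⟨a, rfl⟩

theorem dd_pf_add_mem (hφ : Continuous φ) (hi : Function.Injective φ) {m : ℕ} (hm : m ≠ 0) {W : Set X} (hW : IsOpen (φ '' W)) {f : Co X} (hf : f ∈ Sp m W) :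
    dd (pf φ f) + pf φ (dd f) ∈ Sp (m + 1) ∅ := by
  have h1 : dd (pf φ f) + pf φ (dd f) ∈ Sp (m + 1) (φ '' W) :=
    add_mem (dd_mem (pf_mem hφ hi hm hf)) (pf_mem hφ hi (Nat.succ_ne_zero _) (dd_mem hf))
  have h2 : dd (pf φ f) + pf φ (dd f) ∈ Sp (m + 1) (φ '' W)ᶜ := by
    intro y hy
    rw [notMem_compl_iff] at hy
    refine ⟨_, hW.mem_nhds hy, fun v hv hvO => ?_⟩
    obtain ⟨w, rfl⟩ := exists_list_map fun y hy => image_subset_range _ _ (hvO y hy)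
    have h3 : dd (pf φ f) (w.map φ) = pb φ (dd (pf φ f)) w := rfl
    rw [Pi.add_apply, pf_map hi, h3, ← dd_pb, pb_pf hi, z2]
  have := Sp_inter h1 h2
  rwa [inter_compl_self] at this

theorem pf_pb_add_mem (hφ : Continuous φ) (hi : Function.Injective φ) {m : ℕ} (hm : m ≠ 0) {W : Set X} (hW : IsOpen (φ '' W)) {f : Co Y} (hf : f ∈ Sp m (φ '' W)) :
    pf φ (pb φ f) + f ∈ Sp m ∅ := by
  have hpb : pb φ f ∈ Sp m W := by
    have := pb_mem hf hφ
    rwa [hi.preimage_image] at this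
  have h1 : pf φ (pb φ f) + f ∈ Sp m (φ '' W) := add_mem (pf_mem hφ hi hm hpb) hf
  have h2 : pf φ (pb φ f) + f ∈ Sp m (φ '' W)ᶜ := by
    intro y hy
    rw [notMem_compl_iff] at hy
    refine ⟨_, hW.mem_nhds hy, fun v hv hvO => ?_⟩
    obtain ⟨w, rfl⟩ := exists_list_map fun y hy => image_subset_range _ _ (hvO y hy)
    rw [Pi.add_apply, pf_map hi, pb_apply, z2]
  have := Sp_inter h1 h2
  rwa [inter_compl_self] at this

variable {W : Set X}

theorem Cy.pf (hφ : Continuous φ) (hi : Function.Injective φ) (hW : IsOpen (φ '' W)) {k : ℕ} {f : Co X} (hf : CS.Cy k W f) : CS.Cy k (φ '' W) (CS.pf φ f) := by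
  refine ⟨pf_mem hφ hi (Nat.succ_ne_zero _) hf.1, ?_⟩
  have h1 := dd_pf_add_mem hφ hi (Nat.succ_ne_zero _) hW hf.1
  have h2 := pf_mem hφ hi (Nat.succ_ne_zero _) hf.2
  rw [image_empty] at h2
  have := add_mem h1 h2
  rwa [add_add_cancel'] at this

theorem Ex.pf (hφ : Continuous φ) (hi : Function.Injective φ) (hW : IsOpen (φ '' W)) {k : ℕ} {f : Co X} (hf : Ex k W f) : Ex k (φ '' W) (CS.pf φ f) := by
  obtain ⟨g, h1, h2, h3⟩ := hf
  by_cases hk : k = 0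
  · subst hk
    apply Ex.of_null
    have : f ∈ Sp 1 ∅ := by
      have : CS.dd g ∈ Sp 1 ∅ := by
        intro x _
        refine ⟨univ, Filter.univ_mem, fun v hv _ => ?_⟩
        obtain ⟨a, rfl⟩ := List.length_eq_one_iff.1 hv
        simp [dd_cons, h2]
      have := add_mem h3 this
      rwa [add_add_cancel'] at this
    have := pf_mem hφ hi one_ne_zero this
    rwa [image_empty] at this
  refine ⟨CS.pf φ g, pf_mem hφ hi hk h1, by rw [pf_nil, h2], ?_⟩
  have h4 := dd_pf_add_mem hφ hi hk hW h1
  have h5 := pf_mem hφ hi (Nat.succ_ne_zero _) h3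
  rw [image_empty, pf_add] at h5
  have := add_mem h4 h5
  convert this using 1
  have := co2 (CS.pf φ (CS.dd g))
  linear_combination -this

theorem Cy.pb' (hφ : Continuous φ) (hi : Function.Injective φ) (hW : IsOpen (φ '' W)) {k : ℕ} {f : Co Y} (hf : CS.Cy k (φ '' W) f) : CS.Cy k W (CS.pb φ f) := by
  have := hf.pb hφ
  rwa [hi.preimage_image] at this

theorem Ex.pb' (hφ : Continuous φ) (hi : Function.Injective φ) (hW : IsOpen (φ '' W)) {k : ℕ} {f : Co Y} (hf : Ex k (φ '' W) f) : Ex k W (CS.pb φ f) := by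
  have := hf.pb hφ
  rwa [hi.preimage_image] at this

theorem Ex.of_pb (hφ : Continuous φ) (hi : Function.Injective φ) (hW : IsOpen (φ '' W)) {k : ℕ} {f : Co Y} (hf : CS.Cy k (φ '' W) f) (h : Ex k W (CS.pb φ f)) : Ex k (φ '' W) f := by
  have h1 := h.pf hφ hi hW
  exact h1.congr (Ex.of_null (pf_pb_add_mem hφ hi (Nat.succ_ne_zero _) hW hf.1))

theorem CellLike.image (hφ : Continuous φ) (hi : Function.Injective φ) (hW : IsOpen (φ '' W)) {n : ℕ} (h : CellLike n W) : CellLike n (φ '' W) := by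
  refine ⟨?_, ?_, ?_⟩
  · intro k hk f hf
    exact Ex.of_pb hφ hi hW hf (h.van k hk _ (Cy.pb' hφ hi hW hf))
  · obtain ⟨z, hz, hz'⟩ := h.gen
    refine ⟨_, hz.pf hφ hi hW, fun he => hz' ?_⟩
    have := Ex.pb' hφ hi hW he
    rwa [pb_pf hi] at this
  · intro f g hf hg hf' hg'
    apply Ex.of_pb hφ hi hW (hf.add hg)
    rw [pb_add]
    exact h.uniq _ _ (Cy.pb' hφ hi hW hf) (Cy.pb' hφ hi hW hg) (fun h => hf' (Ex.of_pb hφ hi hW hf h))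
      (fun h => hg' (Ex.of_pb hφ hi hW hg h))
end transport

section cube
open unitInterval
/-- open boxes in the cube -/
def bx {n : ℕ} (a b : Fin n → I) : Set (Fin n → I) := {x | ∀ i, a i < x i ∧ x i < b i}
theorem mem_bx {n : ℕ} {a b x : Fin n → I} : x ∈ bx a b ↔ ∀ i, a i < x i ∧ x i < b i := Iff.rfl
theorem isOpen_bx {n : ℕ} (a b : Fin n → I) : IsOpen (bx a b) := by
  have : bx a b = ⋂ i, {x | a i < x i} ∩ {x | x i < b i} := by
    ext x; simp [mem_bx]
  rw [this]
  refine isOpen_iInter_of_finite fun i => ?_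
  exact (isOpen_lt (by fun_prop) (by fun_prop)).inter (isOpen_lt (by fun_prop) (by fun_prop))
theorem bx_inter {n : ℕ} (a b a' b' : Fin n → I) : bx a b ∩ bx a' b' = bx (a ⊔ a') (b ⊓ b') := by
  ext x
  simp only [mem_inter_iff, mem_bx, Pi.sup_apply, Pi.inf_apply, sup_lt_iff, lt_inf_iff]
  constructor
  · rintro ⟨h1, h2⟩ i; exact ⟨⟨(h1 i).1, (h2 i).1⟩, (h1 i).2, (h2 i).2⟩
  · intro h; exact ⟨fun i => ⟨(h i).1.1, (h i).2.1⟩, fun i => ⟨(h i).1.2, (h i).2.2⟩⟩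

/-- open unit cube -/
def oc (n : ℕ) : Set (Fin n → I) := bx 0 1

theorem cellLike_zero : CellLike 0 (oc 0) := by
  have hu : oc 0 = univ := by
    ext x; simp [oc, mem_bx]
  have hrep : ∀ v : List (Fin 0 → I), v = List.replicate v.length default := fun v =>
    List.eq_replicate_iff.2 ⟨rfl, fun y _ => Subsingleton.elim _ _⟩
  rw [hu]
  have key : ∀ f : Co (Fin 0 → I), Ex 0 univ f ↔ f [default] = 0 := by
    intro f
    constructor
    · rintro ⟨g, h1, h2, h3⟩
      obtain ⟨O, hO, h⟩ := h3 default (by simp)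
      have := h [default] rfl (by simpa using mem_of_mem_nhds hO)
      simpa [dd_cons, h2] using this
    · intro h
      refine Ex.of_null fun x _ => ⟨univ, Filter.univ_mem, fun v hv _ => ?_⟩
      rw [hrep v, hv]; exact h
  refine ⟨?_, ?_, ?_⟩
  · intro k hk f hf
    apply const_exact (by omega) (f (List.replicate (k + 1) default)) (cocycle_replicate _ hf.2)
    intro v hv
    rw [hrep v, hv]
  · refine ⟨fun _ => 1, ⟨Sp_univ _, ?_⟩, ?_⟩
    · intro x _
      refine ⟨univ, Filter.univ_mem, fun v hv _ => ?_⟩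
      rw [dd_const, hv]; decide
    · rw [key]; decide
  · intro f g hf hg hf' hg'
    rw [key] at *
    rw [Pi.add_apply, (z2_cases _).resolve_left hf', (z2_cases _).resolve_left hg']; decide

theorem cellLike_oc (n : ℕ) : CellLike n (oc n) := by
  induction n with
  | zero => exact cellLike_zero
  | succ n ih =>
    have h : CellLike (n + 1) (oc n ×ˢ Ioo (0 : I) 1) := ih.susp (isOpen_bx _ _)
    set φ : (Fin n → I) × I → (Fin (n + 1) → I) := fun p => Fin.cons p.2 p.1
    have hφ : Continuous φ := by
      refine continuous_pi fun i => ?_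
      refine Fin.cases ?_ (fun i => ?_) i
      · simp only [φ, Fin.cons_zero]; fun_prop
      · simp only [φ, Fin.cons_succ]; fun_prop
    have hi : Function.Injective φ := by
      rintro ⟨a, b⟩ ⟨c, d⟩ h
      have this := Fin.cons_inj.1 h
      exact Prod.ext this.2 this.1
    have him : φ '' (oc n ×ˢ Ioo 0 1) = oc (n + 1) := by
      ext x
      constructor
      · rintro ⟨⟨y, s⟩, ⟨hy, hs⟩, rfl⟩
        intro i
        refine Fin.cases ?_ (fun i => ?_) i
        · exact hs
        · exact hy i
      · intro hx
        exact ⟨(Fin.tail x, x 0), ⟨fun i => hx i.succ, hx 0⟩, Fin.cons_self_tail x⟩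
    have := h.image hφ hi (by rw [him]; exact isOpen_bx _ _)
    rwa [him] at this

/-- affine parametrization of a box -/
noncomputable def af {n : ℕ} (a b : Fin n → I) : (Fin n → I) → (Fin n → I) := fun x i =>
  ⟨(1 - (x i : ℝ)) * a i + x i * b i, by
    have := (x i).2; have h2 := (a i).2; have h3 := (b i).2
    exact convex_Icc (0 : ℝ) 1 h2 h3 (by linarith [this.2]) this.1 (by ring)⟩
theorem continuous_af {n : ℕ} (a b : Fin n → I) : Continuous (af a b) := by
  unfold af
  refine continuous_pi fun i => Continuous.subtype_mk ?_ _
  fun_prop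
theorem af_inj {n : ℕ} {a b : Fin n → I} (h : ∀ i, a i < b i) : Function.Injective (af a b) := by
  intro x y hxy
  funext i
  have := congrArg Subtype.val (congrFun hxy i)
  simp only [af] at this
  have h2 : (a i : ℝ) < b i := h i
  apply Subtype.ext
  have h3 : ((x i : ℝ) - y i) * (b i - a i) = 0 := by linear_combination this
  rcases mul_eq_zero.1 h3 with h | h <;> linarith
theorem af_image {n : ℕ} {a b : Fin n → I} (h : ∀ i, a i < b i) : af a b '' oc n = bx a b := by
  ext y
  constructor
  · rintro ⟨x, hx, rfl⟩ i
    have h2 : (a i : ℝ) < b i := h i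
    have h3 : (0 : ℝ) < x i := (hx i).1
    have h4 : (x i : ℝ) < 1 := (hx i).2
    constructor <;> rw [← Subtype.coe_lt_coe] <;> simp only [af] <;> nlinarith
  · intro hy
    have hab : ∀ i, (0 : ℝ) < b i - a i := fun i => sub_pos.2 (h i)
    have h3 : ∀ i, (a i : ℝ) < y i := fun i => (hy i).1
    have h4 : ∀ i, (y i : ℝ) < b i := fun i => (hy i).2
    refine ⟨fun i => ⟨(y i - a i) / (b i - a i), div_nonneg (by linarith [h3 i]) (hab i).le,
      (div_le_one (hab i)).2 (by linarith [h4 i])⟩, fun i => ⟨?_, ?_⟩, ?_⟩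
    · rw [← Subtype.coe_lt_coe]; exact div_pos (by linarith [h3 i]) (hab i)
    · rw [← Subtype.coe_lt_coe]; exact (div_lt_one (hab i)).2 (by linarith [h4 i])
    · funext i
      apply Subtype.ext
      simp only [af]
      have := (hab i).ne'
      field_simp
      ring

theorem exists_bx {n : ℕ} {O : Set (Fin n → I)} (hO : IsOpen O) {x : Fin n → I} (hx : x ∈ O) (hx' : x ∈ oc n) :
    ∃ a b, x ∈ bx a b ∧ bx a b ⊆ O ∧ bx a b ⊆ oc n := by
  have h := hO.mem_nhds hx
  rw [nhds_pi, Filter.mem_pi] at h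
  obtain ⟨J, hJ, t, ht, hts⟩ := h
  have : ∀ i, ∃ l u, x i ∈ Ioo l u ∧ Ioo l u ⊆ t i := fun i =>
    (mem_nhds_iff_exists_Ioo_subset' ⟨0, (hx' i).1⟩ ⟨1, (hx' i).2⟩).1 (ht i)
  choose l u h1 h2 using this
  refine ⟨l, u, fun i => h1 i, fun y hy => hts fun i _ => h2 i (hy i), fun y hy i => ⟨?_, ?_⟩⟩
  · exact lt_of_le_of_lt (l i).2.1 (hy i).1
  · exact lt_of_lt_of_le (hy i).2 (u i).2.2

/-- restricting to a sub-box is injective on top cohomology -/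
theorem sub_inj {n k : ℕ} {a b : Fin n → I} (h : ∀ i, a i < b i) {f : Co (Fin n → I)} (hf : Cy k (bx a b) f)
    (he : Ex k (oc n) f) : Ex k (bx a b) f := by
  rw [← af_image h] at hf ⊢
  have hop : IsOpen (af a b '' oc n) := by rw [af_image h]; exact isOpen_bx _ _
  apply Ex.of_pb (continuous_af a b) (af_inj h) hop hf
  set P : ℝ → I := projIcc 0 1 zero_le_one with hP
  have hPc : Continuous P := continuous_projIcc
  set H : (Fin n → I) × ℝ → (Fin n → I) := fun p => af (fun i => ⟨(1 - (P p.2 : ℝ)) * a i, by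
      have := (P p.2).2; have h2 := (a i).2
      exact ⟨mul_nonneg (by linarith [this.2]) h2.1, mul_le_one₀ (by linarith [this.1]) h2.1 h2.2⟩⟩)
      (fun i => ⟨(1 - (P p.2 : ℝ)) * b i + P p.2 * (1 : ℝ), by
      have := (P p.2).2; have h2 := (b i).2
      exact convex_Icc (0 : ℝ) 1 h2 (by simp) (by linarith [this.2]) this.1 (by ring)⟩) p.1 with hH
  have hHc : Continuous H := by
    rw [hH]; unfold af
    refine continuous_pi fun i => Continuous.subtype_mk ?_ _
    fun_prop
  have hH0 : (fun x => H (x, 0)) = af a b := by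
    funext x i
    apply Subtype.ext
    simp [hH, af, hP]
  have hH1 : (fun x => H (x, 1)) = id := by
    funext x i
    apply Subtype.ext
    simp [hH, af, hP]
  rw [af_image h] at hf
  obtain ⟨g, hg, hg0, hgf⟩ := homotopy hHc (m := k) (isOpen_bx a b) isOpen_empty hf.1 hf.2
  have hid : pb id f = f := by funext v; simp [pb_apply]
  rw [hH0, hH1, hid] at hgf
  refine he.congr ⟨g, Sp_mono ?_ hg, hg0, Sp_mono ?_ hgf⟩
  · rintro x ⟨t, ht, hx⟩ i
    have h1 := (hx i).1
    have h2 := (hx i).2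
    rw [← Subtype.coe_lt_coe] at h1 h2
    simp only [hH, af] at h1 h2
    have h3 := (P t).2
    have h4 := (a i).2
    have h5 := (b i).2
    constructor
    · refine lt_of_le_of_ne (x i).2.1 ?_
      intro h0
      have h0' : ((x i : I) : ℝ) = 0 := by rw [← h0]; rfl
      rw [h0'] at h1
      nlinarith [h3.1, h4.1]
    · refine lt_of_le_of_ne (x i).2.2 ?_
      intro h0
      have h0' : ((x i : I) : ℝ) = 1 := by rw [h0]; rfl
      rw [h0'] at h2
      nlinarith [h3.1, h5.2]
  · rintro x ⟨t, ht, hx⟩; exact hx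
end cube
end CS

open scoped Topology
namespace CS
set_option linter.all false
open Set unitInterval

/-- `φ` parametrizes an open `n`-cell -/
structure Bx {X : Type*} [TopologicalSpace X] (n : ℕ) (φ : (Fin n → I) → X) : Prop where
  cont : Continuous φ
  inj : Function.Injective φ
  op : IsOpen (φ '' oc n)

section
variable {X : Type*} [TopologicalSpace X] [T2Space X] {n : ℕ} {φ : (Fin n → I) → X}

theorem Bx.cell (h : Bx n φ) : CellLike n (φ '' oc n) := (cellLike_oc n).image h.cont h.inj h.op

theorem Bx.open_image (h : Bx n φ) {O : Set (Fin n → I)} (hO : IsOpen O) (hs : O ⊆ oc n) : IsOpen (φ '' O) := by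
  have : φ '' O = φ '' oc n \ φ '' Oᶜ := by
    ext y
    constructor
    · rintro ⟨x, hx, rfl⟩
      refine ⟨⟨x, hs hx, rfl⟩, ?_⟩
      rintro ⟨x', hx', h'⟩
      rw [h.inj h'] at hx'
      exact hx' hx
    · rintro ⟨⟨x, hx, rfl⟩, h2⟩
      refine ⟨x, ?_, rfl⟩
      by_contra h3
      exact h2 ⟨x, h3, rfl⟩
  rw [this]
  exact h.op.sdiff (hO.isClosed_compl.isCompact.image h.cont).isClosed

theorem bx_subset_oc (a b : Fin n → I) : bx a b ⊆ oc n := fun y hy i =>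
  ⟨lt_of_le_of_lt (a i).2.1 (hy i).1, lt_of_lt_of_le (hy i).2 (b i).2.2⟩

theorem Bx.isOpen_bx (h : Bx n φ) (a b : Fin n → I) : IsOpen (φ '' bx a b) :=
  h.open_image (CS.isOpen_bx a b) (bx_subset_oc a b)

theorem Bx.sub (h : Bx n φ) {a b : Fin n → I} (hab : ∀ i, a i < b i) : Bx n (φ ∘ af a b) :=
  ⟨h.cont.comp (continuous_af a b), h.inj.comp (af_inj hab), by
    rw [image_comp, af_image hab]; exact h.isOpen_bx a b⟩

theorem Bx.sub_image {a b : Fin n → I} (hab : ∀ i, a i < b i) : (φ ∘ af a b) '' oc n = φ '' bx a b := by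
  rw [image_comp, af_image hab]

theorem Bx.cell_bx (h : Bx n φ) {a b : Fin n → I} (hab : ∀ i, a i < b i) : CellLike n (φ '' bx a b) := by
  have := (h.sub hab).cell
  rwa [Bx.sub_image hab] at this

theorem Bx.sub_inj (h : Bx n φ) {k : ℕ} {a b : Fin n → I} (hab : ∀ i, a i < b i) {f : Co X}
    (hf : Cy k (φ '' bx a b) f) (he : Ex k (φ '' oc n) f) : Ex k (φ '' bx a b) f := by
  apply Ex.of_pb h.cont h.inj (h.isOpen_bx a b) hf
  apply CS.sub_inj hab
  · exact Cy.pb' h.cont h.inj (h.isOpen_bx a b) hf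
  · exact Ex.pb' h.cont h.inj h.op he

/-- union of a list of boxes -/
def UW (φ : (Fin n → I) → X) (l : List ((Fin n → I) × (Fin n → I))) : Set X :=
  {x | ∃ p ∈ l, x ∈ φ '' bx p.1 p.2}

theorem UW_cons (p : (Fin n → I) × (Fin n → I)) (l) : UW φ (p :: l) = φ '' bx p.1 p.2 ∪ UW φ l := by
  ext x; simp [UW]

theorem Bx.isOpen_UW (h : Bx n φ) (l) : IsOpen (UW φ l) := by
  induction l with
  | nil => 
    convert isOpen_empty
    ext x; simp [UW]
  | cons p l ih => rw [UW_cons]; exact (h.isOpen_bx _ _).union ih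

theorem Bx.UW_inter (h : Bx n φ) (p : (Fin n → I) × (Fin n → I)) (l : List ((Fin n → I) × (Fin n → I))) :
    φ '' bx p.1 p.2 ∩ UW φ l = UW φ (l.map fun q => (p.1 ⊔ q.1, p.2 ⊓ q.2)) := by
  ext x
  simp only [UW, mem_inter_iff, mem_ofPred_eq, List.mem_map]
  constructor
  · rintro ⟨h1, q, hq, h2⟩
    refine ⟨_, ⟨q, hq, rfl⟩, ?_⟩
    rw [← bx_inter, image_inter h.inj]; exact ⟨h1, h2⟩
  · rintro ⟨_, ⟨q, hq, rfl⟩, h2⟩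
    rw [← bx_inter, image_inter h.inj] at h2
    exact ⟨h2.1, q, hq, h2.2⟩

variable [CompactSpace X]

theorem Bx.gen_list (h : Bx n φ) (N : ℕ) : ∀ l : List ((Fin n → I) × (Fin n → I)), l.length = N → ∀ k, n ≤ k → 
    ∀ P : Co X → Prop, (∀ f g, P f → P g → P (f + g)) → 
    (∀ a b, (∀ i, a i < b i) → φ '' bx a b ⊆ UW φ l → ∀ f, Cy k (φ '' bx a b) f → P f) →
    (∀ f, Ex k (UW φ l) f → P f) → ∀ f, Cy k (UW φ l) f → P f := by
  induction N with
  | zero =>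
    intro l hl k hk P h1 h2 h3 f hf
    rw [List.length_eq_zero_iff] at hl
    subst hl
    apply h3
    apply Ex.of_null
    have := hf.1
    have e : UW φ [] = ∅ := by ext x; simp [UW]
    rwa [e] at this
  | succ N ih =>
    intro l hl k hk P h1 h2 h3 f hf
    rcases l with _ | ⟨p, l⟩
    · simp at hl
    have hl' : l.length = N := by simpa using hl
    have hf' := hf
    rw [UW_cons] at hf
    have hVo := h.isOpen_UW l
    obtain ⟨f1, hf1, f2, hf2, hff, _⟩ := split (Nat.succ_ne_zero k) (h.isOpen_bx p.1 p.2) hVo hf.1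
    have hd : dd f1 ∈ Sp (k + 2) (UW φ (l.map fun q => (p.1 ⊔ q.1, p.2 ⊓ q.2))) := by
      rw [← h.UW_inter]
      apply Sp_inter (dd_mem hf1)
      have e : dd f1 = dd f + dd f2 := by rw [hff, dd_add, add_add_cancel']
      rw [e]
      exact add_mem (Sp_null_le hf.2) (dd_mem hf2)
    obtain ⟨u, hu1, hu2, hu3⟩ := ih _ (by simpa using hl') (k + 1) (by omega)
      (Ex (k + 1) (UW φ (l.map fun q => (p.1 ⊔ q.1, p.2 ⊓ q.2)))) (fun _ _ => Ex.add)
      (fun a b hab hs g hg => ((h.cell_bx hab).van _ (by omega) g hg).mono hs) (fun _ => id)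
      (dd f1) ⟨hd, by rw [dd_dd]; exact zero_mem _⟩
    rw [← h.UW_inter] at hu1
    have c1 : Cy k (φ '' bx p.1 p.2) (f1 + u) :=
      ⟨add_mem hf1 (Sp_mono inter_subset_left hu1), by rw [dd_add]; exact hu3⟩
    have c2 : Cy k (UW φ l) (f2 + u) := by
      refine ⟨add_mem hf2 (Sp_mono inter_subset_right hu1), ?_⟩
      have := add_mem hf.2 hu3
      convert this using 1
      rw [hff, dd_add, dd_add]
      have := co2 (dd f1)
      linear_combination -this
    have e : f = (f1 + u) + (f2 + u) := by
      rw [hff]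
      have := co2 u
      linear_combination -this
    rw [e]
    apply h1
    · by_cases hab : ∀ i, p.1 i < p.2 i
      · exact h2 _ _ hab (by rw [UW_cons]; exact subset_union_left) _ c1
      · apply h3
        apply Ex.of_null
        have he : φ '' bx p.1 p.2 = ∅ := by
          rw [image_eq_empty, eq_empty_iff_forall_notMem]
          intro x hx
          exact hab fun i => (hx i).1.trans (hx i).2
        have := c1.1
        rwa [he] at this
    · refine ih l hl' k hk P h1 (fun a b hab hs => h2 a b hab ?_) (fun g hg => h3 g (hg.mono ?_)) _ c2
      · rw [UW_cons]; exact hs.trans subset_union_right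
      · rw [UW_cons]; exact subset_union_right

/-- cocycles in degree `≥ n` supported inside a cell are generated by those supported in small boxes -/
theorem Bx.generate (h : Bx n φ) {k : ℕ} (hk : n ≤ k) {Ω : Set X} (hΩ : IsOpen Ω) (hs : Ω ⊆ φ '' oc n)
    (P : Co X → Prop) (h1 : ∀ f g, P f → P g → P (f + g))
    (h2 : ∀ a b, (∀ i, a i < b i) → φ '' bx a b ⊆ Ω → ∀ f, Cy k (φ '' bx a b) f → P f)
    (h3 : ∀ f, Ex k Ω f → P f) {f : Co X} (hf : Cy k Ω f) : P f := by
  have hK : IsCompact (supp (k + 1) f) := (isClosed_supp _ _).isCompact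
  have hKs : supp (k + 1) f ⊆ Ω := supp_subset.1 hf.1
  obtain ⟨l, hl1, hl2⟩ : ∃ l, supp (k + 1) f ⊆ UW φ l ∧ UW φ l ⊆ Ω := by
    refine hK.induction_on (p := fun K => ∃ l, K ∩ supp (k + 1) f ⊆ UW φ l ∧ UW φ l ⊆ Ω) ?_ ?_ ?_ ?_ |>.imp
      fun l hl => ⟨fun x hx => hl.1 ⟨hx, hx⟩, hl.2⟩
    · exact ⟨[], by simp, by rintro x ⟨p, hp, _⟩; simp at hp⟩
    · rintro s t hst ⟨l, hl, hl'⟩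
      exact ⟨l, (inter_subset_inter_left _ hst).trans hl, hl'⟩
    · rintro s t ⟨l, hl, hl'⟩ ⟨r, hr, hr'⟩
      refine ⟨l ++ r, ?_, ?_⟩
      · rintro x ⟨hx | hx, hx'⟩
        · obtain ⟨p, hp, h⟩ := hl ⟨hx, hx'⟩
          exact ⟨p, by simp [hp], h⟩
        · obtain ⟨p, hp, h⟩ := hr ⟨hx, hx'⟩
          exact ⟨p, by simp [hp], h⟩
      · rintro x ⟨p, hp, hx⟩
        rcases List.mem_append.1 hp with hp | hp
        · exact hl' ⟨p, hp, hx⟩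
        · exact hr' ⟨p, hp, hx⟩
    · intro x hx
      obtain ⟨y, hy, rfl⟩ := hs (hKs hx)
      obtain ⟨a, b, h4, h5, h6⟩ := exists_bx (hΩ.preimage h.cont) (hKs hx) hy
      refine ⟨φ '' bx a b, mem_nhdsWithin_of_mem_nhds ((h.isOpen_bx a b).mem_nhds ⟨y, h4, rfl⟩), [(a, b)], ?_, ?_⟩
      · rintro z ⟨hz, _⟩
        exact ⟨(a, b), by simp, hz⟩
      · rintro z ⟨p, hp, hz⟩
        rw [List.mem_singleton] at hp
        subst hp
        obtain ⟨w, hw, rfl⟩ := hz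
        exact h5 hw
  exact h.gen_list _ l rfl k hk P h1 (fun a b hab hs' => h2 a b hab (hs'.trans hl2))
    (fun g hg => h3 g (hg.mono hl2)) f ⟨supp_subset.2 hl1, hf.2⟩
end
end CS

open scoped Topology
namespace CS
set_option linter.all false
open Set unitInterval

section
variable {X : Type*} [TopologicalSpace X] [T2Space X] {n : ℕ} {φ ψ : (Fin n → I) → X}

/-- `c` is a fundamental cocycle of the cell `ψ` -/
structure Gn (n : ℕ) (ψ : (Fin n → I) → X) (c : Co X) : Prop where
  bx : Bx n ψ
  cy : Cy n (ψ '' oc n) c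
  ne : ¬ Ex n (ψ '' oc n) c

theorem Bx.exists_gn (h : Bx n φ) : ∃ c, Gn n φ c := by
  obtain ⟨c, h1, h2⟩ := h.cell.gen
  exact ⟨c, h, h1, h2⟩

theorem Gn.uniq {c c' : Co X} (h : Gn n φ c) (h' : Gn n φ c') : Ex n (φ '' oc n) (c + c') :=
  h.bx.cell.uniq _ _ h.cy h'.cy h.ne h'.ne

theorem Bx.cases (h : Bx n φ) {c : Co X} (hc : Cy n (φ '' oc n) c) : Ex n (φ '' oc n) c ∨ Gn n φ c := by
  by_cases h' : Ex n (φ '' oc n) c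
  · exact Or.inl h'
  · exact Or.inr ⟨h, hc, h'⟩

theorem Bx.gn_of_sub (h : Bx n φ) {a b : Fin n → I} (hab : ∀ i, a i < b i) {c : Co X} (hc : Gn n (φ ∘ af a b) c) :
    Gn n φ c := by
  have h1 := hc.cy
  have h2 := hc.ne
  rw [Bx.sub_image hab] at h1 h2
  exact ⟨h, h1.mono (image_mono (bx_subset_oc a b)), fun he => h2 (h.sub_inj hab h1 he)⟩

theorem Bx.exists_sub (h : Bx n φ) {O : Set X} (hO : IsOpen O) {x : Fin n → I} (hx : x ∈ oc n) (hxO : φ x ∈ O) :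
    ∃ a b, (∀ i, a i < b i) ∧ x ∈ CS.bx a b ∧ (φ ∘ af a b) '' oc n ⊆ O := by
  obtain ⟨a, b, h1, h2, h3⟩ := exists_bx (hO.preimage h.cont) hxO hx
  have hab : ∀ i, a i < b i := fun i => (h1 i).1.trans (h1 i).2
  refine ⟨a, b, hab, h1, ?_⟩
  rw [Bx.sub_image hab]
  rintro _ ⟨y, hy, rfl⟩
  exact h2 hy

theorem oc_nonempty (n : ℕ) : (oc n).Nonempty := by
  refine ⟨fun _ => ⟨1/2, by constructor <;> norm_num⟩, fun i => ⟨?_, ?_⟩⟩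
  · rw [← Subtype.coe_lt_coe]; norm_num
  · rw [← Subtype.coe_lt_coe]; norm_num

theorem Ex.smul {k : ℕ} {W : Set X} {f : Co X} (r : ZMod 2) (hf : Ex k W f) : Ex k W (r • f) := by
  rcases z2_cases r with h | h
  · rw [h, zero_smul]; exact Ex.of_null (zero_mem _)
  · rwa [h, one_smul]
theorem Cy.smul {k : ℕ} {W : Set X} {f : Co X} (r : ZMod 2) (hf : Cy k W f) : Cy k W (r • f) := by
  rcases z2_cases r with h | h
  · rw [h, zero_smul]; exact Cy.of_null (zero_mem _)
  · rwa [h, one_smul]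

/-- submodule of coboundaries -/
def ExS (k : ℕ) (W : Set X) : Submodule (ZMod 2) (Co X) where
  carrier := {f | Ex k W f}
  add_mem' := fun h h' => Ex.add h h'
  zero_mem' := Ex.of_null (zero_mem _)
  smul_mem' := fun r f h => Ex.smul r h
/-- submodule of cocycles -/
def CyS (k : ℕ) (W : Set X) : Submodule (ZMod 2) (Co X) where
  carrier := {f | Cy k W f}
  add_mem' := fun h h' => Cy.add h h'
  zero_mem' := Cy.of_null (zero_mem _)
  smul_mem' := fun r f h => Cy.smul r h
theorem mem_ExS {k : ℕ} {W : Set X} {f : Co X} : f ∈ ExS k W ↔ Ex k W f := Iff.rfl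
theorem mem_CyS {k : ℕ} {W : Set X} {f : Co X} : f ∈ CyS k W ↔ Cy k W f := Iff.rfl

/-- trace on `W` -/
structure Tr (n : ℕ) (W : Set X) (t : Co X →ₗ[ZMod 2] ZMod 2) : Prop where
  ex : ∀ f, Ex n W f → t f = 0
  gn : ∀ ψ c, Gn n ψ c → ψ '' oc n ⊆ W → t c = 1

variable [CompactSpace X]

theorem Bx.gn_in (h : Bx n φ) {c : Co X} (hc : Gn n ψ c) (hs : ψ '' oc n ⊆ φ '' oc n) : Gn n φ c := by
  refine ⟨h, hc.cy.mono hs, fun he => ?_⟩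
  obtain ⟨x, hx⟩ := oc_nonempty n
  obtain ⟨y, hy, hyx⟩ := hs ⟨x, hx, rfl⟩
  obtain ⟨a, b, hab, -, hs'⟩ := h.exists_sub hc.bx.op hy (by rw [hyx]; exact ⟨x, hx, rfl⟩)
  obtain ⟨c', hc'⟩ := (h.sub hab).exists_gn
  have h1 := h.gn_of_sub hab hc'
  have h2 : Gn n ψ c' := ⟨hc.bx, hc'.cy.mono hs', fun he' => h1.ne (he'.mono hs)⟩
  exact h1.ne (he.congr ((hc.uniq h2).mono hs))

theorem Bx.trace (h : Bx n φ) : ∃ t, Tr n (φ '' oc n) t := by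
  obtain ⟨z, hz⟩ := h.exists_gn
  obtain ⟨t, ht1, ht2⟩ := Submodule.exists_le_ker_of_notMem (p := ExS n (φ '' oc n)) (show z ∉ ExS n (φ '' oc n) from hz.ne)
  have key : ∀ f, Ex n (φ '' oc n) f → t f = 0 := fun f hf => ht2 hf
  refine ⟨t, key, fun ψ c hc hs => ?_⟩
  have := key _ (hz.uniq (h.gn_in hc hs))
  rw [map_add] at this
  rw [← z2_eq this]
  exact (z2_cases _).resolve_left ht1

theorem exists_fun_of_ker {A B : Type*} [AddCommGroup A] [Module (ZMod 2) A] [AddCommGroup B] [Module (ZMod 2) B]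
    (s : A →ₗ[ZMod 2] B) (τ : A →ₗ[ZMod 2] ZMod 2) (h : LinearMap.ker s ≤ LinearMap.ker τ) :
    ∃ t : B →ₗ[ZMod 2] ZMod 2, ∀ a, t (s a) = τ a := by
  have h1 : τ ∈ (LinearMap.ker s).dualAnnihilator := by
    rw [Submodule.mem_dualAnnihilator]
    exact fun w hw => h hw
  rw [← LinearMap.range_dualMap_eq_dualAnnihilator_ker] at h1
  obtain ⟨t, ht⟩ := h1
  exact ⟨t, fun a => by rw [← ht]; rfl⟩

theorem Tr.union (hn : n ≠ 0) {U : Set X} (hU : IsOpen U) {t : Co X →ₗ[ZMod 2] ZMod 2} (ht : Tr n U t) (h : Bx n φ) :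
    ∃ t', Tr n (U ∪ φ '' oc n) t' := by
  obtain ⟨r, hr⟩ := h.trace
  set V := φ '' oc n with hV
  have agree : ∀ f, Cy n (U ∩ V) f → t f = r f := by
    intro f hf
    refine h.generate le_rfl (hU.inter h.op) inter_subset_right (fun f => t f = r f) ?_ ?_ ?_ hf
    · intro f g hf hg
      simp only [map_add, hf, hg]
    · intro a b hab hs f hf
      rw [← Bx.sub_image hab] at hf hs
      rcases (h.sub hab).cases hf with h1 | h1
      · rw [ht.ex f (h1.mono (hs.trans inter_subset_left)), hr.ex f (h1.mono (hs.trans inter_subset_right))]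
      · rw [ht.gn _ f h1 (hs.trans inter_subset_left), hr.gn _ f h1 (hs.trans inter_subset_right)]
    · intro f hf
      rw [ht.ex f (hf.mono inter_subset_left), hr.ex f (hf.mono inter_subset_right)]
  obtain ⟨t', ht'⟩ := exists_fun_of_ker
    ((CyS n U).subtype.coprod (CyS n V).subtype) ((t.comp (CyS n U).subtype).coprod (r.comp (CyS n V).subtype)) (by
      rintro ⟨⟨f, hf⟩, ⟨g, hg⟩⟩ hfg
      rw [LinearMap.mem_ker] at hfg ⊢
      simp only [LinearMap.coprod_apply, Submodule.subtype_apply, LinearMap.comp_apply] at hfg ⊢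
      have e : f = g := by
        funext v; exact z2_eq (congrFun hfg v)
      subst e
      rw [agree f ⟨Sp_inter hf.1 hg.1, hf.2⟩, z2])
  have key : ∀ f g, Cy n U f → Cy n V g → t' (f + g) = t f + r g := fun f g hf hg =>
    ht' (⟨f, hf⟩, ⟨g, hg⟩)
  have keyU : ∀ f, Cy n U f → t' f = t f := fun f hf => by
    have := key f 0 hf (Cy.of_null (zero_mem _))
    simpa using this
  have keyV : ∀ f, Cy n V f → t' f = r f := fun f hf => by
    have := key 0 f (Cy.of_null (zero_mem _)) hf
    simpa using this
  have hex : ∀ f, Ex n (U ∪ V) f → t' f = 0 := by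
    rintro f ⟨g, hg, hg0, hfg⟩
    obtain ⟨g1, h1, g2, h2, h3, h4, h5⟩ := split hn hU h.op hg
    have e : f = (f + dd g) + (dd g1 + dd g2) := by
      rw [← dd_add, ← h3, add_add_cancel']
    rw [e, map_add, keyU _ (Cy.of_null hfg), ht.ex _ (Ex.of_null hfg), zero_add, key _ _ (Cy.dd h1) (Cy.dd h2),
      ht.ex _ (Ex.dd h1 h4), hr.ex _ (Ex.dd h2 (h5.trans hg0)), zero_add]
  refine ⟨t', hex, fun ψ c hc hs => ?_⟩
  obtain ⟨x, hx⟩ := oc_nonempty n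
  have hfin : ∀ a b, (∀ i, a i < b i) → ∀ c', Gn n (ψ ∘ af a b) c' → t' c' = 1 → t' c = 1 := by
    intro a b hab c' hc' h1
    have := hex _ ((hc.uniq (hc.bx.gn_of_sub hab hc')).mono hs)
    rw [map_add] at this
    rw [z2_eq this, h1]
  rcases hs ⟨x, hx, rfl⟩ with hx' | hx'
  · obtain ⟨a, b, hab, -, hs'⟩ := hc.bx.exists_sub hU hx hx'
    obtain ⟨c', hc'⟩ := (hc.bx.sub hab).exists_gn
    refine hfin a b hab c' hc' ?_
    rw [keyU _ (hc'.cy.mono hs')]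
    exact ht.gn _ _ hc' hs'
  · obtain ⟨a, b, hab, -, hs'⟩ := hc.bx.exists_sub h.op hx hx'
    obtain ⟨c', hc'⟩ := (hc.bx.sub hab).exists_gn
    refine hfin a b hab c' hc' ?_
    rw [keyV _ (hc'.cy.mono hs')]
    exact hr.gn _ _ hc' hs'

/-- the trace on a closed manifold -/
theorem exists_trace (hn : n ≠ 0) (hX : ∀ x : X, ∃ φ, Bx n φ ∧ x ∈ φ '' oc n) : ∃ t, Tr n (univ : Set X) t := by
  choose φ h1 h2 using hX
  obtain ⟨s, hs⟩ := isCompact_univ.elim_finite_subcover (fun x => φ x '' oc n) (fun x => (h1 x).op)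
    (fun x _ => mem_iUnion.2 ⟨x, h2 x⟩)
  suffices h : ∀ s : Finset X, ∃ t, Tr n (⋃ i ∈ s, φ i '' oc n) t by
    obtain ⟨t, ht⟩ := h s
    rw [univ_subset_iff.1 hs] at ht
    exact ⟨t, ht⟩
  classical
  intro s
  induction s using Finset.induction_on with
  | empty =>
    refine ⟨0, fun _ _ => rfl, fun ψ c hc hs => ?_⟩
    obtain ⟨x, hx⟩ := oc_nonempty n
    have := hs ⟨x, hx, rfl⟩
    simp at this
  | insert a s ha ih =>
    obtain ⟨t, ht⟩ := ih
    have := ht.union hn (isOpen_biUnion fun i _ => (h1 i).op) (h1 a)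
    rwa [Finset.set_biUnion_insert, union_comm]
end
end CS

open scoped Topology
namespace CS
set_option linter.all false
open Set unitInterval

/-- every point lies in an open cell -/
def Mf (n : ℕ) (X : Type*) [TopologicalSpace X] : Prop := ∀ x : X, ∃ φ, Bx n φ ∧ x ∈ φ '' oc n

section
variable {X : Type*} [TopologicalSpace X] [T2Space X] {n : ℕ} {φ ψ : (Fin n → I) → X}

/-- small cells around each point -/
theorem Mf.small (hX : Mf n X) {x : X} {O : Set X} (hO : IsOpen O) (hx : x ∈ O) :
    ∃ φ, Bx n φ ∧ x ∈ φ '' oc n ∧ φ '' oc n ⊆ O := by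
  obtain ⟨φ, hφ, y, hy, rfl⟩ := hX x
  obtain ⟨a, b, hab, hx', hs⟩ := hφ.exists_sub hO hy hx
  refine ⟨_, hφ.sub hab, ?_, hs⟩
  rw [Bx.sub_image hab]
  exact ⟨y, hx', rfl⟩

variable [CompactSpace X]
theorem not_contractible [Nonempty X] (hn : n ≠ 0) (hX : Mf n X) {H : X × ℝ → X} (hH : Continuous H) {q : X}
    (h0 : ∀ x, H (x, 0) = x) (h1 : ∀ x, H (x, 1) = q) : False := by
  obtain ⟨t, ht⟩ := exists_trace hn hX
  obtain ⟨φ, hφ, -⟩ := hX q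
  obtain ⟨c, hc⟩ := hφ.exists_gn
  have h := null_exact hH h1 (by omega) hc.cy.2
  have e : CS.pb (fun x => H (x, 0)) c = c := by
    funext v; simp [pb_apply, h0]
  rw [e] at h
  have h2 := ht.ex _ h
  rw [ht.gn _ _ hc (subset_univ _)] at h2
  exact one_ne_zero h2

theorem dd_two (f : Co X) (x y : X) : dd f [x, y] = f [y] + f [x] := by
  simp [dd_cons]

/-- a 0-cochain with null differential is locally constant -/
theorem locconst {f : Co X} (hf : dd f ∈ Sp 2 ∅) : IsLocallyConstant fun x => f [x] := by
  rw [IsLocallyConstant.iff_eventually_eq]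
  intro x
  obtain ⟨O, hO, h⟩ := hf x (by simp)
  filter_upwards [hO] with y hy
  have := h [x, y] rfl (by simpa using ⟨mem_of_mem_nhds hO, hy⟩)
  rw [dd_two] at this
  exact z2_eq this

/-- one-dimensional case : sides of a point in a cell -/
theorem sides_aux [PreconnectedSpace X] (hX : Mf 1 X) {A B : Set X} {p : X} (hA : IsOpen A) (hB : IsOpen B)
    (hAB : A ∪ B = {p}ᶜ) (hd : Disjoint A B) {φ : (Fin 1 → I) → X} (hφ : Bx 1 φ) {s : I} (hs0 : 0 < s) (hs1 : s < 1)
    (hp : φ (fun _ => s) = p) (hl : ∀ r, 0 < r → r < s → φ (fun _ => r) ∈ A)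
    (hr : ∀ r, s < r → r < 1 → φ (fun _ => r) ∈ B) : False := by
  classical
  obtain ⟨t, ht⟩ := exists_trace one_ne_zero hX
  obtain ⟨r, h0r, hrs⟩ := exists_between hs0
  obtain ⟨r1, h0r1, hr1r⟩ := exists_between h0r
  obtain ⟨r2, hrr2, hr2s⟩ := exists_between hrs
  obtain ⟨r3, h0r3, hr3⟩ := exists_between h0r1
  have hpA : p ∉ A := fun h => (by
    have h' : p ∈ A ∪ B := Or.inl h
    rw [hAB] at h'; exact h' rfl)
  set A' : Set X := A \ φ '' {x | r < x 0 ∧ x 0 < s} with hA'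
  have hmem : ∀ q, φ (fun _ => q) ∈ φ '' {x : Fin 1 → I | r < x 0 ∧ x 0 < s} ↔ r < q ∧ q < s := by
    intro q
    constructor
    · rintro ⟨x, hx, h⟩
      have := hφ.inj h
      subst this; exact hx
    · intro h; exact ⟨_, h, rfl⟩
  set f : Co X := fun v => match v with
    | [x] => if x ∈ A' then 1 else 0
    | _ => 0 with hf
  have hf1 : ∀ x, f [x] = if x ∈ A' then 1 else 0 := fun x => rfl
  have hab : ∀ i : Fin 1, (fun _ => r1 : Fin 1 → I) i < (fun _ => r2 : Fin 1 → I) i := fun _ => hr1r.trans hrr2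
  -- local constancy
  have loc : ∀ O : Set X, IsOpen O → (O ⊆ A' ∨ Disjoint O A') → ∀ x ∈ O, ∃ O ∈ 𝓝 x, ∀ v : List X, v.length = 2 →
      (∀ y ∈ v, y ∈ O) → dd f v = 0 := by
    intro O hO h x hx
    refine ⟨O, hO.mem_nhds hx, fun v hv hy => ?_⟩
    obtain ⟨a, b, rfl⟩ := List.length_eq_two.1 hv
    rw [dd_two, hf1, hf1]
    have ha : a ∈ O := hy a (by simp)
    have hb : b ∈ O := hy b (by simp)
    rcases h with h | h
    · rw [if_pos (h ha), if_pos (h hb), z2]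
    · rw [if_neg (disjoint_left.1 h ha), if_neg (disjoint_left.1 h hb), z2]
  have hop : ∀ u w : I, IsOpen (φ '' bx (fun _ => u) (fun _ => w)) := fun u w => hφ.isOpen_bx _ _
  have hcy : Cy 1 (φ '' bx (fun _ => r1) (fun _ => r2)) (dd f) := by
    refine ⟨?_, by rw [dd_dd]; exact zero_mem _⟩
    intro x hx
    by_cases hxp : x ∈ φ '' bx (fun _ => r) (fun _ => 1)
    · refine loc _ (hop r 1) (Or.inr ?_) x hxp
      rw [disjoint_left]
      rintro _ ⟨y, hy, rfl⟩ hyA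
      have hy0 : y = fun _ => y 0 := by funext i; rw [Subsingleton.elim i 0]
      rcases lt_trichotomy (y 0) s with h | h | h
      · exact hyA.2 ⟨y, ⟨(hy 0).1, h⟩, rfl⟩
      · rw [hy0, h, hp] at hyA; exact hpA hyA.1
      · exact disjoint_left.1 hd hyA.1 (by rw [hy0]; exact hr _ h (hy 0).2)
    · have hxp' : x ≠ p := by
        rintro rfl
        exact hxp ⟨_, fun i => ⟨hrs, hs1⟩, hp⟩
      have hxr : x ≠ φ (fun _ => r) := by
        rintro rfl
        exact hx ⟨_, fun i => ⟨hr1r, hrr2⟩, rfl⟩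
      have : x ∈ A ∪ B := by rw [hAB]; exact hxp'
      rcases this with h | h
      · -- inside A
        have hc : IsClosed (φ '' {x | r ≤ x 0 ∧ x 0 ≤ s}) := by
          refine (IsCompact.image (IsClosed.isCompact ?_) hφ.cont).isClosed
          exact (isClosed_le (f := fun _ => r) (g := fun x : Fin 1 → I => x 0) (by fun_prop) (by fun_prop)).inter
            (isClosed_le (f := fun x : Fin 1 → I => x 0) (g := fun _ => s) (by fun_prop) (by fun_prop))
        refine loc (A \ φ '' {x | r ≤ x 0 ∧ x 0 ≤ s}) (hA.sdiff hc) (Or.inl ?_) x ⟨h, ?_⟩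
        · exact diff_subset_diff_right (image_mono fun y hy => ⟨hy.1.le, hy.2.le⟩)
        · rintro ⟨y, hy, rfl⟩
          have hy0 : y = fun _ => y 0 := by funext i; rw [Subsingleton.elim i 0]
          rcases eq_or_lt_of_le hy.1 with h1 | h1
          · exact hxr (by rw [hy0, ← h1])
          · exact hxp ⟨y, fun i => by rw [Subsingleton.elim i 0]; exact ⟨h1, hy.2.trans_lt hs1⟩, rfl⟩
      · exact loc B hB (Or.inr (hd.symm.mono_right diff_subset)) x h
  have hcy' := hcy
  rw [← Bx.sub_image hab] at hcy'
  have hfe : t (dd f) = 0 := ht.ex _ (Ex.dd (Sp_univ f) rfl)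
  rcases (hφ.sub hab).cases hcy' with h | h
  · rw [Bx.sub_image hab] at h
    obtain ⟨g, hg, hg0, hfg⟩ := h
    rw [← dd_add] at hfg
    have hlc := locconst hfg
    have : (f + g) [p] = (f + g) [φ (fun _ => r3)] := hlc.apply_eq_of_preconnectedSpace p (φ fun _ => r3)
    have hgz : ∀ x, x ∉ φ '' bx (fun _ => r1) (fun _ => r2) → g [x] = 0 := by
      intro x hx
      obtain ⟨O, hO, h⟩ := hg x hx
      exact h [x] rfl (by simpa using mem_of_mem_nhds hO)
    rw [Pi.add_apply, Pi.add_apply, hgz, hgz, hf1, hf1, if_neg (fun h => hpA h.1), if_pos] at this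
    · exact absurd this (by decide)
    · refine ⟨hl _ h0r3 (hr3.trans (hr1r.trans hrs)), ?_⟩
      rw [hmem]
      exact fun h => absurd h.1 (hr3.trans hr1r).not_gt
    · rintro ⟨y, hy, h⟩
      have := hφ.inj h
      subst this
      exact absurd (hy 0).1 hr3.not_gt
    · rintro ⟨y, hy, h⟩
      rw [← hp] at h
      have := hφ.inj h
      subst this
      exact absurd (hy 0).2 hr2s.not_gt
  · rw [ht.gn _ _ h (subset_univ _)] at hfe
    exact one_ne_zero hfe

theorem preconn_aux [PreconnectedSpace X] {A B : Set X} {p : X} (hA : IsOpen A) (hB : IsOpen B)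
    (hAB : A ∪ B = {p}ᶜ) (hd : Disjoint A B) (hne : B.Nonempty) {O : Set X} (hO : IsOpen O) (hp : p ∈ O) (h : O \ {p} ⊆ A) :
    False := by
  have hpB : p ∉ B := fun h => (by
    have h' : p ∈ A ∪ B := Or.inr h
    rw [hAB] at h'; exact h' rfl)
  have hAc : B = (A ∪ O)ᶜ := by
    ext x
    constructor
    · rintro hx (h' | h')
      · exact disjoint_left.1 hd h' hx
      · exact disjoint_left.1 hd (h ⟨h', fun e => hpB (mem_singleton_iff.1 e ▸ hx)⟩) hx
    · intro hx
      have : x ∈ A ∪ B := by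
        rw [hAB]; rintro rfl; exact hx (Or.inr hp)
      exact this.resolve_left fun h => hx (Or.inl h)
  have hcl : IsClopen B := ⟨by rw [hAc]; exact (hA.union hO).isClosed_compl, hB⟩
  rcases isClopen_iff.1 hcl with h | h
  · exact hne.ne_empty h
  · exact hpB (h ▸ trivial)

theorem preconn_one [PreconnectedSpace X] (hX : Mf 1 X) (p : X) : IsPreconnected ({p}ᶜ : Set X) := by
  rw [isPreconnected_iff_subset_of_disjoint]
  intro U V hU hV hs hd
  by_contra hcon
  push Not at hcon
  have hop : IsOpen ({p}ᶜ : Set X) := isOpen_compl_singleton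
  set A := {p}ᶜ ∩ U
  set B := {p}ᶜ ∩ V
  have hA : IsOpen A := hop.inter hU
  have hB : IsOpen B := hop.inter hV
  have hAB : A ∪ B = {p}ᶜ := by
    rw [← inter_union_distrib_left]; exact inter_eq_left.2 hs
  have hdis : Disjoint A B := by
    rw [disjoint_iff_inter_eq_empty, ← hd]; ext x; simp [A, B]; tauto
  have hAne : A.Nonempty := by
    obtain ⟨x, hx, hx'⟩ := not_subset.1 hcon.2
    exact ⟨x, hx, (hs hx).resolve_right hx'⟩
  have hBne : B.Nonempty := by
    obtain ⟨x, hx, hx'⟩ := not_subset.1 hcon.1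
    exact ⟨x, hx, (hs hx).resolve_left hx'⟩
  obtain ⟨φ, hφ, y, hy, hyp⟩ := hX p
  have hy0 : ∀ y : Fin 1 → I, y = fun _ => y 0 := fun y => by funext i; rw [Subsingleton.elim i 0]
  set s := y 0
  have hs0 : 0 < s := (hy 0).1
  have hs1 : s < 1 := (hy 0).2
  have hps : φ (fun _ => s) = p := by rw [← hyp]; congr 1; exact (hy0 y).symm
  have hsub : ∀ T : Set I, IsPreconnected T → s ∉ T → (∀ r ∈ T, φ (fun _ => r) ∈ A) ∨ (∀ r ∈ T, φ (fun _ => r) ∈ B) := by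
    intro T hT hsT
    have hc : IsPreconnected ((fun r : I => φ (fun _ => r)) '' T) := hT.image _
      (hφ.cont.comp (by fun_prop)).continuousOn
    have hsub : (fun r : I => φ (fun _ => r)) '' T ⊆ A ∪ B := by
      rw [hAB]
      rintro _ ⟨r, hr, rfl⟩ h
      rw [mem_singleton_iff, ← hps] at h
      have := congrFun (hφ.inj h) 0
      exact hsT (this ▸ hr)
    rcases hc.subset_or_subset hA hB hdis hsub with h | h
    · exact Or.inl fun r hr => h ⟨r, hr, rfl⟩
    · exact Or.inr fun r hr => h ⟨r, hr, rfl⟩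
  have hO : ∀ C : Set X, (∀ r ∈ Ioo 0 s, φ (fun _ => r) ∈ C) → (∀ r ∈ Ioo s 1, φ (fun _ => r) ∈ C) →
      φ '' oc 1 \ {p} ⊆ C := by
    rintro C h1 h2 _ ⟨⟨x, hx, rfl⟩, hne⟩
    rw [hy0 x] at hne ⊢
    rcases lt_trichotomy (x 0) s with h | h | h
    · exact h1 _ ⟨(hx 0).1, h⟩
    · rw [h] at hne; exact (hne hps).elim
    · exact h2 _ ⟨h, (hx 0).2⟩
  have hpO : p ∈ φ '' oc 1 := ⟨y, hy, hyp⟩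
  rcases hsub (Ioo 0 s) isPreconnected_Ioo (by simp) with h1 | h1 <;>
  rcases hsub (Ioo s 1) isPreconnected_Ioo (by simp) with h2 | h2
  · exact preconn_aux hA hB hAB hdis hBne hφ.op hpO (hO A h1 h2)
  · exact sides_aux hX hA hB hAB hdis hφ hs0 hs1 hps (fun r a b => h1 r ⟨a, b⟩) (fun r a b => h2 r ⟨a, b⟩)
  · exact sides_aux hX hB hA (by rwa [union_comm]) hdis.symm hφ hs0 hs1 hps (fun r a b => h1 r ⟨a, b⟩) (fun r a b => h2 r ⟨a, b⟩)
  · exact preconn_aux hB hA (by rwa [union_comm]) hdis.symm hAne hφ.op hpO (hO B h1 h2)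
end
end CS

open scoped Topology
namespace CS
set_option linter.all false
open Set unitInterval

section
variable {X : Type*} 
/-- product with a 0-cochain -/
def mulF (a : X → ZMod 2) (f : Co X) : Co X := fun v => match v with
  | [] => 0
  | x :: w => a x * f (x :: w)
/-- product of a 1-cochain with a cochain -/
def cup (α f : Co X) : Co X := fun v => match v with
  | x :: y :: w => α [x, y] * f (y :: w)
  | _ => 0
theorem mulF_nil (a : X → ZMod 2) (f : Co X) : mulF a f [] = 0 := rfl
theorem mulF_cons (a : X → ZMod 2) (f : Co X) (x : X) (w : List X) : mulF a f (x :: w) = a x * f (x :: w) := rfl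
theorem cup_cons (α f : Co X) (x y : X) (w : List X) : cup α f (x :: y :: w) = α [x, y] * f (y :: w) := rfl
theorem cup_nil (α f : Co X) : cup α f [] = 0 := rfl
theorem dd_smul (r : ZMod 2) (f : Co X) : dd (r • f) = r • dd f :=
  (dL X).map_smul r f
theorem mulF_add (a : X → ZMod 2) (f g : Co X) : mulF a (f + g) = mulF a f + mulF a g := by
  funext v; rcases v with _ | ⟨x, v⟩
  · simp [mulF_nil]
  · simp [mulF_cons, mul_add]
theorem cup_add (α f g : Co X) : cup α (f + g) = cup α f + cup α g := by
  funext v; rcases v with _ | ⟨x, _ | ⟨y, v⟩⟩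
  · simp [cup]
  · simp [cup]
  · simp [cup, mul_add]
theorem add_cup (α f g : Co X) : cup (f + g) α = cup f α + cup g α := by
  funext v; rcases v with _ | ⟨x, _ | ⟨y, v⟩⟩
  · simp [cup]
  · simp [cup]
  · simp [cup, add_mul]
theorem dd_mulF (a : X → ZMod 2) (f : Co X) (x y : X) (w : List X) :
    dd (mulF a f) (x :: y :: w) = (a x + a y) * f (y :: w) + a x * dd f (x :: y :: w) := by
  have e : (fun v => mulF a f (x :: v)) = a x • (fun v => f (x :: v)) := by
    funext v; simp [mulF_cons]
  rw [dd_cons, e, dd_smul, dd_cons f, mulF_cons]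
  simp only [Pi.smul_apply, smul_eq_mul]
  have := z2 (a x * f (y :: w))
  linear_combination -this
theorem dd_three (f : Co X) (x y z : X) : dd f [x, y, z] = f [y, z] + f [x, z] + f [x, y] := by
  simp [dd_cons, add_assoc]
theorem dd_cup (α f : Co X) (x y z : X) (w : List X) :
    dd (cup α f) (x :: y :: z :: w) = dd α [x, y, z] * f (z :: w) + α [x, y] * dd f (y :: z :: w) := by
  have e : (fun v => cup α f (x :: v)) = mulF (fun y => α [x, y]) f := by
    funext v
    rcases v with _ | ⟨y, v⟩
    · simp [mulF_nil, cup]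
    · simp [mulF_cons, cup]
  rw [dd_cons, e, dd_mulF, dd_three, cup_cons]
  ring
variable [TopologicalSpace X] 
theorem mulF_mem {m : ℕ} {W : Set X} (a : X → ZMod 2) {f : Co X} (hf : f ∈ Sp m W) : mulF a f ∈ Sp m W := by
  intro x hx
  obtain ⟨O, hO, h⟩ := hf x hx
  refine ⟨O, hO, fun v hv hy => ?_⟩
  rcases v with _ | ⟨y, v⟩
  · rfl
  · rw [mulF_cons, h _ hv hy, mul_zero]
theorem cup_mem {m : ℕ} {W : Set X} (α : Co X) {f : Co X} (hf : f ∈ Sp m W) : cup α f ∈ Sp (m + 1) W := by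
  intro x hx
  obtain ⟨O, hO, h⟩ := hf x hx
  refine ⟨O, hO, fun v hv hy => ?_⟩
  rcases v with _ | ⟨y, _ | ⟨z, v⟩⟩
  · rfl
  · rfl
  · rw [cup_cons, h _ (by simpa using hv) (fun t ht => hy t (List.mem_cons_of_mem _ ht)), mul_zero]
theorem cup_mem' {m : ℕ} {W : Set X} {α : Co X} (f : Co X) (hf : α ∈ Sp 2 W) : cup α f ∈ Sp m W := by
  intro x hx
  obtain ⟨O, hO, h⟩ := hf x hx
  refine ⟨O, hO, fun v hv hy => ?_⟩
  rcases v with _ | ⟨y, _ | ⟨z, v⟩⟩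
  · rfl
  · rfl
  · rw [cup_cons, h [y, z] rfl (fun t ht => hy t (by simp at ht ⊢; tauto)), zero_mul]
theorem dd_cup_mem {m : ℕ} (hm : m ≠ 0) {α : Co X} (hα : dd α ∈ Sp 3 ∅) (f : Co X) :
    dd (cup α f) + cup α (dd f) ∈ Sp (m + 2) ∅ := by
  intro x hx
  obtain ⟨O, hO, h⟩ := hα x hx
  refine ⟨O, hO, fun v hv hy => ?_⟩
  rcases v with _ | ⟨y, _ | ⟨z, _ | ⟨w, v⟩⟩⟩
  · rfl
  · simp at hv
  · simp at hv; omega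
  · rw [Pi.add_apply, dd_cup, h [y, z, w] rfl (fun t ht => hy t (by simp at ht ⊢; tauto)), zero_mul, zero_add, cup_cons, z2]

/-- `U` contracts inside `Y` -/
def Ctr (U Y : Set X) : Prop := ∃ H : X × ℝ → X, ∃ q, ContinuousOn H (U ×ˢ Icc 0 1) ∧ (∀ x ∈ U, H (x, 0) = x) ∧
  (∀ x ∈ U, H (x, 1) = q) ∧ MapsTo H (U ×ˢ Icc 0 1) Y

variable [T2Space X] 

theorem Ctr.loc_exact {U K : Set X} (h : Ctr U univ) (hK : IsCompact K) (hKU : K ⊆ U) {k : ℕ} (hk : 1 ≤ k) {f : Co X}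
    (hf : dd f ∈ Sp (k + 2) ∅) : ∃ g : Co X, g [] = 0 ∧ f + dd g ∈ Sp (k + 1) (interior K)ᶜ := by
  obtain ⟨H, q, hH, h0, h1, -⟩ := h
  have : CompactSpace K := isCompact_iff_compactSpace.1 hK
  set G : K × ℝ → X := fun p => H (p.1, projIcc 0 1 zero_le_one p.2)
  have hG : Continuous G := by
    refine hH.comp_continuous ?_ ?_
    · have : Continuous (projIcc (0:ℝ) 1 zero_le_one) := continuous_projIcc
      fun_prop
    · exact fun p => ⟨hKU p.1.2, (projIcc (0:ℝ) 1 zero_le_one p.2).2⟩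
  obtain ⟨g, -, hg0, hg⟩ := null_exact hG (q := q) (by
    intro x
    simp only [G]
    rw [projIcc_right]; exact h1 _ (hKU x.2)) hk hf
  have e : (fun x : K => G (x, 0)) = Subtype.val := by
    funext x
    simp only [G]
    rw [projIcc_left]; exact h0 _ (hKU x.2)
  rw [e] at hg
  refine ⟨CS.pf Subtype.val g, by rw [pf_nil, hg0], ?_⟩
  intro x hx
  rw [notMem_compl_iff] at hx
  obtain ⟨O, hO, h⟩ := hg ⟨x, interior_subset hx⟩ (by simp)
  rw [mem_nhds_subtype] at hO
  obtain ⟨O', hO', hs⟩ := hO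
  refine ⟨O' ∩ interior K, Filter.inter_mem hO' (isOpen_interior.mem_nhds hx), fun v hv hy => ?_⟩
  obtain ⟨w, rfl⟩ := exists_list_map (φ := (Subtype.val : K → X)) (v := v) fun y hy' => ⟨⟨y, interior_subset (hy y hy').2⟩, rfl⟩
  have h2 := h w (by simpa using hv) (fun y hy' => hs (hy y (List.mem_map_of_mem hy')).1)
  have h3 : dd (CS.pf Subtype.val g) (w.map Subtype.val) = CS.pb (Subtype.val : K → X) (dd (CS.pf Subtype.val g)) w := rfl
  rw [Pi.add_apply, h3, ← dd_pb, pb_pf Subtype.val_injective]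
  exact h2

variable [CompactSpace X]

/-- cup products vanish on spaces of category one -/
theorem cup_exact {U V : Set X} (hU : IsOpen U) (hV : IsOpen V) (hUV : U ∪ V = univ) (cU : Ctr U univ) (cV : Ctr V univ)
    {m : ℕ} (hm : 1 ≤ m) {α β : Co X} (hα : dd α ∈ Sp 3 ∅) (hβ : dd β ∈ Sp (m + 2) ∅) : Ex (m + 1) univ (cup α β) := by
  obtain ⟨O, hO, hO1, hO2⟩ := normal_exists_closure_subset hV.isClosed_compl hU (by
    intro x hx
    exact ((hUV ▸ mem_univ x : x ∈ U ∪ V)).resolve_right hx)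
  obtain ⟨Q, hQ, hQ1, hQ2⟩ := normal_exists_closure_subset hO.isClosed_compl hV (by
    rw [compl_subset_comm]; exact hO1)
  obtain ⟨g, hg0, hg⟩ := cU.loc_exact isClosed_closure.isCompact hO2 le_rfl hα
  obtain ⟨h, hh0, hh⟩ := cV.loc_exact isClosed_closure.isCompact hQ2 hm hβ
  set α' := α + dd g
  set β' := β + dd h
  have hdβ' : dd β' ∈ Sp (m + 2) ∅ := by
    rw [dd_add, dd_dd, add_zero]; exact hβ
  have h1 : cup α' β' ∈ Sp (m + 2) ∅ := by
    refine Sp_mono ?_ (Sp_inter (cup_mem' (m := m + 2) β' hg) (cup_mem α' hh))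
    rintro x ⟨hx1, hx2⟩
    by_cases hx : x ∈ O
    · exact hx1 (interior_maximal subset_closure hO hx)
    · exact hx2 (interior_maximal subset_closure hQ (hQ1 hx))
  have h2 : cup (dd g) β' + dd (mulF (fun x => g [x]) β') ∈ Sp (m + 2) ∅ := by
    intro x hx
    obtain ⟨P, hP, hz⟩ := hdβ' x hx
    refine ⟨P, hP, fun v hv hy => ?_⟩
    rcases v with _ | ⟨y, _ | ⟨z, v⟩⟩
    · rfl
    · simp at hv
    · rw [Pi.add_apply, dd_mulF, hz _ hv hy, cup_cons, dd_two]
      have := z2 ((g [z] + g [y]) * β' (z :: v))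
      linear_combination this
  have h3 := dd_cup_mem (m := m) (by omega) hα h
  refine ⟨mulF (fun x => g [x]) β' + cup α h, Sp_univ _, by simp [mulF_nil, cup_nil], ?_⟩
  have := add_mem (add_mem h1 h2) h3
  convert this using 1
  have e : cup α β = cup α' β' + cup (dd g) β' + cup α (dd h) := by
    rw [← add_cup, show α' + dd g = α from add_add_cancel' _ _, ← cup_add, show β' + dd h = β from add_add_cancel' _ _]
  rw [e, dd_add]
  abel

/-- exact pairs in the twisted complex -/
def DE (n : ℕ) (α f g : Co X) : Prop := ∃ β ω : Co X, β [] = 0 ∧ ω [] = 0 ∧ f + dd β ∈ Sp (n + 1) ∅ ∧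
  g + cup α β + dd ω ∈ Sp (n + 1) ∅

theorem DE.add {n : ℕ} {α f g f' g' : Co X} (h : DE n α f g) (h' : DE n α f' g') : DE n α (f + f') (g + g') := by
  obtain ⟨β, ω, h1, h2, h3, h4⟩ := h
  obtain ⟨β', ω', h1', h2', h3', h4'⟩ := h'
  refine ⟨β + β', ω + ω', by simp [h1, h1'], by simp [h2, h2'], ?_, ?_⟩
  · rw [dd_add]; convert add_mem h3 h3' using 1; abel
  · rw [dd_add, cup_add]; convert add_mem h4 h4' using 1; abel

theorem DE.of_null {n : ℕ} {α f g : Co X} (h : f ∈ Sp (n + 1) ∅) (h' : g ∈ Sp (n + 1) ∅) : DE n α f g := by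
  have e : cup α (0 : Co X) = 0 := by
    funext v; rcases v with _ | ⟨x, _ | ⟨y, v⟩⟩ <;> simp [cup]
  exact ⟨0, 0, rfl, rfl, by rwa [dd_zero, add_zero], by rwa [e, dd_zero, add_zero, add_zero]⟩

/-- the set where α is coherent -/
def Coh (α : Co X) (O : Set X) : Prop := ∀ x ∈ O, ∀ y ∈ O, ∀ z ∈ O, α [y, z] + α [x, z] + α [x, y] = 0

theorem Coh.self {α : Co X} {O : Set X} (h : Coh α O) {x y : X} (hx : x ∈ O) (hy : y ∈ O) : α [x, y] + α [y, x] = 0 := by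
  have h1 := h x hx y hy y hy
  have h2 := h y hy x hx y hy
  have h3 := h y hy y hy y hy
  have h4 := z2 (α [y, y])
  have h5 := z2 (α [x, y])
  linear_combination h2 - h3 + h4

theorem DE.sub {n : ℕ} (hn : n ≠ 0) {α : Co X} {O : Set X} (hO : Coh α O) {ψ ψ' : (Fin n → I) → X} {c c' : Co X} (hc : Gn n ψ c)
    (hc' : Gn n ψ' c') (hs : (ψ') '' oc n ⊆ ψ '' oc n) (hψ : ψ '' oc n ⊆ O) {y : X} (hy : y ∈ O) (s : ZMod 2) :
    DE n α (c + c') (mulF (fun z => s + α [y, z]) c + mulF (fun z => s + α [y, z]) c') := by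
  obtain ⟨β, hβ, hβ0, hβ1⟩ := hc.uniq (hc.bx.gn_in hc' hs)
  rw [← mulF_add]
  set a := fun z => s + α [y, z]
  have hd : dd β ∈ Sp (n + 1) (ψ '' oc n) := dd_mem hβ
  refine ⟨β, mulF a β, hβ0, rfl, hβ1, ?_⟩
  have h1 : mulF a (c + c' + dd β) ∈ Sp (n + 1) ∅ := mulF_mem a hβ1
  have h2 : mulF a (dd β) + cup α β + dd (mulF a β) ∈ Sp (n + 1) ∅ := by
    have e1 : mulF a (dd β) + cup α β + dd (mulF a β) ∈ Sp (n + 1) (ψ '' oc n) :=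
      add_mem (add_mem (mulF_mem a hd) (cup_mem α hβ)) (dd_mem (mulF_mem a hβ))
    have e2 : mulF a (dd β) + cup α β + dd (mulF a β) ∈ Sp (n + 1) (ψ '' oc n)ᶜ := by
      intro x hx
      rw [notMem_compl_iff] at hx
      refine ⟨_, hc.bx.op.mem_nhds hx, fun v hv hy' => ?_⟩
      rcases v with _ | ⟨z, _ | ⟨w, v⟩⟩
      · rfl
      · simp at hv; omega
      · rw [Pi.add_apply, Pi.add_apply, dd_mulF, mulF_cons, cup_cons]
        have h5 := hO y hy z (hψ (hy' z (by simp))) w (hψ (hy' w (by simp)))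
        have h6 := z2 (a z * dd β (z :: w :: v))
        have h7 := z2 s
        simp only [a] at h6 ⊢
        linear_combination h6 + β (w :: v) * h5 + β (w :: v) * h7
    have := Sp_inter e1 e2
    rwa [inter_compl_self] at this
  have := add_mem h1 h2
  convert this using 1
  rw [mulF_add a (c + c')]
  have := co2 (mulF a (dd β))
  linear_combination -this

/-- on a closed manifold of category one all 1-cocycles are exact -/
theorem one_exact [ConnectedSpace X] {n : ℕ} (hn : 2 ≤ n) (hX : Mf n X) {U V : Set X} (hU : IsOpen U) (hV : IsOpen V)
    (hUV : U ∪ V = univ) (cU : Ctr U univ) (cV : Ctr V univ) {α : Co X} (hα : dd α ∈ Sp 3 ∅) :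
    ∃ l : X → ZMod 2, ∀ y, ∃ O ∈ 𝓝 y, ∀ z ∈ O, ∀ w ∈ O, α [z, w] = l z + l w := by
  obtain ⟨t, ht⟩ := exists_trace (by omega) hX
  have hcoh : ∀ y : X, ∃ O, IsOpen O ∧ y ∈ O ∧ Coh α O := by
    intro y
    obtain ⟨O, hO, hy, h⟩ := mem_Sp_open.1 hα y (by simp)
    refine ⟨O, hO, hy, fun a ha b hb d hd => ?_⟩
    have := h [a, b, d] rfl (by simp; tauto)
    rwa [dd_three] at this
  choose O hO hyO hOc using hcoh
  have : ∀ y, ∃ ψ c, Gn n ψ c ∧ y ∈ ψ '' oc n ∧ ψ '' oc n ⊆ O y := by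
    intro y
    obtain ⟨ψ, h1, h2, h3⟩ := hX.small (hO y) (hyO y)
    obtain ⟨c, hc⟩ := h1.exists_gn
    exact ⟨ψ, c, hc, h2, h3⟩
  choose ψ c hc hy hs using this
  have hn0 : n ≠ 0 := by omega
  -- moving
  have move : ∀ y y' s, y' ∈ ψ y '' oc n → DE n α (c y + c y')
      (mulF (fun z => s + α [y, z]) (c y) + mulF (fun z => (s + α [y, y']) + α [y', z]) (c y')) := by
    intro y y' s hyy
    obtain ⟨χ, h1, h2, h3⟩ := hX.small ((hc y).bx.op.inter (hc y').bx.op) ⟨hyy, hy y'⟩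
    obtain ⟨d, hd⟩ := h1.exists_gn
    have k1 := DE.sub hn0 (hOc y) (hc y) hd (h3.trans inter_subset_left) (hs y) (hyO y) s
    have k2 := DE.sub hn0 (hOc y') (hc y') hd (h3.trans inter_subset_right) (hs y') (hyO y') (s + α [y, y'])
    have k3 : DE n α 0 (mulF (fun z => s + α [y, z]) d + mulF (fun z => (s + α [y, y']) + α [y', z]) d) := by
      apply DE.of_null (zero_mem _)
      have e1 : mulF (fun z => s + α [y, z]) d + mulF (fun z => (s + α [y, y']) + α [y', z]) d ∈ 
        Sp (n + 1) (χ '' oc n) := add_mem (mulF_mem _ hd.cy.1) (mulF_mem _ hd.cy.1)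
      have e2 : mulF (fun z => s + α [y, z]) d + mulF (fun z => (s + α [y, y']) + α [y', z]) d ∈ 
          Sp (n + 1) (χ '' oc n)ᶜ := by
        intro x hx
        rw [notMem_compl_iff] at hx
        refine ⟨_, h1.op.mem_nhds hx, fun v hv hy' => ?_⟩
        rcases v with _ | ⟨z, v⟩
        · rfl
        · rw [Pi.add_apply, mulF_cons, mulF_cons]
          have h5 := hOc y y (hyO y) y' (hs y hyy) z (hs y (h3 (hy' z (by simp))).1)
          have h7 := z2 s
          linear_combination d (z :: v) * h5 + d (z :: v) * h7
      have := Sp_inter e1 e2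
      rwa [inter_compl_self] at this
    convert (k1.add k2).add k3 using 1
    · have := co2 d; linear_combination -this
    · have h4 := co2 (mulF (fun z => s + α [y, z]) d)
      have h5 := co2 (mulF (fun z => (s + α [y, y']) + α [y', z]) d)
      linear_combination -h4 - h5
  obtain ⟨x0⟩ : Nonempty X := inferInstance
  set R : X → ZMod 2 → Prop := fun y s => DE n α (c x0 + c y)
    (mulF (fun z => 0 + α [x0, z]) (c x0) + mulF (fun z => s + α [y, z]) (c y)) with hR
  have step : ∀ y y' s, y' ∈ ψ y '' oc n → R y s → R y' (s + α [y, y']) := by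
    intro y y' s hyy h
    have := h.add (move y y' s hyy)
    simp only [hR]
    convert this using 1
    · have := co2 (c y); linear_combination -this
    · have := co2 (mulF (fun z => s + α [y, z]) (c y))
      linear_combination -this
  have step' : ∀ y y' s, y' ∈ ψ y '' oc n → R y' s → R y (s + α [y, y']) := by
    intro y y' s hyy h
    have := h.add (move y y' (s + α [y, y']) hyy)
    rw [show s + α [y, y'] + α [y, y'] = s by rw [add_assoc, z2, add_zero]] at this
    simp only [hR]
    convert this using 1
    · have := co2 (c y'); linear_combination -this
    · have := co2 (mulF (fun z => s + α [y', z]) (c y'))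
      linear_combination -this
  have hall : ∀ y, ∃ s, R y s := by
    have hcl : IsClopen {y | ∃ s, R y s} := by
      constructor
      · rw [← isOpen_compl_iff, isOpen_iff_mem_nhds]
        intro y hyn
        refine Filter.mem_of_superset ((hc y).bx.op.mem_nhds (hy y)) fun y' hy' => ?_
        rintro ⟨s, h⟩
        exact hyn ⟨_, step' y y' s hy' h⟩
      · rw [isOpen_iff_mem_nhds]
        rintro y ⟨s, h⟩
        exact Filter.mem_of_superset ((hc y).bx.op.mem_nhds (hy y)) fun y' hy' => ⟨_, step y y' s hy' h⟩
    have h0 : x0 ∈ {y | ∃ s, R y s} := ⟨0, by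
      simp only [hR]
      rw [co2, co2]; exact DE.of_null (zero_mem _) (zero_mem _)⟩
    intro y
    have := hcl.eq_univ ⟨x0, h0⟩
    have h2 : y ∈ {y | ∃ s, R y s} := by rw [this]; trivial
    exact h2
  have huniq : ∀ y s s', R y s → R y s' → s = s' := by
    intro y s s' h h'
    by_contra hne
    have hss : s + s' = 1 := (z2_cases _).resolve_left fun h => hne (z2_eq h)
    obtain ⟨β, ω, b0, w0, h1, h2⟩ := h.add h'
    rw [co2, zero_add] at h1
    have e : mulF (fun z => 0 + α [x0, z]) (c x0) + mulF (fun z => s + α [y, z]) (c y) +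
        (mulF (fun z => 0 + α [x0, z]) (c x0) + mulF (fun z => s' + α [y, z]) (c y)) + c y ∈ Sp (n + 1) ∅ := by
      intro x _
      refine ⟨univ, Filter.univ_mem, fun v hv _ => ?_⟩
      rcases v with _ | ⟨z, v⟩
      · simp at hv
      · simp only [Pi.add_apply, mulF_cons]
        have a1 := z2 ((0 + α [x0, z]) * c x0 (z :: v))
        have a2 := z2 (α [y, z])
        have a3 := z2 (c y (z :: v))
        linear_combination a1 + c y (z :: v) * a2 + c y (z :: v) * hss + a3
    obtain ⟨m, rfl⟩ : ∃ m, n = m + 1 := ⟨n - 1, by omega⟩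
    have hcup := cup_exact hU hV hUV cU cV (m := m) (by omega) hα h1
    have h3 : Ex (m + 1) univ (c y) := by
      refine Ex.congr hcup ⟨ω, Sp_univ _, w0, ?_⟩
      have := add_mem e h2
      convert this using 1
      have a1 := co2 (mulF (fun z => 0 + α [x0, z]) (c x0) + mulF (fun z => s + α [y, z]) (c y) +
        (mulF (fun z => 0 + α [x0, z]) (c x0) + mulF (fun z => s' + α [y, z]) (c y)))
      linear_combination -a1
    have := ht.ex _ h3
    rw [ht.gn _ _ (hc y) (subset_univ _)] at this
    exact one_ne_zero this
  choose l hl using hall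
  refine ⟨l, fun y => ⟨_, (hc y).bx.op.mem_nhds (hy y), fun z hz w hw => ?_⟩⟩
  have h1 := huniq _ _ _ (hl z) (step y z _ hz (hl y))
  have h2 := huniq _ _ _ (hl w) (step y w _ hw (hl y))
  have h3 := hOc y y (hyO y) z (hs y hz) w (hs y hw)
  have h4 := z2 (l y)
  have h5 := z2 (α [y, z])
  have h6 := z2 (α [y, w])
  rw [h1, h2]
  linear_combination h3 - h4 - h5 - h6
end
end CS

open scoped Topology
namespace CS
set_option linter.all false
open Set unitInterval
section
variable {X : Type*} [TopologicalSpace X] [T2Space X] [CompactSpace X]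
theorem one_exact_off [ConnectedSpace X] {n : ℕ} (hn : 2 ≤ n) (hX : Mf n X) {U V : Set X} (hU : IsOpen U) (hV : IsOpen V)
    (hUV : U ∪ V = univ) (cU : Ctr U univ) (cV : Ctr V univ) {p : X} {B : Set X} (hB : IsOpen B) (hpB : p ∈ B) {a : Co X} (ha0 : a [] = 0)
    (ha : dd a ∈ Sp 3 {p}) :
    ∃ l : X → ZMod 2, ∀ y, y ∉ B → ∃ O ∈ 𝓝 y, ∀ z ∈ O, ∀ w ∈ O, a [z, w] = l z + l w := by
  obtain ⟨t, ht⟩ := exists_trace (by omega) hX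
  obtain ⟨φ, hφ, hp, hs⟩ := hX.small hB hpB
  have hcy : Cy 2 (φ '' oc n) (dd a) := ⟨Sp_mono (singleton_subset_iff.2 hp) ha, by rw [dd_dd]; exact zero_mem _⟩
  have hex : Ex 2 (φ '' oc n) (dd a) := by
    by_cases h2 : 2 = n
    · subst h2
      rcases hφ.cases hcy with h | h
      · exact h
      · have := ht.ex _ (Ex.dd (k := 2) (Sp_univ a) ha0)
        rw [ht.gn _ _ h (subset_univ _)] at this
        exact absurd this one_ne_zero
    · exact hφ.cell.van 2 h2 _ hcy
  obtain ⟨g, hg, hg0, hag⟩ := hex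
  rw [← dd_add] at hag
  obtain ⟨l, hl⟩ := one_exact hn hX hU hV hUV cU cV hag
  refine ⟨l, fun y hy => ?_⟩
  obtain ⟨O, hO, h1⟩ := hl y
  obtain ⟨O', hO', h2⟩ := hg y (fun h => hy (hs h))
  refine ⟨O ∩ O', Filter.inter_mem hO hO', fun z hz w hw => ?_⟩
  rw [← h1 z hz.1 w hw.1, Pi.add_apply, h2 [z, w] rfl (by simp [hz.2, hw.2]), add_zero]
end
end CS

open scoped Topology
namespace CS
set_option linter.all false
open Set unitInterval

/-- general position: finite zeros -/
theorem gp_finite {n : ℕ} (g : EuclideanSpace ℝ (Fin n) → EuclideanSpace ℝ (Fin n))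
    (hg : UniformContinuous g) {K : Set (EuclideanSpace ℝ (Fin n))} (hK : IsCompact K)
    {ε : ℝ} (hε : 0 < ε) :
    ∃ f : EuclideanSpace ℝ (Fin n) → EuclideanSpace ℝ (Fin n), Continuous f ∧
      (∀ x, ‖f x - g x‖ < ε) ∧ {x ∈ K | f x = 0}.Finite := by
  obtain ⟨f, hf, hfg⟩ := hg.exists_contDiff_dist_le (half_pos hε)
  have hd : Differentiable ℝ f := hf.differentiable (by simp)
  set s : Set (EuclideanSpace ℝ (Fin n)) := {x | (fderiv ℝ f x).det = 0}
  have h0 : MeasureTheory.volume (f '' s) = 0 :=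
    MeasureTheory.addHaar_image_eq_zero_of_det_fderivWithin_eq_zero MeasureTheory.volume
      (fun x _ => (hd x).hasFDerivAt.hasFDerivWithinAt) (fun x hx => hx)
  obtain ⟨c, hc, hcs⟩ : ∃ c ∈ Metric.ball (0 : EuclideanSpace ℝ (Fin n)) (ε / 2), c ∉ f '' s := by
    by_contra hcon
    push Not at hcon
    have := MeasureTheory.measure_mono_null hcon h0
    exact (Metric.measure_ball_pos MeasureTheory.volume _ (half_pos hε)).ne' this
  refine ⟨fun x => f x - c, by have := hf.continuous; fun_prop, fun x => ?_, ?_⟩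
  · have h1 := hfg x
    rw [dist_eq_norm] at h1
    have h2 : ‖c‖ < ε / 2 := by simpa using hc
    calc ‖f x - c - g x‖ = ‖(f x - g x) - c‖ := by congr 1; abel
      _ ≤ ‖f x - g x‖ + ‖c‖ := norm_sub_le _ _
      _ < ε := by linarith
  · apply IsCompact.finite
    · have : IsClosed {x | f x - c = 0} := isClosed_eq (by have := hf.continuous; fun_prop) continuous_const
      exact hK.inter_right this
    · rw [isDiscrete_iff_nhdsNE]
      rintro x ⟨hxK, hx⟩
      have hx' : f x = c := sub_eq_zero.1 hx
      have hdet : (fderiv ℝ f x).det ≠ 0 := fun h => hcs ⟨x, h, hx'⟩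
      have hs := (hf.contDiffAt (x := x)).hasStrictFDerivAt (by simp)
      let L := (fderiv ℝ f x).toContinuousLinearEquivOfDetNeZero hdet
      have hs' : HasStrictFDerivAt f (L : EuclideanSpace ℝ (Fin n) →L[ℝ] EuclideanSpace ℝ (Fin n)) x := hs
      set Φ := hs'.toOpenPartialHomeomorph f
      have hΦ : Φ.source ∈ 𝓝 x := Φ.open_source.mem_nhds (hs'.mem_toOpenPartialHomeomorph_source)
      rw [Filter.inf_principal_eq_bot, mem_nhdsWithin_iff_exists_mem_nhds_inter]
      refine ⟨Φ.source, hΦ, ?_⟩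
      rintro y ⟨hy, hyx⟩ ⟨_, hy'⟩
      apply hyx
      apply Φ.injOn hy (hs'.mem_toOpenPartialHomeomorph_source)
      show f y = f x
      rw [hx', sub_eq_zero.1 hy']

/-- scattered: covered by disjoint small opens -/
def Sc {M : Type*} [TopologicalSpace M] (small : Set M → Prop) (Λ : Set M) : Prop :=
  ∃ Q : ℕ → Set M, (∀ j, IsOpen (Q j) ∧ small (Q j)) ∧ (∀ i j, i ≠ j → Disjoint (Q i) (Q j)) ∧
    Λ ⊆ ⋃ j, Q j

structure Sml {M : Type*} [TopologicalSpace M] (small : Set M → Prop) : Prop where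
  her : ∀ A B, IsOpen A → B ⊆ A → small A → small B
  loc : ∀ x, ∃ A, IsOpen A ∧ x ∈ A ∧ small A

theorem Sc.insert {M : Type*} [TopologicalSpace M] [T2Space M] {small : Set M → Prop}
    (hs : Sml small) {Λ : Set M} (hΛ : IsCompact Λ) (h : Sc small Λ) (x : M) :
    Sc small (insert x Λ) := by
  obtain ⟨Q, hQ, hd, hc⟩ := h
  by_cases hx : x ∈ ⋃ j, Q j
  · exact ⟨Q, hQ, hd, insert_subset hx hc⟩
  have hxΛ : x ∉ Λ := fun h => hx (hc h)
  obtain ⟨G, H, hG, hH, hGΛ, hHx, hGH⟩ := SeparatedNhds.of_isCompact_isCompact hΛ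
    (isCompact_singleton (x := x)) (disjoint_singleton_right.2 hxΛ)
  obtain ⟨A, hA, hxA, hAs⟩ := hs.loc x
  refine ⟨fun j => Nat.casesOn j (A ∩ H) (fun j => Q j ∩ G), ?_, ?_, ?_⟩
  · rintro (_ | j)
    · exact ⟨hA.inter hH, hs.her A _ hA inter_subset_left hAs⟩
    · exact ⟨(hQ j).1.inter hG, hs.her _ _ (hQ j).1 inter_subset_left (hQ j).2⟩
  · rintro (_ | i) (_ | j) hij
    · exact absurd rfl hij
    · exact (hGH.symm).mono inter_subset_right inter_subset_right
    · exact hGH.mono inter_subset_right inter_subset_right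
    · exact (hd i j (fun h => hij (by rw [h]))).mono inter_subset_left inter_subset_left
  · rintro y (rfl | hy)
    · exact mem_iUnion.2 ⟨0, hxA, hHx rfl⟩
    · obtain ⟨j, hj⟩ := mem_iUnion.1 (hc hy)
      exact mem_iUnion.2 ⟨j + 1, hj, hGΛ hy⟩

theorem Sc.union_finite {M : Type*} [TopologicalSpace M] [T2Space M] {small : Set M → Prop}
    (hs : Sml small) {Λ : Set M} (hΛ : IsCompact Λ) (h : Sc small Λ) {F : Set M} (hF : F.Finite) :
    Sc small (F ∪ Λ) := by
  have : IsCompact (F ∪ Λ) ∧ Sc small (F ∪ Λ) := by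
    induction F, hF using Set.Finite.induction_on with
    | empty => simpa using ⟨hΛ, h⟩
    | insert hx hf ih =>
      rw [insert_union]
      exact ⟨ih.1.insert _, Sc.insert hs ih.1 ih.2 _⟩
  exact this.2

theorem Sc.mono {M : Type*} [TopologicalSpace M] {small : Set M → Prop} {A B : Set M}
    (h : Sc small B) (hAB : A ⊆ B) : Sc small A := by
  obtain ⟨Q, a, b, c⟩ := h
  exact ⟨Q, a, b, hAB.trans c⟩

/-- perturbation of a map on a cell -/
theorem gp_cube {n : ℕ} (g : (Fin n → I) → EuclideanSpace ℝ (Fin n)) (hg : Continuous g)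
    {ε : ℝ} (hε : 0 < ε) :
    ∃ f : (Fin n → I) → EuclideanSpace ℝ (Fin n), Continuous f ∧
      (∀ x, ‖f x - g x‖ < ε) ∧ {x | f x = 0}.Finite := by
  let pr : EuclideanSpace ℝ (Fin n) → (Fin n → I) := fun y i => projIcc 0 1 zero_le_one (y i)
  have hpr : UniformContinuous pr := by
    rw [uniformContinuous_pi]
    intro i
    have h1 : UniformContinuous (projIcc (0:ℝ) 1 zero_le_one) :=
      (LipschitzWith.projIcc zero_le_one).uniformContinuous
    have h2 : UniformContinuous fun y : EuclideanSpace ℝ (Fin n) => y i :=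
      (EuclideanSpace.proj i : EuclideanSpace ℝ (Fin n) →L[ℝ] ℝ).uniformContinuous
    exact h1.comp h2
  let em : (Fin n → I) → EuclideanSpace ℝ (Fin n) := fun u => WithLp.toLp 2 (fun i => (u i : ℝ))
  have hem : Continuous em := by
    apply (PiLp.continuous_toLp 2 (fun _ : Fin n => ℝ)).comp; fun_prop
  have hpe : ∀ u, pr (em u) = u := by
    intro u; funext i; simp [pr, em]
  have hcu : UniformContinuous (g ∘ pr) :=
    (CompactSpace.uniformContinuous_of_continuous hg).comp hpr
  obtain ⟨f, hf, hfg, hfin⟩ := gp_finite (g ∘ pr) hcu (isCompact_range hem) hε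
  refine ⟨f ∘ em, hf.comp hem, fun x => ?_, ?_⟩
  · have := hfg (em x)
    simpa [hpe] using this
  · have hinj : Function.Injective em := fun a b h => by rw [← hpe a, ← hpe b, h]
    refine (hfin.preimage hinj.injOn).subset ?_
    intro x hx
    exact ⟨mem_range_self x, hx⟩

theorem gp_list {M : Type*} [TopologicalSpace M] [Nonempty M] [T2Space M] [CompactSpace M] {n : ℕ}
    {small : Set M → Prop} (hs : Sml small)
    (g : M × I → EuclideanSpace ℝ (Fin n)) (hg : Continuous g)
    (ζs : List ((Fin n → I) → M × I)) (hζ : ∀ ζ ∈ ζs, Continuous ζ ∧ Function.Injective ζ)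
    {ε : ℝ} (hε : 0 < ε) :
    ∃ η : M × I → EuclideanSpace ℝ (Fin n), Continuous η ∧ (∀ z, ‖η z‖ < ε) ∧
      Sc small (Prod.fst '' {z | (∃ ζ ∈ ζs, z ∈ range ζ) ∧ g z + η z = 0}) := by
  induction ζs generalizing ε with
  | nil =>
    refine ⟨fun _ => 0, continuous_const, by simpa using hε, fun _ => ∅, ?_, ?_, ?_⟩
    · intro j
      obtain ⟨x⟩ := ‹Nonempty M›
      obtain ⟨A, hA, _, hAs⟩ := hs.loc x
      exact ⟨isOpen_empty, hs.her A _ hA (empty_subset _) hAs⟩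
    · intros; exact disjoint_bot_left
    · simp
  | cons ζ ζs ih =>
    obtain ⟨η, hη, hηε, Q, hQ, hQd, hQc⟩ := ih (fun s h => hζ s (List.mem_cons_of_mem _ h)) (half_pos hε)
    obtain ⟨hζc, hζi⟩ := hζ ζ List.mem_cons_self
    have hemb : Topology.IsClosedEmbedding ζ := hζc.isClosedEmbedding hζi
    have hRc : IsClosed {z : M × I | ∃ s ∈ ζs, z ∈ range s} := by
      have : {z : M × I | ∃ s ∈ ζs, z ∈ range s} = ⋃ s ∈ {s | s ∈ ζs}, range s := by
        ext z; simp
      rw [this]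
      apply (List.finite_toSet ζs).isClosed_biUnion
      intro s h
      exact (isCompact_range (hζ s (List.mem_cons_of_mem _ h)).1).isClosed
    set T : Set (M × I) := {z | ∃ s ∈ ζs, z ∈ range s} ∩ {z | z.1 ∉ ⋃ j, Q j} with hT
    have hTc : IsCompact T := by
      apply IsClosed.isCompact
      apply hRc.inter
      exact (isOpen_iUnion fun j => (hQ j).1).isClosed_compl.preimage continuous_fst
    obtain ⟨δ, hδ, hδT⟩ : ∃ δ > 0, ∀ z ∈ T, δ ≤ ‖g z + η z‖ := by
      rcases T.eq_empty_or_nonempty with hTe | hTn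
      · exact ⟨1, one_pos, by simp [hTe]⟩
      · obtain ⟨z, hz, hmin⟩ := hTc.exists_isMinOn hTn (f := fun z => ‖g z + η z‖)
          (by fun_prop)
        refine ⟨‖g z + η z‖, ?_, fun y hy => hmin hy⟩
        rw [gt_iff_lt, norm_pos_iff]
        intro h0
        exact hz.2 (hQc ⟨z, ⟨hz.1, h0⟩, rfl⟩)
    set ε' := min δ (ε / 2) / 2 with hε'
    have hε'0 : 0 < ε' := by have : 0 < min δ (ε/2) := lt_min hδ (by linarith)
                             linarith
    have hε'δ : ε' < δ := by have := min_le_left δ (ε/2)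
                             have : 0 < min δ (ε/2) := lt_min hδ (by linarith)
                             linarith
    have hε'ε : ε' < ε / 2 := by have := min_le_right δ (ε/2)
                                 have : 0 < min δ (ε/2) := lt_min hδ (by linarith)
                                 linarith
    obtain ⟨f, hf, hfg, hfin⟩ := gp_cube (fun u => g (ζ u) + η (ζ u)) (by fun_prop) hε'0
    have := Metric.instTietzeExtensionClosedBall ℝ (0 : EuclideanSpace ℝ (Fin n)) hε'0
    obtain ⟨θ, hθ, hθe⟩ := ContinuousMap.exists_extension_forall_mem hemb
      (⟨fun u => f u - (g (ζ u) + η (ζ u)), by fun_prop⟩ : C(Fin n → I, EuclideanSpace ℝ (Fin n)))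
      (t := Metric.closedBall (0 : EuclideanSpace ℝ (Fin n)) ε')
      (fun u => by simpa using (hfg u).le)
    have hθ' : ∀ z, ‖θ z‖ ≤ ε' := fun z => by simpa using hθ z
    have hθζ : ∀ u, g (ζ u) + (η (ζ u) + θ (ζ u)) = f u := by
      intro u
      have : θ (ζ u) = f u - (g (ζ u) + η (ζ u)) := congrArg (fun k => k u) (congrArg DFunLike.coe hθe)
      rw [this]; abel
    refine ⟨fun z => η z + θ z, by fun_prop, fun z => ?_, ?_⟩
    · calc ‖η z + θ z‖ ≤ ‖η z‖ + ‖θ z‖ := norm_add_le _ _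
        _ < ε := by linarith [hηε z, hθ' z]
    · have hcomp : IsCompact (Prod.fst '' {z | (∃ s ∈ ζs, z ∈ range s) ∧ g z + (η z + θ z) = 0}) := by
        refine IsCompact.image (IsClosed.isCompact (hRc.inter (isClosed_eq ?_ continuous_const))) continuous_fst
        fun_prop
      have hsc : Sc small (Prod.fst '' {z | (∃ s ∈ ζs, z ∈ range s) ∧ g z + (η z + θ z) = 0}) := by
        refine ⟨Q, hQ, hQd, ?_⟩
        rintro _ ⟨z, ⟨hz, hz0⟩, rfl⟩
        by_contra hcon
        have h1 := hδT z ⟨hz, hcon⟩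
        have h2 : g z + η z = - θ z := by
          rw [← add_assoc] at hz0
          exact eq_neg_of_add_eq_zero_left hz0
        rw [h2, norm_neg] at h1
        linarith [hθ' z]
      refine (Sc.union_finite hs hcomp hsc (hfin.image (fun u => (ζ u).1))).mono ?_
      rintro _ ⟨z, ⟨⟨s, hsm, hz⟩, hz0⟩, rfl⟩
      rcases List.mem_cons.1 hsm with rfl | hsm
      · left
        obtain ⟨u, rfl⟩ := hz
        exact ⟨u, by rw [mem_ofPred_eq, ← hθζ]; exact hz0, rfl⟩
      · right
        exact ⟨z, ⟨⟨s, hsm, hz⟩, hz0⟩, rfl⟩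
end CS

open scoped Topology
namespace CS
set_option linter.all false
open Set unitInterval

section cells
variable {M : Type*} [TopologicalSpace M] [T2Space M] {n : ℕ} {φ : (Fin n → I) → M}

theorem af_mem_bx {a b a' b' : Fin n → I} (h1 : ∀ i, a i < a' i) (h2 : ∀ i, b' i < b i)
    (h3 : ∀ i, a' i < b' i) (x : Fin n → I) : af a' b' x ∈ CS.bx a b := by
  intro i
  have e1 : (a i : ℝ) < a' i := h1 i
  have e2 : (b' i : ℝ) < b i := h2 i
  have e3 : (a' i : ℝ) < b' i := h3 i
  have := (x i).2.1
  have := (x i).2.2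
  constructor <;> rw [← Subtype.coe_lt_coe] <;> simp only [af] <;> nlinarith

theorem Bx.exists_sub' (h : Bx n φ) {O : Set M} (hO : IsOpen O) {x : Fin n → I} (hx : x ∈ oc n)
    (hxO : φ x ∈ O) : ∃ a b, (∀ i, a i < b i) ∧ x ∈ CS.bx a b ∧ range (φ ∘ af a b) ⊆ O ∧
      range (φ ∘ af a b) ⊆ φ '' oc n := by
  obtain ⟨a, b, h1, h2, h3⟩ := exists_bx (hO.preimage h.cont) hxO hx
  choose a' ha' using fun i => exists_between (h1 i).1
  choose b' hb' using fun i => exists_between (h1 i).2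
  have hm := af_mem_bx (fun i => (ha' i).1) (fun i => (hb' i).2) (fun i => (ha' i).2.trans (hb' i).1)
  refine ⟨a', b', fun i => (ha' i).2.trans (hb' i).1, fun i => ⟨(ha' i).2, (hb' i).1⟩, ?_, ?_⟩
  · rintro _ ⟨y, rfl⟩
    exact h2 (hm y)
  · rintro _ ⟨y, rfl⟩
    exact ⟨_, h3 (hm y), rfl⟩

theorem Mf.small' (hX : Mf n M) {x : M} {O : Set M} (hO : IsOpen O) (hx : x ∈ O) :
    ∃ φ, Bx n φ ∧ x ∈ φ '' oc n ∧ range φ ⊆ O := by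
  obtain ⟨φ, hφ, y, hy, rfl⟩ := hX x
  obtain ⟨a, b, hab, hx', hs, -⟩ := hφ.exists_sub' hO hy hx
  refine ⟨_, hφ.sub hab, ?_, hs⟩
  rw [Bx.sub_image hab]
  exact ⟨y, hx', rfl⟩

theorem Bx.emb (h : Bx n φ) : Topology.IsClosedEmbedding φ := h.cont.isClosedEmbedding h.inj

theorem Bx.isClosed (h : Bx n φ) : IsClosed (range φ) := h.emb.isClosed_range

noncomputable def cinv (φ : (Fin n → I) → M) : M → (Fin n → I) := Function.invFun φ

theorem Bx.cinv_apply (h : Bx n φ) (u) : cinv φ (φ u) = u := Function.leftInverse_invFun h.inj u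

theorem Bx.apply_cinv (h : Bx n φ) {x : M} (hx : x ∈ range φ) : φ (cinv φ x) = x := by
  obtain ⟨u, rfl⟩ := hx
  rw [h.cinv_apply]

theorem Bx.cinv_cont (h : Bx n φ) : ContinuousOn (cinv φ) (range φ) := by
  rw [continuousOn_iff_continuous_domRestrict]
  have h1 : Continuous (h.emb.isEmbedding.toHomeomorph.symm) := Homeomorph.continuous _
  convert h1 using 1
  funext x
  obtain ⟨_, u, rfl⟩ := x
  show cinv φ (φ u) = _
  rw [h.cinv_apply, eq_comm, Homeomorph.symm_apply_eq]
  rfl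

/-- the linear contraction of a cell -/
noncomputable def cctr (φ : (Fin n → I) → M) (c : Fin n → I) : M × ℝ → M := fun z =>
  φ (af (cinv φ z.1) c (fun _ => projIcc 0 1 zero_le_one z.2))

theorem continuous_af2 : Continuous fun q : (Fin n → I) × (Fin n → I) × I => af q.1 q.2.1 (fun _ => q.2.2) := by
  unfold af
  refine continuous_pi fun i => Continuous.subtype_mk ?_ _
  fun_prop

theorem Bx.cctr_cont (h : Bx n φ) (c) : ContinuousOn (cctr φ c) (range φ ×ˢ univ) := by
  unfold cctr
  refine h.cont.comp_continuousOn ?_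
  have h1 : ContinuousOn (fun z : M × ℝ => (cinv φ z.1, c, projIcc (0:ℝ) 1 zero_le_one z.2)) (range φ ×ˢ univ) := by
    refine ContinuousOn.prodMk (h.cinv_cont.comp continuousOn_fst fun z hz => hz.1) (ContinuousOn.prodMk continuousOn_const ?_)
    exact (continuous_projIcc.comp continuous_snd).continuousOn
  exact continuous_af2.comp_continuousOn h1

theorem Bx.cctr_zero (h : Bx n φ) (c) {x : M} (hx : x ∈ range φ) : cctr φ c (x, 0) = x := by
  have : af (cinv φ x) c (fun _ => projIcc (0:ℝ) 1 zero_le_one 0) = cinv φ x := by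
    funext i; apply Subtype.ext; simp [af]
  simp only [cctr]
  rw [this, h.apply_cinv hx]

theorem cctr_one (φ : (Fin n → I) → M) (c) (x : M) : cctr φ c (x, 1) = φ c := by
  have : af (cinv φ x) c (fun _ => projIcc (0:ℝ) 1 zero_le_one 1) = c := by
    funext i; apply Subtype.ext; simp [af]
  simp only [cctr]
  rw [this]

theorem Bx.ctr (h : Bx n φ) {Y : Set M} (hY : range φ ⊆ Y) : Ctr (range φ) Y :=
  ⟨cctr φ 0, φ 0, (h.cctr_cont 0).mono (prod_mono_right (subset_univ _)), fun x hx => h.cctr_zero 0 hx,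
    fun x _ => cctr_one φ 0 x, fun z _ => hY (mem_range_self _)⟩

theorem Ctr.mono {U V Y Y' : Set M} (h : Ctr U Y) (hV : V ⊆ U) (hY : Y ⊆ Y') : Ctr V Y' := by
  obtain ⟨H, q, h1, h2, h3, h4⟩ := h
  exact ⟨H, q, h1.mono (prod_mono_left hV), fun x hx => h2 x (hV hx), fun x hx => h3 x (hV hx),
    fun z hz => hY (h4 ⟨hV hz.1, hz.2⟩)⟩

def bd (φ : (Fin n → I) → M) : Set M := φ '' (oc n)ᶜ

theorem isOpen_oc : IsOpen (oc n) := isOpen_bx _ _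

theorem Bx.isClosed_bd (h : Bx n φ) : IsClosed (bd φ) :=
  h.emb.isClosedMap _ isOpen_oc.isClosed_compl

theorem range_eq_bd (φ : (Fin n → I) → M) : range φ = φ '' oc n ∪ bd φ := by
  rw [bd, ← image_union, union_compl_self, image_univ]

theorem Bx.disj_bd (h : Bx n φ) : Disjoint (φ '' oc n) (bd φ) :=
  (disjoint_image_iff h.inj).2 disjoint_compl_right

theorem faces (φ : (Fin n → I) → M) (h : Bx n φ) : ∃ ζs : List ((Fin n → I) → M × I),
    (∀ ζ ∈ ζs, Continuous ζ ∧ Function.Injective ζ) ∧ ∀ x ∈ bd φ, ∀ t, ∃ ζ ∈ ζs, (x, t) ∈ range ζ := by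
  classical
  let fc : Fin n × Bool → (Fin n → I) → M × I := fun q u =>
    (φ (Function.update u q.1 (if q.2 then 1 else 0)), u q.1)
  refine ⟨(Finset.univ.toList).map fc, ?_, ?_⟩
  · intro ζ hζ
    obtain ⟨⟨i, b⟩, -, rfl⟩ := List.mem_map.1 hζ
    refine ⟨?_, ?_⟩
    · have := h.cont
      show Continuous fun u => (φ (Function.update u i (if b then 1 else 0)), u i)
      refine (h.cont.comp ?_).prodMk (continuous_apply i)
      exact continuous_id.update i continuous_const
    · intro u v huv
      have h1 := h.inj (congrArg Prod.fst huv)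
      have h2 : u i = v i := congrArg Prod.snd huv
      funext j
      by_cases hj : j = i
      · rw [hj, h2]
      · have := congrFun h1 j
        simpa [Function.update_of_ne hj] using this
  · rintro _ ⟨u, hu, rfl⟩ t
    have : ∃ i, u i = 0 ∨ u i = 1 := by
      by_contra hcon
      push Not at hcon
      apply hu
      intro i
      exact ⟨lt_of_le_of_ne (u i).2.1 (fun hh => (hcon i).1 hh.symm), lt_of_le_of_ne (u i).2.2 (hcon i).2⟩
    obtain ⟨i, hi⟩ := this
    have key : ∀ b : Bool, u i = (if b then 1 else 0) → fc (i, b) (Function.update u i t) = (φ u, t) := by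
      intro b hb
      simp only [fc, Function.update_idem, Function.update_self]
      rw [← hb, Function.update_eq_self]
    rcases hi with hi | hi
    · exact ⟨fc (i, false), List.mem_map.2 ⟨_, by simp, rfl⟩, Function.update u i t, key false (by simpa using hi)⟩
    · exact ⟨fc (i, true), List.mem_map.2 ⟨_, by simp, rfl⟩, Function.update u i t, key true (by simpa using hi)⟩

theorem faces_fin {m : ℕ} (φ : Fin m → (Fin n → I) → M) (h : ∀ a, Bx n (φ a)) :
    ∃ ζs : List ((Fin n → I) → M × I),
    (∀ ζ ∈ ζs, Continuous ζ ∧ Function.Injective ζ) ∧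
      ∀ x ∈ ⋃ a, bd (φ a), ∀ t, ∃ ζ ∈ ζs, (x, t) ∈ range ζ := by
  choose ζs h1 h2 using fun a => faces (φ a) (h a)
  refine ⟨(Finset.univ.toList : List (Fin m)).flatMap ζs, ?_, ?_⟩
  · intro ζ hζ
    obtain ⟨a, -, ha⟩ := List.mem_flatMap.1 hζ
    exact h1 a ζ ha
  · intro x hx t
    obtain ⟨a, ha⟩ := mem_iUnion.1 hx
    obtain ⟨ζ, hζ, hr⟩ := h2 a x ha t
    exact ⟨ζ, List.mem_flatMap.2 ⟨a, by simp, hζ⟩, hr⟩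

theorem cell_cover (hM : Mf n M) {K W : Set M} (hK : IsCompact K) (hW : IsOpen W) (hKW : K ⊆ W) :
    ∃ (m : ℕ) (φ : Fin m → (Fin n → I) → M), (∀ a, Bx n (φ a) ∧ range (φ a) ⊆ W) ∧
      K ⊆ ⋃ a, φ a '' oc n := by
  choose φ h1 h2 h3 using fun x : K => hM.small' hW (hKW x.2)
  obtain ⟨t, ht⟩ := hK.elim_finite_subcover (fun x => φ x '' oc n) (fun x => (h1 x).op)
    (fun x hx => mem_iUnion.2 ⟨⟨x, hx⟩, h2 _⟩)
  refine ⟨t.card, fun a => φ (t.equivFin.symm a), fun a => ⟨h1 _, h3 _⟩, fun x hx => ?_⟩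
  obtain ⟨y, hy, hxy⟩ := mem_iUnion₂.1 (ht hx)
  exact mem_iUnion.2 ⟨t.equivFin ⟨y, hy⟩, by simpa using hxy⟩

/-- disjoint pieces -/
def pc {m : ℕ} (φ : Fin m → (Fin n → I) → M) (a : Fin m) : Set M :=
  φ a '' oc n \ ((⋃ b ∈ {b | b < a}, range (φ b)) ∪ ⋃ b, bd (φ b))

variable {m : ℕ} {Φ : Fin m → (Fin n → I) → M}
theorem isOpen_pc (h : ∀ a, Bx n (Φ a)) (a) : IsOpen (pc Φ a) := by
  refine (h a).op.sdiff (IsClosed.union ?_ ?_)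
  · exact (Set.toFinite _).isClosed_biUnion fun b _ => (h b).isClosed
  · exact isClosed_iUnion_of_finite fun b => (h b).isClosed_bd

theorem pc_subset (a) : pc Φ a ⊆ Φ a '' oc n := diff_subset

theorem pc_disj (a b) (hab : a ≠ b) : Disjoint (pc Φ a) (pc Φ b) := by
  have key : ∀ a b, a < b → Disjoint (pc Φ a) (pc Φ b) := by
    intro a b hab
    rw [Set.disjoint_left]
    intro x hx hx'
    apply hx'.2
    left
    exact mem_iUnion₂.2 ⟨a, hab, image_subset_range _ _ hx.1⟩
  rcases lt_or_gt_of_ne hab with h | h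
  · exact key _ _ h
  · exact (key _ _ h).symm

theorem iUnion_pc (x : M) (hx : x ∈ ⋃ a, range (Φ a)) (hS : x ∉ ⋃ a, bd (Φ a)) : x ∈ ⋃ a, pc Φ a := by
  classical
  have hex : ∃ k : ℕ, ∃ hk : k < m, x ∈ range (Φ ⟨k, hk⟩) := by
    obtain ⟨a, ha⟩ := mem_iUnion.1 hx
    exact ⟨a, a.2, ha⟩
  obtain ⟨hk, hxk⟩ := Nat.find_spec hex
  refine mem_iUnion.2 ⟨⟨Nat.find hex, hk⟩, ?_, ?_⟩
  · rw [range_eq_bd] at hxk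
    rcases hxk with h | h
    · exact h
    · exact absurd (mem_iUnion.2 ⟨(⟨Nat.find hex, hk⟩ : Fin m), h⟩) hS
  · rintro (h | h)
    · obtain ⟨b, hb, hxb⟩ := mem_iUnion₂.1 h
      exact Nat.find_min hex (m := b) hb ⟨b.2, hxb⟩
    · exact hS h
end cells

/-- extraction from Sc -/
theorem Sc.extract {M : Type*} [TopologicalSpace M] [NormalSpace M] {small : Set M → Prop} {Λ : Set M}
    (hΛ : IsClosed Λ) (h : Sc small Λ) : ∃ (Q : ℕ → Set M) (O : Set M), (∀ j, IsOpen (Q j) ∧ small (Q j)) ∧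
      (∀ i j, i ≠ j → Disjoint (Q i) (Q j)) ∧ IsOpen O ∧ Λ ⊆ O ∧ closure O ⊆ ⋃ j, Q j ∧
      ∀ J : Set ℕ, closure (⋃ j ∈ J, O ∩ Q j) ⊆ ⋃ j ∈ J, Q j := by
  obtain ⟨Q, hQ, hd, hc⟩ := h
  obtain ⟨O, hO, hΛO, hOQ⟩ := normal_exists_closure_subset hΛ (isOpen_iUnion fun j => (hQ j).1) hc
  refine ⟨Q, O, hQ, hd, hO, hΛO, hOQ, fun J x hx => ?_⟩
  have h1 : x ∈ closure O := closure_mono (iUnion₂_subset fun j _ => inter_subset_left) hx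
  obtain ⟨j, hj⟩ := mem_iUnion.1 (hOQ h1)
  obtain ⟨y, hy, hy'⟩ := mem_closure_iff.1 hx (Q j) (hQ j).1 hj
  obtain ⟨i, hi, hyi⟩ := mem_iUnion₂.1 hy'
  have : i = j := by
    by_contra hne
    exact Set.disjoint_left.1 (hd i j hne) hyi.2 hy
  exact mem_iUnion₂.2 ⟨j, this ▸ hi, hj⟩
end CS

open scoped Topology
namespace CS
set_option linter.all false
open Set unitInterval

section
variable {M : Type*} [TopologicalSpace M] [T2Space M] [CompactSpace M] [Nonempty M] {n : ℕ}

theorem proj_closed {A : Set M} (hA : IsClosed A) {h : M × ℝ → M} (hc : ContinuousOn h (A ×ˢ Icc 0 1))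
    {T : Set M} (hT : IsClosed T) : IsClosed {x ∈ A | ∃ t ∈ Icc (0:ℝ) 1, h (x, t) ∈ T} := by
  have hAc : IsCompact (A ×ˢ Icc (0:ℝ) 1) := hA.isCompact.prod isCompact_Icc
  have h1 : IsCompact ((A ×ˢ Icc (0:ℝ) 1) ∩ h ⁻¹' T) :=
    hAc.of_isClosed_subset (hc.preimage_isClosed_of_isClosed (hA.prod isClosed_Icc) hT) inter_subset_left
  convert (h1.image continuous_fst).isClosed using 1
  ext x
  constructor
  · rintro ⟨hx, t, ht, h⟩
    exact ⟨(x, t), ⟨⟨hx, ht⟩, h⟩, rfl⟩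
  · rintro ⟨⟨x, t⟩, ⟨⟨hx, ht⟩, h⟩, rfl⟩
    exact ⟨hx, t, ht, h⟩

theorem perturb (Ψ : OpenPartialHomeomorph (EuclideanSpace ℝ (Fin n)) M) (hs : Ψ.source = Metric.ball 0 2)
    {A A0 : Set M} (hA : IsClosed A) (hA0 : IsClosed A0) (hA0A : A0 ⊆ A) {h : M × ℝ → M}
    (hc : ContinuousOn h (A ×ˢ Icc 0 1)) (h0 : ∀ x ∈ A, h (x, 0) ≠ Ψ 0) (h1 : ∀ x ∈ A, h (x, 1) ≠ Ψ 0)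
    (h2 : ∀ x ∈ A0, ∀ t ∈ Icc (0:ℝ) 1, h (x, t) ≠ Ψ 0) :
    ∃ L : Set M, IsClosed L ∧ L ⊆ A ∧ Disjoint L A0 ∧ ∀ small : Set M → Prop, Sml small →
      ∀ ζs : List ((Fin n → I) → M × I), (∀ ζ ∈ ζs, Continuous ζ ∧ Function.Injective ζ) →
      ∀ S : Set M, (∀ x ∈ S, ∀ t, ∃ ζ ∈ ζs, (x, t) ∈ range ζ) →
      ∃ h' : M × ℝ → M, ContinuousOn h' (A ×ˢ Icc 0 1) ∧ (∀ x ∈ A, h' (x, 0) = h (x, 0)) ∧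
        (∀ x ∈ A, h' (x, 1) = h (x, 1)) ∧ (∀ x ∈ A, x ∉ L → ∀ t ∈ Icc (0:ℝ) 1, h' (x, t) = h (x, t)) ∧
        IsClosed {x ∈ A | ∃ t ∈ Icc (0:ℝ) 1, h' (x, t) = Ψ 0} ∧
        {x ∈ A | ∃ t ∈ Icc (0:ℝ) 1, h' (x, t) = Ψ 0} ⊆ L ∧
        Sc small ({x ∈ A | ∃ t ∈ Icc (0:ℝ) 1, h' (x, t) = Ψ 0} ∩ S) := by
  have hAI : IsClosed (A ×ˢ Icc (0:ℝ) 1) := hA.prod isClosed_Icc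
  have hAc : IsCompact (A ×ˢ Icc (0:ℝ) 1) := hA.isCompact.prod isCompact_Icc
  set T0 : Set (M × ℝ) := (A ×ˢ {0, 1}) ∪ (A0 ×ˢ Icc 0 1) with hT0
  have hT0s : T0 ⊆ A ×ˢ Icc 0 1 := by
    rintro ⟨x, t⟩ (⟨hx, ht⟩ | ⟨hx, ht⟩)
    · refine ⟨hx, ?_⟩
      rcases ht with rfl | rfl <;> simp
    · exact ⟨hA0A hx, ht⟩
  have hT0c : IsCompact T0 := (hA.isCompact.prod (Set.toFinite _).isCompact).union (hA0.isCompact.prod isCompact_Icc)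
  have hTcl : IsClosed (h '' T0) := (hT0c.image_of_continuousOn (hc.mono hT0s)).isClosed
  have hpT : Ψ 0 ∉ h '' T0 := by
    rintro ⟨⟨x, t⟩, (⟨hx, ht⟩ | ⟨hx, ht⟩), hh⟩
    · rcases ht with rfl | rfl
      · exact h0 x hx hh
      · exact h1 x hx hh
    · exact h2 x hx t ht hh
  have h0s : (0 : EuclideanSpace ℝ (Fin n)) ∈ Ψ.source := by rw [hs]; simp
  have hnb : Ψ ⁻¹' (h '' T0)ᶜ ∈ 𝓝 (0 : EuclideanSpace ℝ (Fin n)) :=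
    (Ψ.continuousAt h0s).preimage_mem_nhds (hTcl.isOpen_compl.mem_nhds hpT)
  obtain ⟨ε, hε, hεb⟩ := Metric.mem_nhds_iff.1 hnb
  set ρ := min (ε / 2) 1 with hρ
  have hρ0 : 0 < ρ := lt_min (by linarith) one_pos
  have hρ1 : ρ ≤ 1 := min_le_right _ _
  have hρε : ρ < ε := lt_of_le_of_lt (min_le_left _ _) (by linarith)
  have hcb : Metric.closedBall (0 : EuclideanSpace ℝ (Fin n)) ρ ⊆ Ψ.source := by
    rw [hs]; exact Metric.closedBall_subset_ball (by linarith)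
  set Bc := Ψ '' Metric.closedBall 0 ρ with hBc
  have hBcl : IsClosed Bc :=
    ((isCompact_closedBall _ _).image_of_continuousOn (Ψ.continuousOn.mono hcb)).isClosed
  set Bo := Ψ '' Metric.ball 0 ρ with hBo
  have hBop : IsOpen Bo := Ψ.isOpen_image_of_subset_source Metric.isOpen_ball (Metric.ball_subset_closedBall.trans hcb)
  have hBT : ∀ z ∈ T0, h z ∉ Bc := by
    rintro z hz ⟨y, hy, hyz⟩
    have : y ∈ Metric.ball (0 : EuclideanSpace ℝ (Fin n)) ε := Metric.closedBall_subset_ball hρε hy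
    exact hεb this ⟨z, hz, hyz.symm⟩
  have hpB : Ψ 0 ∈ Bc := ⟨0, by simp [hρ0.le], rfl⟩
  refine ⟨{x ∈ A | ∃ t ∈ Icc (0:ℝ) 1, h (x, t) ∈ Bc}, proj_closed hA hc hBcl, fun x hx => hx.1, ?_, ?_⟩
  · rw [Set.disjoint_left]
    rintro x ⟨hx, t, ht, hb⟩ hx0
    exact hBT (x, t) (Or.inr ⟨hx0, ht⟩) hb
  intro small hsm ζs hζ S hS
  -- closed subset of M × I
  let ι : M × I → M × ℝ := fun z => (z.1, z.2)
  have hι : Continuous ι := by fun_prop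
  set K : Set (M × I) := {z | z.1 ∈ A ∧ h (ι z) ∈ Bc} with hK
  have hιA : ∀ z : M × I, z.1 ∈ A → ι z ∈ A ×ˢ Icc (0:ℝ) 1 := fun z hz => ⟨hz, z.2.2⟩
  have hhι : ContinuousOn (fun z => h (ι z)) {z : M × I | z.1 ∈ A} := hc.comp hι.continuousOn hιA
  have hKcl : IsClosed K := hhι.preimage_isClosed_of_isClosed (hA.preimage continuous_fst) hBcl
  have hVc : ContinuousOn (fun z => Ψ.symm (h (ι z))) K := by
    refine Ψ.symm.continuousOn.comp (hhι.mono fun z hz => hz.1) ?_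
    rintro z ⟨_, y, hy, hyz⟩
    simp only [← hyz]
    exact Ψ.map_source (hcb hy)
  obtain ⟨V, hV⟩ := ContinuousMap.exists_restrict_eq hKcl
    (⟨K.domRestrict (fun z => Ψ.symm (h (ι z))), continuousOn_iff_continuous_domRestrict.1 hVc⟩ :
      C(K, EuclideanSpace ℝ (Fin n)))
  have hV' : ∀ z ∈ K, V z = Ψ.symm (h (ι z)) := fun z hz =>
    congrArg (fun k => k ⟨z, hz⟩) (congrArg DFunLike.coe hV)
  obtain ⟨η, hη, hηρ, hsc⟩ := gp_list hsm V V.continuous ζs hζ (ε := ρ / 4) (by linarith)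
  let χ : ℝ → ℝ := fun r => max 0 (min 1 (2 - 2 * r / ρ))
  have hχ : Continuous χ := by fun_prop
  have hχ0 : ∀ r, 0 ≤ χ r := fun r => le_max_left _ _
  have hχ1 : ∀ r, χ r ≤ 1 := fun r => max_le zero_le_one (min_le_left _ _)
  have hχa : ∀ r, r ≤ ρ / 2 → χ r = 1 := by
    intro r hr
    have : 1 ≤ 2 - 2 * r / ρ := by
      have : 2 * r / ρ ≤ 1 := by rw [div_le_one hρ0]; linarith
      linarith
    simp only [χ]; rw [min_eq_left this]; norm_num
  have hχb : ∀ r, ρ ≤ r → χ r = 0 := by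
    intro r hr
    have : 2 - 2 * r / ρ ≤ 0 := by
      have : 2 ≤ 2 * r / ρ := by rw [le_div_iff₀ hρ0]; linarith
      linarith
    simp only [χ]; exact max_eq_left ((min_le_right _ _).trans this)
  let pj : M × ℝ → M × I := fun z => (z.1, projIcc 0 1 zero_le_one z.2)
  have hpj : Continuous pj := by
    exact continuous_fst.prodMk (continuous_projIcc.comp continuous_snd)
  have hιp : ∀ z ∈ A ×ˢ Icc (0:ℝ) 1, ι (pj z) = z := by
    rintro ⟨x, t⟩ ⟨_, ht⟩
    simp only [ι, pj]
    rw [projIcc_of_mem zero_le_one ht]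
  set V2 : M × I → EuclideanSpace ℝ (Fin n) := fun z => V z + χ ‖V z‖ • η z with hV2
  have hV2c : Continuous V2 := by have := V.continuous; fun_prop
  have hVn : ∀ z ∈ K, ‖V z‖ ≤ ρ := by
    rintro z hz
    obtain ⟨_, y, hy, hyz⟩ := id hz
    rw [hV' z hz, ← hyz, Ψ.left_inv (hcb hy)]
    simpa using hy
  have hV2n : ∀ z ∈ K, V2 z ∈ Ψ.source := by
    intro z hz
    rw [hs, mem_ball_zero_iff]
    have : ‖χ ‖V z‖ • η z‖ ≤ ρ / 4 := by
      rw [norm_smul, Real.norm_of_nonneg (hχ0 _)]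
      have := hηρ z
      have := hχ1 ‖V z‖
      have := hχ0 ‖V z‖
      nlinarith [norm_nonneg (η z)]
    calc ‖V2 z‖ ≤ ‖V z‖ + ‖χ ‖V z‖ • η z‖ := norm_add_le _ _
      _ < 2 := by linarith [hVn z hz]
  classical
  set h' : M × ℝ → M := fun z => if h z ∈ Bc then Ψ (V2 (pj z)) else h z with hh'
  have hin : ∀ z ∈ A ×ˢ Icc (0:ℝ) 1, h z ∈ Bc → pj z ∈ K := by
    intro z hz hb
    exact ⟨hz.1, by rw [hιp z hz]; exact hb⟩
  have hout : ∀ z, h z ∉ Bc → h' z = h z := fun z hz => if_neg hz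
  have hbdy : ∀ z ∈ A ×ˢ Icc (0:ℝ) 1, h z ∈ Bc → h z ∉ Bo → Ψ (V2 (pj z)) = h z := by
    intro z hz hb hbo
    have hk := hin z hz hb
    obtain ⟨y, hy, hyz⟩ := hb
    have hVy : V (pj z) = y := by
      rw [hV' _ hk, hιp z hz, ← hyz, Ψ.left_inv (hcb hy)]
    have hyρ : ρ ≤ ‖y‖ := by
      by_contra hlt
      exact hbo ⟨y, by simpa using hlt, hyz⟩
    simp only [hV2, hVy, hχb _ hyρ, zero_smul, add_zero]
    exact hyz
  have hin' : ∀ z ∈ A ×ˢ Icc (0:ℝ) 1, h z ∉ Bo → h' z = h z := by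
    intro z hz hbo
    by_cases hb : h z ∈ Bc
    · simp only [hh', if_pos hb]; exact hbdy z hz hb hbo
    · exact hout z hb
  have hh'c : ContinuousOn h' (A ×ˢ Icc 0 1) := by
    have hun : A ×ˢ Icc (0:ℝ) 1 = (A ×ˢ Icc (0:ℝ) 1 ∩ h ⁻¹' Bc) ∪ (A ×ˢ Icc (0:ℝ) 1 ∩ h ⁻¹' Boᶜ) := by
      ext z
      constructor
      · intro hz
        by_cases hb : h z ∈ Bo
        · exact Or.inl ⟨hz, image_mono Metric.ball_subset_closedBall hb⟩
        · exact Or.inr ⟨hz, hb⟩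
      · rintro (hz | hz) <;> exact hz.1
    rw [hun]
    refine ContinuousOn.union_of_isClosed ?_ ?_ (hc.preimage_isClosed_of_isClosed hAI hBcl)
      (hc.preimage_isClosed_of_isClosed hAI hBop.isClosed_compl)
    · have : ContinuousOn (fun z => Ψ (V2 (pj z))) (A ×ˢ Icc (0:ℝ) 1 ∩ h ⁻¹' Bc) :=
        Ψ.continuousOn.comp (hV2c.comp hpj).continuousOn fun z hz => hV2n _ (hin z hz.1 hz.2)
      exact this.congr fun z hz => if_pos hz.2
    · exact (hc.mono inter_subset_left).congr fun z hz => hin' z hz.1 hz.2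
  have hzero : ∀ x ∈ A, ∀ t (ht : t ∈ Icc (0:ℝ) 1), h' (x, t) = Ψ 0 → h (x, t) ∈ Bc ∧
      V (x, ⟨t, ht⟩) + η (x, ⟨t, ht⟩) = 0 := by
    intro x hx t ht hz
    by_cases hb : h (x, t) ∈ Bc
    · refine ⟨hb, ?_⟩
      have hk := hin (x, t) ⟨hx, ht⟩ hb
      have hpjx : pj (x, t) = (x, ⟨t, ht⟩) := by
        simp only [pj]; rw [projIcc_of_mem zero_le_one ht]
      simp only [hh', if_pos hb] at hz
      have h3 := Ψ.injOn (hV2n _ hk) h0s hz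
      rw [hpjx] at h3
      set y : M × I := (x, ⟨t, ht⟩) with hy
      have h4 : V y = - (χ ‖V y‖ • η y) := eq_neg_of_add_eq_zero_left h3
      have h5 : ‖V y‖ ≤ ρ / 2 := by
        rw [h4, norm_neg, norm_smul, Real.norm_of_nonneg (hχ0 _)]
        have := hηρ y
        have := hχ1 ‖V y‖
        have := hχ0 ‖V y‖
        rw [← h4] at *
        nlinarith [norm_nonneg (η y)]
      have h6 : V y + χ ‖V y‖ • η y = 0 := h3
      rwa [hχa _ h5, one_smul] at h6
    · rw [hout _ hb] at hz
      exact absurd (hz ▸ hpB) hb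
  refine ⟨h', hh'c, fun x hx => hout _ (hBT _ (Or.inl ⟨hx, by simp⟩)),
    fun x hx => hout _ (hBT _ (Or.inl ⟨hx, by simp⟩)), fun x hx hxL t ht => hout _ fun hb => hxL ⟨hx, t, ht, hb⟩, ?_, ?_, ?_⟩
  · exact proj_closed hA hh'c isClosed_singleton
  · rintro x ⟨hx, t, ht, hz⟩
    exact ⟨hx, t, ht, (hzero x hx t ht hz).1⟩
  · refine hsc.mono ?_
    rintro x ⟨⟨hx, t, ht, hz⟩, hxS⟩
    exact ⟨(x, ⟨t, ht⟩), ⟨hS x hxS _, (hzero x hx t ht hz).2⟩, rfl⟩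
end
end CS

open scoped Topology
namespace CS
set_option linter.all false
open Set unitInterval

section
variable {M : Type*} [TopologicalSpace M] {n : ℕ}
variable {Z : Type*} [TopologicalSpace Z]

/-- continuity on a union of relatively open pieces -/
theorem co_iUnion {ι : Sort*} {A : Type*} [TopologicalSpace A] {f : A → Z} {C : Set A} {O : ι → Set A}
    (hO : ∀ i, IsOpen (O i)) (h : ∀ i, ContinuousOn f (O i ∩ C)) : ContinuousOn f ((⋃ i, O i) ∩ C) := by
  rintro x ⟨hx, hxC⟩
  obtain ⟨i, hi⟩ := mem_iUnion.1 hx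
  have h1 := h i x ⟨hi, hxC⟩
  have h2 : ContinuousWithinAt f C x := by
    rw [inter_comm] at h1
    exact (continuousWithinAt_inter ((hO i).mem_nhds hi)).1 h1
  exact h2.mono inter_subset_right

theorem co_union {A : Type*} [TopologicalSpace A] {f : A → Z} {C O P : Set A}
    (hO : IsOpen O) (hP : IsOpen P) (h : ContinuousOn f (O ∩ C)) (h' : ContinuousOn f (P ∩ C)) :
    ContinuousOn f ((O ∪ P) ∩ C) := by
  rw [union_eq_iUnion]
  exact co_iUnion (fun b => by cases b <;> assumption) (fun b => by cases b <;> assumption)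

/-- concatenation of homotopies -/
noncomputable def hcat {A : Type*} (H K : A × ℝ → Z) : A × ℝ → Z := fun z =>
  if z.2 ≤ 1 / 2 then H (z.1, 2 * z.2) else K (z.1, 2 * z.2 - 1)

theorem hcat_cont {A : Type*} [TopologicalSpace A] {H K : A × ℝ → Z} {U : Set A}
    (hH : ContinuousOn H (U ×ˢ Icc 0 1)) (hK : ContinuousOn K (U ×ˢ Icc 0 1))
    (hHK : ∀ x ∈ U, H (x, 1) = K (x, 0)) : ContinuousOn (hcat H K) (U ×ˢ Icc 0 1) := by
  unfold hcat
  have hc1 : {a : A × ℝ | a.2 ≤ 1/2} = Prod.snd ⁻¹' Iic (1/2) := rfl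
  have hc2 : {a : A × ℝ | ¬ a.2 ≤ 1/2} ⊆ Prod.snd ⁻¹' Ici (1/2) := fun a ha => le_of_lt (not_le.1 ha)
  have hcl1 : closure {a : A × ℝ | a.2 ≤ 1/2} ⊆ Prod.snd ⁻¹' Iic (1/2) :=
    (IsClosed.closure_subset (isClosed_Iic.preimage continuous_snd))
  have hcl2 : closure {a : A × ℝ | ¬ a.2 ≤ 1/2} ⊆ Prod.snd ⁻¹' Ici (1/2) :=
    closure_minimal hc2 (isClosed_Ici.preimage continuous_snd)
  apply ContinuousOn.if
  · rintro ⟨x, t⟩ ⟨⟨hx, _⟩, hf⟩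
    rw [frontier_eq_closure_inter_closure] at hf
    have h1 : t ≤ 1/2 := hcl1 hf.1
    have h2 : 1/2 ≤ t := hcl2 hf.2
    have h3 : t = 1/2 := le_antisymm h1 h2
    simp only [h3]
    norm_num
    exact hHK x hx
  · refine hH.comp (by fun_prop) ?_
    rintro ⟨x, t⟩ ⟨⟨hx, ht⟩, hf⟩
    have : t ≤ 1/2 := hcl1 hf
    exact ⟨hx, by have := ht.1; show 0 ≤ 2 * t; linarith, by show 2 * t ≤ 1; linarith⟩
  · refine hK.comp (by fun_prop) ?_
    rintro ⟨x, t⟩ ⟨⟨hx, ht⟩, hf⟩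
    have : 1/2 ≤ t := hcl2 hf
    exact ⟨hx, by show 0 ≤ 2 * t - 1; linarith, by have := ht.2; show 2 * t - 1 ≤ 1; linarith⟩

theorem hcat_zero {A : Type*} (H K : A × ℝ → Z) (x : A) : hcat H K (x, 0) = H (x, 0) := by
  simp [hcat]

theorem hcat_one {A : Type*} (H K : A × ℝ → Z) (x : A) : hcat H K (x, 1) = K (x, 1) := by
  have : ¬ ((1:ℝ) ≤ 1 / 2) := by norm_num
  simp only [hcat, if_neg this]; norm_num

theorem hcat_mapsTo {A : Type*} {H K : A × ℝ → Z} {U : Set A} {Y : Set Z}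
    (hH : MapsTo H (U ×ˢ Icc 0 1) Y) (hK : MapsTo K (U ×ˢ Icc 0 1) Y) :
    MapsTo (hcat H K) (U ×ˢ Icc 0 1) Y := by
  rintro ⟨x, t⟩ ⟨hx, ht0, ht1⟩
  simp only [hcat]
  split_ifs with h
  · exact hH ⟨hx, by show 0 ≤ 2 * t; dsimp only at ht0; linarith, by show 2 * t ≤ 1; linarith⟩
  · exact hK ⟨hx, by show 0 ≤ 2 * t - 1; linarith, by show 2 * t - 1 ≤ 1; dsimp only at ht1; linarith⟩

theorem Ctr.to {V Y : Set M} (h : Ctr V Y) (hY : IsPathConnected Y) {y : M} (hy : y ∈ Y) :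
    ∃ H : M × ℝ → M, ContinuousOn H (V ×ˢ Icc 0 1) ∧ (∀ x ∈ V, H (x, 0) = x) ∧
      (∀ x ∈ V, H (x, 1) = y) ∧ MapsTo H (V ×ˢ Icc 0 1) Y := by
  obtain ⟨H, q, h1, h2, h3, h4⟩ := h
  rcases V.eq_empty_or_nonempty with rfl | ⟨v, hv⟩
  · exact ⟨H, by simpa using h1, by simp, by simp, h4⟩
  have hq : q ∈ Y := by
    have : H (v, 1) ∈ Y := h4 ⟨hv, by simp⟩
    rwa [h3 v hv] at this
  obtain ⟨γ, hγ⟩ := (hY.joinedIn q hq y hy)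
  refine ⟨hcat H (fun z => γ.extend z.2), hcat_cont h1 ?_ ?_, ?_, ?_, hcat_mapsTo h4 ?_⟩
  · exact (γ.continuous_extend.comp continuous_snd).continuousOn
  · intro x hx; simp [h3 x hx]
  · intro x hx; rw [hcat_zero, h2 x hx]
  · intro x hx; rw [hcat_one]; simp
  · rintro ⟨x, t⟩ ⟨_, ht⟩
    show γ.extend t ∈ Y
    rw [γ.extend_apply ht]
    exact hγ _

abbrev Eu (n : ℕ) := EuclideanSpace ℝ (Fin n)

/-- the complement of the open unit ball -/
def XX (Ψ : OpenPartialHomeomorph (Eu n) M) : Set M := (Ψ '' Metric.ball 0 1)ᶜ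
def Zo (Ψ : OpenPartialHomeomorph (Eu n) M) : Set M := Ψ '' Metric.ball 0 (11/10)
def Zc (Ψ : OpenPartialHomeomorph (Eu n) M) : Set M := Ψ '' Metric.closedBall 0 (11/10)

/-- good sets: open, prescribed near the ball, contraction with prescribed form near the sphere -/
structure Good (Ψ : OpenPartialHomeomorph (Eu n) M) (R : Set (Eu n)) (s : Eu n × ℝ → Eu n) (w : Eu n)
    (U Y : Set M) : Prop where
  op : IsOpen U
  reg : U ∩ Zo Ψ = Ψ '' (R ∩ Metric.ball 0 (11/10))
  ctr : ∃ H : M × ℝ → M, ContinuousOn H ((U ∩ XX Ψ) ×ˢ Icc 0 1) ∧ (∀ x ∈ U ∩ XX Ψ, H (x, 0) = x) ∧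
    (∀ x ∈ U ∩ XX Ψ, H (x, 1) = Ψ w) ∧ MapsTo H ((U ∩ XX Ψ) ×ˢ Icc 0 1) Y ∧
    ∀ v, Ψ v ∈ U → 1 ≤ ‖v‖ → ‖v‖ ≤ 11/10 → ∀ t ∈ Icc (0:ℝ) 1, H (Ψ v, t) = Ψ (s (v, t)) ∧ H (Ψ v, t) ≠ Ψ 0

variable {Ψ : OpenPartialHomeomorph (Eu n) M} {R : Set (Eu n)} {s : Eu n × ℝ → Eu n} {w : Eu n} {U V Y : Set M}

theorem Good.shrink (h : Good Ψ R s w U Y) (hV : IsOpen V) (hVU : V ⊆ U) (hZ : U ∩ Zo Ψ ⊆ V) : Good Ψ R s w V Y := by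
  obtain ⟨ho, hr, H, h1, h2, h3, h4, h5⟩ := h
  have hm : V ∩ XX Ψ ⊆ U ∩ XX Ψ := inter_subset_inter_left _ hVU
  refine ⟨hV, ?_, H, h1.mono (prod_mono_left hm), fun x hx => h2 x (hm hx), fun x hx => h3 x (hm hx),
    fun z hz => h4 ⟨hm hz.1, hz.2⟩, fun v hv => h5 v (hVU hv)⟩
  rw [← hr]
  exact Subset.antisymm (inter_subset_inter_left _ hVU) (fun x hx => ⟨hZ hx, hx.2⟩)

theorem mem_Zc_norm (hs : Ψ.source = Metric.ball 0 2) {v : Eu n} (hv : ‖v‖ ≤ 11/10) : Ψ v ∈ Zc Ψ :=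
  ⟨v, by simpa using hv, rfl⟩

theorem Zo_subset_Zc : Zo Ψ ⊆ Zc Ψ := image_mono Metric.ball_subset_closedBall

theorem Good.add {ι : Type*} (h : Good Ψ R s w U Y) {V : ι → Set M} (hV : ∀ j, IsOpen (V j))
    (hd : ∀ i j, i ≠ j → Disjoint (V i) (V j)) (hU : ∀ j, Disjoint U (V j)) (hZ : ∀ j, Disjoint (V j) (Zc Ψ))
    {Y' : Set M} (hY' : Y' ⊆ Y) (hpc : IsPathConnected Y') (hw : Ψ w ∈ Y') (hctr : ∀ j, Ctr (V j) Y') :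
    Good Ψ R s w (U ∪ ⋃ j, V j) Y := by
  classical
  obtain ⟨ho, hr, H, h1, h2, h3, h4, h5⟩ := h
  choose K k1 k2 k3 k4 using fun j => (hctr j).to hpc hw
  set G : M × ℝ → M := fun z => if hz : ∃ j, z.1 ∈ V j then K hz.choose z else H z with hG
  have hGV : ∀ j, ∀ x ∈ V j, ∀ t, G (x, t) = K j (x, t) := by
    intro j x hx t
    have hex : ∃ j, x ∈ V j := ⟨j, hx⟩
    have : hex.choose = j := by
      by_contra hne
      exact Set.disjoint_left.1 (hd _ _ hne) hex.choose_spec hx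
    simp only [hG]
    rw [dif_pos hex, this]
  have hGU : ∀ x ∈ U, ∀ t, G (x, t) = H (x, t) := by
    intro x hx t
    have hex : ¬ ∃ j, x ∈ V j := fun ⟨j, hj⟩ => Set.disjoint_left.1 (hU j) hx hj
    simp only [hG]
    rw [dif_neg hex]
  refine ⟨ho.union (isOpen_iUnion hV), ?_, G, ?_, ?_, ?_, ?_, ?_⟩
  · rw [← hr, union_inter_distrib_right, iUnion_inter]
    have : ⋃ j, V j ∩ Zo Ψ = ∅ := by
      rw [iUnion_eq_empty]
      intro j
      exact Set.disjoint_iff_inter_eq_empty.1 ((hZ j).mono_right Zo_subset_Zc)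
    rw [this, union_empty]
  · have e : ((U ∪ ⋃ j, V j) ∩ XX Ψ) ×ˢ Icc (0:ℝ) 1 =
        ((U ×ˢ univ) ∪ ⋃ j, (V j ×ˢ (univ : Set ℝ))) ∩ (XX Ψ ×ˢ Icc (0:ℝ) 1) := by
      ext ⟨x, t⟩; simp; tauto
    rw [e]
    refine co_union (ho.prod isOpen_univ) (isOpen_iUnion fun j => (hV j).prod isOpen_univ) ?_ ?_
    · rw [prod_inter_prod, univ_inter]
      exact h1.congr fun z hz => hGU z.1 hz.1.1 z.2
    · refine co_iUnion (fun j => (hV j).prod isOpen_univ) fun j => ?_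
      rw [prod_inter_prod, univ_inter]
      exact ((k1 j).mono (prod_mono_left inter_subset_left)).congr fun z hz => hGV j z.1 hz.1.1 z.2
  · rintro x ⟨hx | hx, hxX⟩
    · rw [hGU x hx, h2 x ⟨hx, hxX⟩]
    · obtain ⟨j, hj⟩ := mem_iUnion.1 hx
      rw [hGV j x hj, k2 j x hj]
  · rintro x ⟨hx | hx, hxX⟩
    · rw [hGU x hx, h3 x ⟨hx, hxX⟩]
    · obtain ⟨j, hj⟩ := mem_iUnion.1 hx
      rw [hGV j x hj, k3 j x hj]
  · rintro ⟨x, t⟩ ⟨⟨hx | hx, hxX⟩, ht⟩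
    · rw [hGU x hx]; exact h4 ⟨⟨hx, hxX⟩, ht⟩
    · obtain ⟨j, hj⟩ := mem_iUnion.1 hx
      rw [hGV j x hj]; exact hY' (k4 j ⟨hj, ht⟩)
  · intro v hv hv1 hv2 t ht
    rcases hv with hv | hv
    · rw [hGU _ hv]; exact h5 v hv hv1 hv2 t ht
    · obtain ⟨j, hj⟩ := mem_iUnion.1 hv
      exact absurd (⟨v, by simpa using hv2, rfl⟩ : Ψ v ∈ Zc Ψ) (Set.disjoint_left.1 (hZ j) hj)
end

section
variable {M : Type*} [TopologicalSpace M] [T2Space M] [CompactSpace M] [Nonempty M] {n : ℕ}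
variable {Ψ : OpenPartialHomeomorph (Eu n) M} {R : Set (Eu n)} {s : Eu n × ℝ → Eu n} {w : Eu n} {U V Y : Set M}

theorem isClosed_Zc (hs : Ψ.source = Metric.ball 0 2) : IsClosed (Zc Ψ) :=
  ((isCompact_closedBall _ _).image_of_continuousOn (Ψ.continuousOn.mono
    (by rw [hs]; exact Metric.closedBall_subset_ball (by norm_num)))).isClosed
theorem isOpen_Zo (hs : Ψ.source = Metric.ball 0 2) : IsOpen (Zo Ψ) :=
  Ψ.isOpen_image_of_subset_source Metric.isOpen_ball (by rw [hs]; exact Metric.ball_subset_ball (by norm_num))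
theorem isClosed_XX (hs : Ψ.source = Metric.ball 0 2) : IsClosed (XX Ψ) :=
  (Ψ.isOpen_image_of_subset_source Metric.isOpen_ball (by rw [hs]; exact Metric.ball_subset_ball (by norm_num))).isClosed_compl
theorem p_notMem_XX : Ψ 0 ∉ XX Ψ := fun h => h ⟨0, by simp, rfl⟩
theorem p_mem_Zc : Ψ 0 ∈ Zc Ψ := ⟨0, by simp; norm_num, rfl⟩

/-- elements of `XX ∩ Zc` are images of annulus points -/
theorem mem_XX_Zc (hs : Ψ.source = Metric.ball 0 2) {x : M} (hx : x ∈ XX Ψ) (hz : x ∈ Zc Ψ) :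
    ∃ v, 1 ≤ ‖v‖ ∧ ‖v‖ ≤ 11/10 ∧ Ψ v = x := by
  obtain ⟨v, hv, rfl⟩ := hz
  refine ⟨v, ?_, by simpa using hv, rfl⟩
  by_contra h
  exact hx ⟨v, by simpa using h, rfl⟩

/-- perturbing a good set off `p`, at the cost of removing `L` -/
theorem Good.perturb (h : Good Ψ R s w U Y) (hs : Ψ.source = Metric.ball 0 2) (hw : Ψ w ≠ Ψ 0) {F : Set M}
    (hF : IsClosed F) (hFU : F ⊆ U) :
    ∃ L : Set M, IsClosed L ∧ L ⊆ F ∩ XX Ψ ∧ Disjoint L (Zc Ψ) ∧ ∀ small : Set M → Prop, Sml small →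
      ∀ ζs : List ((Fin n → I) → M × I), (∀ ζ ∈ ζs, Continuous ζ ∧ Function.Injective ζ) →
      ∀ S : Set M, (∀ x ∈ S, ∀ t, ∃ ζ ∈ ζs, (x, t) ∈ range ζ) →
      ∃ L' : Set M, IsClosed L' ∧ L' ⊆ L ∧ Sc small (L' ∩ S) ∧
        Good Ψ R s w ((interior F \ L') ∪ (U ∩ Zo Ψ)) {Ψ 0}ᶜ := by
  classical
  obtain ⟨ho, hr, H, h1, h2, h3, h4, h5⟩ := h
  have hFX : F ∩ XX Ψ ⊆ U ∩ XX Ψ := inter_subset_inter_left _ hFU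
  obtain ⟨L, hL1, hL2, hL3, hL4⟩ := CS.perturb Ψ hs (A := F ∩ XX Ψ) (A0 := F ∩ XX Ψ ∩ Zc Ψ) (h := H)
    (hF.inter (isClosed_XX hs)) ((hF.inter (isClosed_XX hs)).inter (isClosed_Zc hs)) inter_subset_left
    (h1.mono (prod_mono_left hFX))
    (fun x hx => by
      rw [h2 x (hFX hx)]; intro h; rw [h] at hx; exact p_notMem_XX hx.2)
    (fun x hx => by rw [h3 x (hFX hx)]; exact hw)
    (fun x hx t ht => by
      obtain ⟨v, hv1, hv2, rfl⟩ := mem_XX_Zc hs hx.1.2 hx.2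
      exact (h5 v (hFU hx.1.1) hv1 hv2 t ht).2)
  refine ⟨L, hL1, hL2, ?_, ?_⟩
  · rw [Set.disjoint_left] at hL3 ⊢
    exact fun x hx hz => hL3 hx ⟨hL2 hx, hz⟩
  intro small hsm ζs hζ S hS
  obtain ⟨h', k1, k2, k3, k4, k5, k6, k7⟩ := hL4 small hsm ζs hζ S hS
  set L' := {x ∈ F ∩ XX Ψ | ∃ t ∈ Icc (0:ℝ) 1, h' (x, t) = Ψ 0} with hL'
  refine ⟨L', k5, k6, k7, ?_⟩
  set G : M × ℝ → M := fun z => if z.1 ∈ F then h' z else H z with hG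
  have hGF : ∀ x ∈ F, ∀ t, G (x, t) = h' (x, t) := fun x hx t => if_pos hx
  have hGZ : ∀ x ∈ U, x ∈ XX Ψ → x ∈ Zc Ψ → ∀ t ∈ Icc (0:ℝ) 1, G (x, t) = H (x, t) := by
    intro x hx hX hZ t ht
    by_cases hxF : x ∈ F
    · rw [hGF x hxF]
      exact k4 x ⟨hxF, hX⟩ (fun hxL => Set.disjoint_left.1 hL3 hxL ⟨⟨hxF, hX⟩, hZ⟩) t ht
    · exact if_neg hxF
  have hsub : ∀ x ∈ (interior F \ L') ∪ (U ∩ Zo Ψ), x ∈ U := by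
    rintro x (hx | hx)
    · exact hFU (interior_subset hx.1)
    · exact hx.1
  refine ⟨(isOpen_interior.sdiff k5).union (ho.inter (isOpen_Zo hs)), ?_, G, ?_, ?_, ?_, ?_, ?_⟩
  · rw [← hr]
    ext x
    constructor
    · rintro ⟨hx, hz⟩; exact ⟨hsub x hx, hz⟩
    · rintro hx; exact ⟨Or.inr hx, hx.2⟩
  · have e : (((interior F \ L') ∪ (U ∩ Zo Ψ)) ∩ XX Ψ) ×ˢ Icc (0:ℝ) 1 =
        (((interior F \ L') ×ˢ univ) ∪ ((U ∩ Zo Ψ) ×ˢ (univ : Set ℝ))) ∩ (XX Ψ ×ˢ Icc (0:ℝ) 1) := by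
      ext ⟨x, t⟩; simp; tauto
    rw [e]
    refine co_union ((isOpen_interior.sdiff k5).prod isOpen_univ) ((ho.inter (isOpen_Zo hs)).prod isOpen_univ) ?_ ?_
    · rw [prod_inter_prod, univ_inter]
      refine (k1.mono (prod_mono_left ?_)).congr fun z hz => hGF z.1 (interior_subset hz.1.1.1) z.2
      rintro x ⟨hx, hX⟩
      exact ⟨interior_subset hx.1, hX⟩
    · rw [prod_inter_prod, univ_inter]
      refine (h1.mono (prod_mono_left ?_)).congr fun z hz => hGZ z.1 hz.1.1.1 hz.1.2 (Zo_subset_Zc hz.1.1.2) z.2 hz.2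
      rintro x ⟨hx, hX⟩
      exact ⟨hx.1, hX⟩
  · rintro x ⟨hx, hX⟩
    have h6 := h2 x ⟨hsub x hx, hX⟩
    by_cases hxF : x ∈ F
    · rw [hGF x hxF, k2 x ⟨hxF, hX⟩, h6]
    · rw [← h6]; simp only [hG, if_neg hxF, h6]
  · rintro x ⟨hx, hX⟩
    have h6 := h3 x ⟨hsub x hx, hX⟩
    by_cases hxF : x ∈ F
    · rw [hGF x hxF, k3 x ⟨hxF, hX⟩, h6]
    · simp only [hG, if_neg hxF, h6]
  · rintro ⟨x, t⟩ ⟨⟨hx, hX⟩, ht⟩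
    rcases hx with hx | hx
    · rw [hGF x (interior_subset hx.1)]
      intro hp
      exact hx.2 ⟨⟨interior_subset hx.1, hX⟩, t, ht, hp⟩
    · rw [hGZ x hx.1 hX (Zo_subset_Zc hx.2) t ht]
      obtain ⟨v, hv1, hv2, rfl⟩ := mem_XX_Zc hs hX (Zo_subset_Zc hx.2)
      exact (h5 v hx.1 hv1 hv2 t ht).2
  · intro v hv hv1 hv2 t ht
    have hX : Ψ v ∈ XX Ψ := by
      rintro ⟨v', hv', he⟩
      have : v' = v := Ψ.injOn (by rw [hs]; exact Metric.ball_subset_ball (by norm_num) hv') (by rw [hs]; simp; linarith) he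
      rw [this] at hv'
      simp at hv'; linarith
    rw [hGZ _ (hsub _ hv) hX ⟨v, by simpa using hv2, rfl⟩ t ht]
    exact h5 v (hsub _ hv) hv1 hv2 t ht
end
end CS

open scoped Topology
namespace CS
set_option linter.all false
open Set unitInterval

section
variable {M : Type*} [TopologicalSpace M] [T2Space M] [CompactSpace M] [Nonempty M] {n : ℕ}
variable {Ψ : OpenPartialHomeomorph (Eu n) M}

theorem swap_core (hM : Mf n M) (hs : Ψ.source = Metric.ball 0 2) (hpc : IsPathConnected ({Ψ 0}ᶜ : Set M))
    {Ri Rl Rj : Set (Eu n)} {si sl sj : Eu n × ℝ → Eu n} {wi wl wj : Eu n} {Ui Ul Uj Yi Yl Yj T : Set M}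
    (hi : Good Ψ Ri si wi Ui Yi) (hl : Good Ψ Rl sl wl Ul Yl) (hj : Good Ψ Rj sj wj Uj Yj) (hT : IsOpen T)
    (hwi : Ψ wi ≠ Ψ 0) (hwl : Ψ wl ≠ Ψ 0) (hwj : Ψ wj ≠ Ψ 0) (hYl : {Ψ 0}ᶜ ⊆ Yl) (hYj : {Ψ 0}ᶜ ⊆ Yj)
    (hcov : ∀ x ∈ XX Ψ, x ∈ Ui ∨ x ∈ Ul ∨ x ∈ Uj ∨ x ∈ T) :
    ∃ Ui' Ul' Uj', Good Ψ Ri si wi Ui' {Ψ 0}ᶜ ∧ Good Ψ Rl sl wl Ul' Yl ∧ Good Ψ Rj sj wj Uj' Yj ∧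
      ∀ x ∈ XX Ψ, x ∈ Ui' ∨ x ∈ Ul' ∨ x ∈ Uj' ∨ x ∈ T := by
  classical
  set Xin := XX Ψ \ (Ul ∪ Uj ∪ T) with hXin
  have hXc : IsClosed Xin := (isClosed_XX hs).sdiff ((hl.op.union hj.op).union hT)
  have hXU : Xin ⊆ Ui := by
    rintro x ⟨hx, hx'⟩
    rcases hcov x hx with h | h | h | h
    · exact h
    all_goals exact absurd (by simp [h]) hx'
  obtain ⟨G, hG, hXG, hGU⟩ := normal_exists_closure_subset hXc hi.op hXU
  set F := closure G with hF
  have hXF : Xin ⊆ interior F := hXG.trans (interior_maximal subset_closure hG)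
  obtain ⟨L, hLc, hLF, hLZ, hL⟩ := hi.perturb hs hwi (F := F) isClosed_closure hGU
  obtain ⟨m, φ, hφ, hcovφ⟩ := cell_cover hM (K := L ∩ Xin) (W := interior F \ Zc Ψ) (hLc.inter hXc).isCompact
    (isOpen_interior.sdiff (isClosed_Zc hs))
    (fun x hx => ⟨hXF hx.2, fun hz => Set.disjoint_left.1 hLZ hx.1 hz⟩)
  set N := ⋃ a, φ a '' oc n with hN
  set RR := ⋃ a, range (φ a) with hRR
  set S := ⋃ a, bd (φ a) with hS
  have hRRc : IsClosed RR := isClosed_iUnion_of_finite fun a => (hφ a).1.isClosed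
  have hSc : IsClosed S := isClosed_iUnion_of_finite fun a => (hφ a).1.isClosed_bd
  have hNo : IsOpen N := isOpen_iUnion fun a => (hφ a).1.op
  have hNR : N ⊆ RR := iUnion_mono fun a => image_subset_range _ _
  have hRW : RR ⊆ interior F \ Zc Ψ := iUnion_subset fun a => (hφ a).2
  set E := RR \ (Uj ∪ T) with hE
  have hEc : IsClosed E := hRRc.sdiff (hj.op.union hT)
  set small : Set M → Prop := fun O => O ∩ L = ∅ ∨ (Ctr O {Ψ 0}ᶜ ∧ O ∩ Zc Ψ = ∅ ∧ (O ∩ E = ∅ ∨ O ⊆ N ∪ Ul)) with hsmall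
  have hsm : Sml small := by
    constructor
    · rintro A B - hBA (h | ⟨h1, h2, h3⟩)
      · left
        exact subset_empty_iff.1 ((inter_subset_inter_left _ hBA).trans h.subset)
      · refine Or.inr ⟨h1.mono hBA subset_rfl, subset_empty_iff.1 ((inter_subset_inter_left _ hBA).trans h2.subset), ?_⟩
        rcases h3 with h3 | h3
        · exact Or.inl (subset_empty_iff.1 ((inter_subset_inter_left _ hBA).trans h3.subset))
        · exact Or.inr (hBA.trans h3)
    · intro x
      by_cases hx : x ∈ L
      swap
      · exact ⟨Lᶜ, hLc.isOpen_compl, hx, Or.inl (by simp)⟩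
      have hxX : x ∈ XX Ψ := (hLF hx).2
      have hxp : x ≠ Ψ 0 := fun h => p_notMem_XX (h ▸ hxX)
      have hxZ : x ∉ Zc Ψ := Set.disjoint_left.1 hLZ hx
      have hW : IsOpen ((Zc Ψ)ᶜ : Set M) := (isClosed_Zc hs).isOpen_compl
      have hWp : (Zc Ψ)ᶜ ⊆ ({Ψ 0}ᶜ : Set M) := by
        rintro y hy h; rw [mem_singleton_iff.1 h] at hy; exact hy p_mem_Zc
      have fin : ∀ O : Set M, IsOpen O → x ∈ O → (O ∩ E = ∅ ∨ O ⊆ N ∪ Ul) → ∃ A, IsOpen A ∧ x ∈ A ∧ small A := by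
        intro O hO hxO h
        obtain ⟨ψ, hψ, hxψ, hr⟩ := hM.small' (hW.inter hO) ⟨hxZ, hxO⟩
        have h0 : ψ '' oc n ⊆ range ψ := image_subset_range _ _
        refine ⟨ψ '' oc n, hψ.op, hxψ, Or.inr ⟨(hψ.ctr ((hr.trans inter_subset_left).trans hWp)).mono h0 subset_rfl, ?_, ?_⟩⟩
        · exact subset_empty_iff.1 (fun y hy => (hr (h0 hy.1)).1 hy.2)
        · rcases h with h | h
          · exact Or.inl (subset_empty_iff.1 (fun y hy => h.subset ⟨(hr (h0 hy.1)).2, hy.2⟩))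
          · exact Or.inr (fun y hy => h (hr (h0 hy)).2)
      by_cases hxE : x ∈ E
      swap
      · exact fin Eᶜ hEc.isOpen_compl hxE (Or.inl (by simp))
      refine fin (N ∪ Ul) (hNo.union hl.op) ?_ (Or.inr subset_rfl)
      by_cases hxl : x ∈ Ul
      · exact Or.inr hxl
      · left
        refine hcovφ ⟨hx, hxX, ?_⟩
        rintro ((h | h) | h)
        · exact hxl h
        · exact hxE.2 (Or.inl h)
        · exact hxE.2 (Or.inr h)
  obtain ⟨ζs, hζ1, hζ2⟩ := faces_fin φ (fun a => (hφ a).1)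
  obtain ⟨L', hL'c, hL'L, hSc', hgood⟩ := hL small hsm ζs hζ1 S hζ2
  obtain ⟨Q, O, hQ, hQd, hO, hΛO, hOQ, hOJ⟩ := hSc'.extract (hL'c.inter hSc)
  set J : Set ℕ := {b | (Q b ∩ E).Nonempty ∧ (Q b ∩ L).Nonempty} with hJ
  have hJs : ∀ b ∈ J, Ctr (Q b) {Ψ 0}ᶜ ∧ Q b ∩ Zc Ψ = ∅ ∧ Q b ⊆ N ∪ Ul := by
    rintro b ⟨hb1, hb2⟩
    rcases (hQ b).2 with h | ⟨h1, h2, h3 | h3⟩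
    · exact absurd h hb2.ne_empty
    · exact absurd h3 hb1.ne_empty
    · exact ⟨h1, h2, h3⟩
  set B := ⋃ b ∈ J, O ∩ Q b with hB
  have hBJ := hOJ J
  have hclZ : Disjoint (closure B) (Zc Ψ) := by
    rw [Set.disjoint_left]
    intro x hx hz
    obtain ⟨b, hb, hxb⟩ := mem_iUnion₂.1 (hBJ hx)
    exact (hJs b hb).2.1.subset ⟨hxb, hz⟩
  have hBe : B = ⋃ b : J, O ∩ Q b := by rw [hB, biUnion_eq_iUnion]
  refine ⟨_, (Ul \ RR) ∪ ⋃ a, pc φ a, (Uj \ closure B) ∪ B, hgood, ?_, ?_, ?_⟩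
  · refine (hl.shrink (hl.op.sdiff hRRc) diff_subset ?_).add (isOpen_pc fun a => (hφ a).1) pc_disj ?_ ?_ hYl hpc hwl ?_
    · exact fun x hx => ⟨hx.1, fun h => (hRW h).2 (Zo_subset_Zc hx.2)⟩
    · intro a
      rw [Set.disjoint_left]
      exact fun x hx hx' => hx.2 (hNR (mem_iUnion.2 ⟨a, pc_subset a hx'⟩))
    · intro a
      rw [Set.disjoint_left]
      exact fun x hx hz => (hRW (hNR (mem_iUnion.2 ⟨a, pc_subset a hx⟩))).2 hz
    · intro a
      refine ((hφ a).1.ctr (Y := {Ψ 0}ᶜ) ?_).mono ((pc_subset a).trans (image_subset_range _ _)) subset_rfl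
      rintro x hx h
      rw [mem_singleton_iff.1 h] at hx
      exact ((hφ a).2 hx).2 p_mem_Zc
  · suffices h : Good Ψ Rj sj wj ((Uj \ closure B) ∪ ⋃ b : J, O ∩ Q b) Yj by rwa [← hBe] at h
    refine (hj.shrink (hj.op.sdiff isClosed_closure) diff_subset ?_).add (fun b => hO.inter (hQ _).1) ?_ ?_ ?_ hYj hpc hwj ?_
    · exact fun x hx => ⟨hx.1, fun h => Set.disjoint_left.1 hclZ h (Zo_subset_Zc hx.2)⟩
    · intro a b hab
      exact (hQd a b (fun h => hab (Subtype.ext h))).mono inter_subset_right inter_subset_right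
    · intro a
      rw [Set.disjoint_left]
      exact fun x hx hx' => hx.2 (subset_closure (hBe ▸ mem_iUnion.2 ⟨a, hx'⟩))
    · intro a
      rw [Set.disjoint_left]
      exact fun x hx hz => (hJs a a.2).2.1.subset ⟨hx.2, hz⟩
    · intro a
      exact (hJs a a.2).1.mono inter_subset_right subset_rfl
  · intro x hx
    have inRR : x ∈ RR → (∃ b ∈ J, x ∈ Q b) ∨ x ∈ E → x ∈ (interior F \ L') ∪ (Ui ∩ Zo Ψ) ∨ x ∈ (Ul \ RR) ∪ ⋃ a, pc φ a ∨ x ∈ (Uj \ closure B) ∪ B := by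
      intro hxR hb
      by_cases hxL : x ∈ L'
      swap
      · exact Or.inl (Or.inl ⟨(hRW hxR).1, hxL⟩)
      by_cases hxS : x ∈ S
      swap
      · exact Or.inr (Or.inl (Or.inr (iUnion_pc x hxR hxS)))
      have hxO := hΛO ⟨hxL, hxS⟩
      right; right; right
      rcases hb with ⟨b, hb, hxb⟩ | hxE
      · exact mem_iUnion₂.2 ⟨b, hb, hxO, hxb⟩
      · obtain ⟨b, hxb⟩ := mem_iUnion.1 (hOQ (subset_closure hxO))
        exact mem_iUnion₂.2 ⟨b, ⟨⟨x, hxb, hxE⟩, ⟨x, hxb, hL'L hxL⟩⟩, hxO, hxb⟩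
    by_cases hxT : x ∈ T
    · simp [hxT]
    have key : x ∈ (interior F \ L') ∪ (Ui ∩ Zo Ψ) ∨ x ∈ (Ul \ RR) ∪ ⋃ a, pc φ a ∨ x ∈ (Uj \ closure B) ∪ B := by
      by_cases hxj : x ∈ Uj
      · by_cases hxB : x ∈ closure B
        swap
        · exact Or.inr (Or.inr (Or.inl ⟨hxj, hxB⟩))
        obtain ⟨b, hb, hxb⟩ := mem_iUnion₂.1 (hBJ hxB)
        by_cases hxR : x ∈ RR
        · exact inRR hxR (Or.inl ⟨b, hb, hxb⟩)
        · rcases (hJs b hb).2.2 hxb with h | h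
          · exact absurd (hNR h) hxR
          · exact Or.inr (Or.inl (Or.inl ⟨h, hxR⟩))
      · by_cases hxR : x ∈ RR
        · exact inRR hxR (Or.inr ⟨hxR, by rintro (h | h) <;> contradiction⟩)
        by_cases hxl : x ∈ Ul
        · exact Or.inr (Or.inl (Or.inl ⟨hxl, hxR⟩))
        have hxin : x ∈ Xin := ⟨hx, by rintro ((h | h) | h) <;> contradiction⟩
        refine Or.inl (Or.inl ⟨hXF hxin, fun h => hxR (hNR (hcovφ ⟨hL'L h, hxin⟩))⟩)
    tauto

/-- all colors, at least three of them -/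
theorem swap_all {k : ℕ} (hk : 2 ≤ k) (hM : Mf n M) (hs : Ψ.source = Metric.ball 0 2)
    (hpc : IsPathConnected ({Ψ 0}ᶜ : Set M))
    {R : Fin (k+1) → Set (Eu n)} {s : Fin (k+1) → Eu n × ℝ → Eu n} {w : Fin (k+1) → Eu n} {U : Fin (k+1) → Set M}
    (hg : ∀ i, Good Ψ (R i) (s i) (w i) (U i) univ) (hw : ∀ i, Ψ (w i) ≠ Ψ 0) (hcov : XX Ψ ⊆ ⋃ i, U i) :
    ∃ U' : Fin (k+1) → Set M, (∀ i, Good Ψ (R i) (s i) (w i) (U' i) {Ψ 0}ᶜ) ∧ XX Ψ ⊆ ⋃ i, U' i := by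
  classical
  have key : ∀ D : Finset (Fin (k+1)), ∃ U' : Fin (k+1) → Set M,
      (∀ i, Good Ψ (R i) (s i) (w i) (U' i) (if i ∈ D then {Ψ 0}ᶜ else univ)) ∧ XX Ψ ⊆ ⋃ i, U' i := by
    intro D
    induction D using Finset.induction_on with
    | empty => exact ⟨U, by simpa using hg, hcov⟩
    | insert i D hiD ih =>
      obtain ⟨V, hV, hVc⟩ := ih
      obtain ⟨l, hl⟩ : ∃ l, l ≠ i := by
        have : ({i} : Finset (Fin (k+1))) ≠ Finset.univ := by
          intro h
          have := congrArg Finset.card h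
          simp at this; omega
        by_contra h; push Not at h
        exact this (Finset.eq_univ_of_forall fun x => by simp [h x])
      obtain ⟨j, hji, hjl⟩ : ∃ j, j ≠ i ∧ j ≠ l := by
        have : ({i, l} : Finset (Fin (k+1))) ≠ Finset.univ := by
          intro h
          have := congrArg Finset.card h
          have h2 := Finset.card_le_two (a := i) (b := l)
          simp at this; omega
        by_contra h; push Not at h
        refine this (Finset.eq_univ_of_forall fun x => ?_)
        by_cases hx : x = i
        · simp [hx]
        · simp [h x hx]
      have hY : ∀ m, ({Ψ 0}ᶜ : Set M) ⊆ (if m ∈ D then {Ψ 0}ᶜ else univ) := by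
        intro m; split_ifs <;> simp
      obtain ⟨Vi, Vl, Vj, h1, h2, h3, h4⟩ := swap_core hM hs hpc (hV i) (hV l) (hV j)
        (T := ⋃ m ∈ {m | m ≠ i ∧ m ≠ l ∧ m ≠ j}, V m) (isOpen_biUnion fun m _ => (hV m).op)
        (hw i) (hw l) (hw j) (hY l) (hY j) (by
          intro x hx
          obtain ⟨m, hm⟩ := mem_iUnion.1 (hVc hx)
          by_cases h1 : m = i
          · subst h1; exact Or.inl hm
          by_cases h2 : m = l
          · subst h2; exact Or.inr (Or.inl hm)
          by_cases h3 : m = j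
          · subst h3; exact Or.inr (Or.inr (Or.inl hm))
          exact Or.inr (Or.inr (Or.inr (mem_iUnion₂.2 ⟨m, ⟨h1, h2, h3⟩, hm⟩))))
      refine ⟨fun m => if m = i then Vi else if m = l then Vl else if m = j then Vj else V m, ?_, ?_⟩
      · intro m
        by_cases e1 : m = i
        · subst e1; simpa using h1
        by_cases e2 : m = l
        · subst e2; simpa [e1] using h2
        by_cases e3 : m = j
        · subst e3; simpa [e1, e2] using h3
        simpa [e1, e2, e3] using hV m
      · intro x hx
        rcases h4 x hx with h | h | h | h
        · exact mem_iUnion.2 ⟨i, by simpa using h⟩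
        · exact mem_iUnion.2 ⟨l, by simpa [hl] using h⟩
        · exact mem_iUnion.2 ⟨j, by simpa [hji, hjl] using h⟩
        · obtain ⟨m, ⟨e1, e2, e3⟩, hm⟩ := mem_iUnion₂.1 h
          exact mem_iUnion.2 ⟨m, by simpa [e1, e2, e3] using hm⟩
  simpa using key Finset.univ
end
end CS

open scoped Topology
namespace CS
set_option linter.all false
open Set unitInterval

section
variable {M : Type*} [TopologicalSpace M] {n : ℕ}
variable {Ψ : OpenPartialHomeomorph (Eu n) M} {R : Set (Eu n)} {s : Eu n × ℝ → Eu n} {w : Eu n} {U V Y : Set M}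

/-- radial normalization of vectors of norm at most one -/
noncomputable def nz (v : Eu n) : Eu n := (max ‖v‖ 1 / ‖v‖) • v

theorem norm_nz {v : Eu n} (hv : v ≠ 0) : ‖nz v‖ = max ‖v‖ 1 := by
  have : 0 < ‖v‖ := norm_pos_iff.2 hv
  rw [nz, norm_smul, Real.norm_of_nonneg (by positivity)]
  field_simp

theorem nz_eq {v : Eu n} (hv : 1 ≤ ‖v‖) : nz v = v := by
  have : 0 < ‖v‖ := by linarith
  rw [nz, max_eq_left hv, div_self this.ne', one_smul]

theorem nz_cont : ContinuousOn (nz (n := n)) {0}ᶜ := by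
  unfold nz
  refine ContinuousOn.smul (ContinuousOn.div (f := fun v : Eu n => max ‖v‖ 1) (g := fun v : Eu n => ‖v‖) ?_ ?_ ?_) continuousOn_id
  · fun_prop
  · fun_prop
  · intro x hx; exact norm_ne_zero_iff.2 hx

open Classical in
/-- radial retraction onto `XX` -/
noncomputable def rr (Ψ : OpenPartialHomeomorph (Eu n) M) (x : M) : M :=
  if x ∈ Ψ.target then Ψ (nz (Ψ.symm x)) else x

theorem rr_apply (hs : Ψ.source = Metric.ball 0 2) {v : Eu n} (hv : ‖v‖ < 2) : rr Ψ (Ψ v) = Ψ (nz v) := by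
  have : v ∈ Ψ.source := by rw [hs]; simpa using hv
  rw [rr, if_pos (Ψ.map_source this), Ψ.left_inv this]

theorem mem_XX_norm (hs : Ψ.source = Metric.ball 0 2) {v : Eu n} (hv : ‖v‖ < 2) : Ψ v ∈ XX Ψ ↔ 1 ≤ ‖v‖ := by
  constructor
  · intro h
    by_contra h'
    exact h ⟨v, by simpa using h', rfl⟩
  · rintro h ⟨v', hv', he⟩
    have : v' = v := Ψ.injOn (by rw [hs]; exact Metric.ball_subset_ball (by norm_num) hv') (by rw [hs]; simpa using hv) he
    rw [this] at hv'
    simp at hv'; linarith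

theorem mem_src (hs : Ψ.source = Metric.ball 0 2) {v : Eu n} : v ∈ Ψ.source ↔ ‖v‖ < 2 := by
  rw [hs]; simp

theorem rr_eq (hs : Ψ.source = Metric.ball 0 2) {x : M} (hx : x ∈ XX Ψ) : rr Ψ x = x := by
  by_cases h : x ∈ Ψ.target
  · obtain ⟨v, hv, rfl⟩ : ∃ v ∈ Ψ.source, Ψ v = x := ⟨Ψ.symm x, Ψ.map_target h, Ψ.right_inv h⟩
    rw [mem_src hs] at hv
    rw [rr_apply hs hv, nz_eq ((mem_XX_norm hs hv).1 hx)]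
  · rw [rr, if_neg h]

theorem rr_mem (hs : Ψ.source = Metric.ball 0 2) {x : M} (hx : x ≠ Ψ 0) : rr Ψ x ∈ XX Ψ := by
  by_cases h : x ∈ Ψ.target
  · obtain ⟨v, hv, rfl⟩ : ∃ v ∈ Ψ.source, Ψ v = x := ⟨Ψ.symm x, Ψ.map_target h, Ψ.right_inv h⟩
    rw [mem_src hs] at hv
    have hv0 : v ≠ 0 := fun h => hx (by rw [h])
    rw [rr_apply hs hv, mem_XX_norm hs, norm_nz hv0]
    · exact le_max_right _ _
    · rw [norm_nz hv0]; exact max_lt hv (by norm_num)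
  · rw [rr, if_neg h]
    rintro ⟨v, hv, rfl⟩
    exact h (Ψ.map_source (by rw [hs]; exact Metric.ball_subset_ball (by norm_num) hv))

theorem rr_cont [T2Space M] (hs : Ψ.source = Metric.ball 0 2) : ContinuousOn (rr Ψ) {Ψ 0}ᶜ := by
  have h0 : (0 : Eu n) ∈ Ψ.source := by rw [mem_src hs]; simp
  have hcl : IsClosed (Ψ '' Metric.closedBall 0 1) :=
    ((isCompact_closedBall _ _).image_of_continuousOn (Ψ.continuousOn.mono
      (by rw [hs]; exact Metric.closedBall_subset_ball (by norm_num)))).isClosed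
  intro x hx
  by_cases h : x ∈ Ψ.target
  · have h1 : ContinuousAt (fun x => Ψ (nz (Ψ.symm x))) x := by
      have hv := Ψ.map_target h
      have hv0 : Ψ.symm x ≠ 0 := fun h' => hx (by rw [← h', Ψ.right_inv h]; rfl)
      have h2 : ContinuousAt nz (Ψ.symm x) := nz_cont.continuousAt (isOpen_compl_singleton.mem_nhds hv0)
      have h3 : nz (Ψ.symm x) ∈ Ψ.source := by
        rw [mem_src hs] at hv ⊢
        rw [norm_nz hv0]; exact max_lt hv (by norm_num)
      exact ContinuousAt.comp (g := Ψ) (Ψ.continuousAt h3) (ContinuousAt.comp (g := nz) h2 (Ψ.continuousAt_symm h))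
    refine (h1.congr ?_).continuousWithinAt
    filter_upwards [Ψ.open_target.mem_nhds h] with y hy
    rw [rr, if_pos hy]
  · refine (continuousAt_id.congr ?_).continuousWithinAt
    have hx' : x ∉ Ψ '' Metric.closedBall 0 1 := by
      rintro ⟨v, hv, rfl⟩
      exact h (Ψ.map_source (by rw [hs]; exact Metric.closedBall_subset_ball (by norm_num) hv))
    filter_upwards [hcl.isOpen_compl.mem_nhds hx'] with y hy
    rw [rr_eq hs]
    · rfl
    · rintro ⟨v, hv, rfl⟩
      exact hy ⟨v, Metric.ball_subset_closedBall hv, rfl⟩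

theorem Good.push [T2Space M] (h : Good Ψ R s w U {Ψ 0}ᶜ) (hs : Ψ.source = Metric.ball 0 2) (hw : ‖w‖ = 1)
    (hsn : ∀ v, ‖v‖ = 1 → ∀ t ∈ Icc (0:ℝ) 1, ‖s (v, t)‖ ≤ 1) : ∃ K : M × ℝ → M,
    ContinuousOn K ((U ∩ XX Ψ) ×ˢ Icc 0 1) ∧ (∀ x ∈ U ∩ XX Ψ, K (x, 0) = x) ∧
    (∀ x ∈ U ∩ XX Ψ, K (x, 1) = Ψ w) ∧ MapsTo K ((U ∩ XX Ψ) ×ˢ Icc 0 1) (XX Ψ) ∧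
    ∀ v, Ψ v ∈ U → ‖v‖ = 1 → ∀ t ∈ Icc (0:ℝ) 1, K (Ψ v, t) = Ψ (nz (s (v, t))) ∧ ‖nz (s (v, t))‖ = 1 := by
  obtain ⟨ho, hr, H, h1, h2, h3, h4, h5⟩ := h
  refine ⟨fun z => rr Ψ (H z), (rr_cont hs).comp h1 h4, ?_, ?_, fun z hz => rr_mem hs (h4 hz), ?_⟩
  · intro x hx; simp only [h2 x hx]; exact rr_eq hs hx.2
  · intro x hx; simp only [h3 x hx]; exact rr_eq hs ((mem_XX_norm hs (by rw [hw]; norm_num)).2 hw.ge)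
  · intro v hv hv1 t ht
    have hle := hsn v hv1 t ht
    obtain ⟨e1, e2⟩ := h5 v hv hv1.ge (by rw [hv1]; norm_num) t ht
    have hne : s (v, t) ≠ 0 := fun h => e2 (by rw [e1, h])
    refine ⟨?_, by rw [norm_nz hne, max_eq_right hle]⟩
    simp only [e1]
    exact rr_apply hs (by linarith)

theorem interior_D (e : ↥(Metric.ball (0 : EuclideanSpace ℝ (Fin n)) 2) → M) (hs : Ψ.source = Metric.ball 0 2)
    (hΨ : ∀ x : ↥(Metric.ball (0 : EuclideanSpace ℝ (Fin n)) 2), Ψ x = e x) (m : M) : m ∉ interior (imageClosedUnitBall e) ↔ m ∈ XX Ψ := by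
  rw [XX, mem_compl_iff, not_iff_not]
  have hD : imageClosedUnitBall e = Ψ '' Metric.closedBall 0 1 := by
    ext x; constructor
    · rintro ⟨v, hv, rfl⟩
      exact ⟨v, by simpa using hv, hΨ v⟩
    · rintro ⟨v, hv, rfl⟩
      have hv' : ‖v‖ ≤ 1 := by simpa using hv
      refine ⟨⟨v, by simp; linarith⟩, hv', (hΨ ⟨v, by simp; linarith⟩).symm⟩
  have hsub : Metric.closedBall (0 : Eu n) 1 ⊆ Ψ.source := by
    rw [hs]; exact Metric.closedBall_subset_ball (by norm_num)
  rw [hD]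
  constructor
  · intro hm
    obtain ⟨v, hv, hvm⟩ := interior_subset hm
    refine ⟨v, ?_, hvm⟩
    rw [← interior_closedBall (0 : Eu n) one_ne_zero]
    rw [mem_interior_iff_mem_nhds] at hm ⊢
    have h1 := (Ψ.continuousAt (hsub hv)).preimage_mem_nhds (hvm ▸ hm)
    filter_upwards [h1, Ψ.open_source.mem_nhds (hsub hv)] with y hy hys
    obtain ⟨y', hy', he⟩ := hy
    rwa [← Ψ.injOn (hsub hy') hys he]
  · intro hm
    refine interior_maximal (image_mono Metric.ball_subset_closedBall) ?_ hm
    exact Ψ.isOpen_image_of_subset_source Metric.isOpen_ball (Metric.ball_subset_closedBall.trans hsub)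

end

section
variable {n : ℕ} {M N : Type*} [TopologicalSpace M] [TopologicalSpace N] [T2Space M] [T2Space N]

open Classical in
theorem glue {e : ↥(Metric.ball (0 : EuclideanSpace ℝ (Fin n)) 2) → M}
    {e' : ↥(Metric.ball (0 : EuclideanSpace ℝ (Fin n)) 2) → N}
    {Ψ : OpenPartialHomeomorph (Eu n) M} {Ψ' : OpenPartialHomeomorph (Eu n) N}
    (hs : Ψ.source = Metric.ball 0 2) (hΨ : ∀ x : ↥(Metric.ball (0 : EuclideanSpace ℝ (Fin n)) 2), Ψ x = e x)
    (hs' : Ψ'.source = Metric.ball 0 2) (hΨ' : ∀ x : ↥(Metric.ball (0 : EuclideanSpace ℝ (Fin n)) 2), Ψ' x = e' x) {k : ℕ}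
    {R : Fin (k+1) → Set (Eu n)} {s : Fin (k+1) → Eu n × ℝ → Eu n} {w : Fin (k+1) → Eu n}
    (hw : ∀ i, ‖w i‖ = 1) (hsn : ∀ i v, ‖v‖ = 1 → ∀ t ∈ Icc (0:ℝ) 1, ‖s i (v, t)‖ ≤ 1)
    {U : Fin (k+1) → Set M} {U' : Fin (k+1) → Set N}
    (hg : ∀ i, Good Ψ (R i) (s i) (w i) (U i) {Ψ 0}ᶜ) (hc : XX Ψ ⊆ ⋃ i, U i)
    (hg' : ∀ i, Good Ψ' (R i) (s i) (w i) (U' i) {Ψ' 0}ᶜ) (hc' : XX Ψ' ⊆ ⋃ i, U' i) :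
    lsCat (ConnectedSum e e') ≤ k := by
  apply Nat.sInf_le
  have hD := interior_D e hs hΨ
  have hD' := interior_D e' hs' hΨ'
  let π : ({ m : M // m ∉ interior (imageClosedUnitBall e) } ⊕
        { m : N // m ∉ interior (imageClosedUnitBall e') }) → ConnectedSum e e' := Quot.mk _
  have hπ : Topology.IsQuotientMap π := isQuotientMap_quot_mk
  have memU : ∀ i v, ‖v‖ = 1 → (Ψ v ∈ U i ↔ v ∈ R i) := by
    intro i v hv
    constructor
    · intro h
      have : Ψ v ∈ U i ∩ Zo Ψ := ⟨h, v, by simp [hv]; norm_num, rfl⟩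
      rw [(hg i).reg] at this
      obtain ⟨v', ⟨h1, h2⟩, he⟩ := this
      rwa [← Ψ.injOn (by rw [hs]; exact Metric.ball_subset_ball (by norm_num) h2) (by rw [hs]; simp [hv]) he]
    · intro h
      have : Ψ v ∈ Ψ '' (R i ∩ Metric.ball 0 (11/10)) := ⟨v, ⟨h, by simp [hv]; norm_num⟩, rfl⟩
      rw [← (hg i).reg] at this
      exact this.1
  have memU' : ∀ i v, ‖v‖ = 1 → (Ψ' v ∈ U' i ↔ v ∈ R i) := by
    intro i v hv
    constructor
    · intro h
      have : Ψ' v ∈ U' i ∩ Zo Ψ' := ⟨h, v, by simp [hv]; norm_num, rfl⟩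
      rw [(hg' i).reg] at this
      obtain ⟨v', ⟨h1, h2⟩, he⟩ := this
      rwa [← Ψ'.injOn (by rw [hs']; exact Metric.ball_subset_ball (by norm_num) h2) (by rw [hs']; simp [hv]) he]
    · intro h
      have : Ψ' v ∈ (Ψ') '' (R i ∩ Metric.ball 0 (11/10)) := ⟨v, ⟨h, by simp [hv]; norm_num⟩, rfl⟩
      rw [← (hg' i).reg] at this
      exact this.1
  let W : Fin (k+1) → Set (ConnectedSum e e') := fun i => {q | Quot.lift
    (Sum.elim (fun m => m.1 ∈ U i) (fun m => m.1 ∈ U' i)) (by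
      rintro (a | a) (b | b) ⟨x, hx, h⟩
      · exact h.elim
      · obtain ⟨h1, h2⟩ := h
        simp only [Sum.elim_inl, Sum.elim_inr, eq_iff_iff, h1, h2]
        rw [← hΨ, ← hΨ', memU i x hx, memU' i x hx]
      · exact h.elim
      · exact h.elim) q}
  have hWl : ∀ i m, π (Sum.inl m) ∈ W i ↔ m.1 ∈ U i := fun i m => Iff.rfl
  have hWr : ∀ i m, π (Sum.inr m) ∈ W i ↔ m.1 ∈ U' i := fun i m => Iff.rfl
  have hWo : ∀ i, IsOpen (W i) := by
    intro i
    rw [← hπ.isOpen_preimage, isOpen_sum_iff]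
    exact ⟨(hg i).op.preimage continuous_subtype_val, (hg' i).op.preimage continuous_subtype_val⟩
  refine ⟨W, hWo, ?_, ?_⟩
  · rw [eq_univ_iff_forall]
    intro q
    induction q using Quot.ind with
    | mk a =>
    rcases a with a | a
    · obtain ⟨i, hi⟩ := mem_iUnion.1 (hc ((hD a).1 a.2))
      exact mem_iUnion.2 ⟨i, (hWl i a).2 hi⟩
    · obtain ⟨i, hi⟩ := mem_iUnion.1 (hc' ((hD' a).1 a.2))
      exact mem_iUnion.2 ⟨i, (hWr i a).2 hi⟩
  intro i
  obtain ⟨K, k1, k2, k3, k4, k5⟩ := (hg i).push hs (hw i) (hsn i)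
  obtain ⟨K', k1', k2', k3', k4', k5'⟩ := (hg' i).push hs' (hw i) (hsn i)
  have hwX : Ψ (w i) ∉ interior (imageClosedUnitBall e) :=
    (hD _).2 ((mem_XX_norm hs (by rw [hw]; norm_num)).2 (hw i).ge)
  let c : ConnectedSum e e' := π (Sum.inl ⟨Ψ (w i), hwX⟩)
  let f : M → ConnectedSum e e' := fun x => if h : x ∉ interior (imageClosedUnitBall e) then π (Sum.inl ⟨x, h⟩) else c
  let f' : N → ConnectedSum e e' := fun x => if h : x ∉ interior (imageClosedUnitBall e') then π (Sum.inr ⟨x, h⟩) else c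
  have hf : ∀ m : { m : M // m ∉ interior (imageClosedUnitBall e) }, f m = π (Sum.inl m) := fun m => dif_pos m.2
  have hf' : ∀ m : { m : N // m ∉ interior (imageClosedUnitBall e') }, f' m = π (Sum.inr m) := fun m => dif_pos m.2
  have hfc : ContinuousOn f {m : M | m ∉ interior (imageClosedUnitBall e)} := by
    rw [continuousOn_iff_continuous_domRestrict]
    have : Set.domRestrict {m : M | m ∉ interior (imageClosedUnitBall e)} f = fun m => π (Sum.inl m) := by
      funext m; exact hf m
    rw [this]
    exact hπ.continuous.comp continuous_inl
  have hfc' : ContinuousOn f' {m : N | m ∉ interior (imageClosedUnitBall e')} := by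
    rw [continuousOn_iff_continuous_domRestrict]
    have : Set.domRestrict {m : N | m ∉ interior (imageClosedUnitBall e')} f' = fun m => π (Sum.inr m) := by
      funext m; exact hf' m
    rw [this]
    exact hπ.continuous.comp continuous_inr
  have hff' : ∀ v, ‖v‖ = 1 → f (Ψ v) = f' (Ψ' v) := by
    intro v hv
    have h1 : Ψ v ∉ interior (imageClosedUnitBall e) :=
      (hD _).2 ((mem_XX_norm hs (by rw [hv]; norm_num)).2 hv.ge)
    have h2 : Ψ' v ∉ interior (imageClosedUnitBall e') :=
      (hD' _).2 ((mem_XX_norm hs' (by rw [hv]; norm_num)).2 hv.ge)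
    rw [hf ⟨_, h1⟩, hf' ⟨_, h2⟩]
    exact Quot.sound ⟨⟨v, by simp [hv]⟩, hv, hΨ ⟨v, by simp [hv]⟩, hΨ' ⟨v, by simp [hv]⟩⟩
  let g : ({ m : M // m ∉ interior (imageClosedUnitBall e) } ⊕
        { m : N // m ∉ interior (imageClosedUnitBall e') }) → I → ConnectedSum e e' := fun z t =>
    Sum.elim (fun m => if m.1 ∈ U i then f (K (m.1, t)) else c) (fun m => if m.1 ∈ U' i then f' (K' (m.1, t)) else c) z
  let G : ConnectedSum e e' → I → ConnectedSum e e' := fun q t => Quot.lift (fun z => g z t) (by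
      rintro (a | a) (b | b) ⟨x, hx, h⟩
      · exact h.elim
      · obtain ⟨h1, h2⟩ := h
        simp only [g, Sum.elim_inl, Sum.elim_inr, h1, h2]
        rw [← hΨ, ← hΨ']
        by_cases hxR : (x : Eu n) ∈ R i
        · rw [if_pos ((memU i _ hx).2 hxR), if_pos ((memU' i _ hx).2 hxR)]
          obtain ⟨a1, a2⟩ := k5 x ((memU i _ hx).2 hxR) hx t t.2
          obtain ⟨b1, b2⟩ := k5' x ((memU' i _ hx).2 hxR) hx t t.2
          rw [a1, b1]
          exact hff' _ a2
        · rw [if_neg (fun h => hxR ((memU i _ hx).1 h)), if_neg (fun h => hxR ((memU' i _ hx).1 h))]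
      · exact h.elim
      · exact h.elim) q
  have hGl : ∀ m t, m.1 ∈ U i → G (π (Sum.inl m)) t = f (K (m.1, t)) := fun m t hm => if_pos hm
  have hGr : ∀ m t, m.1 ∈ U' i → G (π (Sum.inr m)) t = f' (K' (m.1, t)) := fun m t hm => if_pos hm
  have hGc : Continuous fun z : I × W i => G z.2 z.1 := by
    refine (hπ.restrictPreimage_isOpen (hWo i)).continuous_lift_prod_right ?_
    rw [continuous_iff_continuousAt]
    rintro ⟨t, ⟨a, ha⟩⟩
    suffices h : ContinuousAt (fun z : I × _ => G (π z.2) z.1) (t, a) by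
      exact ContinuousAt.comp (g := fun z : I × _ => G (π z.2) z.1) (f := fun z : I × (π ⁻¹' W i) => (z.1, z.2.1)) h (by fun_prop)
    rcases a with a | a
    · have emb := (Topology.IsOpenEmbedding.id (X := I)).prodMap (Topology.IsOpenEmbedding.inl
        (X := { m : M // m ∉ interior (imageClosedUnitBall e) }) (Y := { m : N // m ∉ interior (imageClosedUnitBall e') }))
      refine (emb.continuousAt_iff (x := (t, a))).1 ?_
      have ha' : a.1 ∈ U i := (hWl i a).1 ha
      have h1 : ContinuousOn (fun z : I × { m : M // m ∉ interior (imageClosedUnitBall e) } => f (K (z.2.1, z.1.1)))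
          {z | z.2.1 ∈ U i} := by
        refine hfc.comp (k1.comp (by fun_prop) ?_) ?_
        · rintro ⟨t, m⟩ hm
          exact ⟨⟨hm, (hD _).1 m.2⟩, t.2⟩
        · rintro ⟨t, m⟩ hm
          exact (hD _).2 (k4 ⟨⟨hm, (hD _).1 m.2⟩, t.2⟩)
      have hop : IsOpen {z : I × { m : M // m ∉ interior (imageClosedUnitBall e) } | z.2.1 ∈ U i} :=
        (hg i).op.preimage (by fun_prop)
      refine (h1.continuousAt (hop.mem_nhds ha')).congr ?_
      filter_upwards [hop.mem_nhds ha'] with z hz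
      exact (hGl z.2 z.1 hz).symm
    · have emb := (Topology.IsOpenEmbedding.id (X := I)).prodMap (Topology.IsOpenEmbedding.inr
        (X := { m : M // m ∉ interior (imageClosedUnitBall e) }) (Y := { m : N // m ∉ interior (imageClosedUnitBall e') }))
      refine (emb.continuousAt_iff (x := (t, a))).1 ?_
      have ha' : a.1 ∈ U' i := (hWr i a).1 ha
      have h1 : ContinuousOn (fun z : I × { m : N // m ∉ interior (imageClosedUnitBall e') } => f' (K' (z.2.1, z.1.1)))
          {z | z.2.1 ∈ U' i} := by
        refine hfc'.comp (k1'.comp (by fun_prop) ?_) ?_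
        · rintro ⟨t, m⟩ hm
          exact ⟨⟨hm, (hD' _).1 m.2⟩, t.2⟩
        · rintro ⟨t, m⟩ hm
          exact (hD' _).2 (k4' ⟨⟨hm, (hD' _).1 m.2⟩, t.2⟩)
      have hop : IsOpen {z : I × { m : N // m ∉ interior (imageClosedUnitBall e') } | z.2.1 ∈ U' i} :=
        (hg' i).op.preimage (by fun_prop)
      refine (h1.continuousAt (hop.mem_nhds ha')).congr ?_
      filter_upwards [hop.mem_nhds ha'] with z hz
      exact (hGr z.2 z.1 hz).symm
  refine ⟨c, ⟨⟨⟨fun z => G z.2 z.1, hGc⟩, ?_, ?_⟩⟩⟩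
  · rintro ⟨q, hq⟩
    induction q using Quot.ind with
    | mk a =>
    rcases a with a | a
    · have h := (hWl i a).1 hq
      refine (hGl a 0 h).trans ?_
      show f (K (a.1, 0)) = π (Sum.inl a)
      rw [k2 a.1 ⟨h, (hD _).1 a.2⟩, hf]
    · have h := (hWr i a).1 hq
      refine (hGr a 0 h).trans ?_
      show f' (K' (a.1, 0)) = π (Sum.inr a)
      rw [k2' a.1 ⟨h, (hD' _).1 a.2⟩, hf']
  · rintro ⟨q, hq⟩
    induction q using Quot.ind with
    | mk a =>
    rcases a with a | a
    · have h := (hWl i a).1 hq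
      refine (hGl a 1 h).trans ?_
      show f (K (a.1, 1)) = c
      rw [k3 a.1 ⟨h, (hD _).1 a.2⟩]
      exact hf ⟨_, hwX⟩
    · have h := (hWr i a).1 hq
      refine (hGr a 1 h).trans ?_
      show f' (K' (a.1, 1)) = c
      rw [k3' a.1 ⟨h, (hD' _).1 a.2⟩, ← hff' _ (hw i)]
      exact hf ⟨_, hwX⟩
end
end CS

open scoped Topology
namespace CS
set_option linter.all false
open Set unitInterval

section
variable {n : ℕ}
/-- standard data near the sphere -/
noncomputable def dv (i0 : Fin n) : Eu n := EuclideanSpace.single i0 (1:ℝ)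
def sR (i0 : Fin n) (i : ℕ) : Set (Eu n) :=
  if i = 0 then {v | v i0 < ‖v‖ / 2} else if i = 1 then {v | 0 < v i0} else ∅
noncomputable def sw (i0 : Fin n) (i : ℕ) : Eu n := if i = 0 then - dv i0 else dv i0
noncomputable def sl (w : Eu n) (z : Eu n × ℝ) : Eu n := (1 - min 1 (2 * z.2)) • z.1 + (min 1 (2 * z.2)) • w

theorem norm_dv (i0 : Fin n) : ‖dv i0‖ = 1 := by simp [dv]
theorem norm_sw (i0 : Fin n) (i : ℕ) : ‖sw i0 i‖ = 1 := by
  unfold sw; split_ifs <;> simp [norm_dv]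
theorem dv_apply (i0 : Fin n) : dv i0 i0 = 1 := by simp [dv]

theorem lin_norm {v w : Eu n} {t c : ℝ} (ht : 0 ≤ t) (ht1 : t ≤ 1) (hv : ‖v‖ ≤ c) (hw : ‖w‖ ≤ c) :
    ‖(1 - t) • v + t • w‖ ≤ c := by
  calc ‖(1 - t) • v + t • w‖ ≤ ‖(1 - t) • v‖ + ‖t • w‖ := norm_add_le _ _
    _ = (1 - t) * ‖v‖ + t * ‖w‖ := by
      rw [norm_smul, norm_smul, Real.norm_of_nonneg ht, Real.norm_of_nonneg (by linarith)]
    _ ≤ c := by nlinarith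

theorem sl_norm {v w : Eu n} {t c : ℝ} (ht : 0 ≤ t) (hv : ‖v‖ ≤ c) (hw : ‖w‖ ≤ c) : ‖sl w (v, t)‖ ≤ c :=
  lin_norm (by positivity) (min_le_left _ _) hv hw

/-- straight lines to the direction avoid zero -/
theorem lin_ne_one {i0 : Fin n} {v : Eu n} (hv : 0 < v i0) {t : ℝ} (ht : 0 ≤ t) (ht1 : t ≤ 1) :
    (1 - t) • v + t • dv i0 ≠ 0 := by
  intro h
  have := congrArg (fun u : Eu n => u i0) h
  simp [dv_apply] at this
  rcases eq_or_lt_of_le ht with rfl | ht0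
  · simp at this; linarith
  · nlinarith [mul_nonneg (by linarith : 0 ≤ 1 - t) hv.le]

theorem lin_ne_zero {i0 : Fin n} {v : Eu n} (hv : v i0 < ‖v‖ / 2) {t : ℝ} (ht : 0 ≤ t) (ht1 : t ≤ 1) :
    (1 - t) • v + t • (- dv i0) ≠ 0 := by
  intro h
  have h1 : (1 - t) • v = t • dv i0 := by
    have : (1 - t) • v = t • dv i0 + ((1 - t) • v + t • (- dv i0)) := by simp
    rw [this, h, add_zero]
  have h2 := congrArg (fun u : Eu n => u i0) h1
  have h3 := congrArg norm h1
  simp [dv_apply] at h2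
  rw [norm_smul, norm_smul, norm_dv, Real.norm_of_nonneg ht, Real.norm_of_nonneg (by linarith)] at h3
  have h4 : (1 - t) * (v i0 - ‖v‖) = 0 := by rw [mul_sub, h2, h3]; ring
  rcases mul_eq_zero.1 h4 with h5 | h5
  · have : t = 1 := by linarith
    subst this; simp at h3
  · have := norm_nonneg v
    have : v i0 = ‖v‖ := by linarith
    linarith
end

section
variable {M : Type*} [TopologicalSpace M] {n : ℕ}
variable {Ψ : OpenPartialHomeomorph (Eu n) M}

open Classical in
/-- extension by the identity of a homotopy supported in the ball -/
noncomputable def tm (Ψ : OpenPartialHomeomorph (Eu n) M) (T : Eu n × ℝ → Eu n) (z : M × ℝ) : M :=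
  if z.1 ∈ Ψ.target then Ψ (T (Ψ.symm z.1, z.2)) else z.1

theorem tm_apply (hs : Ψ.source = Metric.ball 0 2) {T : Eu n × ℝ → Eu n} {v : Eu n} (hv : ‖v‖ < 2) (t : ℝ) :
    tm Ψ T (Ψ v, t) = Ψ (T (v, t)) := by
  have : v ∈ Ψ.source := by rw [hs]; simpa using hv
  rw [tm, if_pos (Ψ.map_source this), Ψ.left_inv this]

theorem target_cases (hs : Ψ.source = Metric.ball 0 2) (x : M) : x ∉ Ψ.target ∨ ∃ v, ‖v‖ < 2 ∧ x = Ψ v := by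
  by_cases h : x ∈ Ψ.target
  · exact Or.inr ⟨Ψ.symm x, (mem_src hs).1 (Ψ.map_target h), (Ψ.right_inv h).symm⟩
  · exact Or.inl h

theorem isClosed_cb [T2Space M] (hs : Ψ.source = Metric.ball 0 2) {r : ℝ} (hr : r < 2) : IsClosed (Ψ '' Metric.closedBall 0 r) :=
  ((isCompact_closedBall _ _).image_of_continuousOn (Ψ.continuousOn.mono
      (by rw [hs]; exact Metric.closedBall_subset_ball hr))).isClosed

theorem mem_cb (hs : Ψ.source = Metric.ball 0 2) {v : Eu n} (hv : ‖v‖ < 2) {A : Set (Eu n)} (hA : ∀ a ∈ A, ‖a‖ < 2) :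
    Ψ v ∈ Ψ '' A ↔ v ∈ A := by
  constructor
  · rintro ⟨u, hu, he⟩
    rwa [← Ψ.injOn ((mem_src hs).2 (hA u hu)) ((mem_src hs).2 hv) he]
  · exact fun h => ⟨v, h, rfl⟩

theorem tm_cont [T2Space M] (hs : Ψ.source = Metric.ball 0 2) {T : Eu n × ℝ → Eu n}
    (hT : Continuous T) (hid : ∀ v t, 19/10 ≤ ‖v‖ → T (v, t) = v)
    (hb : ∀ v, ∀ t ∈ Icc (0:ℝ) 1, ‖v‖ < 2 → ‖T (v, t)‖ < 2) : ContinuousOn (tm Ψ T) (univ ×ˢ Icc 0 1) := by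
  rintro ⟨x, t⟩ ⟨-, ht⟩
  rcases target_cases hs x with h | ⟨v, hv, rfl⟩
  · have hx' : x ∉ Ψ '' Metric.closedBall 0 (19/10) := by
      rintro ⟨v, hv, rfl⟩
      exact h (Ψ.map_source (by rw [hs]; exact Metric.closedBall_subset_ball (by norm_num) hv))
    have hop : IsOpen {z : M × ℝ | z.1 ∉ Ψ '' Metric.closedBall 0 (19/10)} :=
      (isClosed_cb hs (by norm_num)).isOpen_compl.preimage continuous_fst
    refine (continuousAt_fst.congr ?_).continuousWithinAt
    filter_upwards [hop.mem_nhds hx'] with z hz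
    obtain ⟨y, t'⟩ := z
    rcases target_cases hs y with h' | ⟨v, hv, rfl⟩
    · rw [tm, if_neg h']
    · rw [tm_apply hs hv, hid]
      by_contra h''
      exact hz ⟨v, by simp; linarith, rfl⟩
  · have hx : Ψ v ∈ Ψ.target := Ψ.map_source ((mem_src hs).2 hv)
    have e : Ψ.symm (Ψ v) = v := Ψ.left_inv ((mem_src hs).2 hv)
    have h1 : ContinuousAt (fun z : M × ℝ => Ψ (T (Ψ.symm z.1, z.2))) (Ψ v, t) := by
      have h2 : ContinuousAt (fun z : M × ℝ => T (Ψ.symm z.1, z.2)) (Ψ v, t) := by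
        refine ContinuousAt.comp (g := T) hT.continuousAt (ContinuousAt.prodMk ?_ continuousAt_snd)
        exact ContinuousAt.comp (g := Ψ.symm) (Ψ.continuousAt_symm hx) continuousAt_fst
      refine ContinuousAt.comp (g := Ψ) (Ψ.continuousAt ?_) h2
      rw [mem_src hs]
      simp only [e]
      exact hb v t ht hv
    refine (h1.congr ?_).continuousWithinAt
    filter_upwards [(Ψ.open_target.preimage continuous_fst).mem_nhds (show (Ψ v, t) ∈ Prod.fst ⁻¹' Ψ.target from hx)] with z hz
    rw [tm, if_pos (show z.1 ∈ Ψ.target from hz)]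

open Classical in
/-- radial cut-off functions on `M` -/
noncomputable def cf (Ψ : OpenPartialHomeomorph (Eu n) M) (c : ℝ → ℝ) (x : M) : ℝ :=
  if x ∈ Ψ.target then c ‖Ψ.symm x‖ else 0

theorem cf_apply (hs : Ψ.source = Metric.ball 0 2) {c : ℝ → ℝ} {v : Eu n} (hv : ‖v‖ < 2) : cf Ψ c (Ψ v) = c ‖v‖ := by
  have : v ∈ Ψ.source := by rw [hs]; simpa using hv
  rw [cf, if_pos (Ψ.map_source this), Ψ.left_inv this]

theorem cf_cont [T2Space M] (hs : Ψ.source = Metric.ball 0 2) {c : ℝ → ℝ} (hc : Continuous c)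
    (h0 : ∀ r, 19/10 ≤ r → c r = 0) : Continuous (cf Ψ c) := by
  rw [continuous_iff_continuousAt]
  intro x
  rcases target_cases hs x with h | ⟨v, hv, rfl⟩
  · have hx' : x ∉ Ψ '' Metric.closedBall 0 (19/10) := by
      rintro ⟨v, hv, rfl⟩
      exact h (Ψ.map_source (by rw [hs]; exact Metric.closedBall_subset_ball (by norm_num) hv))
    refine (continuousAt_const (y := (0:ℝ))).congr ?_
    filter_upwards [(isClosed_cb hs (by norm_num)).isOpen_compl.mem_nhds hx'] with y hy
    rcases target_cases hs y with h' | ⟨v, hv, rfl⟩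
    · rw [cf, if_neg h']
    · rw [cf_apply hs hv, h0]
      by_contra h''
      exact hy ⟨v, by simp; linarith, rfl⟩
  · have hx : Ψ v ∈ Ψ.target := Ψ.map_source ((mem_src hs).2 hv)
    have h1 : ContinuousAt (fun x => c ‖Ψ.symm x‖) (Ψ v) :=
      ContinuousAt.comp (g := c) hc.continuousAt (Ψ.continuousAt_symm hx).norm
    refine h1.congr ?_
    filter_upwards [Ψ.open_target.mem_nhds hx] with y hy
    rw [cf, if_pos hy]

noncomputable def ramp (a b r : ℝ) : ℝ := max 0 (min 1 ((b - r) / (b - a)))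
theorem ramp_cont (a b : ℝ) : Continuous (ramp a b) := by unfold ramp; fun_prop
theorem ramp_nonneg (a b r : ℝ) : 0 ≤ ramp a b r := le_max_left _ _
theorem ramp_le (a b r : ℝ) : ramp a b r ≤ 1 := max_le (by norm_num) (min_le_left _ _)
theorem ramp_one {a b r : ℝ} (h : a < b) (hr : r ≤ a) : ramp a b r = 1 := by
  have h0 : 0 < b - a := by linarith
  have : 1 ≤ (b - r) / (b - a) := by rw [le_div_iff₀ h0]; linarith
  rw [ramp, min_eq_left this]; norm_num
theorem ramp_zero {a b r : ℝ} (h : a < b) (hr : b ≤ r) : ramp a b r = 0 := by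
  have h0 : 0 < b - a := by linarith
  have : (b - r) / (b - a) ≤ 0 := div_nonpos_of_nonpos_of_nonneg (by linarith) h0.le
  rw [ramp, max_eq_left]; exact (min_le_right _ _).trans this

/-- squeezing the ball of radius 1.8 to the center -/
noncomputable def sq (z : Eu n × ℝ) : Eu n := (1 - z.2 * ramp (18/10) (19/10) ‖z.1‖) • z.1

theorem sq_cont : Continuous (sq (n := n)) := by
  unfold sq
  have := ramp_cont (18/10) (19/10)
  fun_prop

theorem sq_norm (v : Eu n) {t : ℝ} (ht : t ∈ Icc (0:ℝ) 1) : ‖sq (v, t)‖ ≤ ‖v‖ := by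
  have h1 := ramp_nonneg (18/10) (19/10) ‖v‖
  have h2 := ramp_le (18/10) (19/10) ‖v‖
  rw [sq, norm_smul, Real.norm_of_nonneg (by nlinarith [ht.1, ht.2])]
  have : t * ramp (18/10) (19/10) ‖v‖ ≥ 0 := mul_nonneg ht.1 h1
  nlinarith [norm_nonneg v]

theorem sq_id (v : Eu n) (t : ℝ) (hv : 19/10 ≤ ‖v‖) : sq (v, t) = v := by
  simp [sq, ramp_zero (by norm_num : (18/10:ℝ) < 19/10) hv]
theorem sq_one {v : Eu n} (hv : ‖v‖ ≤ 18/10) : sq (v, 1) = 0 := by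
  simp [sq, ramp_one (by norm_num : (18/10:ℝ) < 19/10) hv]

theorem sqz_cont [T2Space M] (hs : Ψ.source = Metric.ball 0 2) : ContinuousOn (tm Ψ sq) (univ ×ˢ Icc 0 1) :=
  tm_cont hs sq_cont sq_id (fun v t ht hv => (sq_norm v ht).trans_lt hv)

theorem sqz_zero (hs : Ψ.source = Metric.ball 0 2) (x : M) : tm Ψ sq (x, 0) = x := by
  rcases target_cases hs x with h | ⟨v, hv, rfl⟩
  · rw [tm, if_neg h]
  · rw [tm_apply hs hv]; simp [sq]

/-- `ρ₁` -/
noncomputable def sz (Ψ : OpenPartialHomeomorph (Eu n) M) (x : M) : M := tm Ψ sq (x, 1)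

theorem sz_cont [T2Space M] (hs : Ψ.source = Metric.ball 0 2) : Continuous (sz Ψ) :=
  (sqz_cont hs).comp_continuous (f := fun x : M => (x, (1:ℝ))) (by fun_prop) (fun x => by simp)

theorem sz_p (hs : Ψ.source = Metric.ball 0 2) {v : Eu n} (hv : ‖v‖ ≤ 18/10) : sz Ψ (Ψ v) = Ψ 0 := by
  rw [sz, tm_apply hs (by linarith), sq_one hv]

theorem Ctr.squeeze [T2Space M] (hs : Ψ.source = Metric.ball 0 2) {U : Set M} (h : Ctr U univ) : Ctr (sz Ψ ⁻¹' U) univ := by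
  obtain ⟨H, q, h1, h2, h3, h4⟩ := h
  refine ⟨hcat (tm Ψ sq) (fun z => H (sz Ψ z.1, z.2)), q, hcat_cont ((sqz_cont hs).mono (prod_mono_left (subset_univ _))) ?_ ?_, ?_, ?_,
    fun _ _ => mem_univ _⟩
  · refine h1.comp (((sz_cont hs).comp continuous_fst).prodMk continuous_snd).continuousOn ?_
    rintro ⟨x, t⟩ ⟨hx, ht⟩
    exact ⟨hx, ht⟩
  · intro x hx
    exact (h2 (sz Ψ x) hx).symm
  · intro x hx; rw [hcat_zero, sqz_zero hs]
  · intro x hx; rw [hcat_one]; exact h3 _ hx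

/-- first stage of the contraction of the zeroth set -/
noncomputable def st (w : Eu n) (z : Eu n × ℝ) : Eu n :=
  (1 - z.2 * ramp (12/10) (14/10) ‖z.1‖) • z.1 + (z.2 * ramp (12/10) (14/10) ‖z.1‖) • w

theorem st_cont (w : Eu n) : Continuous (st w) := by
  unfold st
  have := ramp_cont (12/10) (14/10)
  fun_prop

theorem st_norm {v w : Eu n} {t c : ℝ} (ht : t ∈ Icc (0:ℝ) 1) (hv : ‖v‖ ≤ c) (hw : ‖w‖ ≤ c) : ‖st w (v, t)‖ ≤ c := by
  have h1 := ramp_nonneg (12/10) (14/10) ‖v‖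
  have h2 := ramp_le (12/10) (14/10) ‖v‖
  exact lin_norm (mul_nonneg ht.1 h1) (by nlinarith [ht.1, ht.2]) hv hw

theorem st_id {v w : Eu n} (t : ℝ) (hv : 14/10 ≤ ‖v‖) : st w (v, t) = v := by
  simp [st, ramp_zero (by norm_num : (12/10:ℝ) < 14/10) hv]
theorem st_in {v w : Eu n} (t : ℝ) (hv : ‖v‖ ≤ 12/10) : st w (v, t) = (1 - t) • v + t • w := by
  simp [st, ramp_one (by norm_num : (12/10:ℝ) < 14/10) hv]

end

section
variable {M : Type*} [TopologicalSpace M] [T2Space M] {n : ℕ}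
variable {Ψ : OpenPartialHomeomorph (Eu n) M}

theorem half_zero (hs : Ψ.source = Metric.ball 0 2) (i0 : Fin n) {U : Set M} (hU : IsOpen U) (hp : Ψ 0 ∈ U)
    (h : Ctr U univ) :
    Good Ψ (sR i0 0) (sl (sw i0 0)) (sw i0 0)
      (sz Ψ ⁻¹' U \ Ψ '' {v | ‖v‖ ≤ 15/10 ∧ ‖v‖ / 2 ≤ v i0}) univ := by
  obtain ⟨H, q, h1, h2, h3, -⟩ := h.squeeze hs
  set w := sw i0 0 with hw
  have hw1 : ‖w‖ = 1 := norm_sw i0 0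
  set V := sz Ψ ⁻¹' U with hV
  set C : Set (Eu n) := {v | ‖v‖ ≤ 15/10 ∧ ‖v‖ / 2 ≤ v i0} with hC
  have hC2 : ∀ a ∈ C, ‖a‖ < 2 := fun a ha => by have := ha.1; linarith
  have hCc : IsClosed (Ψ '' C) := by
    have hcl : IsClosed C := (isClosed_le (f := fun v : Eu n => ‖v‖) (g := fun _ => (15/10:ℝ)) (by fun_prop) (by fun_prop)).inter
      (isClosed_le (f := fun v : Eu n => ‖v‖/2) (g := fun v => v i0) (by fun_prop) (by fun_prop))
    have hco : IsCompact C := (isCompact_closedBall (0 : Eu n) (15/10)).of_isClosed_subset hcl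
      (fun v hv => by simpa using hv.1)
    exact (hco.image_of_continuousOn (Ψ.continuousOn.mono (fun v hv => (mem_src hs).2 (hC2 v hv)))).isClosed
  have hVo : IsOpen V := hU.preimage (sz_cont hs)
  have hin : ∀ v, ‖v‖ ≤ 18/10 → Ψ v ∈ V := fun v hv => by
    show sz Ψ (Ψ v) ∈ U
    rw [sz_p hs hv]; exact hp
  set G1 : M × ℝ → M := tm Ψ (st w) with hG1
  have g1c : ContinuousOn G1 (univ ×ˢ Icc 0 1) := tm_cont hs (st_cont w) (fun v t hv => st_id t (by linarith)) (by
    intro v t ht hv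
    have := st_norm (c := max ‖v‖ 1) ht (le_max_left _ _) (by rw [hw1]; exact le_max_right _ _) (v := v) (w := w)
    exact this.trans_lt (max_lt hv (by norm_num)))
  have g1V : ∀ x ∈ V, G1 (x, 1) ∈ V := by
    intro x hx
    rcases target_cases hs x with h | ⟨v, hv, rfl⟩
    · rw [hG1, tm, if_neg h]; exact hx
    · rw [hG1, tm_apply hs hv]
      by_cases hv' : 14/10 ≤ ‖v‖
      · rw [st_id _ hv']; exact hx
      · exact hin _ ((st_norm (c := 14/10) (by simp) (by linarith) (by rw [hw1]; norm_num)).trans (by norm_num))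
  have g1w : ∀ v : Eu n, ‖v‖ ≤ 12/10 → G1 (Ψ v, 1) = Ψ w := by
    intro v hv
    rw [hG1, tm_apply hs (by linarith), st_in _ hv]; simp
  set χ : M → ℝ := cf Ψ (ramp (11/10) (12/10)) with hχ
  have χc : Continuous χ := cf_cont hs (ramp_cont _ _) (fun r hr => ramp_zero (by norm_num) (by linarith))
  have χ01 : ∀ x, 0 ≤ χ x ∧ χ x ≤ 1 := by
    intro x
    rw [hχ, cf]
    split_ifs
    · exact ⟨ramp_nonneg _ _ _, ramp_le _ _ _⟩
    · norm_num
  have χ1 : ∀ v : Eu n, ‖v‖ ≤ 11/10 → χ (Ψ v) = 1 := fun v hv => by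
    rw [hχ, cf_apply hs (by linarith), ramp_one (by norm_num) hv]
  have χ0 : ∀ x, (∃ v, ‖v‖ ≤ 12/10 ∧ x = Ψ v) ∨ χ x = 0 := by
    intro x
    rcases target_cases hs x with h | ⟨v, hv, rfl⟩
    · right; rw [hχ, cf, if_neg h]
    · by_cases hv' : ‖v‖ ≤ 12/10
      · exact Or.inl ⟨v, hv', rfl⟩
      · right; rw [hχ, cf_apply hs hv, ramp_zero (by norm_num) (by linarith)]
  have hwV : Ψ w ∈ V := hin w (by rw [hw1]; norm_num)
  set G2 : M × ℝ → M := fun z => H (G1 (z.1, 1), (1 - χ z.1) * z.2) with hG2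
  set G3 : M × ℝ → M := fun z => H (Ψ w, (1 - χ z.1) * (1 - z.2)) with hG3
  have hm : ∀ x, ∀ t ∈ Icc (0:ℝ) 1, (1 - χ x) * t ∈ Icc (0:ℝ) 1 := by
    intro x t ht
    obtain ⟨a, b⟩ := χ01 x
    exact ⟨mul_nonneg (by linarith) ht.1, by nlinarith [ht.1, ht.2]⟩
  have g2c : ContinuousOn G2 (V ×ˢ Icc 0 1) := by
    refine h1.comp (ContinuousOn.prodMk ?_ ?_) ?_
    · refine g1c.comp (f := fun z : M × ℝ => (z.1, (1:ℝ))) (by fun_prop) (fun z _ => by simp)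
    · fun_prop
    · rintro ⟨x, t⟩ ⟨hx, ht⟩
      exact ⟨g1V x hx, hm x t ht⟩
  have g3c : ContinuousOn G3 (V ×ˢ Icc 0 1) := by
    refine h1.comp (ContinuousOn.prodMk continuousOn_const ?_) ?_
    · fun_prop
    · rintro ⟨x, t⟩ ⟨hx, ht⟩
      exact ⟨hwV, hm x (1 - t) ⟨by linarith [ht.2], by linarith [ht.1]⟩⟩
  have g12 : ∀ x ∈ V, G1 (x, 1) = hcat G2 G3 (x, 0) := by
    intro x hx
    rw [hcat_zero]
    simp only [hG2, mul_zero]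
    exact (h2 _ (g1V x hx)).symm
  have g23 : ∀ x ∈ V, G2 (x, 1) = G3 (x, 0) := by
    intro x hx
    simp only [hG2, hG3, mul_one, sub_zero]
    rcases χ0 x with ⟨v, hv, rfl⟩ | h
    · rw [g1w v hv]
    · rw [h, sub_zero, h3 _ (g1V x hx), h3 _ hwV]
  have hall : ContinuousOn (hcat G1 (hcat G2 G3)) (V ×ˢ Icc 0 1) :=
    hcat_cont (g1c.mono (prod_mono_left (subset_univ _))) (hcat_cont g2c g3c g23) g12
  have hVx : (V \ Ψ '' C) ∩ XX Ψ ⊆ V := fun x hx => hx.1.1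
  refine ⟨hVo.sdiff hCc, ?_, hcat G1 (hcat G2 G3), hall.mono (prod_mono_left hVx), ?_, ?_, fun _ _ => mem_univ _, ?_⟩
  · ext x
    constructor
    · rintro ⟨⟨hx1, hx2⟩, v, hv, rfl⟩
      have hv' : ‖v‖ < 11/10 := by simpa using hv
      refine ⟨v, ⟨?_, hv⟩, rfl⟩
      simp only [sR, if_true]
      by_contra h
      exact hx2 ⟨v, ⟨by linarith, not_lt.1 h⟩, rfl⟩
    · rintro ⟨v, ⟨hvR, hv⟩, rfl⟩
      have hv' : ‖v‖ < 11/10 := by simpa using hv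
      simp only [sR, if_true] at hvR
      refine ⟨⟨hin v (by linarith), ?_⟩, v, hv, rfl⟩
      rw [mem_cb hs (by linarith) hC2]
      intro h
      have h5 : ‖v‖ / 2 ≤ v i0 := h.2
      have h6 : v i0 < ‖v‖ / 2 := hvR
      linarith
  · intro x hx
    rw [hcat_zero]
    rcases target_cases hs x with h | ⟨v, hv, rfl⟩
    · rw [hG1, tm, if_neg h]
    · rw [hG1, tm_apply hs hv]; simp [st]
  · intro x hx
    rw [hcat_one, hcat_one]
    simp only [hG3, sub_self, mul_zero]
    exact h2 _ hwV
  · intro v hv hv1 hv2 t ht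
    have hvR : v i0 < ‖v‖ / 2 := by
      by_contra h
      exact hv.2 ⟨v, ⟨by linarith, not_lt.1 h⟩, rfl⟩
    have key : hcat G1 (hcat G2 G3) (Ψ v, t) = Ψ (sl w (v, t)) := by
      by_cases h : t ≤ 1/2
      · rw [hcat]
        simp only [if_pos h]
        rw [hG1, tm_apply hs (by linarith), st_in _ (by linarith), sl, min_eq_right (by linarith)]
      · have e : Ψ (sl w (v, t)) = Ψ w := by
          rw [sl, min_eq_left (by show (1:ℝ) ≤ 2 * t; linarith)]; simp
        rw [e, hcat]
        simp only [if_neg h]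
        rw [hcat]
        have hz : ∀ t : ℝ, (1 - χ (Ψ v)) * t = 0 := fun t => by rw [χ1 v hv2]; ring
        split_ifs
        · simp only [hG2, hz]
          rw [g1w v (by linarith), h2 _ hwV]
        · simp only [hG3, hz]
          rw [h2 _ hwV]
    rw [key]
    refine ⟨rfl, fun h => ?_⟩
    have hn : ‖sl w (v, t)‖ ≤ 11/10 := sl_norm ht.1 hv2 (by rw [hw1]; norm_num)
    have h0 := Ψ.injOn ((mem_src hs).2 (by linarith)) ((mem_src hs).2 (by simp)) h
    exact lin_ne_zero hvR (by have := ht.1; positivity) (min_le_left _ _) h0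

/-- far sets plus a half ball -/
theorem half_far (hs : Ψ.source = Metric.ball 0 2) (hpu : IsPathConnected (univ : Set M)) (i0 : Fin n) {U : Set M} (hU : IsOpen U)
    (h : Ctr U univ) (hUZ : Disjoint U (Ψ '' Metric.closedBall 0 (18/10))) :
    Good Ψ (sR i0 1) (sl (sw i0 1)) (sw i0 1) (U ∪ Ψ '' {v | ‖v‖ < 17/10 ∧ 0 < v i0}) univ := by
  set w := sw i0 1 with hw
  have hwd : w = dv i0 := by rw [hw, sw]; simp
  have hw1 : ‖w‖ = 1 := norm_sw i0 1
  set C : Set (Eu n) := {v | ‖v‖ < 17/10 ∧ 0 < v i0} with hC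
  have hC2 : ∀ a ∈ C, ‖a‖ < 2 := fun a ha => by have := ha.1; linarith
  have hCs : C ⊆ Ψ.source := fun v hv => (mem_src hs).2 (hC2 v hv)
  have hCo : IsOpen C := (isOpen_lt (f := fun v : Eu n => ‖v‖) (g := fun _ => (17/10:ℝ)) (by fun_prop) (by fun_prop)).inter
      (isOpen_lt (f := fun _ => (0:ℝ)) (g := fun v : Eu n => v i0) (by fun_prop) (by fun_prop))
  obtain ⟨H, h1, h2, h3, -⟩ := h.to hpu (mem_univ (Ψ w))
  have hCo' : IsOpen (Ψ '' C) := Ψ.isOpen_image_of_subset_source hCo hCs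
  classical
  set G : M × ℝ → M := fun z => if z.1 ∈ U then H z else Ψ (sl w (Ψ.symm z.1, z.2)) with hG
  have hdis : ∀ v ∈ C, Ψ v ∉ U := fun v hv hvU =>
    Set.disjoint_left.1 hUZ hvU ⟨v, by have := hv.1; simp; linarith, rfl⟩
  have hGU : ∀ x ∈ U, ∀ t, G (x, t) = H (x, t) := fun x hx t => if_pos hx
  have hGC : ∀ v ∈ C, ∀ t, G (Ψ v, t) = Ψ (sl w (v, t)) := fun v hv t => by
    simp only [hG]; rw [if_neg (hdis v hv), Ψ.left_inv (hCs hv)]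
  have slc : Continuous (sl w) := by unfold sl; fun_prop
  refine ⟨hU.union hCo', ?_, G, ?_, ?_, ?_, fun _ _ => mem_univ _, ?_⟩
  · ext x
    constructor
    · rintro ⟨hx1 | hx1, hx2⟩
      · refine absurd ?_ (Set.disjoint_left.1 hUZ hx1)
        obtain ⟨v, hv, rfl⟩ := hx2
        exact ⟨v, by have : ‖v‖ < 11/10 := by simpa using hv
                     simp; linarith, rfl⟩
      · obtain ⟨v, hv, rfl⟩ := hx2
        have hv' : ‖v‖ < 11/10 := by simpa using hv
        refine ⟨v, ⟨?_, hv⟩, rfl⟩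
        rw [mem_cb hs (by linarith) hC2] at hx1
        simp only [sR, one_ne_zero, if_true, if_false]
        exact hx1.2
    · rintro ⟨v, ⟨hvR, hv⟩, rfl⟩
      have hv' : ‖v‖ < 11/10 := by simpa using hv
      simp only [sR, one_ne_zero, if_true, if_false] at hvR
      exact ⟨Or.inr ⟨v, ⟨by linarith, hvR⟩, rfl⟩, v, hv, rfl⟩
  · have e : ((U ∪ Ψ '' C) ∩ XX Ψ) ×ˢ Icc (0:ℝ) 1 =
        ((U ×ˢ univ) ∪ ((Ψ '' C) ×ˢ (univ : Set ℝ))) ∩ (XX Ψ ×ˢ Icc (0:ℝ) 1) := by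
      ext ⟨x, t⟩; simp; tauto
    rw [e]
    refine co_union (hU.prod isOpen_univ) (hCo'.prod isOpen_univ) ?_ ?_
    · rw [prod_inter_prod, univ_inter]
      exact (h1.mono (prod_mono_left inter_subset_left)).congr fun z hz => hGU z.1 hz.1.1 z.2
    · rw [prod_inter_prod, univ_inter]
      have hc : ContinuousOn (fun z : M × ℝ => Ψ (sl w (Ψ.symm z.1, z.2))) ((Ψ '' C ∩ XX Ψ) ×ˢ Icc 0 1) := by
        refine Ψ.continuousOn.comp (slc.comp_continuousOn (ContinuousOn.prodMk ?_ continuousOn_snd)) ?_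
        · refine Ψ.continuousOn_symm.comp continuousOn_fst ?_
          rintro ⟨x, t⟩ ⟨⟨⟨v, hv, rfl⟩, -⟩, -⟩
          exact Ψ.map_source (hCs hv)
        · rintro ⟨x, t⟩ ⟨⟨⟨v, hv, rfl⟩, -⟩, ht⟩
          rw [mem_src hs]
          simp only [Ψ.left_inv (hCs hv)]
          exact (sl_norm (c := 17/10) ht.1 hv.1.le (by rw [hw1]; norm_num)).trans_lt (by norm_num)
      refine hc.congr ?_
      rintro ⟨x, t⟩ ⟨⟨⟨v, hv, rfl⟩, -⟩, -⟩
      simp only [Ψ.left_inv (hCs hv)]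
      exact hGC v hv t
  · rintro x ⟨hx | ⟨v, hv, rfl⟩, -⟩
    · rw [hGU x hx, h2 x hx]
    · rw [hGC v hv]; simp [sl]
  · rintro x ⟨hx | ⟨v, hv, rfl⟩, -⟩
    · rw [hGU x hx, h3 x hx]
    · rw [hGC v hv]; simp [sl]
  · intro v hv hv1 hv2 t ht
    have hvC : v ∈ C := by
      rcases hv with hv | hv
      · exact absurd ⟨v, by simp; linarith, rfl⟩ (Set.disjoint_left.1 hUZ hv)
      · rwa [mem_cb hs (by linarith) hC2] at hv
    rw [hGC v hvC]
    refine ⟨rfl, fun h => ?_⟩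
    have hn : ‖sl w (v, t)‖ ≤ 11/10 := sl_norm ht.1 hv2 (by rw [hw1]; norm_num)
    have h0 := Ψ.injOn ((mem_src hs).2 (by linarith)) ((mem_src hs).2 (by simp)) h
    rw [hwd] at h0
    exact lin_ne_one hvC.2 (by have := ht.1; positivity) (min_le_left _ _) h0

theorem good_far {w : Eu n} {s : Eu n × ℝ → Eu n} {Y Y' : Set M} (hs : Ψ.source = Metric.ball 0 2) (hpu : IsPathConnected Y) (hw : Ψ w ∈ Y) {U : Set M} (hU : IsOpen U)
    (h : Ctr U Y) (hUZ : Disjoint U (Zc Ψ)) : Good Ψ ∅ s w U Y := by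
  obtain ⟨H, h1, h2, h3, h4⟩ := h.to hpu hw
  refine ⟨hU, ?_, H, h1.mono (prod_mono_left inter_subset_left), fun x hx => h2 x hx.1, fun x hx => h3 x hx.1,
    fun z hz => h4 ⟨hz.1.1, hz.2⟩, ?_⟩
  · rw [empty_inter, image_empty]
    exact Set.disjoint_iff_inter_eq_empty.1 (hUZ.mono_right Zo_subset_Zc)
  · intro v hv _ hv2
    exact absurd ⟨v, by simpa using hv2, rfl⟩ (Set.disjoint_left.1 hUZ hv)

theorem half_half (hs : Ψ.source = Metric.ball 0 2) (hpu : IsPathConnected (univ : Set M)) (i0 : Fin n) {k : ℕ} (hk : 1 ≤ k)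
    {U : Fin (k+1) → Set M} (hU : ∀ i, IsOpen (U i)) (hcov : ⋃ i, U i = univ) (hc : ∀ i, Ctr (U i) univ) :
    ∃ U' : Fin (k+1) → Set M, (∀ i : Fin (k+1), Good Ψ (sR i0 i) (sl (sw i0 i)) (sw i0 i) (U' i) univ) ∧ XX Ψ ⊆ ⋃ i, U' i := by
  obtain ⟨j, hj⟩ := mem_iUnion.1 (hcov.symm ▸ mem_univ (Ψ 0))
  set V : Fin (k+1) → Set M := fun i => U (Equiv.swap 0 j i) with hV
  have hV0 : Ψ 0 ∈ V 0 := by simpa [hV] using hj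
  have hVc : ∀ x, ∃ i, x ∈ V i := by
    intro x
    obtain ⟨i, hi⟩ := mem_iUnion.1 (hcov.symm ▸ mem_univ x)
    exact ⟨Equiv.swap 0 j i, by simpa [hV] using hi⟩
  have hVo : ∀ i, IsOpen (V i) := fun i => hU _
  have hVt : ∀ i, Ctr (V i) univ := fun i => hc _
  set D : Set M := Ψ '' Metric.closedBall 0 (18/10) with hD
  have hDc : IsClosed D := isClosed_cb hs (by norm_num)
  have hZD : Zc Ψ ⊆ D := image_mono (Metric.closedBall_subset_closedBall (by norm_num))
  set far : Fin (k+1) → Set M := fun i => sz Ψ ⁻¹' V i \ D with hfar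
  have f1 : ∀ i, IsOpen (far i) := fun i => ((hVo i).preimage (sz_cont hs)).sdiff hDc
  have f2 : ∀ i, Ctr (far i) univ := fun i => ((hVt i).squeeze hs).mono diff_subset subset_rfl
  have f3 : ∀ i, Disjoint (far i) D := fun i => disjoint_sdiff_left
  refine ⟨fun i => if (i:ℕ) = 0 then sz Ψ ⁻¹' V i \ Ψ '' {v | ‖v‖ ≤ 15/10 ∧ ‖v‖ / 2 ≤ v i0} else
    if (i:ℕ) = 1 then far i ∪ Ψ '' {v | ‖v‖ < 17/10 ∧ 0 < v i0} else far i, ?_, ?_⟩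
  · intro i
    by_cases h0 : (i:ℕ) = 0
    · have : i = 0 := Fin.ext h0
      subst this
      simp only [if_pos h0, h0]
      exact half_zero hs i0 (hVo 0) hV0 (hVt 0)
    by_cases h1 : (i:ℕ) = 1
    · simp only [if_neg h0, if_pos h1]
      rw [h1]
      exact half_far hs hpu i0 (f1 i) (f2 i) (f3 i)
    · simp only [if_neg h0, if_neg h1, sR]
      exact good_far (Y' := univ) hs hpu (mem_univ _) (f1 i) (f2 i) ((f3 i).mono_right hZD)
  · intro x hx
    by_cases hxD : x ∈ D
    · obtain ⟨v, hv, rfl⟩ := hxD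
      have hv' : ‖v‖ ≤ 18/10 := by simpa using hv
      have hv1 := (mem_XX_norm hs (by linarith)).1 hx
      by_cases hC : ‖v‖ ≤ 15/10 ∧ ‖v‖ / 2 ≤ v i0
      · refine mem_iUnion.2 ⟨⟨1, by omega⟩, ?_⟩
        simp only [one_ne_zero, if_true, if_false]
        exact Or.inr ⟨v, ⟨by linarith [hC.1], by linarith [hC.2]⟩, rfl⟩
      · refine mem_iUnion.2 ⟨0, ?_⟩
        simp only [Fin.val_zero, if_true]
        refine ⟨?_, ?_⟩
        · show sz Ψ (Ψ v) ∈ V 0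
          rw [sz_p hs hv']; exact hV0
        · rw [mem_cb hs (by linarith)]
          · exact hC
          · intro a ha
            have := ha.1; linarith
    · obtain ⟨i, hi⟩ := hVc (sz Ψ x)
      refine mem_iUnion.2 ⟨i, ?_⟩
      simp only
      split_ifs
      · refine ⟨hi, ?_⟩
        rintro ⟨v, hv, rfl⟩
        exact hxD ⟨v, by have := hv.1; simp; linarith, rfl⟩
      · exact Or.inl ⟨hi, hxD⟩
      · exact ⟨hi, hxD⟩
end
end CS

open scoped Topology
namespace CS
set_option linter.all false
open Set unitInterval
section
variable {n : ℕ} {M : Type*} [TopologicalSpace M]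

theorem mf_charted [T2Space M] [ChartedSpace (EuclideanSpace ℝ (Fin n)) M] : Mf n M := by
  intro x
  let χ := chartAt (EuclideanSpace ℝ (Fin n)) x
  have hx : x ∈ χ.source := mem_chart_source _ x
  let c : Fin n → ℝ := (χ x).ofLp
  let T : Set (Fin n → ℝ) := {y | WithLp.toLp 2 y ∈ χ.target}
  have hTo : IsOpen T := χ.open_target.preimage (by fun_prop : Continuous fun y : Fin n → ℝ => (WithLp.toLp 2 y : EuclideanSpace ℝ (Fin n)))
  have hcT : c ∈ T := χ.map_source hx
  obtain ⟨ε, hε, hb⟩ := Metric.nhds_basis_closedBall.mem_iff.1 (hTo.mem_nhds hcT)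
  let L : (Fin n → I) → (Fin n → ℝ) := fun u i => c i + ε * (2 * (u i : ℝ) - 1)
  have hLc : Continuous L := by fun_prop
  have hLT : ∀ u, L u ∈ T := fun u => hb (by
    rw [Metric.mem_closedBall, dist_pi_le_iff hε.le]
    intro i
    have := (u i).2
    simp only [L, Real.dist_eq, add_sub_cancel_left]
    rw [abs_mul, abs_of_pos hε]
    have h2 : |2 * (u i : ℝ) - 1| ≤ 1 := abs_le.2 ⟨by linarith [this.1], by linarith [this.2]⟩
    nlinarith)
  have hLi : Function.Injective L := by
    intro u v h
    ext i
    have := congrFun h i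
    simp only [L] at this
    have h2 : ε * (2 * (u i : ℝ) - 1) = ε * (2 * (v i : ℝ) - 1) := by linarith
    have := mul_left_cancel₀ hε.ne' h2
    linarith
  have hLo : L '' oc n = Metric.ball c ε ∩ {y | ∀ i, dist (y i) (c i) < ε} := by
    ext y; constructor
    · rintro ⟨u, hu, rfl⟩
      have : ∀ i, dist (L u i) (c i) < ε := by
        intro i
        have h := hu i
        have h1 : (0:ℝ) < u i := h.1
        have h2 : (u i : ℝ) < 1 := h.2
        simp only [L, Real.dist_eq, add_sub_cancel_left]
        rw [abs_mul, abs_of_pos hε]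
        have h2 : |2 * (u i : ℝ) - 1| < 1 := abs_lt.2 ⟨by linarith, by linarith⟩
        nlinarith
      exact ⟨by rw [Metric.mem_ball, dist_pi_lt_iff hε]; exact this, this⟩
    · rintro ⟨-, h⟩
      have h' : ∀ i, -ε < y i - c i ∧ y i - c i < ε := fun i => abs_lt.1 (h i)
      have h3 : ∀ i, (0:ℝ) < ((y i - c i) / ε + 1) / 2 ∧ ((y i - c i) / ε + 1) / 2 < 1 := by
        intro i
        have e1 : -1 < (y i - c i) / ε := by rw [lt_div_iff₀ hε]; linarith [(h' i).1]
        have e2 : (y i - c i) / ε < 1 := by rw [div_lt_iff₀ hε]; linarith [(h' i).2]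
        constructor <;> linarith
      refine ⟨fun i => ⟨((y i - c i) / ε + 1) / 2, (h3 i).1.le, (h3 i).2.le⟩, fun i => ⟨(h3 i).1, (h3 i).2⟩, ?_⟩
      ext i
      simp only [L]
      field_simp
      ring
  have hLop : IsOpen (L '' oc n) := by
    rw [hLo]
    have : {y : Fin n → ℝ | ∀ i, dist (y i) (c i) < ε} = ⋂ i, {y | dist (y i) (c i) < ε} := by ext; simp
    rw [this]
    exact Metric.isOpen_ball.inter (isOpen_iInter_of_finite fun i => isOpen_lt (by fun_prop) (by fun_prop))
  refine ⟨fun u => χ.symm (WithLp.toLp 2 (L u)), ⟨?_, ?_, ?_⟩, ?_⟩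
  · exact χ.continuousOn_symm.comp_continuous (by fun_prop) hLT
  · intro u v h
    have := χ.symm.injOn (hLT u) (hLT v) h
    exact hLi (by simpa using this)
  · have : (fun u => χ.symm (WithLp.toLp 2 (L u))) '' oc n = χ.symm '' ((WithLp.ofLp : EuclideanSpace ℝ (Fin n) → _) ⁻¹' (L '' oc n)) := by
      ext z; constructor
      · rintro ⟨u, hu, rfl⟩
        exact ⟨_, ⟨u, hu, rfl⟩, rfl⟩
      · rintro ⟨y, ⟨u, hu, hy⟩, rfl⟩
        refine ⟨u, hu, ?_⟩
        simp only [hy]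
    rw [this]
    refine χ.symm.isOpen_image_of_subset_source (hLop.preimage (by fun_prop)) ?_
    rintro y ⟨u, hu, hy⟩
    have := hLT u
    rw [hy] at this
    exact this
  · refine ⟨fun _ => ⟨1/2, by constructor <;> norm_num⟩, fun i => ⟨?_, ?_⟩, ?_⟩
    · rw [← Subtype.coe_lt_coe]; norm_num
    · rw [← Subtype.coe_lt_coe]; norm_num
    · have : L (fun _ => ⟨1/2, by constructor <;> norm_num⟩) = c := by
        ext i; simp [L]
      simp only [this]
      exact χ.left_inv hx

theorem Mf.lpc [T2Space M] (hM : Mf n M) : LocallyPathConnectedSpace M := by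
  refine ⟨fun x => ⟨fun t => ?_⟩⟩
  constructor
  · intro ht
    obtain ⟨O, hOt, hO, hx⟩ := mem_nhds_iff.1 ht
    obtain ⟨φ, hφ, h1, h2⟩ := hM.small' hO hx
    haveI : PathConnectedSpace I := isPathConnected_iff_pathConnectedSpace.1 ((convex_Icc (0:ℝ) 1).isPathConnected ⟨0, by simp⟩)
    refine ⟨range φ, ⟨Filter.mem_of_superset (hφ.op.mem_nhds h1) (image_subset_range _ _), ?_⟩, h2.trans hOt⟩
    exact isPathConnected_range hφ.cont
  · rintro ⟨s, ⟨h1, -⟩, h2⟩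
    exact Filter.mem_of_superset h1 h2

theorem Mf.pc [T2Space M] [ConnectedSpace M] (hM : Mf n M) : IsPathConnected (univ : Set M) := by
  haveI := hM.lpc
  exact isOpen_univ.isConnected_iff_isPathConnected.1 isConnected_univ

theorem compl_pc [T2Space M] [CompactSpace M] [ConnectedSpace M] (hM : Mf n M) (hn : 1 ≤ n) {Ψ : OpenPartialHomeomorph (Eu n) M}
    (hs : Ψ.source = Metric.ball 0 2) : IsPathConnected ({Ψ 0}ᶜ : Set M) := by
  haveI := hM.lpc
  refine isOpen_compl_singleton.isConnected_iff_isPathConnected.1 ⟨?_, ?_⟩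
  · refine ⟨Ψ (dv ⟨0, hn⟩), fun h => ?_⟩
    have h1 : ‖dv (⟨0, hn⟩ : Fin n)‖ = 1 := by
      have := norm_sw (⟨0, hn⟩ : Fin n) 1
      rwa [sw, if_neg (by norm_num)] at this
    have := Ψ.injOn ((mem_src hs).2 (by rw [h1]; norm_num)) ((mem_src hs).2 (by simp)) h
    rw [this] at h1; simp at h1
  rcases Nat.lt_or_ge 1 n with hn2 | hn2
  swap
  · obtain rfl : n = 1 := le_antisymm hn2 hn
    exact preconn_one hM _
  have hB : IsPreconnected (Ψ '' (Metric.ball 0 2 \ {0})) := by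
    have h0 : IsPreconnected (Metric.ball (0 : Eu n) 2 \ {0}) := by
      have hr : 1 < Module.rank ℝ (Eu n) := by
        rw [← Module.finrank_eq_rank, finrank_euclideanSpace_fin]; exact_mod_cast hn2
      have h1 := (isConnected_compl_singleton_of_one_lt_rank hr (0 : Eu n)).isPreconnected
      have h2 := h1.image (fun v : Eu n => (2 / (1 + ‖v‖)) • v) (Continuous.continuousOn (by
        refine Continuous.smul (continuous_const.div (continuous_const.add continuous_norm) (fun v => (by positivity : (0:ℝ) < 1 + ‖v‖).ne')) continuous_id))
      convert h2 using 1
      ext v; constructor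
      · rintro ⟨hv, hv0⟩
        have hv' : ‖v‖ < 2 := by simpa using hv
        have hp : 0 < 2 - ‖v‖ := by linarith
        refine ⟨(1 / (2 - ‖v‖)) • v, ?_, ?_⟩
        · simp only [mem_compl_iff, mem_singleton_iff] at hv0 ⊢
          simp [hv0, hp.ne']
        · simp only [norm_smul, norm_div, norm_one, Real.norm_eq_abs, abs_of_pos hp, smul_smul]
          have : 2 / (1 + 1 / (2 - ‖v‖) * ‖v‖) * (1 / (2 - ‖v‖)) = 1 := by
            field_simp; ring
          rw [this, one_smul]
      · rintro ⟨u, hu, rfl⟩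
        have hu' : u ≠ 0 := hu
        have h0 : 0 < ‖u‖ := norm_pos_iff.2 hu'
        refine ⟨?_, ?_⟩
        · simp only [mem_ball_zero_iff, norm_smul, norm_div, Real.norm_eq_abs, abs_of_pos (by positivity : 0 < 1 + ‖u‖)]
          rw [abs_of_pos two_pos, div_mul_eq_mul_div, div_lt_iff₀ (by positivity)]
          linarith
        · have : 2 / (1 + ‖u‖) ≠ 0 := by positivity
          simp [hu', this]
    exact h0.image _ (Ψ.continuousOn.mono (by rw [hs]; exact diff_subset))
  have hBo : IsOpen (Ψ '' Metric.ball 0 2) := Ψ.isOpen_image_of_subset_source Metric.isOpen_ball hs.ge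
  have key : ∀ A B : Set M, IsOpen A → IsOpen B → {Ψ 0}ᶜ ⊆ A ∪ B → {Ψ 0}ᶜ ∩ (A ∩ B) = ∅ → Ψ '' (Metric.ball 0 2 \ {0}) ⊆ A →
      {Ψ 0}ᶜ ⊆ A := by
    intro A B hA hB' hc hd hs'
    have hu : univ ⊆ A ∪ Ψ '' Metric.ball 0 2 ∨ univ ⊆ B \ {Ψ 0} := by
      have hpre : IsPreconnected (univ : Set M) := isPreconnected_univ
      rw [isPreconnected_iff_subset_of_disjoint] at hpre
      refine hpre _ _ (hA.union hBo) (hB'.sdiff isClosed_singleton) ?_ ?_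
      · intro x _
        by_cases hx : x = Ψ 0
        · exact Or.inl (Or.inr ⟨0, by simp, hx.symm⟩)
        · rcases hc hx with h | h
          · exact Or.inl (Or.inl h)
          · exact Or.inr ⟨h, hx⟩
      · rw [eq_empty_iff_forall_notMem]
        rintro x ⟨-, h1, h2, h3⟩
        have hxA : x ∈ A := by
          rcases h1 with h1 | ⟨v, hv, rfl⟩
          · exact h1
          · exact hs' ⟨v, ⟨hv, fun h => h3 (by rw [mem_singleton_iff.1 h]; rfl)⟩, rfl⟩
        exact eq_empty_iff_forall_notMem.1 hd x ⟨h3, hxA, h2⟩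
    rcases hu with h | h
    · intro x hx
      rcases h (mem_univ x) with h1 | ⟨v, hv, rfl⟩
      · exact h1
      · exact hs' ⟨v, ⟨hv, fun h => hx (by rw [mem_singleton_iff.1 h]; rfl)⟩, rfl⟩
    · exact absurd rfl (h (mem_univ (Ψ 0))).2
  have hsub : Ψ '' (Metric.ball 0 2 \ {0}) ⊆ {Ψ 0}ᶜ := by
    rintro _ ⟨v, ⟨hv, hv0⟩, rfl⟩ h
    exact hv0 (Ψ.injOn (hs.ge hv) (hs.ge (by simp)) h)
  rw [isPreconnected_iff_subset_of_disjoint]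
  intro A B hA hB' hc hd
  rw [isPreconnected_iff_subset_of_disjoint] at hB
  rcases hB A B hA hB' (hsub.trans hc) (by
    rw [eq_empty_iff_forall_notMem] at hd ⊢
    exact fun x hx => hd x ⟨hsub hx.1, hx.2⟩) with h | h
  · exact Or.inl (key A B hA hB' hc hd h)
  · exact Or.inr (key B A hB' hA (by rwa [union_comm]) (by rwa [inter_comm B A]) h)

theorem ctr_of_null {U : Set M} (h : ContinuousMap.Nullhomotopic (⟨Subtype.val, continuous_subtype_val⟩ : C(U, M))) : Ctr U univ := by
  classical
  obtain ⟨y, ⟨F⟩⟩ := h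
  refine ⟨fun z => if h : z.1 ∈ U then F (projIcc 0 1 zero_le_one z.2, ⟨z.1, h⟩) else z.1, y, ?_, ?_, ?_, fun _ _ => mem_univ _⟩
  · rw [continuousOn_iff_continuous_domRestrict]
    have : Continuous (fun z : ↥(U ×ˢ Icc (0:ℝ) 1) => F (projIcc 0 1 zero_le_one z.1.2, ⟨z.1.1, z.2.1⟩)) := by
      refine F.continuous.comp (Continuous.prodMk ?_ ?_)
      · exact continuous_projIcc.comp (by fun_prop)
      · fun_prop
    convert this using 1
    ext z
    exact dif_pos z.2.1
  · intro x hx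
    simp only [dif_pos hx, projIcc_left]
    exact F.apply_zero _
  · intro x hx
    simp only [dif_pos hx, projIcc_right]
    exact F.apply_one _

theorem null_of_ctr {U : Set M} (h : Ctr U univ) : ContinuousMap.Nullhomotopic (⟨Subtype.val, continuous_subtype_val⟩ : C(U, M)) := by
  obtain ⟨H, q, h1, h2, h3, -⟩ := h
  refine ⟨q, ⟨⟨⟨fun z => H (z.2.1, z.1), ?_⟩, ?_, ?_⟩⟩⟩
  · exact h1.comp_continuous (by fun_prop) (fun z => ⟨z.2.2, z.1.2⟩)
  · intro x; exact h2 _ x.2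
  · intro x; exact h3 _ x.2

theorem cat_cover [T2Space M] [CompactSpace M] [ConnectedSpace M] (hM : Mf n M) {k : ℕ} (hk : lsCat M ≤ k) :
    ∃ U : Fin (k+1) → Set M, (∀ i, IsOpen (U i)) ∧ ⋃ i, U i = univ ∧ ∀ i, Ctr (U i) univ := by
  have hne : {k : ℕ | ∃ U : Fin (k + 1) → Set M, (∀ i, IsOpen (U i)) ∧ (⋃ i, U i) = Set.univ ∧
    ∀ i, ContinuousMap.Nullhomotopic (⟨Subtype.val, continuous_subtype_val⟩ : C(U i, M))}.Nonempty := by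
    obtain ⟨m, φ, h1, h2⟩ := cell_cover hM isCompact_univ isOpen_univ subset_rfl
    have hm : 0 < m := by
      obtain ⟨a, -⟩ := mem_iUnion.1 (h2 (mem_univ (Classical.arbitrary M)))
      exact a.pos
    obtain ⟨k, rfl⟩ : ∃ k, m = k + 1 := ⟨m - 1, by omega⟩
    refine ⟨k, fun a => φ a '' oc n, fun a => (h1 a).1.op, univ_subset_iff.1 h2, fun a => null_of_ctr ?_⟩
    exact ((h1 a).1.ctr (subset_univ _)).mono (image_subset_range _ _) subset_rfl
  obtain ⟨U, h1, h2, h3⟩ := Nat.sInf_mem hne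
  refine ⟨fun i => U ⟨min i (lsCat M), by unfold lsCat; omega⟩, fun i => h1 _, ?_, fun i => ctr_of_null (h3 _)⟩
  rw [eq_univ_iff_forall]
  intro x
  obtain ⟨i, hi⟩ := mem_iUnion.1 (h2.symm ▸ mem_univ x : x ∈ ⋃ i, U i)
  have hi2 : (i:ℕ) ≤ lsCat M := by have := i.2; unfold lsCat; omega
  refine mem_iUnion.2 ⟨⟨i, by omega⟩, ?_⟩
  convert hi using 2
  ext
  simpa using hi2

theorem cat_pos [T2Space M] [CompactSpace M] [ConnectedSpace M] (hM : Mf n M) (hn : n ≠ 0) : 1 ≤ lsCat M := by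
  by_contra hc
  obtain ⟨U, h1, h2, h3⟩ := cat_cover hM (k := 0) (by omega)
  have hU : U 0 = univ := by
    rw [← h2]; ext x; simp
  obtain ⟨H, q, a1, a2, a3, -⟩ := h3 0
  rw [hU] at a1 a2 a3
  refine not_contractible hn hM (H := fun z => H (z.1, projIcc (0:ℝ) 1 zero_le_one z.2)) (q := q) ?_ ?_ ?_
  · refine a1.comp_continuous ?_ (fun z => ⟨mem_univ _, Subtype.coe_prop _⟩)
    exact continuous_fst.prodMk (continuous_subtype_val.comp (continuous_projIcc.comp continuous_snd))
  · intro x; simp [a2]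
  · intro x; simp [a3]

theorem exists_psi {e : ↥(Metric.ball (0 : EuclideanSpace ℝ (Fin n)) 2) → M} (he : Topology.IsOpenEmbedding e) :
    ∃ Ψ : OpenPartialHomeomorph (Eu n) M, Ψ.source = Metric.ball 0 2 ∧ ∀ x : ↥(Metric.ball (0 : EuclideanSpace ℝ (Fin n)) 2), Ψ x = e x := by
  have hz : (0 : EuclideanSpace ℝ (Fin n)) ∈ Metric.ball 0 2 := by simp
  haveI : Nonempty ↥(Metric.ball (0 : EuclideanSpace ℝ (Fin n)) 2) := ⟨⟨0, hz⟩⟩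
  have hv : Topology.IsOpenEmbedding (Subtype.val : ↥(Metric.ball (0 : EuclideanSpace ℝ (Fin n)) 2) → _) := Metric.isOpen_ball.isOpenEmbedding_subtypeVal
  refine ⟨(hv.toOpenPartialHomeomorph _).symm.trans (he.toOpenPartialHomeomorph _), ?_, ?_⟩
  · ext x; simp
  · intro x
    have := hv.toOpenPartialHomeomorph_left_inv (x := x)
    simp only [OpenPartialHomeomorph.coe_trans, Function.comp]
    rw [this]; rfl

theorem final_zero_aux {X : Type*} [TopologicalSpace X] [T2Space X] [ConnectedSpace X] {f : ↥(Metric.ball (0 : EuclideanSpace ℝ (Fin 0)) 2) → X}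
      (hf : Topology.IsOpenEmbedding f) : IsEmpty { m : X // m ∉ interior (imageClosedUnitBall f) } := by
    obtain ⟨Ψ, hs, hΨ⟩ := exists_psi hf
    refine ⟨fun m => ?_⟩
    have h1 := (interior_D f hs hΨ m.1).1 m.2
    have h2 : Ψ '' Metric.ball 0 1 = {Ψ 0} := by
      ext x; constructor
      · rintro ⟨v, -, rfl⟩; rw [Subsingleton.elim v 0]; rfl
      · intro h; exact ⟨0, by simp, h.symm⟩
    have h3 : IsClopen ({Ψ 0} : Set X) := ⟨isClosed_singleton, by
      rw [← h2]; exact Ψ.isOpen_image_of_subset_source Metric.isOpen_ball (by rw [hs]; exact Metric.ball_subset_ball (by norm_num))⟩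
    have h4 := h3.eq_univ ⟨_, rfl⟩
    rw [XX, h2, h4] at h1
    exact h1 (mem_univ _)

theorem final_zero [T2Space M] [ConnectedSpace M] {N : Type*} [TopologicalSpace N] [T2Space N] [ConnectedSpace N]
    {e : ↥(Metric.ball (0 : EuclideanSpace ℝ (Fin 0)) 2) → M} {e' : ↥(Metric.ball (0 : EuclideanSpace ℝ (Fin 0)) 2) → N}
    (he : Topology.IsOpenEmbedding e) (he' : Topology.IsOpenEmbedding e') : lsCat (ConnectedSum e e') = 0 := by
  haveI := final_zero_aux he
  haveI := final_zero_aux he'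
  haveI : IsEmpty (ConnectedSum e e') := ⟨fun x => Quot.ind (β := fun _ => False) (fun a => isEmptyElim a) x⟩
  unfold lsCat
  rw [Nat.sInf_eq_zero]
  right
  rw [eq_empty_iff_forall_notMem]
  rintro k ⟨U, -, -, h⟩
  obtain ⟨y, -⟩ := h 0
  exact isEmptyElim y
end
end CS

open scoped Topology
namespace CS
set_option linter.all false
open Set unitInterval
section
variable {n : ℕ} {M : Type*} [TopologicalSpace M] [T2Space M] {Ψ : OpenPartialHomeomorph (Eu n) M}

/-- a star shaped cap is good -/
theorem good_cap (hs : Ψ.source = Metric.ball 0 2) {C R : Set (Eu n)} {w : Eu n} (hw : ‖w‖ = 1) (hC : IsOpen C)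
    (hCb : ∀ v ∈ C, ‖v‖ < 2) (hR : C ∩ Metric.ball 0 (11/10) = R ∩ Metric.ball 0 (11/10))
    (hl : ∀ v ∈ C, ∀ t : ℝ, 0 ≤ t → t ≤ 1 → (1 - t) • v + t • w ≠ 0) :
    Good Ψ R (sl w) w (Ψ '' C) {Ψ 0}ᶜ := by
  have hCs : C ⊆ Ψ.source := fun v hv => (mem_src hs).2 (hCb v hv)
  have slc : Continuous (sl w) := by unfold sl; fun_prop
  have hne : ∀ v ∈ C, ∀ t ∈ Icc (0:ℝ) 1, Ψ (sl w (v, t)) ≠ Ψ 0 := by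
    intro v hv t ht h
    have h1 : ‖sl w (v, t)‖ < 2 := lt_of_le_of_lt
      (sl_norm ht.1 (le_max_left ‖v‖ 1) (by rw [hw]; exact le_max_right _ _)) (max_lt (hCb v hv) (by norm_num))
    have := Ψ.injOn ((mem_src hs).2 h1) ((mem_src hs).2 (by simp)) h
    exact hl v hv _ (le_min zero_le_one (by linarith [ht.1])) (min_le_left _ _) this
  have hG : ∀ v ∈ C, ∀ t, Ψ (sl w (Ψ.symm (Ψ v), t)) = Ψ (sl w (v, t)) := fun v hv t => by rw [Ψ.left_inv (hCs hv)]
  refine ⟨Ψ.isOpen_image_of_subset_source hC hCs, ?_, fun z => Ψ (sl w (Ψ.symm z.1, z.2)), ?_, ?_, ?_, ?_, ?_⟩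
  · rw [← hR, Zo]
    ext x; constructor
    · rintro ⟨⟨v, hv, rfl⟩, u, hu, he⟩
      have hu2 : ‖u‖ < 2 := lt_trans (by simpa using hu) (by norm_num)
      obtain rfl := Ψ.injOn ((mem_src hs).2 hu2) (hCs hv) he
      exact ⟨u, ⟨hv, hu⟩, rfl⟩
    · rintro ⟨v, ⟨h1, h2⟩, rfl⟩
      exact ⟨⟨v, h1, rfl⟩, v, h2, rfl⟩
  · have : ContinuousOn (fun z : M × ℝ => sl w (Ψ.symm z.1, z.2)) ((Ψ '' C ∩ XX Ψ) ×ˢ Icc 0 1) := by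
      refine slc.comp_continuousOn (ContinuousOn.prodMk ?_ continuousOn_snd)
      refine Ψ.continuousOn_symm.comp continuousOn_fst ?_
      rintro ⟨_, t⟩ ⟨⟨⟨v, hv, rfl⟩, -⟩, -⟩
      exact Ψ.map_source (hCs hv)
    refine Ψ.continuousOn.comp this ?_
    rintro ⟨_, t⟩ ⟨⟨⟨v, hv, rfl⟩, -⟩, ht⟩
    simp only [Ψ.left_inv (hCs hv)]
    exact (mem_src hs).2 (lt_of_le_of_lt
      (sl_norm ht.1 (le_max_left ‖v‖ 1) (by rw [hw]; exact le_max_right _ _)) (max_lt (hCb v hv) (by norm_num)))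
  · rintro _ ⟨⟨v, hv, rfl⟩, -⟩
    simp only [hG v hv]; simp [sl]
  · rintro _ ⟨⟨v, hv, rfl⟩, -⟩
    simp only [hG v hv]; simp [sl]
  · rintro ⟨_, t⟩ ⟨⟨⟨v, hv, rfl⟩, -⟩, ht⟩
    simp only [hG v hv]
    exact hne v hv t ht
  · intro v hv h1 h2 t ht
    obtain ⟨u, hu, he⟩ := hv
    obtain rfl := Ψ.injOn (hCs hu) ((mem_src hs).2 (by linarith)) he
    simp only [hG u hu]
    exact ⟨trivial, hne u hu t ht⟩
end

theorem norm_one_dim (v : Eu 1) : ‖v‖ = |v 0| := by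
  rw [EuclideanSpace.norm_eq]; simp [Real.sqrt_sq_eq_abs]

theorem eu_one_fin (c : ℝ) : {v : Eu 1 | ‖v‖ = c}.Finite := by
  refine Set.Finite.subset (Set.toFinite {WithLp.toLp 2 (fun _ => c), WithLp.toLp 2 (fun _ => -c)}) ?_
  intro v hv
  have h : |v 0| = c := by rw [← norm_one_dim]; exact hv
  rcases abs_choice (v 0) with h1 | h1
  · left; ext i; fin_cases i; simp; linarith
  · right; rw [mem_singleton_iff]; ext i; fin_cases i; simp; linarith

theorem bd_one_fin {M : Type*} (φ : (Fin 1 → I) → M) : (bd φ).Finite := by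
  refine Set.Finite.image _ (Set.Finite.subset (Set.toFinite {0, 1}) ?_)
  intro u hu
  by_contra h
  apply hu
  simp only [mem_insert_iff, mem_singleton_iff, not_or] at h
  intro i
  fin_cases i
  refine ⟨lt_of_le_of_ne (u 0).2.1 fun h1 => h.1 ?_, lt_of_le_of_ne (u 0).2.2 fun h1 => h.2 ?_⟩
  · ext i; fin_cases i; simpa using h1.symm
  · ext i; fin_cases i; simpa using h1

theorem one_dim {M : Type*} [TopologicalSpace M] [T2Space M] [CompactSpace M] (hM : Mf 1 M) {Ψ : OpenPartialHomeomorph (Eu 1) M}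
    (hs : Ψ.source = Metric.ball 0 2) (hpc : IsPathConnected ({Ψ 0}ᶜ : Set M)) {k : ℕ} (hk : 1 ≤ k) :
    ∃ U' : Fin (k+1) → Set M, (∀ i : Fin (k+1), Good Ψ (sR 0 i) (sl (sw 0 i)) (sw 0 i) (U' i) {Ψ 0}ᶜ) ∧
      XX Ψ ⊆ ⋃ i, U' i := by
  classical
  haveI : Nonempty M := ⟨Ψ 0⟩
  have hcbs : ∀ r : ℝ, r < 2 → Metric.closedBall (0 : Eu 1) r ⊆ Ψ.source := fun r hr => by
    rw [hs]; exact Metric.closedBall_subset_ball hr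
  set D : ℝ → Set M := fun r => Ψ '' Metric.closedBall 0 r with hD
  have hDc : ∀ r, r < 2 → IsClosed (D r) := fun r hr => isClosed_cb hs hr
  have hDm : ∀ r v, r < 2 → ‖v‖ < 2 → (Ψ v ∈ D r ↔ ‖v‖ ≤ r) := fun r v hr hv => by
    rw [hD, mem_cb hs hv (by intro a ha; exact lt_of_le_of_lt (by simpa using ha) hr)]; simp
  set W : Set M := (D (135/100))ᶜ with hW
  have hWo : IsOpen W := (hDc _ (by norm_num)).isOpen_compl
  have hpD : ∀ r, 0 ≤ r → Ψ 0 ∈ D r := fun r hr => ⟨0, by simpa using hr, rfl⟩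
  have hWp : W ⊆ {Ψ 0}ᶜ := by
    intro x hx h
    rw [mem_singleton_iff.1 h] at hx
    exact hx (hpD _ (by norm_num))
  have hWZ : Disjoint W (Zc Ψ) := by
    rw [Set.disjoint_left]
    rintro x hx ⟨v, hv, rfl⟩
    exact hx ⟨v, Metric.closedBall_subset_closedBall (by norm_num) hv, rfl⟩
  set K : Set M := XX Ψ \ Ψ '' Metric.ball 0 (15/10) with hK
  have hKc : IsCompact K := ((isClosed_XX hs).sdiff (Ψ.isOpen_image_of_subset_source Metric.isOpen_ball
    (by rw [hs]; exact Metric.ball_subset_ball (by norm_num)))).isCompact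
  have hKW : K ⊆ W := by
    rintro x ⟨h1, h2⟩ ⟨v, hv, rfl⟩
    exact h2 ⟨v, by simp at hv ⊢; linarith, rfl⟩

  obtain ⟨m, φ, h1, h2⟩ := cell_cover hM hKc hWo hKW
  have hBx : ∀ a, Bx 1 (φ a) := fun a => (h1 a).1
  set S : Set M := Ψ '' {v | ‖v‖ = 15/10} ∪ ⋃ a, bd (φ a) with hS
  have hSf : S.Finite := ((eu_one_fin _).image _).union (Set.finite_iUnion fun a => bd_one_fin _)
  have hSW : S ⊆ W := by
    rintro x (⟨v, hv, rfl⟩ | hx)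
    · have hv' : ‖v‖ = 15/10 := hv
      show Ψ v ∉ D _
      rw [hDm _ _ (by norm_num) (by rw [hv']; norm_num), hv']; norm_num
    · obtain ⟨a, ha⟩ := mem_iUnion.1 hx
      exact (h1 a).2 (image_subset_range _ _ ha)
  -- color 0
  set C0 : Set (Eu 1) := {v | ‖v‖ < 15/10 ∧ v 0 < 0} with hC0
  have hC0o : IsOpen C0 := (isOpen_lt (f := fun v : Eu 1 => ‖v‖) (g := fun _ => (15/10:ℝ)) (by fun_prop) (by fun_prop)).inter
      (isOpen_lt (f := fun v : Eu 1 => v 0) (g := fun _ => (0:ℝ)) (by fun_prop) (by fun_prop))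
  have hR0 : ∀ v : Eu 1, v ∈ sR 0 0 ↔ v 0 < 0 := by
    intro v
    simp only [sR, if_true, mem_setOf_eq, norm_one_dim]
    rcases abs_cases (v 0) with h | h <;> constructor <;> intro h' <;> linarith [h.1, h.2]
  have g0 : Good Ψ (sR 0 0) (sl (sw 0 0)) (sw 0 0) (Ψ '' C0) {Ψ 0}ᶜ := by
    refine good_cap hs (norm_sw _ _) hC0o (fun v hv => by linarith [hv.1]) ?_ ?_
    · ext v
      constructor
      · rintro ⟨h, h'⟩; exact ⟨(hR0 v).2 h.2, h'⟩
      · rintro ⟨h, h'⟩; exact ⟨⟨by simp at h'; linarith, (hR0 v).1 h⟩, h'⟩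
    · intro v hv t ht0 ht1
      have := lin_ne_zero (i0 := 0) ((hR0 v).2 hv.2) ht0 ht1
      simpa [sw] using this
  set C2 : Set (Eu 1) := {v | ‖v‖ < 15/10 ∧ 12/10 < v 0} with hC2
  have hC2o : IsOpen C2 := (isOpen_lt (f := fun v : Eu 1 => ‖v‖) (g := fun _ => (15/10:ℝ)) (by fun_prop) (by fun_prop)).inter
      (isOpen_lt (f := fun _ => (12/10:ℝ)) (g := fun v : Eu 1 => v 0) (by fun_prop) (by fun_prop))
  have hC2n : ∀ v ∈ C2, 12/10 < ‖v‖ := fun v hv => by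
    rw [norm_one_dim]; exact lt_of_lt_of_le hv.2 (le_abs_self _)
  set C1 : Set (Eu 1) := {v | ‖v‖ < 13/10 ∧ 0 < v 0} with hC1
  have hC1o : IsOpen C1 := (isOpen_lt (f := fun v : Eu 1 => ‖v‖) (g := fun _ => (13/10:ℝ)) (by fun_prop) (by fun_prop)).inter
      (isOpen_lt (f := fun _ => (0:ℝ)) (g := fun v : Eu 1 => v 0) (by fun_prop) (by fun_prop))
  have hwp : ∀ i, Ψ (sw 0 i) ∈ ({Ψ 0}ᶜ : Set M) := fun i h => by
    have h1 := norm_sw (0 : Fin 1) i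
    have := Ψ.injOn ((mem_src hs).2 (by rw [h1]; norm_num)) ((mem_src hs).2 (by simp)) h
    rw [this] at h1; simp at h1
  -- the cap C2 contracts off p
  have ctr2 : Ctr (Ψ '' C2) {Ψ 0}ᶜ := by
    have hC2s : C2 ⊆ Ψ.source := fun v hv => (mem_src hs).2 (by linarith [hv.1])
    set w : Eu 1 := sw 0 1 with hw
    have hw0 : w 0 = 1 := by rw [hw, sw, if_neg (by norm_num), dv_apply]
    have hn : ∀ v ∈ C2, ∀ t ∈ Icc (0:ℝ) 1, ‖(1 - t) • v + t • w‖ < 2 := fun v hv t ht =>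
      lt_of_le_of_lt (lin_norm ht.1 ht.2 (le_max_left ‖v‖ 1) (by rw [norm_sw]; exact le_max_right _ _)) (max_lt (by linarith [hv.1]) (by norm_num))
    refine ⟨fun z => Ψ ((1 - z.2) • Ψ.symm z.1 + z.2 • w), Ψ w, ?_, ?_, ?_, ?_⟩
    · refine Ψ.continuousOn.comp (t := Ψ.source) ?_ ?_
      · have : ContinuousOn (fun z : M × ℝ => Ψ.symm z.1) ((Ψ '' C2) ×ˢ Icc 0 1) := by
          refine Ψ.continuousOn_symm.comp continuousOn_fst ?_
          rintro ⟨_, t⟩ ⟨⟨v, hv, rfl⟩, -⟩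
          exact Ψ.map_source (hC2s hv)
        fun_prop
      · rintro ⟨_, t⟩ ⟨⟨v, hv, rfl⟩, ht⟩
        simp only [Ψ.left_inv (hC2s hv)]
        exact (mem_src hs).2 (hn v hv t ht)
    · rintro _ ⟨v, hv, rfl⟩
      simp [Ψ.left_inv (hC2s hv)]
    · rintro _ ⟨v, hv, rfl⟩
      simp
    · rintro ⟨_, t⟩ ⟨⟨v, hv, rfl⟩, ht⟩ h
      simp only [Ψ.left_inv (hC2s hv)] at h
      have h0 := Ψ.injOn ((mem_src hs).2 (hn v hv t ht)) ((mem_src hs).2 (by simp)) h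
      have := lin_ne_one (i0 := 0) (v := v) (by linarith [hv.2]) ht.1 ht.2
      apply this
      rw [hw, sw, if_neg (by norm_num)] at h0
      exact h0
  set V0 : Option (Fin m) → Set M := fun o => o.elim (Ψ '' C2) (fun a => pc φ a \ D (15/10)) with hV0
  have hcapD : ∀ v, ‖v‖ < 15/10 → Ψ v ∈ D (15/10) := fun v hv => ⟨v, by simpa using hv.le, rfl⟩
  have hDd : ∀ a (A : Set (Eu 1)), (∀ v ∈ A, ‖v‖ < 15/10) → Disjoint (Ψ '' A) (pc φ a \ D (15/10)) := by
    intro a A hA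
    rw [Set.disjoint_left]
    rintro _ ⟨v, hv, rfl⟩ h
    exact h.2 (hcapD v (hA v hv))
  have hpcW : ∀ a, pc φ a ⊆ W := fun a => ((pc_subset a).trans (image_subset_range _ _)).trans (h1 a).2
  have G0 := g0.add (V := V0) (Y' := {Ψ 0}ᶜ) (by
      rintro (_ | a)
      · exact Ψ.isOpen_image_of_subset_source hC2o (fun v hv => (mem_src hs).2 (by linarith [hv.1]))
      · exact (isOpen_pc hBx a).sdiff (hDc _ (by norm_num))) (by
      rintro (_ | a) (_ | b) hab
      · exact absurd rfl hab
      · exact hDd b C2 (fun v hv => hv.1)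
      · exact (hDd a C2 (fun v hv => hv.1)).symm
      · exact (pc_disj a b (fun h => hab (by rw [h]))).mono diff_subset diff_subset) (by
      rintro (_ | a)
      · rw [Set.disjoint_left]
        rintro _ ⟨v, hv, rfl⟩ ⟨u, hu, he⟩
        obtain rfl := Ψ.injOn ((mem_src hs).2 (by linarith [hu.1])) ((mem_src hs).2 (by linarith [hv.1])) he
        linarith [hv.2, hu.2]
      · exact hDd a C0 (fun v hv => hv.1)) (by
      rintro (_ | a)
      · rw [Set.disjoint_left]
        rintro _ ⟨v, hv, rfl⟩ ⟨u, hu, he⟩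
        have hu' : ‖u‖ ≤ 11/10 := by simpa using hu
        obtain rfl := Ψ.injOn ((mem_src hs).2 (by linarith)) ((mem_src hs).2 (by linarith [hv.1])) he
        linarith [hC2n _ hv]
      · exact hWZ.mono_left (diff_subset.trans (hpcW a))) subset_rfl hpc (hwp 0) (by
      rintro (_ | a)
      · exact ctr2
      · exact ((hBx a).ctr ((h1 a).2.trans hWp)).mono (diff_subset.trans ((pc_subset a).trans (image_subset_range _ _))) subset_rfl)
  -- color 1
  have hR1 : ∀ v : Eu 1, v ∈ sR 0 1 ↔ 0 < v 0 := by
    intro v; simp [sR]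
  have g1 : Good Ψ (sR 0 1) (sl (sw 0 1)) (sw 0 1) (Ψ '' C1) {Ψ 0}ᶜ := by
    refine good_cap hs (norm_sw _ _) hC1o (fun v hv => by linarith [hv.1]) ?_ ?_
    · ext v
      constructor
      · rintro ⟨h, h'⟩; exact ⟨(hR1 v).2 h.2, h'⟩
      · rintro ⟨h, h'⟩; exact ⟨⟨by simp at h'; linarith, (hR1 v).1 h⟩, h'⟩
    · intro v hv t ht0 ht1
      have := lin_ne_one (i0 := 0) hv.2 ht0 ht1
      simpa [sw] using this
  obtain ⟨Q, hQ, hQd⟩ := hSf.t2_separation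
  choose ψ c1 c2 c3 using fun x : S => hM.small' (hWo.inter (hQ x.1).2) ⟨hSW x.2, (hQ x.1).1⟩
  have G1 := g1.add (V := fun x : S => ψ x '' oc 1) (Y' := {Ψ 0}ᶜ) (fun x => (c1 x).op) (by
      intro x y hxy
      refine (hQd x.2 y.2 (fun h => hxy (Subtype.ext h))).mono ?_ ?_
      · exact ((image_subset_range _ _).trans (c3 x)).trans inter_subset_right
      · exact ((image_subset_range _ _).trans (c3 y)).trans inter_subset_right) (by
      intro x
      rw [Set.disjoint_left]
      rintro _ ⟨v, hv, rfl⟩ h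
      exact (c3 x (image_subset_range _ _ h)).1 ⟨v, by have := hv.1; simp; linarith, rfl⟩) (by
      intro x
      exact hWZ.mono_left (((image_subset_range _ _).trans (c3 x)).trans inter_subset_left)) subset_rfl hpc (hwp 1) (by
      intro x
      exact ((c1 x).ctr (((c3 x).trans inter_subset_left).trans hWp)).mono (image_subset_range _ _) subset_rfl)
  refine ⟨fun i => if (i:ℕ) = 0 then Ψ '' C0 ∪ ⋃ j, V0 j else if (i:ℕ) = 1 then Ψ '' C1 ∪ ⋃ x : S, ψ x '' oc 1 else ∅, ?_, ?_⟩
  · intro i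
    by_cases e0 : (i:ℕ) = 0
    · simp only [if_pos e0]
      rw [e0]; exact G0
    by_cases e1 : (i:ℕ) = 1
    · simp only [if_neg e0, if_pos e1]
      rw [e1]; exact G1
    · simp only [if_neg e0, if_neg e1, sR]
      exact good_far (Y' := univ) hs hpc (hwp i) isOpen_empty ⟨fun z => z.1, Ψ 0, by simp, by simp, by simp, fun z hz => absurd hz.1 (by simp)⟩ (by simp)
  · intro x hx
    have in0 : x ∈ Ψ '' C0 ∪ ⋃ j, V0 j → x ∈ ⋃ i : Fin (k+1), (if (i:ℕ) = 0 then Ψ '' C0 ∪ ⋃ j, V0 j else if (i:ℕ) = 1 then Ψ '' C1 ∪ ⋃ x : S, ψ x '' oc 1 else ∅) := by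
      intro h
      refine mem_iUnion.2 ⟨0, ?_⟩
      rw [if_pos (by simp)]; exact h
    have in1 : x ∈ Ψ '' C1 ∪ ⋃ x : S, ψ x '' oc 1 → x ∈ ⋃ i : Fin (k+1), (if (i:ℕ) = 0 then Ψ '' C0 ∪ ⋃ j, V0 j else if (i:ℕ) = 1 then Ψ '' C1 ∪ ⋃ x : S, ψ x '' oc 1 else ∅) := by
      intro h
      refine mem_iUnion.2 ⟨⟨1, by omega⟩, ?_⟩
      rw [if_neg (by simp), if_pos rfl]; exact h
    have inS : x ∈ S → x ∈ Ψ '' C1 ∪ ⋃ x : S, ψ x '' oc 1 := fun h => Or.inr (mem_iUnion.2 ⟨⟨x, h⟩, c2 ⟨x, h⟩⟩)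
    by_cases hxS : x ∈ S
    · exact in1 (inS hxS)
    by_cases hxD : x ∈ D (15/10)
    · obtain ⟨v, hv, rfl⟩ := hxD
      have hv' : ‖v‖ ≤ 15/10 := by simpa using hv
      have hv1 := (mem_XX_norm hs (by linarith)).1 hx
      have hv2 : ‖v‖ < 15/10 := lt_of_le_of_ne hv' fun h => hxS (Or.inl ⟨v, h, rfl⟩)
      rcases lt_trichotomy (v 0) 0 with h | h | h
      · exact in0 (Or.inl ⟨v, ⟨hv2, h⟩, rfl⟩)
      · rw [norm_one_dim, h] at hv1; simp at hv1; linarith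
      · by_cases h' : 12/10 < v 0
        · exact in0 (Or.inr (mem_iUnion.2 ⟨none, ⟨v, ⟨hv2, h'⟩, rfl⟩⟩))
        · refine in1 (Or.inl ⟨v, ⟨?_, h⟩, rfl⟩)
          rw [norm_one_dim, abs_of_pos h]; linarith
    · have hxK : x ∈ K := ⟨hx, by
        rintro ⟨v, hv, rfl⟩
        exact hxD (hcapD v (by simpa using hv))⟩
      have h3 := iUnion_pc (Φ := φ) x (by
        obtain ⟨a, ha⟩ := mem_iUnion.1 (h2 hxK)
        exact mem_iUnion.2 ⟨a, image_subset_range _ _ ha⟩) (fun h => hxS (Or.inr h))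
      obtain ⟨a, ha⟩ := mem_iUnion.1 h3
      exact in0 (Or.inr (mem_iUnion.2 ⟨some a, ha, hxD⟩))
end CS

open scoped Topology
namespace CS
set_option linter.all false
open Set unitInterval

section
variable {M : Type*} [TopologicalSpace M]

/-- simple connectivity of a subset (paths with equal ends are homotopic) -/
def SC (Y : Set M) : Prop := ∀ ω ω' : ℝ → M, ContinuousOn ω (Icc 0 1) → ContinuousOn ω' (Icc 0 1) →
  MapsTo ω (Icc 0 1) Y → MapsTo ω' (Icc 0 1) Y → ω 0 = ω' 0 → ω 1 = ω' 1 →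
  ∃ Θ : ℝ × ℝ → M, ContinuousOn Θ (Icc 0 1 ×ˢ Icc 0 1) ∧ MapsTo Θ (Icc 0 1 ×ˢ Icc 0 1) Y ∧
    (∀ t ∈ Icc (0:ℝ) 1, Θ (0, t) = ω t) ∧ (∀ t ∈ Icc (0:ℝ) 1, Θ (1, t) = ω' t) ∧
    (∀ s ∈ Icc (0:ℝ) 1, Θ (s, 0) = ω 0) ∧ (∀ s ∈ Icc (0:ℝ) 1, Θ (s, 1) = ω 1)

open Classical in
theorem exists_index {ι : Type*} [Nonempty ι] {A : ι → Set M} (hd : ∀ i j, i ≠ j → Disjoint (A i) (A j)) :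
    ∃ α : M → ι, ∀ i, ∀ x ∈ A i, α x = i := by
  refine ⟨fun x => if h : ∃ i, x ∈ A i then h.choose else Classical.arbitrary _, ?_⟩
  intro i x hx
  have hex : ∃ i, x ∈ A i := ⟨i, hx⟩
  simp only [dif_pos hex]
  by_contra hne
  exact Set.disjoint_left.1 (hd _ _ hne) hex.choose_spec hx

theorem gl [NormalSpace M] {ι κ : Type*} [Nonempty ι] [Nonempty κ] {Y : Set M} (hsc : SC Y) (hpc : IsPathConnected Y) {q : M} (hq : q ∈ Y)
    {A V : ι → Set M} (hA : ∀ a, IsOpen (A a)) (hAd : ∀ i j, i ≠ j → Disjoint (A i) (A j))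
    (hAV : ∀ a, A a ⊆ V a) {H : ι → M × ℝ → M} (h1 : ∀ a, ContinuousOn (H a) (V a ×ˢ Icc 0 1))
    (h2 : ∀ a, ∀ x ∈ V a, H a (x, 0) = x) (h3 : ∀ a, ∀ x ∈ V a, H a (x, 1) = q) (h4 : ∀ a, MapsTo (H a) (V a ×ˢ Icc 0 1) Y)
    {Q C : κ → Set M} {D : κ → M × ℝ → M} {c : κ → M} (hQ : ∀ b, IsOpen (Q b))
    (hQd : ∀ i j, i ≠ j → Disjoint (Q i) (Q j)) (hD : ∀ b, ContinuousOn (D b) (Q b ×ˢ Icc 0 1))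
    (hD0 : ∀ b, ∀ x ∈ Q b, D b (x, 0) = x) (hD1 : ∀ b, ∀ x ∈ Q b, D b (x, 1) = c b)
    (hDC : ∀ b, MapsTo (D b) (Q b ×ˢ Icc 0 1) (C b)) (hCY : ∀ b, (Q b).Nonempty → C b ⊆ Y)
    (hQA : ∀ a b, (Q b ∩ A a).Nonempty → C b ⊆ V a)
    {O : Set M} (hO : IsOpen O) (hOQ : closure O ⊆ ⋃ b, Q b) :
    ∃ (G : M × ℝ → M) (K : Set M), IsClosed K ∧ K ⊆ ⋃ b, Q b ∧ ContinuousOn G (((⋃ a, A a) ∪ O) ×ˢ Icc 0 1) ∧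
      (∀ x ∈ (⋃ a, A a) ∪ O, G (x, 0) = x) ∧ (∀ x ∈ (⋃ a, A a) ∪ O, G (x, 1) = q) ∧
      MapsTo G (((⋃ a, A a) ∪ O) ×ˢ Icc 0 1) Y ∧ O ⊆ K ∧
      ∀ a, ∀ x ∈ A a, x ∉ K → ∀ t, G (x, t) = hcat Prod.fst (H a) (x, t) := by
  classical
  obtain ⟨α, hα⟩ := exists_index hAd
  obtain ⟨β, hβ⟩ := exists_index hQd
  have hQo : IsOpen (⋃ b, Q b) := isOpen_iUnion hQ
  obtain ⟨O2, hO2, hOO2, hO2Q⟩ := normal_exists_closure_subset isClosed_closure hQo hOQ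
  obtain ⟨u0, hu0, hu1, hu2⟩ := exists_continuous_zero_one_of_isClosed (s := O2ᶜ) (t := closure O)
    hO2.isClosed_compl isClosed_closure (disjoint_compl_left_iff_subset.2 hOO2)
  set u : M → ℝ := fun x => 2 * u0 x with hu
  have huc : Continuous u := by fun_prop
  have hur : ∀ x, 0 ≤ u x ∧ u x ≤ 2 := fun x => ⟨by have := (hu2 x).1; simp only [hu]; linarith, by have := (hu2 x).2; simp only [hu]; linarith⟩
  have huO : ∀ x ∈ O, u x = 2 := fun x hx => by simp only [hu]; rw [hu1 (subset_closure hx)]; norm_num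
  have huO2 : ∀ x, x ∉ O2 → u x = 0 := fun x hx => by simp only [hu]; rw [hu0 hx]; norm_num
  have huQ : ∀ x, u x ≠ 0 → ∃ b, x ∈ Q b := fun x hx => by
    by_contra h
    exact hx (huO2 x fun h' => h (mem_iUnion.1 (hO2Q (subset_closure h'))))
  have hcY : ∀ b, (Q b).Nonempty → c b ∈ C b := by
    rintro b ⟨x, hx⟩
    rw [← hD1 b x hx]; exact hDC b ⟨hx, by simp⟩
  -- paths from the centres
  have hω : ∀ b, ∃ ω : ℝ → M, Continuous ω ∧ MapsTo ω univ Y ∧ ((Q b).Nonempty → ω 0 = c b) ∧ ω 1 = q := by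
    intro b
    by_cases hb : (Q b).Nonempty
    · obtain ⟨γ, hγ⟩ := hpc.joinedIn _ (hCY b hb (hcY b hb)) q hq
      refine ⟨γ.extend, γ.continuous_extend, ?_, fun _ => by simp, by simp⟩
      intro t _
      exact hγ _
    · exact ⟨fun _ => q, continuous_const, fun _ _ => hq, fun h => absurd h hb, rfl⟩
  choose ω hωc hωY hω0 hω1 using hω
  have hΘ : ∀ a b, ∃ Θ : ℝ × ℝ → M, (Q b ∩ A a).Nonempty → ContinuousOn Θ (Icc 0 1 ×ˢ Icc 0 1) ∧
      MapsTo Θ (Icc 0 1 ×ˢ Icc 0 1) Y ∧ (∀ t ∈ Icc (0:ℝ) 1, Θ (0, t) = H a (c b, t)) ∧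
      (∀ t ∈ Icc (0:ℝ) 1, Θ (1, t) = ω b t) ∧ (∀ s ∈ Icc (0:ℝ) 1, Θ (s, 0) = c b) ∧ (∀ s ∈ Icc (0:ℝ) 1, Θ (s, 1) = q) := by
    intro a b
    by_cases hab : (Q b ∩ A a).Nonempty
    swap
    · exact ⟨fun _ => q, fun h => absurd h hab⟩
    have hb : (Q b).Nonempty := hab.mono inter_subset_left
    have hcV : c b ∈ V a := hQA a b hab (hcY b hb)
    obtain ⟨Θ, g1, g2, g3, g4, g5, g6⟩ := hsc (fun t => H a (c b, t)) (ω b)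
      ((h1 a).comp (by fun_prop) (fun t ht => ⟨hcV, ht⟩)) (hωc b).continuousOn
      (fun t ht => h4 a ⟨hcV, ht⟩) ((hωY b).mono_left (subset_univ _))
      (by rw [h2 a _ hcV, hω0 b hb]) (by rw [h3 a _ hcV, hω1 b])
    refine ⟨Θ, fun _ => ⟨g1, g2, g3, g4, ?_, ?_⟩⟩
    · intro s hs; rw [g5 s hs, h2 a _ hcV]
    · intro s hs; rw [g6 s hs, h3 a _ hcV]
  choose Θ hΘ using hΘ
  set v : M → ℝ := fun x => min (u x) 1 with hv
  have hvc : Continuous v := by fun_prop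
  have hvr : ∀ x, v x ∈ Icc (0:ℝ) 1 := fun x => ⟨le_min (hur x).1 zero_le_one, min_le_right _ _⟩
  set P : M × ℝ → M := fun z => if z.1 ∈ ⋃ b, Q b then D (β z.1) (z.1, v z.1 * z.2) else z.1 with hP
  have hvt : ∀ x, ∀ t ∈ Icc (0:ℝ) 1, v x * t ∈ Icc (0:ℝ) 1 := fun x t ht =>
    ⟨mul_nonneg (hvr x).1 ht.1, mul_le_one₀ (hvr x).2 ht.1 ht.2⟩
  have hPQ : ∀ b, ∀ x ∈ Q b, ∀ t, P (x, t) = D b (x, v x * t) := by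
    intro b x hx t
    simp only [hP]
    rw [if_pos (mem_iUnion.2 ⟨b, hx⟩), hβ b x hx]
  have hP0 : ∀ x t, v x * t = 0 → P (x, t) = x := by
    intro x t hx
    by_cases hxQ : ∃ b, x ∈ Q b
    · obtain ⟨b, hb⟩ := hxQ
      rw [hPQ b x hb, hx, hD0 b x hb]
    · simp only [hP]
      rw [if_neg (fun h => hxQ (mem_iUnion.1 h))]
  have hPc : ContinuousOn P (univ ×ˢ Icc 0 1) := by
    have e : (univ ×ˢ Icc 0 1 : Set (M × ℝ)) = ((⋃ b, Q b ×ˢ (univ : Set ℝ)) ∪ ((closure O2)ᶜ ×ˢ univ)) ∩ (univ ×ˢ Icc 0 1) := by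
      rw [eq_comm, inter_eq_right]
      rintro ⟨x, t⟩ -
      by_cases hx : x ∈ closure O2
      · obtain ⟨b, hb⟩ := mem_iUnion.1 (hO2Q hx)
        exact Or.inl (mem_iUnion.2 ⟨b, hb, trivial⟩)
      · exact Or.inr ⟨hx, trivial⟩
    rw [e]
    refine co_union (isOpen_iUnion fun b => (hQ b).prod isOpen_univ) (isClosed_closure.isOpen_compl.prod isOpen_univ)
      (co_iUnion (fun b => (hQ b).prod isOpen_univ) fun b => ?_) ?_
    · refine ((hD b).comp (f := fun z : M × ℝ => (z.1, v z.1 * z.2)) (by fun_prop) ?_).congr ?_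
      · rintro ⟨x, t⟩ ⟨hx, hx'⟩
        exact ⟨hx.1, hvt x t hx'.2⟩
      · rintro ⟨x, t⟩ ⟨hx, hx'⟩
        exact hPQ b x hx.1 t
    · refine continuous_fst.continuousOn.congr ?_
      rintro ⟨x, t⟩ ⟨hx, hx'⟩
      refine hP0 x t ?_
      have : u x = 0 := huO2 x fun h => hx.1 (subset_closure h)
      simp [hv, this]
  have hPV : ∀ a, ∀ x ∈ A a, ∀ t ∈ Icc (0:ℝ) 1, P (x, t) ∈ V a := by
    intro a x hx t ht
    by_cases hxQ : ∃ b, x ∈ Q b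
    · obtain ⟨b, hb⟩ := hxQ
      rw [hPQ b x hb]
      exact hQA a b ⟨x, hb, hx⟩ (hDC b ⟨hb, hvt x t ht⟩)
    · simp only [hP]
      rw [if_neg (fun h => hxQ (mem_iUnion.1 h))]
      exact hAV a hx
  have hVY : ∀ a, V a ⊆ Y := fun a x hx => by
    rw [← h2 a x hx]; exact h4 a ⟨hx, by simp⟩
  set R : M × ℝ → M := fun z => if z.1 ∈ ⋃ a, A a then
    (if u z.1 ≤ 1 then H (α z.1) (P (z.1, 1), z.2) else Θ (α z.1) (β z.1) (u z.1 - 1, z.2)) else ω (β z.1) z.2 with hR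
  have hRA1 : ∀ a, ∀ x ∈ A a, u x ≤ 1 → ∀ t, R (x, t) = H a (P (x, 1), t) := by
    intro a x hx hux t
    simp only [hR]
    rw [if_pos (mem_iUnion.2 ⟨a, hx⟩), if_pos hux, hα a x hx]
  have hRA2 : ∀ a b, ∀ x ∈ A a, x ∈ Q b → 1 ≤ u x → ∀ t ∈ Icc (0:ℝ) 1, R (x, t) = Θ a b (u x - 1, t) := by
    intro a b x hx hxb hux t ht
    by_cases h : u x ≤ 1
    · have h' : u x = 1 := le_antisymm h hux
      have h'' : v x = 1 := by simp [hv, h']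
      rw [hRA1 a x hx h, h', sub_self, (hΘ a b ⟨x, hxb, hx⟩).2.2.1 t ht, hPQ b x hxb, h'', mul_one, hD1 b x hxb]
    · simp only [hR]
      rw [if_pos (mem_iUnion.2 ⟨a, hx⟩), if_neg h, hα a x hx, hβ b x hxb]
  have hRO : ∀ b, ∀ x ∈ O, x ∈ Q b → ∀ t ∈ Icc (0:ℝ) 1, R (x, t) = ω b t := by
    intro b x hxO hxb t ht
    by_cases hxA : ∃ a, x ∈ A a
    · obtain ⟨a, ha⟩ := hxA
      rw [hRA2 a b x ha hxb (by rw [huO x hxO]; norm_num) t ht, huO x hxO]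
      norm_num
      exact (hΘ a b ⟨x, hxb, ha⟩).2.2.2.1 t ht
    · simp only [hR]
      rw [if_neg (fun h => hxA (mem_iUnion.1 h)), hβ b x hxb]
  -- case description of the domain
  have hcase : ∀ x ∈ (⋃ a, A a) ∪ O, (∃ a, x ∈ A a ∧ u x ≤ 1) ∨ (∃ a b, x ∈ A a ∧ x ∈ Q b ∧ 1 ≤ u x) ∨
      ∃ b, x ∈ O ∧ x ∈ Q b := by
    rintro x (hx | hx)
    · obtain ⟨a, ha⟩ := mem_iUnion.1 hx
      rcases le_total (u x) 1 with h | h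
      · exact Or.inl ⟨a, ha, h⟩
      · obtain ⟨b, hb⟩ := huQ x (by linarith)
        exact Or.inr (Or.inl ⟨a, b, ha, hb, h⟩)
    · obtain ⟨b, hb⟩ := mem_iUnion.1 (hOQ (subset_closure hx))
      exact Or.inr (Or.inr ⟨b, hx, hb⟩)
  have hus : ∀ x, 1 ≤ u x → u x - 1 ∈ Icc (0:ℝ) 1 := fun x hx => ⟨by linarith, by linarith [(hur x).2]⟩
  have hRc : ContinuousOn R (((⋃ a, A a) ∪ O) ×ˢ Icc 0 1) := by
    have e : (((⋃ a, A a) ∪ O) ×ˢ Icc 0 1 : Set (M × ℝ)) =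
        ((⋃ a, A a ×ˢ (univ : Set ℝ)) ∪ ⋃ b, (O ∩ Q b) ×ˢ (univ : Set ℝ)) ∩ (univ ×ˢ Icc 0 1) := by
      ext ⟨x, t⟩
      simp only [mem_prod, mem_union, mem_iUnion, mem_inter_iff, mem_univ, and_true, true_and]
      constructor
      · rintro ⟨h | h, ht⟩
        · exact ⟨Or.inl h, ht⟩
        · obtain ⟨b, hb⟩ := mem_iUnion.1 (hOQ (subset_closure h))
          exact ⟨Or.inr ⟨b, h, hb⟩, ht⟩
      · rintro ⟨h | ⟨b, h, hb⟩, ht⟩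
        · exact ⟨Or.inl h, ht⟩
        · exact ⟨Or.inr h, ht⟩
    rw [e]
    refine co_union (isOpen_iUnion fun b => (hA b).prod isOpen_univ) (isOpen_iUnion fun b => (hO.inter (hQ b)).prod isOpen_univ)
      (co_iUnion (fun b => (hA b).prod isOpen_univ) fun a => ?_) (co_iUnion (fun b => (hO.inter (hQ b)).prod isOpen_univ) fun b => ?_)
    · have e2 : (A a ×ˢ univ ∩ univ ×ˢ Icc 0 1 : Set (M × ℝ)) ⊆
          ((A a ∩ {x | u x < 1}) ×ˢ univ ∪ ⋃ b, (A a ∩ Q b) ×ˢ univ) ∩ (univ ×ˢ Icc 0 1) := by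
        rintro ⟨x, t⟩ ⟨⟨hx, -⟩, -, ht⟩
        refine ⟨?_, trivial, ht⟩
        rcases lt_or_ge (u x) 1 with h | h
        · exact Or.inl ⟨⟨hx, h⟩, trivial⟩
        · obtain ⟨b, hb⟩ := huQ x (by linarith)
          exact Or.inr (mem_iUnion.2 ⟨b, ⟨hx, hb⟩, trivial⟩)
      refine ContinuousOn.mono ?_ e2
      have ho1 : IsOpen (A a ∩ {x | u x < 1}) := (hA a).inter (isOpen_Iio.preimage huc)
      have hH : ∀ T : Set (M × ℝ), T ⊆ A a ×ˢ Icc 0 1 → ContinuousOn (fun z : M × ℝ => H a (P (z.1, 1), z.2)) T := by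
        intro T hT
        refine (h1 a).comp (ContinuousOn.prodMk ?_ (by fun_prop)) ?_
        · exact hPc.comp (f := fun z : M × ℝ => (z.1, (1:ℝ))) (by fun_prop) (fun z hz => ⟨trivial, by simp⟩)
        · intro z hz
          exact ⟨hPV a _ (hT hz).1 1 (by simp), (hT hz).2⟩
      refine co_union (ho1.prod isOpen_univ) (isOpen_iUnion fun b => ((hA a).inter (hQ b)).prod isOpen_univ)
        ?_ (co_iUnion (fun b => ((hA a).inter (hQ b)).prod isOpen_univ) fun b => ?_)
      · refine (hH _ ?_).congr ?_
        · rintro ⟨x, t⟩ ⟨⟨⟨h, -⟩, -⟩, -, ht⟩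
          exact ⟨h, ht⟩
        · rintro ⟨x, t⟩ ⟨⟨⟨h, hu'⟩, -⟩, -, ht⟩
          exact hRA1 a x h (le_of_lt hu') t
      · have e3 : ((A a ∩ Q b) ×ˢ univ ∩ univ ×ˢ Icc 0 1 : Set (M × ℝ)) =
            ((A a ∩ Q b) ×ˢ Icc 0 1 ∩ {z | u z.1 ≤ 1}) ∪ ((A a ∩ Q b) ×ˢ Icc 0 1 ∩ {z | 1 ≤ u z.1}) := by
          ext ⟨x, t⟩
          simp only [mem_prod, mem_inter_iff, mem_univ, and_true, true_and, mem_union, mem_setOf_eq]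
          have := le_total (u x) 1
          tauto
        rw [e3]
        have hc1 : IsClosed {z : M × ℝ | u z.1 ≤ 1} := isClosed_Iic.preimage (huc.comp continuous_fst)
        have hc2 : IsClosed {z : M × ℝ | 1 ≤ u z.1} := isClosed_Ici.preimage (huc.comp continuous_fst)
        have k1 : ContinuousOn R ((A a ∩ Q b) ×ˢ Icc 0 1 ∩ {z | u z.1 ≤ 1}) := by
          refine (hH _ ?_).congr ?_
          · rintro ⟨x, t⟩ ⟨⟨⟨h, -⟩, ht⟩, -⟩
            exact ⟨h, ht⟩
          · rintro ⟨x, t⟩ ⟨⟨⟨h, -⟩, ht⟩, hu'⟩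
            exact hRA1 a x h hu' t
        have k2 : ContinuousOn R ((A a ∩ Q b) ×ˢ Icc 0 1 ∩ {z | 1 ≤ u z.1}) := by
          by_cases hab : (Q b ∩ A a).Nonempty
          swap
          · have : ((A a ∩ Q b) ×ˢ Icc 0 1 ∩ {z | 1 ≤ u z.1} : Set (M × ℝ)) = ∅ := by
              rw [eq_empty_iff_forall_notMem]
              rintro ⟨x, t⟩ ⟨⟨h, -⟩, -⟩
              exact hab ⟨x, h.2, h.1⟩
            rw [this]; exact continuousOn_empty _
          refine ((hΘ a b hab).1.comp (f := fun z : M × ℝ => (u z.1 - 1, z.2)) (by fun_prop) ?_).congr ?_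
          · rintro ⟨x, t⟩ ⟨⟨⟨h, -⟩, ht⟩, hu'⟩
            exact ⟨hus x hu', ht⟩
          · rintro ⟨x, t⟩ ⟨⟨⟨h, h'⟩, ht⟩, hu'⟩
            exact hRA2 a b x h h' hu' t ht
        intro z hz
        have key : ∀ (T : Set (M × ℝ)) (K : Set (M × ℝ)), IsClosed K → ContinuousOn R (T ∩ K) → ∀ z ∈ T, ContinuousWithinAt R (T ∩ K) z := by
          intro T K hK hc z hz
          by_cases hzK : z ∈ K
          · exact hc z ⟨hz, hzK⟩
          · have : 𝓝[T ∩ K] z = ⊥ := by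
              rw [← notMem_closure_iff_nhdsWithin_eq_bot]
              exact fun h => hzK (hK.closure_subset_iff.2 inter_subset_right h)
            unfold ContinuousWithinAt
            rw [this]; exact Filter.tendsto_bot
        have hz' : z ∈ (A a ∩ Q b) ×ˢ Icc (0:ℝ) 1 := by rcases hz with hz | hz <;> exact hz.1
        exact (key _ _ hc1 k1 z hz').union (key _ _ hc2 k2 z hz')
    · refine ((hωc b).comp continuous_snd).continuousOn.congr ?_
      rintro ⟨x, t⟩ ⟨⟨⟨h, h'⟩, -⟩, -, ht⟩
      exact hRO b x h h' t ht
  refine ⟨hcat P R, closure O2, isClosed_closure, hO2Q, hcat_cont (hPc.mono (prod_mono_left (subset_univ _))) hRc ?_, ?_, ?_, hcat_mapsTo ?_ ?_, ((subset_closure.trans hOO2).trans subset_closure), ?_⟩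
  · intro x hx
    rcases hcase x hx with ⟨a, ha, hu'⟩ | ⟨a, b, ha, hb, hu'⟩ | ⟨b, hxO, hb⟩
    · rw [hRA1 a x ha hu', h2 a _ (hPV a x ha 1 (by simp))]
    · have : v x = 1 := by simp [hv, hu']
      rw [hRA2 a b x ha hb hu' 0 (by simp), (hΘ a b ⟨x, hb, ha⟩).2.2.2.2.1 _ (hus x hu'), hPQ b x hb, this, mul_one, hD1 b x hb]
    · have : v x = 1 := by simp [hv, huO x hxO]
      rw [hRO b x hxO hb 0 (by simp), hω0 b ⟨x, hb⟩, hPQ b x hb, this, mul_one, hD1 b x hb]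
  · intro x hx
    rw [hcat_zero, hP0 x 0 (mul_zero _)]
  · intro x hx
    rw [hcat_one]
    rcases hcase x hx with ⟨a, ha, hu'⟩ | ⟨a, b, ha, hb, hu'⟩ | ⟨b, hxO, hb⟩
    · rw [hRA1 a x ha hu', h3 a _ (hPV a x ha 1 (by simp))]
    · rw [hRA2 a b x ha hb hu' 1 (by simp), (hΘ a b ⟨x, hb, ha⟩).2.2.2.2.2 _ (hus x hu')]
    · rw [hRO b x hxO hb 1 (by simp), hω1]
  · rintro ⟨x, t⟩ ⟨hx, ht⟩
    rcases hx with hx | hx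
    · obtain ⟨a, ha⟩ := mem_iUnion.1 hx
      exact hVY a (hPV a x ha t ht)
    · obtain ⟨b, hb⟩ := mem_iUnion.1 (hOQ (subset_closure hx))
      rw [hPQ b x hb]
      exact hCY b ⟨x, hb⟩ (hDC b ⟨hb, hvt x t ht⟩)
  · rintro ⟨x, t⟩ ⟨hx, ht⟩
    rcases hcase x hx with ⟨a, ha, hu'⟩ | ⟨a, b, ha, hb, hu'⟩ | ⟨b, hxO, hb⟩
    · rw [hRA1 a x ha hu']
      exact h4 a ⟨hPV a x ha 1 (by simp), ht⟩
    · rw [hRA2 a b x ha hb hu' t ht]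
      exact (hΘ a b ⟨x, hb, ha⟩).2.1 ⟨hus x hu', ht⟩
    · rw [hRO b x hxO hb t ht]
      exact hωY b trivial
  · intro a x hx hxK t
    have hux : u x = 0 := huO2 x fun h => hxK (subset_closure h)
    have hvx : v x = 0 := by simp [hv, hux]
    simp only [hcat]
    split_ifs
    · exact hP0 x _ (by simp [hvx])
    · rw [hRA1 a x hx (by rw [hux]; norm_num), hP0 x 1 (by simp [hvx])]

end
end CS

open scoped Topology
namespace CS
set_option linter.all false
open Set unitInterval

section
variable {M : Type*} [TopologicalSpace M] [T2Space M] [CompactSpace M] [Nonempty M] {n : ℕ}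
variable {Ψ : OpenPartialHomeomorph (Eu n) M}

theorem compl_Zc_subset : (Zc Ψ)ᶜ ⊆ XX Ψ :=
  compl_subset_compl.2 (image_mono ((Metric.ball_subset_ball (by norm_num)).trans Metric.ball_subset_closedBall))

theorem Good.merge {R : Set (Eu n)} {s : Eu n × ℝ → Eu n} {w : Eu n} {U Y : Set M} (h : Good Ψ R s w U Y)
    (hs : Ψ.source = Metric.ball 0 2) (hsc : SC Y) (hpc : IsPathConnected Y) (hw : Ψ w ∈ Y)
    {m : ℕ} {A V : Fin m → Set M} (hA : ∀ a, IsOpen (A a)) (hAd : ∀ i j, i ≠ j → Disjoint (A i) (A j))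
    (hAV : ∀ a, A a ⊆ V a) (hV : ∀ a, Ctr (V a) Y) {RR : Set M} (hRR : IsClosed RR) (hAR : ∀ a, A a ⊆ RR)
    (hRZ : Disjoint RR (Zc Ψ)) {κ : Type*} [Nonempty κ]
    {Q C : κ → Set M} {D : κ → M × ℝ → M} {c : κ → M} (hQ : ∀ b, IsOpen (Q b))
    (hQd : ∀ i j, i ≠ j → Disjoint (Q i) (Q j)) (hD : ∀ b, ContinuousOn (D b) (Q b ×ˢ Icc 0 1))
    (hD0 : ∀ b, ∀ x ∈ Q b, D b (x, 0) = x) (hD1 : ∀ b, ∀ x ∈ Q b, D b (x, 1) = c b)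
    (hDC : ∀ b, MapsTo (D b) (Q b ×ˢ Icc 0 1) (C b)) (hCY : ∀ b, (Q b).Nonempty → C b ⊆ Y)
    (hQZ : ∀ b, Disjoint (Q b) (Zc Ψ))
    (hQA : ∀ a b, (Q b ∩ A a).Nonempty → C b ⊆ V a) (hQU : ∀ b, (Q b ∩ (U \ RR)).Nonempty → C b ⊆ U \ Zc Ψ)
    {O : Set M} (hO : IsOpen O) (hOQ : closure O ⊆ ⋃ b, Q b) : Good Ψ R s w ((U \ RR) ∪ ((⋃ a, A a) ∪ O)) Y := by
  classical
  obtain ⟨ho, hr, H, h1, h2, h3, h4, h5⟩ := h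
  choose K k1 k2 k3 k4 using fun a => (hV a).to hpc hw
  set A' : Option (Fin m) → Set M := fun o => o.elim ((U \ RR) \ Zc Ψ) A with hA'
  set V' : Option (Fin m) → Set M := fun o => o.elim (U \ Zc Ψ) V with hV'
  set H' : Option (Fin m) → M × ℝ → M := fun o => o.elim H K with hH'
  have hUX : U \ Zc Ψ ⊆ U ∩ XX Ψ := fun x hx => ⟨hx.1, compl_Zc_subset hx.2⟩
  have hZc := isClosed_Zc hs
  obtain ⟨G, KK, hKc, hKQ, g1, g2, g3, g4, g5, g6⟩ := gl hsc hpc hw (A := A') (V := V') (H := H') (Q := Q) (C := C) (D := D) (c := c) (O := O)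
    (by rintro (_ | a); exacts [(ho.sdiff hRR).sdiff hZc, hA a])
    (by
      rintro (_ | a) (_ | b) hab
      · exact absurd rfl hab
      · exact Set.disjoint_left.2 fun x hx hx' => hx.1.2 (hAR b hx')
      · exact Set.disjoint_left.2 fun x hx' hx => hx.1.2 (hAR a hx')
      · exact hAd a b fun h => hab (by rw [h]))
    (by rintro (_ | a); exacts [diff_subset_diff_left diff_subset, hAV a])
    (by rintro (_ | a); exacts [h1.mono (prod_mono_left hUX), k1 a])
    (by rintro (_ | a); exacts [fun x hx => h2 x (hUX hx), k2 a])
    (by rintro (_ | a); exacts [fun x hx => h3 x (hUX hx), k3 a])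
    (by rintro (_ | a); exacts [fun x hx => h4 ⟨hUX hx.1, hx.2⟩, k4 a])
    hQ hQd hD hD0 hD1 hDC hCY
    (by rintro (_ | a) b hab; exacts [hQU b (hab.mono (inter_subset_inter_right _ diff_subset)), hQA a b hab]) hO hOQ
  have hKZ : Disjoint KK (Zc Ψ) := Set.disjoint_left.2 fun x hx hz => by
    obtain ⟨b, hb⟩ := mem_iUnion.1 (hKQ hx)
    exact Set.disjoint_left.1 (hQZ b) hb hz
  set T := (⋃ a, A' a) ∪ O with hT
  have hA'T : ∀ a, A' a ⊆ T := fun a => (subset_iUnion _ a).trans subset_union_left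
  have hTe : (U \ RR) ∪ ((⋃ a, A a) ∪ O) = (U \ RR) ∪ T := by
    rw [hT, iUnion_option]
    simp only [hA', Option.elim]
    ext x
    simp only [mem_union, mem_diff]
    tauto
  have hAZ : ∀ a, Disjoint (A' a) (Zc Ψ) := by
    rintro (_ | a)
    · exact disjoint_sdiff_left
    · exact hRZ.mono_left (hAR a)
  have hTZ : Disjoint T (Zc Ψ) := by
    rw [hT, disjoint_union_left]
    refine ⟨disjoint_iUnion_left.2 hAZ, hKZ.mono_left g5⟩
  have hTo : IsOpen T := by
    refine IsOpen.union (isOpen_iUnion ?_) hO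
    rintro (_ | a); exacts [(ho.sdiff hRR).sdiff hZc, hA a]
  obtain ⟨W, hWo, hZW, hWc⟩ := normal_exists_closure_subset hZc (hKc.union hRR).isOpen_compl
    (fun x hz hx => by
      rcases hx with hx | hx
      exacts [Set.disjoint_left.1 hKZ hx hz, Set.disjoint_left.1 hRZ hx hz])
  obtain ⟨ω, hω0, hω1, hωr⟩ := exists_continuous_zero_one_of_isClosed (s := closure W) (t := KK) isClosed_closure hKc
    (Set.disjoint_left.2 fun x hx hx' => hWc hx (Or.inl hx'))
  set ρ : M × ℝ → ℝ := fun z => ω z.1 * z.2 + (1 - ω z.1) * ((1 + z.2) / 2) with hρ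
  have hρr : ∀ x, ∀ t ∈ Icc (0:ℝ) 1, ρ (x, t) ∈ Icc (0:ℝ) 1 := by
    rintro x t ⟨ht0, ht1⟩
    obtain ⟨a0, a1⟩ := hωr x
    simp only [hρ]
    constructor
    · have := mul_nonneg a0 ht0
      have := mul_nonneg (sub_nonneg.2 a1) (by linarith : (0:ℝ) ≤ (1 + t)/2)
      linarith
    · have := mul_nonneg a0 (sub_nonneg.2 ht1)
      have := mul_nonneg (sub_nonneg.2 a1) (by linarith : (0:ℝ) ≤ 1 - (1 + t)/2)
      nlinarith
  set G' : M × ℝ → M := fun z => G (z.1, ρ z) with hG'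
  have hG'c : ContinuousOn G' (T ×ˢ Icc 0 1) := by
    refine g1.comp (f := fun z : M × ℝ => (z.1, ρ z)) ?_ ?_
    · simp only [hρ]; fun_prop
    · rintro ⟨x, t⟩ ⟨hx, ht⟩
      exact ⟨hx, hρr x t ht⟩
  have hW : ∀ x ∈ W, x ∉ RR ∧ x ∉ KK ∧ ω x = 0 := fun x hx =>
    ⟨fun h => hWc (subset_closure hx) (Or.inr h), fun h => hWc (subset_closure hx) (Or.inl h), hω0 (subset_closure hx)⟩
  have hTW : ∀ x ∈ T, x ∈ W → x ∈ A' none := by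
    intro x hx hxW
    rcases hx with hx | hx
    · obtain ⟨a, ha⟩ := mem_iUnion.1 hx
      rcases a with _ | a
      · exact ha
      · exact absurd (hAR a ha) (hW x hxW).1
    · exact absurd (g5 hx) (hW x hxW).2.1
  have hGW : ∀ x ∈ T, x ∈ W → ∀ t ∈ Icc (0:ℝ) 1, G' (x, t) = H (x, t) := by
    intro x hx hxW t ht
    have hxA := hTW x hx hxW
    simp only [hG', hρ]
    rw [(hW x hxW).2.2, g6 none x hxA (hW x hxW).2.1]
    simp only [hcat]
    split_ifs with ht'
    · have : t = 0 := le_antisymm (by linarith) ht.1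
      rw [this, h2 x (hUX ⟨hxA.1.1, hxA.2⟩)]
    · simp only [hH', Option.elim]
      congr 2; ring
  set F : M × ℝ → M := fun z => if z.1 ∈ W then H z else G' z with hF
  have hFW : ∀ x ∈ W, ∀ t, F (x, t) = H (x, t) := fun x hx t => by simp only [hF]; rw [if_pos hx]
  have hFT : ∀ x ∈ T, ∀ t ∈ Icc (0:ℝ) 1, F (x, t) = G' (x, t) := by
    intro x hx t ht
    by_cases hxW : x ∈ W
    · rw [hFW x hxW, hGW x hx hxW t ht]
    · simp only [hF]; rw [if_neg hxW]
  have hUT : ∀ x ∈ (U \ RR) ∪ T, (x ∈ W ∧ x ∈ U) ∨ x ∈ T := by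
    intro x hx
    by_cases hxT : x ∈ T
    · exact Or.inr hxT
    · have hx' : x ∈ U \ RR := hx.resolve_right hxT
      by_cases hz : x ∈ Zc Ψ
      · exact Or.inl ⟨hZW hz, hx'.1⟩
      · exact Or.inr (hA'T none ⟨hx', hz⟩)
  have hWU : ∀ x ∈ (U \ RR) ∪ T, x ∈ W → x ∈ U := by
    rintro x (hx | hx) hxW
    · exact hx.1
    · exact (hTW x hx hxW).1.1
  rw [hTe]
  refine ⟨(ho.sdiff hRR).union hTo, ?_, F, ?_, ?_, ?_, ?_, ?_⟩
  · rw [← hr]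
    ext x
    constructor
    · rintro ⟨hx | hx, hz⟩
      · exact ⟨hx.1, hz⟩
      · exact absurd (Zo_subset_Zc hz) (Set.disjoint_left.1 hTZ hx)
    · rintro ⟨hx, hz⟩
      exact ⟨Or.inl ⟨hx, fun h => Set.disjoint_left.1 hRZ h (Zo_subset_Zc hz)⟩, hz⟩
  · have e : ((((U \ RR) ∪ T) ∩ XX Ψ) ×ˢ Icc 0 1 : Set (M × ℝ)) ⊆
        ((W ×ˢ univ) ∪ (T ×ˢ univ)) ∩ ((((U \ RR) ∪ T) ∩ XX Ψ) ×ˢ Icc 0 1) := by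
      rintro ⟨x, t⟩ hz
      refine ⟨?_, hz⟩
      rcases hUT x hz.1.1 with h | h
      · exact Or.inl ⟨h.1, trivial⟩
      · exact Or.inr ⟨h, trivial⟩
    refine ContinuousOn.mono (co_union (hWo.prod isOpen_univ) (hTo.prod isOpen_univ) ?_ ?_) e
    · refine (h1.mono ?_).congr ?_
      · rintro ⟨x, t⟩ ⟨⟨hx, -⟩, ⟨hx', hX⟩, ht⟩
        exact ⟨⟨hWU x hx' hx, hX⟩, ht⟩
      · rintro ⟨x, t⟩ ⟨⟨hx, -⟩, ⟨hx', hX⟩, ht⟩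
        exact hFW x hx t
    · refine (hG'c.mono ?_).congr ?_
      · rintro ⟨x, t⟩ ⟨⟨hx, -⟩, ⟨hx', hX⟩, ht⟩
        exact ⟨hx, ht⟩
      · rintro ⟨x, t⟩ ⟨⟨hx, -⟩, ⟨hx', hX⟩, ht⟩
        exact hFT x hx t ht
  · rintro x ⟨hx, hX⟩
    rcases hUT x hx with ⟨h, h'⟩ | h
    · rw [hFW x h, h2 x ⟨h', hX⟩]
    · rw [hFT x h 0 (by simp)]
      by_cases hxK : x ∈ KK
      · simp only [hG', hρ]
        rw [hω1 hxK]
        norm_num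
        exact g2 x h
      · have hxA : ∃ a, x ∈ A' a := by
          rcases h with h | h
          · exact mem_iUnion.1 h
          · exact absurd (g5 h) hxK
        obtain ⟨a, ha⟩ := hxA
        simp only [hG']
        rw [g6 a x ha hxK]
        simp only [hcat]
        rw [if_pos]
        simp only [hρ]
        have := (hωr x).1
        linarith
  · rintro x ⟨hx, hX⟩
    rcases hUT x hx with ⟨h, h'⟩ | h
    · rw [hFW x h, h3 x ⟨h', hX⟩]
    · rw [hFT x h 1 (by simp)]
      have : ρ (x, 1) = 1 := by simp only [hρ]; ring
      simp only [hG']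
      rw [this, g3 x h]
  · rintro ⟨x, t⟩ ⟨⟨hx, hX⟩, ht⟩
    rcases hUT x hx with ⟨h, h'⟩ | h
    · rw [hFW x h]; exact h4 ⟨⟨h', hX⟩, ht⟩
    · rw [hFT x h t ht]; exact g4 ⟨h, hρr x t ht⟩
  · intro v hv hv1 hv2 t ht
    have hz := mem_Zc_norm hs hv2
    rw [hFW _ (hZW hz)]
    exact h5 v (hWU _ hv (hZW hz)) hv1 hv2 t ht

end
end CS

open scoped Topology
namespace CS
set_option linter.all false
open Set unitInterval

section
variable {M : Type*} [TopologicalSpace M] [T2Space M] [CompactSpace M] [Nonempty M] {n : ℕ}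
variable {Ψ : OpenPartialHomeomorph (Eu n) M}

theorem cell_cover2 (hM : Mf n M) {K W : Set M} (hK : IsCompact K) (hW : IsOpen W) (hKW : K ⊆ W) :
    ∃ (m : ℕ) (φ : Fin m → (Fin n → I) → M) (V : Fin m → Set M), (∀ a, Bx n (φ a) ∧ range (φ a) ⊆ V a ∧ IsOpen (V a) ∧
      V a ⊆ W ∧ ∀ Y, W ⊆ Y → Ctr (V a) Y) ∧ K ⊆ ⋃ a, φ a '' oc n := by
  have : ∀ x : K, ∃ (φ : (Fin n → I) → M) (V : Set M), x.1 ∈ φ '' oc n ∧ (Bx n φ ∧ range φ ⊆ V ∧ IsOpen V ∧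
      V ⊆ W ∧ ∀ Y, W ⊆ Y → Ctr V Y) := by
    intro x
    obtain ⟨φ, h1, ⟨u, hu, hux⟩, h3⟩ := hM.small' hW (hKW x.2)
    obtain ⟨a, b, hab, hx, -, hr⟩ := h1.exists_sub' isOpen_univ hu trivial
    refine ⟨φ ∘ af a b, φ '' oc n, ?_, h1.sub hab, hr, h1.op, (image_subset_range _ _).trans h3, fun Y hY => ?_⟩
    · rw [Bx.sub_image hab]; exact ⟨u, hx, hux⟩
    · exact (h1.ctr (h3.trans hY)).mono (image_subset_range _ _) subset_rfl
  choose φ V h2 h1 using this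
  obtain ⟨t, ht⟩ := hK.elim_finite_subcover (fun x => φ x '' oc n) (fun x => (h1 x).1.op)
    (fun x hx => mem_iUnion.2 ⟨⟨x, hx⟩, h2 _⟩)
  refine ⟨t.card, fun a => φ (t.equivFin.symm a), fun a => V (t.equivFin.symm a), fun a => h1 _, fun x hx => ?_⟩
  obtain ⟨y, hy, hxy⟩ := mem_iUnion₂.1 (ht hx)
  exact mem_iUnion.2 ⟨t.equivFin ⟨y, hy⟩, by simpa using hxy⟩

theorem proc (hM : Mf n M) (hs : Ψ.source = Metric.ball 0 2)
    {Ri Rj : Set (Eu n)} {si sj : Eu n × ℝ → Eu n} {wi wj : Eu n} {Ui Uj Yi Yj : Set M}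
    (hi : Good Ψ Ri si wi Ui Yi) (hj : Good Ψ Rj sj wj Uj Yj)
    (hwi : Ψ wi ≠ Ψ 0) (hwj : Ψ wj ∈ Yj) (hYj : {Ψ 0}ᶜ ⊆ Yj) (hpc : IsPathConnected Yj) (hsc : SC Yj)
    (hcov : ∀ x ∈ XX Ψ, x ∈ Ui ∨ x ∈ Uj) :
    ∃ Ui' Uj', Good Ψ Ri si wi Ui' {Ψ 0}ᶜ ∧ Good Ψ Rj sj wj Uj' Yj ∧ ∀ x ∈ XX Ψ, x ∈ Ui' ∨ x ∈ Uj' := by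
  classical
  set Xin := XX Ψ \ Uj with hXin
  have hXc : IsClosed Xin := (isClosed_XX hs).sdiff hj.op
  have hXU : Xin ⊆ Ui := fun x hx => (hcov x hx.1).resolve_right hx.2
  obtain ⟨G, hG, hXG, hGU⟩ := normal_exists_closure_subset hXc hi.op hXU
  set F := closure G with hF
  have hXF : Xin ⊆ interior F := hXG.trans (interior_maximal subset_closure hG)
  obtain ⟨L, hLc, hLF, hLZ, hL⟩ := hi.perturb hs hwi (F := F) isClosed_closure hGU
  obtain ⟨m, φ, V, hφ, hcovφ⟩ := cell_cover2 hM (K := L ∩ Xin) (W := interior F \ Zc Ψ) (hLc.inter hXc).isCompact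
    (isOpen_interior.sdiff (isClosed_Zc hs))
    (fun x hx => ⟨hXF hx.2, fun hz => Set.disjoint_left.1 hLZ hx.1 hz⟩)
  set N := ⋃ a, φ a '' oc n with hN
  set RR := ⋃ a, range (φ a) with hRR
  set S := ⋃ a, bd (φ a) with hS
  have hRRc : IsClosed RR := isClosed_iUnion_of_finite fun a => (hφ a).1.isClosed
  have hSc : IsClosed S := isClosed_iUnion_of_finite fun a => (hφ a).1.isClosed_bd
  have hNo : IsOpen N := isOpen_iUnion fun a => (hφ a).1.op
  have hNR : N ⊆ RR := iUnion_mono fun a => image_subset_range _ _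
  have hRW : RR ⊆ interior F \ Zc Ψ := iUnion_subset fun a => (hφ a).2.1.trans (hφ a).2.2.2.1
  have hW : IsOpen ((Zc Ψ)ᶜ : Set M) := (isClosed_Zc hs).isOpen_compl
  have hWp : (Zc Ψ)ᶜ ⊆ ({Ψ 0}ᶜ : Set M) := by
    rintro y hy h; rw [mem_singleton_iff.1 h] at hy; exact hy p_mem_Zc
  set tame : Set M → ((Fin n → I) → M) → Prop := fun O ψ => Bx n ψ ∧ O ⊆ range ψ ∧ range ψ ⊆ (Zc Ψ)ᶜ ∧
    (∀ a, range ψ ⊆ V a ∨ O ⊆ (range (φ a))ᶜ) ∧ (range ψ ⊆ Uj ∨ O ⊆ N) with htame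
  set small : Set M → Prop := fun O => O ⊆ Lᶜ ∨ ∃ ψ, tame O ψ with hsmall
  have hsm : Sml small := by
    constructor
    · rintro A B - hBA (h | ⟨ψ, h1, h2, h3, h4, h5⟩)
      · exact Or.inl (hBA.trans h)
      · exact Or.inr ⟨ψ, h1, hBA.trans h2, h3, fun a => (h4 a).imp_right hBA.trans, h5.imp_right hBA.trans⟩
    · intro x
      by_cases hx : x ∈ L
      swap
      · exact ⟨Lᶜ, hLc.isOpen_compl, hx, Or.inl subset_rfl⟩
      have hxX : x ∈ XX Ψ := (hLF hx).2
      have hxZ : x ∉ Zc Ψ := Set.disjoint_left.1 hLZ hx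
      set O1 : Fin m → Set M := fun a => if x ∈ range (φ a) then V a else (range (φ a))ᶜ with hO1
      have hO1o : ∀ a, IsOpen (O1 a) := by
        intro a; simp only [hO1]; split_ifs
        exacts [(hφ a).2.2.1, (hφ a).1.isClosed.isOpen_compl]
      have hxO1 : ∀ a, x ∈ O1 a := by
        intro a; simp only [hO1]; split_ifs with h
        exacts [(hφ a).2.1 h, h]
      set O2 : Set M := if x ∈ Uj then Uj else N with hO2
      have hO2o : IsOpen O2 := by simp only [hO2]; split_ifs; exacts [hj.op, hNo]
      have hxO2 : x ∈ O2 := by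
        simp only [hO2]; split_ifs with h
        exacts [h, hcovφ ⟨hx, hxX, h⟩]
      obtain ⟨ψ, hψ, hxψ, hr⟩ := hM.small' ((hW.inter hO2o).inter (isOpen_iInter_of_finite hO1o))
        ⟨⟨hxZ, hxO2⟩, mem_iInter.2 hxO1⟩
      have h0 : ψ '' oc n ⊆ range ψ := image_subset_range _ _
      refine ⟨ψ '' oc n, hψ.op, hxψ, Or.inr ⟨ψ, hψ, h0, fun y hy => (hr hy).1.1, fun a => ?_, ?_⟩⟩
      · have ha : range ψ ⊆ O1 a := fun y hy => mem_iInter.1 (hr hy).2 a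
        simp only [hO1] at ha
        split_ifs at ha
        exacts [Or.inl ha, Or.inr (h0.trans ha)]
      · have ha : range ψ ⊆ O2 := fun y hy => (hr hy).1.2
        simp only [hO2] at ha
        split_ifs at ha
        exacts [Or.inl ha, Or.inr (h0.trans ha)]
  obtain ⟨ζs, hζ1, hζ2⟩ := faces_fin φ (fun a => (hφ a).1)
  obtain ⟨L', hL'c, hL'L, hSc', hgood⟩ := hL small hsm ζs hζ1 S hζ2
  obtain ⟨Q, O, hQ, hQd, hO, hΛO, hOQ, hOJ⟩ := hSc'.extract (hL'c.inter hSc)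
  set J : Set ℕ := {b | (Q b ∩ L).Nonempty} with hJ
  have hJs : ∀ b, ∃ ψ, b ∈ J → tame (Q b) ψ := by
    intro b
    by_cases hb : b ∈ J
    · rcases (hQ b).2 with h | ⟨ψ, h⟩
      · obtain ⟨y, hy, hyL⟩ := hb
        exact absurd hyL (h hy)
      · exact ⟨ψ, fun _ => h⟩
    · exact ⟨fun _ => Classical.arbitrary M, fun h => absurd h hb⟩
  choose ψ hψ using hJs
  set B := ⋃ b ∈ J, O ∩ Q b with hB
  have hBJ := hOJ J
  set Q' : ℕ → Set M := fun b => if b ∈ J then Q b else ∅ with hQ'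
  have hQ'J : ∀ b x, x ∈ Q' b → b ∈ J ∧ x ∈ Q b := by
    intro b x hx
    simp only [hQ'] at hx
    split_ifs at hx with h
    · exact ⟨h, hx⟩
    · exact absurd hx (notMem_empty x)
  have hQ'o : ∀ b, IsOpen (Q' b) := by
    intro b; simp only [hQ']; split_ifs; exacts [(hQ b).1, isOpen_empty]
  refine ⟨_, _, hgood, hj.merge (κ := ℕ) hs hsc hpc hwj (A := pc φ) (V := V) (RR := RR) (Q := Q') (C := fun b => range (ψ b))
    (D := fun b => cctr (ψ b) 0) (c := fun b => ψ b 0) (O := B) (isOpen_pc fun a => (hφ a).1) pc_disj ?_ ?_ hRRc ?_ ?_ hQ'o ?_ ?_ ?_ ?_ ?_ ?_ ?_ ?_ ?_ ?_ ?_, ?_⟩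
  · exact fun a => ((pc_subset a).trans (image_subset_range _ _)).trans (hφ a).2.1
  · exact fun a => (hφ a).2.2.2.2 _ (fun x hx => hYj (hWp hx.2))
  · exact fun a => ((pc_subset a).trans (image_subset_range _ _)).trans (subset_iUnion (fun a => range (φ a)) a)
  · exact Set.disjoint_left.2 fun x hx hz => (hRW hx).2 hz
  · intro a b hab
    exact Set.disjoint_left.2 fun x hx hx' => Set.disjoint_left.1 (hQd a b hab) (hQ'J a x hx).2 (hQ'J b x hx').2
  · intro b
    by_cases hb : b ∈ J
    · refine ((hψ b hb).1.cctr_cont 0).mono ?_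
      rintro ⟨x, t⟩ ⟨hx, ht⟩
      exact ⟨(hψ b hb).2.1 (hQ'J b x hx).2, trivial⟩
    · have : Q' b = ∅ := by simp only [hQ']; rw [if_neg hb]
      rw [this]; simp
  · intro b x hx
    obtain ⟨hb, hx'⟩ := hQ'J b x hx
    exact (hψ b hb).1.cctr_zero 0 ((hψ b hb).2.1 hx')
  · intro b x hx
    exact cctr_one _ _ _
  · intro b z hz
    exact mem_range_self _
  · rintro b ⟨x, hx⟩
    exact ((hψ b (hQ'J b x hx).1).2.2.1.trans hWp).trans hYj
  · intro b
    refine Set.disjoint_left.2 fun x hx hz => ?_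
    obtain ⟨hb, hx'⟩ := hQ'J b x hx
    exact (hψ b hb).2.2.1 ((hψ b hb).2.1 hx') hz
  · rintro a b ⟨x, hx, hxa⟩
    obtain ⟨hb, hx'⟩ := hQ'J b x hx
    refine ((hψ b hb).2.2.2.1 a).resolve_right fun h => h hx' ?_
    exact image_subset_range _ _ (pc_subset a hxa)
  · rintro b ⟨x, hx, hxU⟩
    obtain ⟨hb, hx'⟩ := hQ'J b x hx
    have := ((hψ b hb).2.2.2.2).resolve_right fun h => hxU.2 (hNR (h hx'))
    exact fun y hy => ⟨this hy, (hψ b hb).2.2.1 hy⟩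
  · exact isOpen_biUnion fun b _ => hO.inter (hQ b).1
  · intro x hx
    obtain ⟨b, hb, hxb⟩ := mem_iUnion₂.1 (hBJ hx)
    exact mem_iUnion.2 ⟨b, by simp only [hQ']; rw [if_pos hb]; exact hxb⟩
  · intro x hx
    by_cases hxR : x ∈ RR
    · by_cases hxL : x ∈ L'
      swap
      · exact Or.inl (Or.inl ⟨(hRW hxR).1, hxL⟩)
      by_cases hxS : x ∈ S
      swap
      · exact Or.inr (Or.inr (Or.inl (iUnion_pc x hxR hxS)))
      have hxO := hΛO ⟨hxL, hxS⟩
      obtain ⟨b, hxb⟩ := mem_iUnion.1 (hOQ (subset_closure hxO))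
      exact Or.inr (Or.inr (Or.inr (mem_iUnion₂.2 ⟨b, ⟨x, hxb, hL'L hxL⟩, hxO, hxb⟩)))
    · by_cases hxj : x ∈ Uj
      · exact Or.inr (Or.inl ⟨hxj, hxR⟩)
      · refine Or.inl (Or.inl ⟨hXF ⟨hx, hxj⟩, fun h => hxR (hNR (hcovφ ⟨hL'L h, hx, hxj⟩))⟩)

end
end CS

open scoped Topology
namespace CS
set_option linter.all false
open Set unitInterval

section
variable {M : Type*} [TopologicalSpace M] [T2Space M] {n : ℕ}

/-- coordinate gauge of the cube around `u` -/
noncomputable def dg (u x : Fin n → I) : Fin n → ℝ := fun i =>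
  max (((x i : ℝ) - u i) / (1 - u i)) (((u i : ℝ) - x i) / u i)

theorem oc_coord {u : Fin n → I} (hu : u ∈ oc n) (i : Fin n) : 0 < (u i : ℝ) ∧ (u i : ℝ) < 1 := by
  have := (mem_bx.1 hu) i
  exact ⟨this.1, this.2⟩

theorem continuous_dg (u : Fin n → I) : Continuous (dg u) := by
  unfold dg
  refine continuous_pi fun i => ?_
  refine Continuous.max ?_ ?_ <;> exact Continuous.div_const (by fun_prop) _

theorem dg_nonneg {u : Fin n → I} (hu : u ∈ oc n) (x : Fin n → I) (i : Fin n) : 0 ≤ dg u x i := by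
  obtain ⟨h0, h1⟩ := oc_coord hu i
  unfold dg
  rcases le_total (u i : ℝ) (x i) with h | h
  · exact le_max_of_le_left (div_nonneg (by linarith) (by linarith))
  · exact le_max_of_le_right (div_nonneg (by linarith) (by linarith))

theorem dg_le {u : Fin n → I} (hu : u ∈ oc n) (x : Fin n → I) (i : Fin n) : dg u x i ≤ ‖dg u x‖ :=
  (le_abs_self _).trans (norm_le_pi_norm (dg u x) i)

theorem dg_norm_le {u : Fin n → I} (hu : u ∈ oc n) (x : Fin n → I) : ‖dg u x‖ ≤ 1 := by
  rw [pi_norm_le_iff_of_nonneg zero_le_one]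
  intro i
  obtain ⟨h0, h1⟩ := oc_coord hu i
  rw [Real.norm_of_nonneg (dg_nonneg hu x i)]
  unfold dg
  refine max_le ?_ ?_
  · rw [div_le_one (by linarith)]; linarith [(x i).2.2]
  · rw [div_le_one (by linarith)]; linarith [(x i).2.1]

theorem dg_attain {u : Fin n → I} (hu : u ∈ oc n) {x : Fin n → I} (hx : 0 < ‖dg u x‖) : ∃ i, dg u x i = ‖dg u x‖ := by
  by_contra! h
  have : ‖dg u x‖ < ‖dg u x‖ := by
    rw [pi_norm_lt_iff hx]
    intro i
    rw [Real.norm_of_nonneg (dg_nonneg hu x i)]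
    exact lt_of_le_of_ne (dg_le hu x i) (h i)
  exact lt_irrefl _ this

theorem dg_pos {u : Fin n → I} (hu : u ∈ oc n) {x : Fin n → I} (hx : x ≠ u) : 0 < ‖dg u x‖ := by
  obtain ⟨i, hi⟩ := Function.ne_iff.1 hx
  obtain ⟨h0, h1⟩ := oc_coord hu i
  refine lt_of_lt_of_le ?_ (dg_le hu x i)
  unfold dg
  have hi' : (x i : ℝ) ≠ u i := fun h => hi (Subtype.ext h)
  rcases lt_or_gt_of_ne hi' with h | h
  · exact lt_max_of_lt_right (div_pos (by linarith) (by linarith))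
  · exact lt_max_of_lt_left (div_pos (by linarith) (by linarith))

theorem dg_one {u : Fin n → I} (hu : u ∈ oc n) {x : Fin n → I} (hx : x ∉ oc n) : ‖dg u x‖ = 1 := by
  refine le_antisymm (dg_norm_le hu x) ?_
  have : ∃ i, x i = 0 ∨ x i = 1 := by
    by_contra! h
    exact hx (mem_bx.2 fun i => ⟨lt_of_le_of_ne (x i).2.1 (Ne.symm (h i).1), lt_of_le_of_ne (x i).2.2 (h i).2⟩)
  obtain ⟨i, hi⟩ := this
  obtain ⟨h0, h1⟩ := oc_coord hu i
  refine le_trans ?_ (dg_le hu x i)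
  unfold dg
  rcases hi with h | h
  · refine le_max_of_le_right ?_
    rw [h]; simp [h0.ne']
  · refine le_max_of_le_left ?_
    rw [h]; simp [(sub_pos.2 h1).ne']

/-- radial push inside the cube -/
noncomputable def psh (u : Fin n → I) (z : (Fin n → I) × ℝ) : Fin n → I := fun i =>
  projIcc 0 1 zero_le_one ((u i : ℝ) + ((z.1 i : ℝ) - u i) * ((1 - z.2) + z.2 / ‖dg u z.1‖))

theorem psh_cont {u : Fin n → I} (hu : u ∈ oc n) : ContinuousOn (psh u) ({u}ᶜ ×ˢ univ) := by
  unfold psh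
  refine continuousOn_pi.2 fun i => ?_
  refine continuous_projIcc.comp_continuousOn ?_
  have h1 : ContinuousOn (fun z : (Fin n → I) × ℝ => z.2 / ‖dg u z.1‖) ({u}ᶜ ×ˢ univ) := by
    refine ContinuousOn.div continuousOn_snd ?_ ?_
    · exact ((continuous_dg u).comp continuous_fst).norm.continuousOn
    · rintro ⟨x, t⟩ ⟨hx, -⟩
      exact (dg_pos hu hx).ne'
  have h2 : Continuous (fun z : (Fin n → I) × ℝ => (z.1 i : ℝ)) := by fun_prop
  exact continuousOn_const.add ((h2.continuousOn.sub continuousOn_const).mul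
    ((continuousOn_const.sub continuousOn_snd).add h1))

theorem psh_zero (u x : Fin n → I) : psh u (x, 0) = x := by
  funext i
  simp only [psh]
  have : (u i : ℝ) + ((x i : ℝ) - u i) * ((1 - 0) + 0 / ‖dg u x‖) = x i := by simp
  rw [this, projIcc_val]

theorem psh_out {u : Fin n → I} (hu : u ∈ oc n) {x : Fin n → I} (hx : x ∉ oc n) (t : ℝ) : psh u (x, t) = x := by
  funext i
  simp only [psh]
  have : (u i : ℝ) + ((x i : ℝ) - u i) * ((1 - t) + t / ‖dg u x‖) = x i := by rw [dg_one hu hx]; ring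
  rw [this, projIcc_val]

theorem psh_one {u : Fin n → I} (hu : u ∈ oc n) {x : Fin n → I} (hx : x ≠ u) : psh u (x, 1) ∉ oc n := by
  have hp := dg_pos hu hx
  obtain ⟨i, hi⟩ := dg_attain hu hp
  obtain ⟨h0, h1⟩ := oc_coord hu i
  intro h
  have h' := (mem_bx.1 h) i
  simp only [psh] at h'
  set g := ‖dg u x‖ with hg
  unfold dg at hi
  rcases max_choice (((x i : ℝ) - u i) / (1 - u i)) (((u i : ℝ) - x i) / u i) with hm | hm
  · rw [hm] at hi
    have e : (x i : ℝ) - u i = g * (1 - u i) := by rw [← hi]; field_simp [(sub_pos.2 h1).ne']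
    have : (u i : ℝ) + ((x i : ℝ) - u i) * ((1 - 1) + 1 / g) = 1 := by
      rw [e]; field_simp; ring
    rw [this, projIcc_right] at h'
    exact lt_irrefl _ h'.2
  · rw [hm] at hi
    have e : (u i : ℝ) - x i = g * u i := by rw [← hi]; field_simp
    have e' : (x i : ℝ) - u i = - (g * u i) := by linarith
    have : (u i : ℝ) + ((x i : ℝ) - u i) * ((1 - 1) + 1 / g) = 0 := by
      rw [e']; field_simp; ring
    rw [this, projIcc_left] at h'
    exact lt_irrefl _ h'.1

theorem co_closed {A Z : Type*} [TopologicalSpace A] [TopologicalSpace Z] {f : A → Z} {T K K' : Set A} (hK : IsClosed K) (hK' : IsClosed K')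
    (h : ContinuousOn f (T ∩ K)) (h' : ContinuousOn f (T ∩ K')) (hT : T ⊆ K ∪ K') : ContinuousOn f T := by
  have key : ∀ (K : Set A), IsClosed K → ContinuousOn f (T ∩ K) → ∀ z ∈ T, ContinuousWithinAt f (T ∩ K) z := by
    intro K hK hc z hz
    by_cases hzK : z ∈ K
    · exact hc z ⟨hz, hzK⟩
    · have : 𝓝[T ∩ K] z = ⊥ := by
        rw [← notMem_closure_iff_nhdsWithin_eq_bot]
        exact fun h => hzK (hK.closure_subset_iff.2 inter_subset_right h)
      unfold ContinuousWithinAt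
      rw [this]; exact Filter.tendsto_bot
  intro z hz
  have := (key K hK h z hz).union (key K' hK' h' z hz)
  rwa [← inter_union_distrib_left, inter_eq_left.2 hT] at this

variable {φ : (Fin n → I) → M}

theorem Bx.push (h : Bx n φ) {u : Fin n → I} (hu : u ∈ oc n) : ∃ K : M × ℝ → M,
    ContinuousOn K ({φ u}ᶜ ×ˢ univ) ∧ (∀ z, K (z, 0) = z) ∧ (∀ z t, z ∉ φ '' oc n → K (z, t) = z) ∧
    (∀ z ∈ range φ, ∀ t, K (z, t) ∈ range φ) ∧ ∀ z ∈ φ '' oc n, z ≠ φ u → K (z, 1) ∈ bd φ := by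
  classical
  set K : M × ℝ → M := fun z => if z.1 ∈ range φ then φ (psh u (cinv φ z.1, z.2)) else z.1 with hK
  have hKr : ∀ v t, K (φ v, t) = φ (psh u (v, t)) := by
    intro v t
    simp only [hK]
    rw [if_pos (mem_range_self v), h.cinv_apply]
  have hKo : ∀ z t, z ∉ φ '' oc n → K (z, t) = z := by
    intro z t hz
    by_cases hzr : z ∈ range φ
    · obtain ⟨v, rfl⟩ := hzr
      rw [hKr, psh_out hu fun h => hz ⟨v, h, rfl⟩]
    · simp only [hK]; rw [if_neg hzr]
  refine ⟨K, ?_, ?_, hKo, ?_, ?_⟩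
  · refine co_closed (K := range φ ×ˢ univ) (K' := (φ '' oc n)ᶜ ×ˢ univ) (h.isClosed.prod isClosed_univ)
      (h.op.isClosed_compl.prod isClosed_univ) ?_ ?_ ?_
    · have h1 : ContinuousOn (fun z : M × ℝ => φ (psh u (cinv φ z.1, z.2))) (({φ u}ᶜ ×ˢ univ) ∩ range φ ×ˢ univ) := by
        refine h.cont.comp_continuousOn ((psh_cont hu).comp (f := fun z : M × ℝ => (cinv φ z.1, z.2)) ?_ ?_)
        · refine ContinuousOn.prodMk ?_ continuousOn_snd
          exact h.cinv_cont.comp continuousOn_fst (fun z hz => hz.2.1)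
        · rintro ⟨x, t⟩ ⟨⟨hx, -⟩, ⟨v, hv⟩, -⟩
          subst hv
          refine ⟨?_, trivial⟩
          simp only [h.cinv_apply]
          exact fun h => hx (by rw [mem_singleton_iff.1 h]; rfl)
      refine h1.congr ?_
      rintro ⟨x, t⟩ ⟨-, hx, -⟩
      simp only [hK]; rw [if_pos hx]
    · refine continuousOn_fst.congr ?_
      rintro ⟨x, t⟩ ⟨-, hx, -⟩
      exact hKo x t hx
    · rintro ⟨x, t⟩ -
      by_cases hx : x ∈ φ '' oc n
      · exact Or.inl ⟨image_subset_range _ _ hx, trivial⟩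
      · exact Or.inr ⟨hx, trivial⟩
  · intro z
    by_cases hzr : z ∈ range φ
    · obtain ⟨v, rfl⟩ := hzr
      rw [hKr, psh_zero]
    · simp only [hK]; rw [if_neg hzr]
  · rintro z ⟨v, rfl⟩ t
    rw [hKr]; exact mem_range_self _
  · rintro z ⟨v, hv, rfl⟩ hne
    rw [hKr]
    exact ⟨_, psh_one hu (fun h => hne (by rw [h])), rfl⟩

theorem dense_oc : Dense (oc n) := by
  have h : Dense (Ioo (0:I) 1) := by
    rw [dense_iff_closure_eq, closure_Ioo zero_ne_one]
    ext x; simp only [mem_Icc, mem_univ, iff_true]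
    exact ⟨x.2.1, x.2.2⟩
  have : oc n = Set.pi univ fun _ => Ioo (0:I) 1 := by
    ext x
    simp only [oc, mem_bx, mem_pi, mem_univ, true_imp_iff, mem_Ioo]
    rfl
  rw [this]
  exact dense_pi _ fun _ _ => h

theorem Bx.dense_compl_bd (h : Bx n φ) : Dense (bd φ)ᶜ := by
  rw [← interior_eq_empty_iff_dense_compl, eq_empty_iff_forall_notMem]
  intro x hx
  obtain ⟨v, hv, rfl⟩ := interior_subset hx
  have ho : IsOpen (φ ⁻¹' interior (bd φ)) := isOpen_interior.preimage h.cont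
  obtain ⟨w, hw, hwo⟩ := dense_oc.inter_open_nonempty _ ho ⟨v, hx⟩
  obtain ⟨w', hw', e⟩ := interior_subset hw
  rw [h.inj e] at hw'
  exact hw' hwo

/-- unions over lists -/
def lo (l : List ((Fin n → I) → M)) : Set M := {x | ∃ φ ∈ l, x ∈ φ '' oc n}
def lb (l : List ((Fin n → I) → M)) : Set M := {x | ∃ φ ∈ l, x ∈ bd φ}

theorem lo_cons (φ : (Fin n → I) → M) (l) : lo (φ :: l) = φ '' oc n ∪ lo l := by
  ext x; simp [lo]
theorem lb_cons (φ : (Fin n → I) → M) (l) : lb (φ :: l) = bd φ ∪ lb l := by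
  ext x; simp [lb]

inductive Rch (Y P : Set M) : List ((Fin n → I) → M) → Prop
  | nil : Rch Y P []
  | cons (φ : (Fin n → I) → M) (l : List ((Fin n → I) → M)) : Rch Y P l → Bx n φ → range φ ⊆ Y →
      (φ '' oc n ∩ (P ∪ lo l)).Nonempty → Rch Y P (φ :: l)

theorem Rch.all {Y P : Set M} {l : List ((Fin n → I) → M)} (h : Rch Y P l) : ∀ φ ∈ l, Bx n φ ∧ range φ ⊆ Y := by
  induction h with
  | nil => simp
  | cons φ l h1 h2 h3 h4 ih =>
    intro ψ hψ
    rcases List.mem_cons.1 hψ with rfl | h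
    exacts [⟨h2, h3⟩, ih ψ h]

theorem Rch.append {Y P : Set M} {l l' : List ((Fin n → I) → M)} (h : Rch Y P l) (h' : Rch Y P l') : Rch Y P (l ++ l') := by
  induction h with
  | nil => exact h'
  | cons φ l h1 h2 h3 h4 ih =>
    refine Rch.cons φ _ ih h2 h3 (h4.mono (inter_subset_inter_right _ (union_subset_union_right _ ?_)))
    rintro x ⟨ψ, hψ, hx⟩
    exact ⟨ψ, List.mem_append_left _ hψ, hx⟩

theorem isOpen_lo {l : List ((Fin n → I) → M)} (h : ∀ φ ∈ l, Bx n φ) : IsOpen (lo l) := by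
  have : lo l = ⋃ φ ∈ {φ | φ ∈ l}, φ '' oc n := by ext x; simp [lo]
  rw [this]; exact isOpen_biUnion fun φ hφ => (h φ hφ).op

theorem dense_lb {l : List ((Fin n → I) → M)} (h : ∀ φ ∈ l, Bx n φ) : Dense (lb l)ᶜ ∧ IsClosed (lb l) := by
  induction l with
  | nil =>
    have : lb ([] : List ((Fin n → I) → M)) = ∅ := by ext; simp [lb]
    rw [this]; simp
  | cons φ l ih =>
    obtain ⟨h1, h2⟩ := ih fun ψ hψ => h ψ (List.mem_cons_of_mem _ hψ)
    have hφ := h φ List.mem_cons_self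
    rw [lb_cons, compl_union]
    exact ⟨hφ.dense_compl_bd.inter_of_isOpen_right h1 h2.isOpen_compl, hφ.isClosed_bd.union h2⟩

theorem Rch.push {Y P X : Set M} {l : List ((Fin n → I) → M)} (h : Rch Y P l) (hXY : X ⊆ Y) (hP : IsOpen P) (hPX : Disjoint P X) :
    ∃ Ξ : M × ℝ → M, ContinuousOn Ξ (X ×ˢ Icc 0 1) ∧ (∀ x ∈ X, Ξ (x, 0) = x) ∧ MapsTo Ξ (X ×ˢ Icc 0 1) Y ∧
      ∀ x ∈ X, Ξ (x, 1) ∈ (X \ lo l) ∪ lb l := by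
  induction h with
  | nil => exact ⟨Prod.fst, continuousOn_fst, fun x _ => rfl, fun z hz => hXY hz.1, fun x hx => Or.inl ⟨hx, by simp [lo]⟩⟩
  | cons φ l h1 h2 h3 h4 ih =>
    obtain ⟨Ξ, g1, g2, g3, g4⟩ := ih
    have hl := fun ψ hψ => (h1.all ψ hψ).1
    obtain ⟨o, ⟨⟨u, hu, rfl⟩, ho2⟩, ho3⟩ := (dense_lb hl).1.inter_open_nonempty _ (h2.op.inter (hP.union (isOpen_lo hl))) h4
    have hmiss : ∀ x ∈ X, Ξ (x, 1) ≠ φ u := by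
      intro x hx he
      rcases g4 x hx with h | h
      · rw [he] at h
        rcases ho2 with h' | h'
        exacts [Set.disjoint_left.1 hPX h' h.1, h.2 h']
      · rw [he] at h; exact ho3 h
    obtain ⟨K, k1, k2, k3, k4, k5⟩ := h2.push hu
    have hKY : ∀ z ∈ Y, ∀ t, K (z, t) ∈ Y := by
      intro z hz t
      by_cases hz' : z ∈ range φ
      · exact h3 (k4 z hz' t)
      · rw [k3 z t fun h => hz' (image_subset_range _ _ h)]; exact hz
    refine ⟨hcat Ξ (fun z => K (Ξ (z.1, 1), z.2)), hcat_cont g1 ?_ ?_, ?_, hcat_mapsTo g3 ?_, ?_⟩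
    · refine k1.comp (f := fun z : M × ℝ => (Ξ (z.1, 1), z.2)) (ContinuousOn.prodMk ?_ continuousOn_snd) ?_
      · exact g1.comp (f := fun z : M × ℝ => (z.1, (1:ℝ))) (by fun_prop) (fun z hz => ⟨hz.1, by simp⟩)
      · rintro ⟨x, t⟩ ⟨hx, ht⟩
        exact ⟨hmiss x hx, trivial⟩
    · intro x hx; rw [k2]
    · intro x hx; rw [hcat_zero, g2 x hx]
    · rintro ⟨x, t⟩ ⟨hx, ht⟩
      exact hKY (Ξ (x, 1)) (g3 (show ((x, (1:ℝ)) : M × ℝ) ∈ X ×ˢ Icc 0 1 from ⟨hx, by simp⟩)) t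
    · intro x hx
      rw [hcat_one, lo_cons, lb_cons]
      show K (Ξ (x, 1), 1) ∈ _
      by_cases hz : Ξ (x, 1) ∈ φ '' oc n
      · exact Or.inr (Or.inl (k5 _ hz (hmiss x hx)))
      · rw [k3 _ _ hz]
        rcases g4 x hx with h | h
        · exact Or.inl ⟨h.1, fun h' => h'.elim hz h.2⟩
        · exact Or.inr (Or.inr h)

/-- shelling -/
theorem shell (hM : Mf n M) {Y P X : Set M} (hY : IsPreconnected Y) (hYo : IsOpen Y) (hX : IsCompact X) (hXY : X ⊆ Y) (hP : IsOpen P)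
    (hPX : Disjoint P X) (hne : (P ∩ Y).Nonempty) :
    ∃ (m : ℕ) (φ : Fin m → (Fin n → I) → M), (∀ a, Bx n (φ a) ∧ range (φ a) ⊆ Y) ∧
    ∃ Ξ : M × ℝ → M, ContinuousOn Ξ (X ×ˢ Icc 0 1) ∧ (∀ x ∈ X, Ξ (x, 0) = x) ∧ MapsTo Ξ (X ×ˢ Icc 0 1) Y ∧
      ∀ x ∈ X, Ξ (x, 1) ∈ ⋃ a, bd (φ a) := by
  set LL := {l : List ((Fin n → I) → M) // Rch Y P l} with hLL
  have hlo : ∀ l : LL, IsOpen (lo l.1) := fun l => isOpen_lo fun ψ hψ => (l.2.all ψ hψ).1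
  set T := P ∪ ⋃ l : LL, lo l.1 with hT
  have hTo : IsOpen T := hP.union (isOpen_iUnion hlo)
  have hstep : ∀ φ : (Fin n → I) → M, Bx n φ → range φ ⊆ Y → (φ '' oc n ∩ T).Nonempty → φ '' oc n ⊆ T := by
    rintro φ hφ hr ⟨y, hy, hyT⟩ x hx
    have : ∃ l : LL, y ∈ P ∪ lo l.1 := by
      rcases hyT with h | h
      · exact ⟨⟨[], Rch.nil⟩, Or.inl h⟩
      · obtain ⟨l, hl⟩ := mem_iUnion.1 h
        exact ⟨l, Or.inr hl⟩
    obtain ⟨l, hl⟩ := this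
    refine Or.inr (mem_iUnion.2 ⟨⟨φ :: l.1, Rch.cons φ _ l.2 hφ hr ⟨y, hy, hl⟩⟩, ?_⟩)
    rw [lo_cons]; exact Or.inl hx
  have hYT : Y ⊆ T := by
    set T' := ⋃ φ ∈ {φ : (Fin n → I) → M | Bx n φ ∧ range φ ⊆ Y ∧ ¬ (φ '' oc n ∩ T).Nonempty}, φ '' oc n with hT'
    have hT'o : IsOpen T' := isOpen_biUnion fun φ hφ => hφ.1.op
    have hcov : Y ⊆ T ∪ T' := by
      intro x hx
      obtain ⟨φ, h1, h2, h3⟩ := hM.small' hYo hx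
      by_cases h : (φ '' oc n ∩ T).Nonempty
      · exact Or.inl (hstep φ h1 h3 h h2)
      · exact Or.inr (mem_iUnion₂.2 ⟨φ, ⟨h1, h3, h⟩, h2⟩)
    refine hY.subset_left_of_subset_union hTo hT'o ?_ hcov ?_
    · refine Set.disjoint_left.2 fun x hx hx' => ?_
      obtain ⟨φ, hφ, hxφ⟩ := mem_iUnion₂.1 hx'
      exact hφ.2.2 ⟨x, hxφ, hx⟩
    · obtain ⟨x, hx, hxY⟩ := hne
      exact ⟨x, hxY, Or.inl hx⟩
  have hXl : X ⊆ ⋃ l : LL, lo l.1 := fun x hx =>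
    (hYT (hXY hx)).resolve_left fun h => Set.disjoint_left.1 hPX h hx
  haveI : Nonempty LL := ⟨⟨[], Rch.nil⟩⟩
  obtain ⟨l, hl⟩ := hX.elim_directed_cover (fun l : LL => lo l.1) hlo hXl (by
    intro l l'
    refine ⟨⟨l.1 ++ l'.1, l.2.append l'.2⟩, ?_, ?_⟩
    · rintro x ⟨φ, hφ, hx⟩; exact ⟨φ, List.mem_append_left _ hφ, hx⟩
    · rintro x ⟨φ, hφ, hx⟩; exact ⟨φ, List.mem_append_right _ hφ, hx⟩)
  obtain ⟨Ξ, g1, g2, g3, g4⟩ := l.2.push hXY hP hPX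
  refine ⟨l.1.length, fun a => l.1.get a, fun a => l.2.all _ (List.get_mem _ _), Ξ, g1, g2, g3, fun x hx => ?_⟩
  rcases g4 x hx with h | ⟨φ, hφ, h⟩
  · exact absurd (hl h.1) h.2
  · obtain ⟨a, rfl⟩ := List.mem_iff_get.1 hφ
    exact mem_iUnion.2 ⟨a, h⟩

end
end CS

open scoped Topology
namespace CS
set_option linter.all false
open Set unitInterval

section
variable {M : Type*} [TopologicalSpace M]

theorem Ctr.sum {ι : Type*} {V : ι → Set M} {S Y : Set M} (hV : ∀ j, IsOpen (V j))
    (hd : ∀ i j, i ≠ j → Disjoint (V i) (V j)) (hY : IsPathConnected Y) (h : ∀ j, Ctr (V j ∩ S) Y) :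
    Ctr ((⋃ j, V j) ∩ S) Y := by
  classical
  obtain ⟨y, hy, -⟩ := id hY
  choose K k1 k2 k3 k4 using fun j => (h j).to hY hy
  set G : M × ℝ → M := fun z => if hz : ∃ j, z.1 ∈ V j then K hz.choose z else z.1 with hG
  have hGV : ∀ j, ∀ x ∈ V j, ∀ t, G (x, t) = K j (x, t) := by
    intro j x hx t
    have hex : ∃ j, x ∈ V j := ⟨j, hx⟩
    have : hex.choose = j := by
      by_contra hne
      exact Set.disjoint_left.1 (hd _ _ hne) hex.choose_spec hx
    simp only [hG]
    rw [dif_pos hex, this]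
  refine ⟨G, y, ?_, ?_, ?_, ?_⟩
  · have e : ((⋃ j, V j) ∩ S) ×ˢ Icc (0:ℝ) 1 = (⋃ j, V j ×ˢ (univ : Set ℝ)) ∩ (S ×ˢ Icc 0 1) := by
      ext ⟨x, t⟩; simp; tauto
    rw [e]
    refine co_iUnion (fun j => (hV j).prod isOpen_univ) fun j => ?_
    rw [prod_inter_prod, univ_inter]
    exact (k1 j).congr fun z hz => hGV j z.1 hz.1.1 z.2
  · rintro x ⟨hx, hS⟩
    obtain ⟨j, hj⟩ := mem_iUnion.1 hx
    rw [hGV j x hj, k2 j x ⟨hj, hS⟩]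
  · rintro x ⟨hx, hS⟩
    obtain ⟨j, hj⟩ := mem_iUnion.1 hx
    rw [hGV j x hj, k3 j x ⟨hj, hS⟩]
  · rintro ⟨x, t⟩ ⟨⟨hx, hS⟩, ht⟩
    obtain ⟨j, hj⟩ := mem_iUnion.1 hx
    rw [hGV j x hj]
    exact k4 j ⟨⟨hj, hS⟩, ht⟩

variable [T2Space M] [CompactSpace M] [Nonempty M] {n : ℕ} {Ψ : OpenPartialHomeomorph (Eu n) M}

/-- swapping step over a union of cell boundaries -/
theorem sstep (hM : Mf n M) (hs : Ψ.source = Metric.ball 0 2) (hpu : IsPathConnected (univ : Set M))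
    {Y : Set M} (hY : IsPathConnected Y) (hYp : {Ψ 0}ᶜ ⊆ Y) (hpe : ({Ψ 0}ᶜ : Set M).Nonempty)
    {m : ℕ} {φ : Fin m → (Fin n → I) → M} (hφ : ∀ a, Bx n (φ a) ∧ range (φ a) ⊆ {Ψ 0}ᶜ)
    {S : Set M} (hSd : S = ⋃ a, bd (φ a)) {C D : Set M} (hC : IsOpen C) (hD : IsOpen D) (hcov : S ⊆ C ∪ D)
    (cC : Ctr (C ∩ S) univ) (cD : Ctr (D ∩ S) Y) :
    ∃ C' D', IsOpen C' ∧ IsOpen D' ∧ S ⊆ C' ∪ D' ∧ Ctr (C' ∩ S) {Ψ 0}ᶜ ∧ Ctr (D' ∩ S) Y := by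
  classical
  have hSc : IsClosed S := by rw [hSd]; exact isClosed_iUnion_of_finite fun a => (hφ a).1.isClosed_bd
  have hSp : S ⊆ {Ψ 0}ᶜ := by
    rw [hSd]; exact iUnion_subset fun a => (image_subset_range _ _).trans (hφ a).2
  obtain ⟨y, hy⟩ := hpe
  obtain ⟨H, h1, h2, h3, -⟩ := cC.to hpu (mem_univ y)
  obtain ⟨G, hG, hXG, hGU⟩ := normal_exists_closure_subset (hSc.sdiff hD) hC
    (fun x hx => (hcov hx.1).resolve_right hx.2)
  set F := closure G with hF
  have hXF : S \ D ⊆ interior F := hXG.trans (interior_maximal subset_closure hG)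
  have hFS : F ∩ S ⊆ C ∩ S := inter_subset_inter_left _ hGU
  obtain ⟨L, -, -, -, hL⟩ := CS.perturb Ψ hs (A := F ∩ S) (A0 := ∅) (h := H)
    (isClosed_closure.inter hSc) isClosed_empty (empty_subset _) (h1.mono (prod_mono_left hFS))
    (fun x hx => by rw [h2 x (hFS hx)]; exact hSp hx.2)
    (fun x hx => by rw [h3 x (hFS hx)]; exact hy) (fun x hx => absurd hx (notMem_empty x))
  set tame : Set M → Prop := fun Q => (∃ ψ, Bx n ψ ∧ Q ⊆ range ψ ∧ range ψ ⊆ {Ψ 0}ᶜ) ∧ (Q ⊆ interior F ∨ Q ⊆ D) with htame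
  set small : Set M → Prop := fun Q => Q ⊆ Sᶜ ∨ tame Q with hsmall
  have hsm : Sml small := by
    constructor
    · rintro A B - hBA (h | ⟨⟨ψ, a1, a2, a3⟩, a4⟩)
      · exact Or.inl (hBA.trans h)
      · exact Or.inr ⟨⟨ψ, a1, hBA.trans a2, a3⟩, a4.imp hBA.trans hBA.trans⟩
    · intro x
      by_cases hx : x ∈ S
      swap
      · exact ⟨Sᶜ, hSc.isOpen_compl, hx, Or.inl subset_rfl⟩
      have : ∃ O, IsOpen O ∧ x ∈ O ∧ (O ⊆ interior F ∨ O ⊆ D) := by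
        by_cases hxD : x ∈ D
        · exact ⟨D, hD, hxD, Or.inr subset_rfl⟩
        · exact ⟨_, isOpen_interior, hXF ⟨hx, hxD⟩, Or.inl subset_rfl⟩
      obtain ⟨O, hO, hxO, hO'⟩ := this
      obtain ⟨ψ, hψ, hxψ, hr⟩ := hM.small' (isOpen_compl_singleton.inter hO) ⟨hSp hx, hxO⟩
      have h0 : ψ '' oc n ⊆ range ψ := image_subset_range _ _
      have h0' : ψ '' oc n ⊆ O := fun y hy => (hr (h0 hy)).2
      exact ⟨ψ '' oc n, hψ.op, hxψ, Or.inr ⟨⟨ψ, hψ, h0, fun y hy => (hr hy).1⟩, hO'.imp h0'.trans h0'.trans⟩⟩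
  obtain ⟨ζs, hζ1, hζ2⟩ := faces_fin φ (fun a => (hφ a).1)
  obtain ⟨h', k1, k2, k3, -, k5, -, k7⟩ := hL small hsm ζs hζ1 S (by rw [hSd]; exact hζ2)
  set Λ := {x ∈ F ∩ S | ∃ t ∈ Icc (0:ℝ) 1, h' (x, t) = Ψ 0} with hΛ
  have hΛS : Λ ∩ S = Λ := inter_eq_left.2 fun x hx => hx.1.2
  rw [hΛS] at k7
  obtain ⟨Q, O, hQ, hQd, hO, hΛO, hOQ, hOJ⟩ := k7.extract k5
  set J : Set ℕ := {b | (Q b ∩ S).Nonempty ∧ ¬ Q b ⊆ D} with hJ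
  have hJt : ∀ b ∈ J, tame (Q b) := by
    rintro b ⟨⟨x, hx, hxS⟩, -⟩
    exact (hQ b).2.resolve_left fun h => h hx hxS
  have hJF : ∀ b ∈ J, Q b ⊆ interior F := fun b hb => (hJt b hb).2.resolve_right hb.2
  set B := ⋃ b ∈ J, O ∩ Q b with hB
  have hBJ := hOJ J
  set V : Option J → Set M := fun o => o.elim (D \ closure B) fun b => O ∩ Q b.1 with hV
  refine ⟨interior F \ Λ, ⋃ o, V o, isOpen_interior.sdiff k5, ?_, ?_, ?_, ?_⟩
  · refine isOpen_iUnion fun o => ?_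
    rcases o with _ | b
    · exact hD.sdiff isClosed_closure
    · exact hO.inter (hQ _).1
  · intro x hx
    by_cases hxC : x ∈ interior F \ Λ
    · exact Or.inl hxC
    refine Or.inr (mem_iUnion.2 ?_)
    by_cases hxF : x ∈ interior F
    · have hxΛ : x ∈ Λ := by by_contra h; exact hxC ⟨hxF, h⟩
      have hxO := hΛO hxΛ
      obtain ⟨b, hb⟩ := mem_iUnion.1 (hOQ (subset_closure hxO))
      by_cases hbJ : b ∈ J
      · exact ⟨some ⟨b, hbJ⟩, hxO, hb⟩
      · have hbD : Q b ⊆ D := by by_contra h; exact hbJ ⟨⟨x, hb, hx⟩, h⟩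
        refine ⟨none, hbD hb, fun hcl => ?_⟩
        obtain ⟨c, hc, hxc⟩ := mem_iUnion₂.1 (hBJ hcl)
        have : b = c := by by_contra hne; exact Set.disjoint_left.1 (hQd b c hne) hb hxc
        exact hbJ (this ▸ hc)
    · have hxD : x ∈ D := by by_contra h; exact hxF (hXF ⟨hx, h⟩)
      refine ⟨none, hxD, fun hcl => ?_⟩
      obtain ⟨c, hc, hxc⟩ := mem_iUnion₂.1 (hBJ hcl)
      exact hxF (hJF c hc hxc)
  · have hsub : (interior F \ Λ) ∩ S ⊆ F ∩ S := fun x hx => ⟨interior_subset hx.1.1, hx.2⟩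
    refine ⟨h', y, k1.mono (prod_mono_left hsub), ?_, ?_, ?_⟩
    · intro x hx; rw [k2 x (hsub hx), h2 x (hFS (hsub hx))]
    · intro x hx; rw [k3 x (hsub hx), h3 x (hFS (hsub hx))]
    · rintro ⟨x, t⟩ ⟨hx, ht⟩ hp
      exact hx.1.2 ⟨hsub hx, t, ht, hp⟩
  · refine Ctr.sum ?_ ?_ hY ?_
    · intro o
      rcases o with _ | b
      · exact hD.sdiff isClosed_closure
      · exact hO.inter (hQ _).1
    · have hb : ∀ b : J, O ∩ Q b.1 ⊆ closure B := fun b =>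
        (subset_iUnion₂ (s := fun b (_ : b ∈ J) => O ∩ Q b) b.1 b.2).trans subset_closure
      rintro (_ | b) (_ | c) hne
      · exact absurd rfl hne
      · exact Set.disjoint_left.2 fun x hx hx' => hx.2 (hb c hx')
      · exact Set.disjoint_left.2 fun x hx hx' => hx'.2 (hb b hx)
      · exact Set.disjoint_left.2 fun x hx hx' => Set.disjoint_left.1
          (hQd b.1 c.1 fun h => hne (by rw [Subtype.ext h])) hx.2 hx'.2
    · rintro (_ | b)
      · exact cD.mono (inter_subset_inter_left _ diff_subset) subset_rfl
      · obtain ⟨⟨ψ, b1, b2, b3⟩, -⟩ := hJt b.1 b.2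
        exact (b1.ctr (b3.trans hYp)).mono (fun x hx => b2 hx.1.2) subset_rfl
end
end CS

open scoped Topology
namespace CS
set_option linter.all false
open Set unitInterval

section
variable {M : Type*} [TopologicalSpace M] {n : ℕ} {Ψ : OpenPartialHomeomorph (Eu n) M}

/-- straight line towards `nz` -/
noncomputable def ln (v : Eu n) (t : ℝ) : Eu n := (1 - t) • v + t • nz v

theorem ln_props {v : Eu n} (hv : v ≠ 0) {t : ℝ} (ht : t ∈ Icc (0:ℝ) 1) :
    ln v t ≠ 0 ∧ ‖ln v t‖ ≤ max ‖v‖ 1 ∧ nz (ln v t) = nz v := by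
  have h0 : 0 < ‖v‖ := norm_pos_iff.2 hv
  set m := max ‖v‖ 1 with hm
  have hm1 : 1 ≤ m := le_max_right _ _
  have hmv : ‖v‖ ≤ m := le_max_left _ _
  set c := (1 - t) + t * (m / ‖v‖) with hc
  have hcv : ln v t = c • v := by
    simp only [ln, nz, hc, add_smul, smul_smul]; rfl
  have hcn : c * ‖v‖ = (1 - t) * ‖v‖ + t * m := by
    rw [hc]; field_simp
  have hle : ‖v‖ ≤ c * ‖v‖ := by rw [hcn]; nlinarith [ht.1, ht.2]
  have hc0 : 0 < c := by
    by_contra h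
    push Not at h
    nlinarith
  have hn : ‖ln v t‖ = c * ‖v‖ := by rw [hcv, norm_smul, Real.norm_of_nonneg hc0.le]
  have hcm : c * ‖v‖ ≤ m := by rw [hcn]; nlinarith [ht.1, ht.2]
  refine ⟨?_, hn ▸ hcm, ?_⟩
  · rw [hcv]; exact smul_ne_zero hc0.ne' hv
  · have h2 : max (c * ‖v‖) 1 = m := by
      rw [hm] at hcm ⊢
      rcases le_total ‖v‖ 1 with h | h
      · rw [max_eq_right h] at hcm ⊢; exact max_eq_right hcm
      · rw [max_eq_left h] at hcm ⊢
        have : c * ‖v‖ = ‖v‖ := le_antisymm hcm hle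
        rw [this, max_eq_left h]
    unfold nz
    rw [hn, h2, hcv, smul_smul]
    congr 1
    field_simp
    exact hm

open Classical in
/-- radial homotopy from the identity to `rr` -/
noncomputable def rh (Ψ : OpenPartialHomeomorph (Eu n) M) (z : M × ℝ) : M :=
  if z.1 ∈ Ψ.target then Ψ (ln (Ψ.symm z.1) z.2) else z.1

theorem rh_zero (x : M) : rh Ψ (x, 0) = x := by
  unfold rh; split_ifs with h
  · simp only [ln, sub_zero, one_smul, zero_smul, add_zero]; exact Ψ.right_inv h
  · rfl

theorem rh_one (x : M) : rh Ψ (x, 1) = rr Ψ x := by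
  unfold rh rr; simp [ln]

theorem rh_props (hs : Ψ.source = Metric.ball 0 2) {x : M} (hx : x ≠ Ψ 0) {t : ℝ} (ht : t ∈ Icc (0:ℝ) 1) :
    rh Ψ (x, t) ≠ Ψ 0 ∧ rr Ψ (rh Ψ (x, t)) = rr Ψ x := by
  by_cases h : x ∈ Ψ.target
  · have hv := Ψ.map_target h
    have hv0 : Ψ.symm x ≠ 0 := fun h' => hx (by rw [← h', Ψ.right_inv h])
    obtain ⟨h1, h2, h3⟩ := ln_props hv0 ht
    have h4 : ‖ln (Ψ.symm x) t‖ < 2 := h2.trans_lt (max_lt ((mem_src hs).1 hv) (by norm_num))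
    have h5 : rh Ψ (x, t) = Ψ (ln (Ψ.symm x) t) := if_pos h
    rw [h5]
    refine ⟨fun he => h1 (Ψ.injOn ((mem_src hs).2 h4) ((mem_src hs).2 (by simp)) he), ?_⟩
    rw [rr_apply hs h4, h3, rr, if_pos h]
  · have h5 : rh Ψ (x, t) = x := if_neg h
    rw [h5]; exact ⟨hx, rfl⟩

theorem rh_cont [T2Space M] (hs : Ψ.source = Metric.ball 0 2) : ContinuousOn (rh Ψ) ({Ψ 0}ᶜ ×ˢ Icc 0 1) := by
  have hcl : IsClosed (Ψ '' Metric.closedBall 0 1) :=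
    ((isCompact_closedBall _ _).image_of_continuousOn (Ψ.continuousOn.mono
      (by rw [hs]; exact Metric.closedBall_subset_ball (by norm_num)))).isClosed
  have e : ({Ψ 0}ᶜ ×ˢ Icc (0:ℝ) 1 : Set (M × ℝ)) =
      ((Ψ.target ×ˢ univ) ∪ ((Ψ '' Metric.closedBall 0 1)ᶜ ×ˢ univ)) ∩ ({Ψ 0}ᶜ ×ˢ Icc (0:ℝ) 1) := by
    refine (inter_eq_right.2 ?_).symm
    rintro ⟨x, t⟩ -
    by_cases h : x ∈ Ψ.target
    · exact Or.inl ⟨h, trivial⟩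
    · refine Or.inr ⟨?_, trivial⟩
      rintro ⟨v, hv, rfl⟩
      exact h (Ψ.map_source (by rw [hs]; exact Metric.closedBall_subset_ball (by norm_num) hv))
  rw [e]
  refine co_union (Ψ.open_target.prod isOpen_univ) (hcl.isOpen_compl.prod isOpen_univ) ?_ ?_
  · refine ContinuousOn.congr (f := fun z : M × ℝ => Ψ (ln (Ψ.symm z.1) z.2)) ?_ (fun z hz => if_pos hz.1.1)
    have hne : ∀ z : M × ℝ, z ∈ (Ψ.target ×ˢ univ) ∩ ({Ψ 0}ᶜ ×ˢ Icc (0:ℝ) 1) → Ψ.symm z.1 ≠ 0 :=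
      fun z hz h' => hz.2.1 (by rw [mem_singleton_iff, ← h', Ψ.right_inv hz.1.1])
    have hsy : ContinuousOn (fun z : M × ℝ => Ψ.symm z.1) ((Ψ.target ×ˢ univ) ∩ ({Ψ 0}ᶜ ×ˢ Icc (0:ℝ) 1)) :=
      Ψ.continuousOn_symm.comp continuousOn_fst fun z hz => hz.1.1
    refine Ψ.continuousOn.comp (f := fun z : M × ℝ => ln (Ψ.symm z.1) z.2) ?_ ?_
    · unfold ln
      have := nz_cont.comp hsy hne
      exact ((continuousOn_const.sub continuousOn_snd).smul hsy).add (continuousOn_snd.smul this)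
    · intro z hz
      rw [mem_src hs]
      exact (ln_props (hne z hz) hz.2.2).2.1.trans_lt (max_lt ((mem_src hs).1 (Ψ.map_target hz.1.1)) (by norm_num))
  · refine continuousOn_fst.congr fun z hz => ?_
    show rh Ψ z = z.1
    unfold rh; split_ifs with h
    · have hv := Ψ.map_target h
      have h1 : 1 ≤ ‖Ψ.symm z.1‖ := by
        by_contra h'
        push Not at h'
        exact hz.1.1 ⟨Ψ.symm z.1, by simpa using h'.le, Ψ.right_inv h⟩
      rw [ln, nz_eq h1, ← add_smul, sub_add_cancel, one_smul, Ψ.right_inv h]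
    · rfl

/-- the complement of a point is covered by two open sets contractible in it -/
theorem two_cover [T2Space M] [CompactSpace M] [Nonempty M] (hM : Mf n M) (hn : 1 ≤ n) (hs : Ψ.source = Metric.ball 0 2)
    (hpu : IsPathConnected (univ : Set M)) (hpc : IsPathConnected ({Ψ 0}ᶜ : Set M)) {U V : Set M} (hU : IsOpen U)
    (hV : IsOpen V) (hUV : U ∪ V = univ) (cU : Ctr U univ) (cV : Ctr V univ) :
    ∃ A B : Set M, IsOpen A ∧ IsOpen B ∧ A ∪ B = {Ψ 0}ᶜ ∧ Ctr A {Ψ 0}ᶜ ∧ Ctr B {Ψ 0}ᶜ ∧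
      (∀ x, x ≠ Ψ 0 → (rr Ψ x ∈ A ↔ x ∈ A)) ∧ (∀ x, x ≠ Ψ 0 → (rr Ψ x ∈ B ↔ x ∈ B)) := by
  have h0 : (0 : Eu n) ∈ Ψ.source := by rw [mem_src hs]; simp
  obtain ⟨m, φ, hφ, Ξ, x1, x2, x3, x4⟩ := shell hM (P := Ψ '' Metric.ball 0 1) (X := XX Ψ) hpc.isConnected.isPreconnected
    isOpen_compl_singleton (isClosed_XX hs).isCompact
    (fun x hx h => p_notMem_XX (by rw [mem_singleton_iff.1 h] at hx; exact hx))
    (Ψ.isOpen_image_of_subset_source Metric.isOpen_ball (by rw [hs]; exact Metric.ball_subset_ball (by norm_num)))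
    (Set.disjoint_left.2 fun x hx hx' => hx' hx) (by
      set v : Eu n := EuclideanSpace.single ⟨0, hn⟩ (1/2 : ℝ) with hv
      have hv1 : ‖v‖ = 1/2 := by rw [hv, EuclideanSpace.norm_single]; norm_num
      refine ⟨Ψ v, ⟨v, by rw [mem_ball_zero_iff, hv1]; norm_num, rfl⟩, fun h => ?_⟩
      have : v = 0 := Ψ.injOn ((mem_src hs).2 (by rw [hv1]; norm_num)) h0 h
      rw [this] at hv1; norm_num at hv1)
  set S := ⋃ a, bd (φ a) with hS
  obtain ⟨C, D, hC, hD, hCD, cC, cD⟩ := sstep hM hs hpu hpu (subset_univ _) hpc.nonempty hφ hS hU hV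
    (by rw [hUV]; exact subset_univ _) (cU.mono inter_subset_left subset_rfl) (cV.mono inter_subset_left subset_rfl)
  obtain ⟨D, C, hD, hC, hDC, cD, cC⟩ := sstep hM hs hpu hpc subset_rfl hpc.nonempty hφ hS hD hC
    (by rw [union_comm]; exact hCD) cD cC
  set f : M → M := fun x => Ξ (rr Ψ x, 1) with hf
  have hfc : ContinuousOn f {Ψ 0}ᶜ := x1.comp (f := fun x => (rr Ψ x, (1:ℝ)))
    ((rr_cont hs).prodMk continuousOn_const) fun x hx => ⟨rr_mem hs hx, by simp⟩
  have hfS : ∀ x, x ≠ Ψ 0 → f x ∈ S := fun x hx => x4 _ (rr_mem hs hx)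
  have key : ∀ {C : Set M}, IsOpen C → Ctr (C ∩ S) {Ψ 0}ᶜ →
      IsOpen ({Ψ 0}ᶜ ∩ f ⁻¹' C) ∧ Ctr ({Ψ 0}ᶜ ∩ f ⁻¹' C) {Ψ 0}ᶜ ∧
      ∀ x, x ≠ Ψ 0 → (rr Ψ x ∈ ({Ψ 0}ᶜ ∩ f ⁻¹' C) ↔ x ∈ ({Ψ 0}ᶜ ∩ f ⁻¹' C)) := by
    intro C hC cC
    obtain ⟨K, q, k1, k2, k3, k4⟩ := cC
    have hX : ∀ x ∈ XX Ψ, x ≠ Ψ 0 := fun x hx h => p_notMem_XX (by rw [h] at hx; exact hx)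
    have hsub : ∀ x ∈ ({Ψ 0}ᶜ ∩ f ⁻¹' C), f x ∈ C ∩ S := fun x hx => ⟨hx.2, hfS x hx.1⟩
    refine ⟨hfc.isOpen_inter_preimage isOpen_compl_singleton hC, ⟨hcat (rh Ψ) (hcat (fun z => Ξ (rr Ψ z.1, z.2))
      (fun z => K (f z.1, z.2))), q, hcat_cont ?_ (hcat_cont ?_ ?_ ?_) ?_, ?_, ?_, hcat_mapsTo ?_ (hcat_mapsTo ?_ ?_)⟩, ?_⟩
    · exact (rh_cont hs).mono (prod_mono_left inter_subset_left)
    · refine x1.comp (f := fun z : M × ℝ => (rr Ψ z.1, z.2)) (ContinuousOn.prodMk ?_ continuousOn_snd) ?_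
      · exact (rr_cont hs).comp continuousOn_fst fun z hz => hz.1.1
      · exact fun z hz => ⟨rr_mem hs hz.1.1, hz.2⟩
    · refine k1.comp (f := fun z : M × ℝ => (f z.1, z.2)) (ContinuousOn.prodMk ?_ continuousOn_snd) ?_
      · exact hfc.comp continuousOn_fst fun z hz => hz.1.1
      · exact fun z hz => ⟨hsub _ hz.1, hz.2⟩
    · intro x hx; rw [k2 _ (hsub x hx)]
    · intro x hx; rw [hcat_zero, rh_one, x2 _ (rr_mem hs hx.1)]
    · intro x hx; rw [hcat_zero, rh_zero]
    · intro x hx; rw [hcat_one, hcat_one]; exact k3 _ (hsub x hx)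
    · exact fun z hz => (rh_props hs hz.1.1 hz.2).1
    · exact fun z hz => x3 (x := (rr Ψ z.1, z.2)) ⟨rr_mem hs hz.1.1, hz.2⟩
    · exact fun z hz => k4 (x := (f z.1, z.2)) ⟨hsub _ hz.1, hz.2⟩
    · intro x hx
      have : f (rr Ψ x) = f x := by simp only [hf]; rw [rr_eq hs (rr_mem hs hx)]
      simp only [mem_inter_iff, mem_preimage, this]
      exact ⟨fun h => ⟨hx, h.2⟩, fun h => ⟨hX _ (rr_mem hs hx), h.2⟩⟩
  obtain ⟨a1, a2, a3⟩ := key hC cC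
  obtain ⟨b1, b2, b3⟩ := key hD cD
  refine ⟨_, _, a1, b1, ?_, a2, b2, a3, b3⟩
  rw [← inter_union_distrib_left, ← preimage_union]
  refine inter_eq_left.2 fun x hx => ?_
  have := hDC (hfS x hx)
  rwa [union_comm]
end
end CS

open scoped Topology
namespace CS
set_option linter.all false
open Set unitInterval

section
variable {M : Type*} [TopologicalSpace M]

/-- locally constant near every point of `A` -/
def LC {G : Type*} (f : M → G) (A : Set M) : Prop := ∀ x ∈ A, ∀ᶠ z in 𝓝 x, f z = f x

open Classical in
/-- the indicator of a set mod 2 -/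
noncomputable def ch (E : Set M) (x : M) : ZMod 2 := if x ∈ E then 1 else 0

/-- mod two coboundary property of a pair of sets -/
def CB (A B : Set M) : Prop := ∀ E : Set M, (∀ x ∈ A ∩ B, ∀ᶠ z in 𝓝 x, (z ∈ E ↔ x ∈ E)) → E ⊆ A ∩ B →
  ∃ l : M → ZMod 2, LC l B ∧ LC (fun z => l z + ch E z) A

variable {n : ℕ} {Ψ : OpenPartialHomeomorph (Eu n) M}


theorem cb_off [T2Space M] [CompactSpace M] [ConnectedSpace M] (hM : Mf n M) (hn : 2 ≤ n) (hs : Ψ.source = Metric.ball 0 2)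
    {U V : Set M} (hU : IsOpen U) (hV : IsOpen V) (hUV : U ∪ V = univ) (cU : Ctr U univ) (cV : Ctr V univ)
    {A B : Set M} (hA : IsOpen A) (hB : IsOpen B) (hAB : A ∪ B = {Ψ 0}ᶜ)
    (sA : ∀ x, x ≠ Ψ 0 → (rr Ψ x ∈ A ↔ x ∈ A)) (sB : ∀ x, x ≠ Ψ 0 → (rr Ψ x ∈ B ↔ x ∈ B)) : CB A B := by
  classical
  intro E hE hEAB
  have hX : ∀ x ∈ XX Ψ, x ≠ Ψ 0 := fun x hx h => p_notMem_XX (by rw [h] at hx; exact hx)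
  have hAp : ∀ x ∈ A, x ≠ Ψ 0 := fun x hx => (hAB ▸ Or.inl hx : x ∈ ({Ψ 0}ᶜ : Set M))
  have hBp : ∀ x ∈ B, x ≠ Ψ 0 := fun x hx => (hAB ▸ Or.inr hx : x ∈ ({Ψ 0}ᶜ : Set M))
  have hop : ∀ x, x ≠ Ψ 0 → x ∈ A ∨ x ∈ B := fun x hx => by
    have : x ∈ ({Ψ 0}ᶜ : Set M) := hx
    rwa [← hAB] at this
  have hEs1 : ∀ x ∈ A ∩ B, (rr Ψ x ∈ E ↔ x ∈ E) := by
    intro x hx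
    have hxp := hAp x hx.1
    have hin : ∀ t ∈ Icc (0:ℝ) 1, rh Ψ (x, t) ∈ A ∩ B := by
      intro t ht
      obtain ⟨h1, h2⟩ := rh_props hs hxp ht
      refine ⟨?_, ?_⟩
      · rw [← sA _ h1, h2, sA _ hxp]; exact hx.1
      · rw [← sB _ h1, h2, sB _ hxp]; exact hx.2
    have hc : ContinuousOn (fun t => rh Ψ (x, t)) (Icc (0:ℝ) 1) :=
      (rh_cont hs).comp (f := fun t => (x, t)) (by fun_prop) fun t ht => ⟨hxp, ht⟩
    have hcst : ContinuousOn (fun t => decide (rh Ψ (x, t) ∈ E)) (Icc (0:ℝ) 1) := by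
      intro t ht
      refine ContinuousWithinAt.congr_of_eventuallyEq (f := fun _ => decide (rh Ψ (x, t) ∈ E)) continuousWithinAt_const ?_ rfl
      filter_upwards [(hc t ht).eventually (hE _ (hin t ht))] with s hs
      simp only [hs]
    have := isPreconnected_Icc.constant hcst (show (1:ℝ) ∈ Icc (0:ℝ) 1 by simp) (show (0:ℝ) ∈ Icc (0:ℝ) 1 by simp)
    simpa [rh_one, rh_zero] using this
  have hEs : ∀ x, x ≠ Ψ 0 → ch E (rr Ψ x) = ch E x := by
    intro x hx
    have : rr Ψ x ∈ E ↔ x ∈ E := by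
      constructor
      · intro h
        have h1 := hEAB h
        exact (hEs1 x ⟨(sA x hx).1 h1.1, (sB x hx).1 h1.2⟩).1 h
      · intro h
        exact (hEs1 x (hEAB h)).2 h
    simp only [ch, this]
  obtain ⟨u, hu0, hu1, -⟩ := exists_continuous_zero_one_of_isClosed (s := XX Ψ \ B) (t := XX Ψ \ A)
    ((isClosed_XX hs).sdiff hB) ((isClosed_XX hs).sdiff hA)
    (Set.disjoint_left.2 fun x hx hx' => (hop x (hX x hx.1)).elim hx'.2 hx.2)
  set w : M → ℝ := fun x => u (rr Ψ x) with hw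
  have hwc : ContinuousOn w {Ψ 0}ᶜ := u.continuous.comp_continuousOn (rr_cont hs)
  have hwat : ∀ x, x ≠ Ψ 0 → ContinuousAt w x := fun x hx => hwc.continuousAt (isOpen_compl_singleton.mem_nhds hx)
  have hwr : ∀ x, x ≠ Ψ 0 → w (rr Ψ x) = w x := fun x hx => by
    simp only [hw]; rw [rr_eq hs (rr_mem hs hx)]
  have hw0 : ∀ x, x ≠ Ψ 0 → x ∉ B → w x = 0 := fun x hx h => hu0 ⟨rr_mem hs hx, fun h' => h ((sB x hx).1 h')⟩
  have hw1 : ∀ x, x ≠ Ψ 0 → x ∉ A → w x = 1 := fun x hx h => hu1 ⟨rr_mem hs hx, fun h' => h ((sA x hx).1 h')⟩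
  set α : Co M := fun v => match v with
    | [z, y] => if w z < 1/2 ∧ w y < 1/2 then ch E z + ch E y else 0
    | _ => 0 with hα
  have hα2 : ∀ z y, α [z, y] = if w z < 1/2 ∧ w y < 1/2 then ch E z + ch E y else 0 := fun z y => rfl
  have hAB1 : ∀ x ∈ A ∩ B, ∃ O ∈ 𝓝 x, ∀ z ∈ O, ∀ y ∈ O, α [z, y] = 0 := by
    intro x hx
    refine ⟨_, hE x hx, fun z hz y hy => ?_⟩
    rw [hα2]
    have : ch E z = ch E y := by
      have hz' : z ∈ E ↔ x ∈ E := hz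
      have hy' : y ∈ E ↔ x ∈ E := hy
      simp only [ch, hz', hy']
    rw [this, z2, ite_self]
  have hA1 : ∀ x, x ≠ Ψ 0 → x ∉ A → ∃ O ∈ 𝓝 x, ∀ z ∈ O, ∀ y ∈ O, α [z, y] = 0 := by
    intro x hx hxA
    refine ⟨{z | 1/2 < w z}, (hwat x hx).eventually (lt_mem_nhds (by rw [hw1 x hx hxA]; norm_num)), fun z hz y hy => ?_⟩
    rw [hα2, if_neg]
    rintro ⟨h, -⟩
    exact absurd h (not_lt.2 (le_of_lt hz))
  have hB1 : ∀ x, x ≠ Ψ 0 → x ∉ B → ∃ O ∈ 𝓝 x, ∀ z ∈ O, ∀ y ∈ O, α [z, y] = ch E z + ch E y := by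
    intro x hx hxB
    refine ⟨{z | w z < 1/2}, (hwat x hx).eventually (gt_mem_nhds (by rw [hw0 x hx hxB]; norm_num)), fun z hz y hy => ?_⟩
    rw [hα2, if_pos ⟨hz, hy⟩]
  have hd : dd α ∈ Sp 3 {Ψ 0} := by
    rw [mem_Sp]
    intro x hx
    have hx : x ≠ Ψ 0 := hx
    have h3 : ∀ O : Set M, (∀ a b c, a ∈ O → b ∈ O → c ∈ O → dd α [a, b, c] = 0) →
        ∀ v : List M, v.length = 3 → (∀ y ∈ v, y ∈ O) → dd α v = 0 := by
      intro O h v hv hvO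
      match v, hv with
      | [a, b, c], _ => exact h a b c (hvO a (by simp)) (hvO b (by simp)) (hvO c (by simp))
    have hz : (∃ O ∈ 𝓝 x, ∀ z ∈ O, ∀ y ∈ O, α [z, y] = 0) → ∃ O ∈ 𝓝 x,
        ∀ v : List M, v.length = 3 → (∀ y ∈ v, y ∈ O) → dd α v = 0 := by
      rintro ⟨O, hO, h⟩
      refine ⟨O, hO, h3 O fun a b c ha hb hc => ?_⟩
      rw [dd_three, h b hb c hc, h a ha c hc, h a ha b hb]; simp
    by_cases hxA : x ∈ A
    · by_cases hxB : x ∈ B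
      · exact hz (hAB1 x ⟨hxA, hxB⟩)
      · obtain ⟨O, hO, h⟩ := hB1 x hx hxB
        refine ⟨O, hO, h3 O fun a b c ha hb hc => ?_⟩
        rw [dd_three, h b hb c hc, h a ha c hc, h a ha b hb]
        linear_combination z2 (ch E a) + z2 (ch E b) + z2 (ch E c)
    · exact hz (hA1 x hx hxA)
  obtain ⟨l, hl⟩ := one_exact_off hn hM hU hV hUV cU cV (B := Ψ '' Metric.ball 0 1)
    (Ψ.isOpen_image_of_subset_source Metric.isOpen_ball (by rw [hs]; exact Metric.ball_subset_ball (by norm_num)))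
    (p := Ψ 0) ⟨0, by simp, rfl⟩ (a := α) rfl hd
  have hαr : ∀ z y, z ≠ Ψ 0 → y ≠ Ψ 0 → α [rr Ψ z, rr Ψ y] = α [z, y] := by
    intro z y hz hy
    rw [hα2, hα2, hwr z hz, hwr y hy, hEs z hz, hEs y hy]
  have hlr : ∀ x, x ≠ Ψ 0 → ∀ᶠ z in 𝓝 x, l (rr Ψ z) = l (rr Ψ x) + α [z, x] := by
    intro x hx
    obtain ⟨O, hO, h⟩ := hl (rr Ψ x) (rr_mem hs hx)
    have hc : ContinuousAt (rr Ψ) x := (rr_cont hs).continuousAt (isOpen_compl_singleton.mem_nhds hx)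
    filter_upwards [hc.eventually hO, isOpen_compl_singleton.mem_nhds hx] with z hz hzp
    have := h _ hz _ (mem_of_mem_nhds hO)
    rw [hαr z x hzp hx] at this
    rw [this]
    linear_combination -z2 (l (rr Ψ x))
  have hz : ∀ x, x ≠ Ψ 0 → (∃ O ∈ 𝓝 x, ∀ z ∈ O, ∀ y ∈ O, α [z, y] = 0) → ∀ᶠ z in 𝓝 x, l (rr Ψ z) = l (rr Ψ x) := by
    rintro x hx ⟨O, hO, h⟩
    filter_upwards [hlr x hx, hO] with z h1 h2
    rw [h1, h z h2 x (mem_of_mem_nhds hO), add_zero]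
  refine ⟨fun x => l (rr Ψ x), ?_, ?_⟩
  · intro x hx
    by_cases hxA : x ∈ A
    · exact hz x (hBp x hx) (hAB1 x ⟨hxA, hx⟩)
    · exact hz x (hBp x hx) (hA1 x (hBp x hx) hxA)
  · intro x hx
    by_cases hxB : x ∈ B
    · filter_upwards [hz x (hAp x hx) (hAB1 x ⟨hx, hxB⟩), hE x ⟨hx, hxB⟩] with z h1 h2
      simp only [h1, ch, h2]
    · obtain ⟨O, hO, h⟩ := hB1 x (hAp x hx) hxB
      filter_upwards [hlr x (hAp x hx), hO] with z h1 h2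
      rw [h1, h z h2 x (mem_of_mem_nhds hO)]
      linear_combination z2 (ch E z)
end
end CS

open scoped Topology
namespace CS
set_option linter.all false
open Set unitInterval

section
universe u
variable {M : Type u} [TopologicalSpace M]

/-- factorization of locally constant group valued functions -/
def FAC (A B : Set M) : Prop := ∀ (G : Type u) [Group G] (g : M → G), LC g (A ∩ B) →
  ∃ a b : M → G, LC a A ∧ LC b B ∧ ∀ x ∈ A ∩ B, g x = (a x)⁻¹ * b x

theorem LC.const {G : Type*} {f : M → G} {A K : Set M} (h : LC f A) (hK : IsPreconnected K) (hKA : K ⊆ A)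
    {x y : M} (hx : x ∈ K) (hy : y ∈ K) : f x = f y := by
  letI : TopologicalSpace G := ⊥
  haveI : DiscreteTopology G := ⟨rfl⟩
  refine hK.constant (f := f) (fun z hz => ?_) hx hy
  exact (continuousAt_const.congr (f := fun _ => f z) ((h z (hKA hz)).mono fun _ h => h.symm)).continuousWithinAt

/-- component of a point in a set -/
abbrev cI (A : Set M) (x : M) : Set M := connectedComponentIn A x

theorem cI_lc [LocallyConnectedSpace M] {A : Set M} (hA : IsOpen A) : LC (cI A) A := by
  intro x hx
  filter_upwards [hA.connectedComponentIn.mem_nhds (mem_connectedComponentIn hx)] with z hz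
  exact (connectedComponentIn_eq hz).symm

theorem LC.cI {G : Type*} {f : M → G} {A : Set M} (h : LC f A) {x y : M} (hx : x ∈ A) (hy : y ∈ A)
    (hxy : CS.cI A x = CS.cI A y) : f x = f y :=
  h.const isPreconnected_connectedComponentIn (connectedComponentIn_subset A x) (mem_connectedComponentIn hx)
    (by rw [show connectedComponentIn A x = connectedComponentIn A y from hxy]; exact mem_connectedComponentIn hy)

/-- nerve graph of a pair of sets -/
def gr (A B : Set M) : SimpleGraph (Set M ⊕ Set M) :=
  SimpleGraph.fromRel fun p q => ∃ x ∈ A ∩ B, p = Sum.inl (cI A x) ∧ q = Sum.inr (cI B x)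

theorem gr_adj {A B : Set M} {p q : Set M ⊕ Set M} (h : (gr A B).Adj p q) :
    ∃ x ∈ A ∩ B, (p = Sum.inl (cI A x) ∧ q = Sum.inr (cI B x)) ∨ (q = Sum.inl (cI A x) ∧ p = Sum.inr (cI B x)) := by
  rw [gr, SimpleGraph.fromRel_adj] at h
  obtain ⟨-, ⟨x, hx, h1, h2⟩ | ⟨x, hx, h1, h2⟩⟩ := h
  · exact ⟨x, hx, Or.inl ⟨h1, h2⟩⟩
  · exact ⟨x, hx, Or.inr ⟨h1, h2⟩⟩

theorem adj_gr {A B : Set M} {x : M} (hx : x ∈ A ∩ B) : (gr A B).Adj (Sum.inl (cI A x)) (Sum.inr (cI B x)) := by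
  rw [gr, SimpleGraph.fromRel_adj]
  exact ⟨by simp, Or.inl ⟨x, hx, rfl, rfl⟩⟩

theorem gr_acyclic [LocallyConnectedSpace M] {A B : Set M} (hA : IsOpen A) (hB : IsOpen B) (h : CB A B) :
    (gr A B).IsAcyclic := by
  classical
  rw [SimpleGraph.isAcyclic_iff_forall_adj_isBridge]
  have key : ∀ x ∈ A ∩ B, (gr A B).IsBridge s(Sum.inl (cI A x), Sum.inr (cI B x)) := by
    intro x hx
    obtain ⟨l, h1, h2⟩ := h {z | z ∈ A ∩ B ∧ cI A z = cI A x ∧ cI B z = cI B x} (by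
      intro y hy
      filter_upwards [cI_lc hA y hy.1, cI_lc hB y hy.2, (hA.inter hB).mem_nhds hy] with z a b c
      simp only [mem_setOf_eq, a, b]
      exact ⟨fun k => ⟨hy, k.2⟩, fun k => ⟨c, k.2⟩⟩) (fun z hz => hz.1)
    set E := {z | z ∈ A ∩ B ∧ cI A z = cI A x ∧ cI B z = cI B x} with hE
    set L : Set M ⊕ Set M → ZMod 2 := fun p => match p with
      | Sum.inl C => if hC : ∃ z ∈ A, cI A z = C then l hC.choose + ch E hC.choose else 0
      | Sum.inr C => if hC : ∃ z ∈ B, cI B z = C then l hC.choose else 0 with hL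
    have hL1 : ∀ z ∈ A, L (Sum.inl (cI A z)) = l z + ch E z := by
      intro z hz
      have hC : ∃ y ∈ A, cI A y = cI A z := ⟨z, hz, rfl⟩
      simp only [hL]
      rw [dif_pos hC]
      exact h2.cI hC.choose_spec.1 hz hC.choose_spec.2
    have hL2 : ∀ z ∈ B, L (Sum.inr (cI B z)) = l z := by
      intro z hz
      have hC : ∃ y ∈ B, cI B y = cI B z := ⟨z, hz, rfl⟩
      simp only [hL]
      rw [dif_pos hC]
      exact h1.cI hC.choose_spec.1 hz hC.choose_spec.2
    rw [SimpleGraph.isBridge_iff]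
    rintro ⟨p⟩
    have hp : ∀ {a b} (p : ((gr A B).deleteEdges {s(Sum.inl (cI A x), Sum.inr (cI B x))}).Walk a b), L a = L b := by
      intro a b p
      induction p with
      | nil => rfl
      | cons hadj p ih =>
        rw [← ih]
        rw [SimpleGraph.deleteEdges_adj] at hadj
        obtain ⟨y, hy, ⟨e1, e2⟩ | ⟨e1, e2⟩⟩ := gr_adj hadj.1 <;> rw [e1, e2] at hadj ⊢ <;>
        · have hyE : y ∉ E := by
            rintro ⟨-, f1, f2⟩
            apply hadj.2
            rw [f1, f2]; simp [Sym2.eq_swap]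
          simp [hL1 y hy.1, hL2 y hy.2, ch, hyE]
    have := hp p
    have hxE : x ∈ E := ⟨hx, rfl, rfl⟩
    rw [hL1 x hx.1, hL2 x hx.2, ch, if_pos hxE] at this
    simp at this
  intro p q hpq
  obtain ⟨x, hx, ⟨rfl, rfl⟩ | ⟨rfl, rfl⟩⟩ := gr_adj hpq
  · exact key x hx
  · rw [Sym2.eq_swap]; exact key x hx

/-- potentials on acyclic graphs -/
theorem potential {V G : Type*} [Group G] {Γ : SimpleGraph V} (h : Γ.IsAcyclic) (c : V → V → G)
    (hc : ∀ v w, Γ.Adj v w → c w v = (c v w)⁻¹) : ∃ f : V → G, ∀ v w, Γ.Adj v w → f w = f v * c v w := by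
  classical
  set rt : V → V := fun v => (Γ.connectedComponentMk v).out with hrt
  have hre : ∀ v, Γ.Reachable (rt v) v := fun v => SimpleGraph.ConnectedComponent.exact (Quot.out_eq _)
  have hpath : ∀ v, ∃ p : Γ.Walk (rt v) v, p.IsPath := fun v => (hre v).exists_isPath
  let pr : (a b : V) → Γ.Walk a b → G := fun a b p => (p.darts.map fun d => c d.fst d.snd).prod
  have hu : ∀ {a b} (p q : Γ.Walk a b), p.IsPath → q.IsPath → p = q := fun p q hp hq =>
    congrArg Subtype.val (h.path_unique ⟨p, hp⟩ ⟨q, hq⟩)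
  choose P hP using hpath
  refine ⟨fun v => pr _ _ (P v), ?_⟩
  intro v w hvw
  have hroot : rt v = rt w := by
    simp only [hrt]; rw [SimpleGraph.ConnectedComponent.sound hvw.reachable]
  have gen : ∀ (r r' : V) (e : r = r') (p : Γ.Walk r v) (q : Γ.Walk r' w), p.IsPath → q.IsPath → pr _ _ q = pr _ _ p * c v w := by
    rintro r _ rfl p q hp hq
    by_cases hv : v ∈ q.support
    · rw [h.path_concat hp hq hvw hv]
      simp [pr, SimpleGraph.Walk.darts_concat]
    · have hw : w ∈ p.support := h.mem_support_of_ne_mem_support_of_adj_of_isPath hp hq hvw hv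
      rw [h.path_concat hq hp hvw.symm hw]
      simp [pr, SimpleGraph.Walk.darts_concat, hc v w hvw]
  exact gen _ _ hroot _ _ (hP v) (hP w)

theorem CB.fac [LocallyConnectedSpace M] {A B : Set M} (hA : IsOpen A) (hB : IsOpen B) (h : CB A B) : FAC A B := by
  classical
  intro G _ g hg
  have hwd : ∀ x ∈ A ∩ B, ∀ y ∈ A ∩ B, cI A y = cI A x → cI B y = cI B x → g y = g x := by
    intro x hx y hy hA' hB'
    obtain ⟨l, h1, h2⟩ := h {z | z ∈ A ∩ B ∧ g z = g x} (by
      intro y hy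
      filter_upwards [hg y hy, (hA.inter hB).mem_nhds hy] with z a c
      simp only [mem_setOf_eq, a]
      exact ⟨fun k => ⟨hy, k.2⟩, fun k => ⟨c, k.2⟩⟩) (fun z hz => hz.1)
    have e1 := h1.cI hy.2 hx.2 hB'
    have e2 := h2.cI hy.1 hx.1 hA'
    simp only [e1, add_right_inj, ch, mem_setOf_eq] at e2
    by_contra hne
    rw [if_neg (fun k => hne k.2), if_pos ⟨hx, trivial⟩] at e2
    simp at e2
  set g0 : Set M → Set M → G := fun C D => if hC : ∃ x ∈ A ∩ B, cI A x = C ∧ cI B x = D then g hC.choose else 1 with hg0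
  have hg0' : ∀ x ∈ A ∩ B, g0 (cI A x) (cI B x) = g x := by
    intro x hx
    have hC : ∃ y ∈ A ∩ B, cI A y = cI A x ∧ cI B y = cI B x := ⟨x, hx, rfl, rfl⟩
    simp only [hg0]
    rw [dif_pos hC]
    exact hwd x hx _ hC.choose_spec.1 hC.choose_spec.2.1 hC.choose_spec.2.2
  set c : Set M ⊕ Set M → Set M ⊕ Set M → G := fun p q => match p, q with
    | Sum.inl C, Sum.inr D => g0 C D
    | Sum.inr D, Sum.inl C => (g0 C D)⁻¹
    | _, _ => 1 with hc
  obtain ⟨f, hf⟩ := potential (gr_acyclic hA hB h) c (by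
    intro v w hvw
    obtain ⟨x, hx, ⟨rfl, rfl⟩ | ⟨rfl, rfl⟩⟩ := gr_adj hvw <;> simp [hc])
  refine ⟨fun x => f (Sum.inl (cI A x)), fun x => f (Sum.inr (cI B x)), ?_, ?_, ?_⟩
  · intro x hx
    filter_upwards [cI_lc hA x hx] with z hz
    rw [hz]
  · intro x hx
    filter_upwards [cI_lc hB x hx] with z hz
    rw [hz]
  · intro x hx
    show g x = (f (Sum.inl (cI A x)))⁻¹ * f (Sum.inr (cI B x))
    rw [hf _ _ (adj_gr hx)]
    simp [hc, hg0' x hx]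
end
end CS

open scoped Topology
namespace CS
set_option linter.all false
open Set unitInterval

section
universe u
open CategoryTheory
variable {N : Type u} [TopologicalSpace N]

/-- class of a path as a morphism -/
noncomputable def hm {x y : N} (γ : Path x y) : (⟨x⟩ : FundamentalGroupoid N) ⟶ ⟨y⟩ := Path.Homotopic.Quotient.mk γ

theorem hm_trans {x y z : N} (γ : Path x y) (δ : Path y z) : hm (γ.trans δ) = hm γ ≫ hm δ := rfl

theorem hm_eq {x y : N} {γ δ : Path x y} : hm γ = hm δ ↔ γ.Homotopic δ := Path.Homotopic.Quotient.eq

/-- paths in the set are trivialized by the given classes -/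
def Tv {q : N} (κ : ∀ x : N, (⟨x⟩ : FundamentalGroupoid N) ⟶ ⟨q⟩) (A : Set N) : Prop :=
  ∀ (x y : N) (γ : Path x y), range γ ⊆ A → hm γ ≫ κ y = κ x

theorem Tv.glue {q : N} {κ : ∀ x : N, (⟨x⟩ : FundamentalGroupoid N) ⟶ ⟨q⟩} {A B : Set N} (hA : IsOpen A) (hB : IsOpen B)
    (hAB : A ∪ B = univ) (h1 : Tv κ A) (h2 : Tv κ B) : Tv κ univ := by
  intro x y γ _
  obtain ⟨t, h0, hmon, ⟨m, hm1⟩, hc⟩ := exists_monotone_Icc_subset_open_cover_unitInterval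
    (c := fun i : Bool => γ ⁻¹' (if i then A else B)) (fun i => (by cases i <;> simp [hA, hB] : IsOpen (if i = true then A else B)).preimage γ.continuous)
    (by
      intro s _
      have : γ s ∈ A ∪ B := hAB ▸ mem_univ _
      rcases this with h | h
      · exact mem_iUnion.2 ⟨true, by simpa using h⟩
      · exact mem_iUnion.2 ⟨false, by simpa using h⟩)
  have key : ∀ k, hm (γ.subpath 0 (t k)) ≫ κ (γ (t k)) = κ (γ 0) := by
    intro k
    induction k with
    | zero =>
      rw [h0, Path.subpath_self]
      exact Category.id_comp _
    | succ k ih =>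
      have e : hm (γ.subpath 0 (t (k+1))) = hm (γ.subpath 0 (t k)) ≫ hm (γ.subpath (t k) (t (k+1))) := by
        rw [← hm_trans, hm_eq]
        exact ⟨(Path.Homotopy.subpathTransSubpath γ 0 (t k) (t (k+1))).symm⟩
      have e2 : hm (γ.subpath (t k) (t (k+1))) ≫ κ (γ (t (k+1))) = κ (γ (t k)) := by
        obtain ⟨i, hi⟩ := hc k
        have hr := Path.range_subpath_of_le γ (t k) (t (k+1)) (hmon (Nat.le_succ k))
        cases i
        · exact h2 _ _ _ (by rw [hr, image_subset_iff]; simpa using hi)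
        · exact h1 _ _ _ (by rw [hr, image_subset_iff]; simpa using hi)
      rw [e, Category.assoc, e2, ih]
  have k1 := key m
  rw [hm1 m le_rfl, Path.subpath_zero_one] at k1
  have : ∀ x' y' (h : x' = x) (h' : y' = y), hm (γ.cast h h') ≫ κ y' = κ x' → hm γ ≫ κ y = κ x := by
    rintro _ _ rfl rfl h
    exact h
  exact this _ _ _ _ k1

theorem Tv.unique {q : N} {κ : ∀ x : N, (⟨x⟩ : FundamentalGroupoid N) ⟶ ⟨q⟩} (h : Tv κ univ) {x y : N}
    (γ δ : Path x y) : γ.Homotopic δ := by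
  rw [← hm_eq, ← cancel_mono (κ y), h x y γ (subset_univ _), h x y δ (subset_univ _)]

theorem path_lc [LocallyPathConnectedSpace N] {G : Type*} {f : N → G} {A : Set N} (hA : IsOpen A)
    (h : ∀ (x y : N) (γ : Path x y), range γ ⊆ A → f x = f y) : LC f A := by
  intro x hx
  obtain ⟨W, ⟨hW, hWp⟩, hWA⟩ := (path_connected_basis x).mem_iff.1 (hA.mem_nhds hx)
  filter_upwards [hW] with z hz
  obtain ⟨γ, hγ⟩ := hWp.joinedIn z hz x (mem_of_mem_nhds hW)
  exact h _ _ γ (range_subset_iff.2 fun t => hWA (hγ t))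

theorem vk [LocallyPathConnectedSpace N] {q : N} {κ ν : ∀ x : N, (⟨x⟩ : FundamentalGroupoid N) ⟶ ⟨q⟩} {A B : Set N}
    (hA : IsOpen A) (hB : IsOpen B) (hAB : A ∪ B = univ) (h1 : Tv κ A) (h2 : Tv ν B) (hF : FAC A B) {x y : N}
    (γ δ : Path x y) : γ.Homotopic δ := by
  classical
  letI : Group ((⟨q⟩ : FundamentalGroupoid N) ⟶ ⟨q⟩) := Groupoid.vertexGroup _
  obtain ⟨a, b, ha, hb, hab⟩ := hF ((⟨q⟩ : FundamentalGroupoid N) ⟶ ⟨q⟩) (fun x => Groupoid.inv (κ x) ≫ ν x)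
    (path_lc (hA.inter hB) fun x y γ hγ => by
      simp only [← h1 x y γ fun _ h => (hγ h).1, ← h2 x y γ fun _ h => (hγ h).2]
      simp)
  have hab' : ∀ x ∈ A ∩ B, κ x ≫ Groupoid.inv (a x) = ν x ≫ Groupoid.inv (b x) := by
    intro x hx
    have h : Groupoid.inv (κ x) ≫ ν x = Groupoid.inv (a x) ≫ b x := hab x hx
    have : ν x = κ x ≫ Groupoid.inv (a x) ≫ b x := by rw [← h]; simp
    rw [this]; simp
  have hr : ∀ {x y : N} (γ : Path x y), IsPreconnected (range γ) := fun γ => isPreconnected_range γ.continuous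
  have hs : ∀ {x y : N} (γ : Path x y), x ∈ range γ ∧ y ∈ range γ := fun γ => ⟨⟨0, γ.source⟩, ⟨1, γ.target⟩⟩
  have e1 : ∀ x ∈ A, (if x ∈ A then κ x ≫ Groupoid.inv (a x) else ν x ≫ Groupoid.inv (b x)) = κ x ≫ Groupoid.inv (a x) :=
    fun x hx => if_pos hx
  have e2 : ∀ x ∈ B, (if x ∈ A then κ x ≫ Groupoid.inv (a x) else ν x ≫ Groupoid.inv (b x)) = ν x ≫ Groupoid.inv (b x) := by
    intro x hx
    split_ifs with h
    · exact hab' x ⟨h, hx⟩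
    · rfl
  refine Tv.unique (q := q) (κ := fun x => if x ∈ A then κ x ≫ Groupoid.inv (a x) else ν x ≫ Groupoid.inv (b x))
    (Tv.glue hA hB hAB ?_ ?_) γ δ
  · intro x y γ hγ
    simp only [e1 x (hγ (hs γ).1), e1 y (hγ (hs γ).2)]
    rw [← Category.assoc, h1 x y γ hγ, ha.const (hr γ) hγ (hs γ).1 (hs γ).2]
  · intro x y γ hγ
    simp only [e2 x (hγ (hs γ).1), e2 y (hγ (hs γ).2)]
    rw [← Category.assoc, h2 x y γ hγ, hb.const (hr γ) hγ (hs γ).1 (hs γ).2]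

/-- a homotopy to a point trivializes paths -/
theorem tr_of_htpy [PathConnectedSpace N] {q : N} {A : Set N} (H : N × I → N) (hH : ContinuousOn H (A ×ˢ univ))
    (h0 : ∀ x ∈ A, H (x, 0) = x) (h1 : ∀ x ∈ A, H (x, 1) = q) :
    ∃ κ : ∀ x : N, (⟨x⟩ : FundamentalGroupoid N) ⟶ ⟨q⟩, Tv κ A := by
  classical
  have hc : ∀ x ∈ A, Continuous fun t : I => H (x, t) := fun x hx =>
    hH.comp_continuous (by fun_prop) fun t => ⟨hx, mem_univ _⟩
  refine ⟨fun x => if hx : x ∈ A then hm ⟨⟨_, hc x hx⟩, h0 x hx, h1 x hx⟩ else hm (PathConnectedSpace.somePath x q), ?_⟩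
  intro x y γ hγ
  have hx : x ∈ A := hγ ⟨0, γ.source⟩
  have hy : y ∈ A := hγ ⟨1, γ.target⟩
  simp only [dif_pos hx, dif_pos hy]
  rw [← hm_trans, hm_eq]
  have hK : Continuous fun p : I × I => H (γ p.1, p.2) :=
    hH.comp_continuous (by fun_prop) fun p => ⟨hγ ⟨_, rfl⟩, mem_univ _⟩
  let K : C(I × I, N) := ⟨_, hK⟩
  let p1 : Path ((0, 0) : I × I) (1, 0) := ⟨⟨fun s => (s, 0), by fun_prop⟩, rfl, rfl⟩
  let p2 : Path ((1, 0) : I × I) (1, 1) := ⟨⟨fun s => (1, s), by fun_prop⟩, rfl, rfl⟩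
  let p3 : Path ((0, 0) : I × I) (0, 1) := ⟨⟨fun s => (0, s), by fun_prop⟩, rfl, rfl⟩
  let p4 : Path ((0, 1) : I × I) (1, 1) := ⟨⟨fun s => (s, 1), by fun_prop⟩, rfl, rfl⟩
  have hh : (p1.trans p2).Homotopic (p3.trans p4) := by
    haveI : ContractibleSpace I := (convex_Icc (0:ℝ) 1).contractibleSpace ⟨0, by simp⟩
    exact SimplyConnectedSpace.paths_homotopic _ _
  have hx0 : x = K (0, 0) := by simp [K, h0 x hx]
  have hq : q = K (1, 1) := by simp [K, h1 y hy]
  have hh2 := (hh.map K).pathCast hx0 hq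
  refine Path.Homotopic.trans ?_ (hh2.trans (Path.Homotopic.trans ?_ ⟨Path.Homotopy.transRefl _⟩))
  · refine hm_eq.1 (congrArg hm ?_)
    ext t
    simp only [Path.trans_apply, Path.cast_coe, Path.map_coe, Function.comp]
    split_ifs
    · exact (h0 _ (hγ ⟨_, rfl⟩)).symm
    · simp [K, p2]
  · refine hm_eq.1 (congrArg hm ?_)
    ext t
    simp only [Path.trans_apply, Path.cast_coe, Path.map_coe, Function.comp]
    split_ifs
    · simp [K, p3]
    · exact h1 _ (hγ ⟨_, rfl⟩)
end
end CS

open scoped Topology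
namespace CS
set_option linter.all false
open Set unitInterval

section
universe u
variable {M : Type u} [TopologicalSpace M]

theorem FAC.sub {A B Y : Set M} (hY : IsOpen Y) (hA : A ⊆ Y) (h : FAC A B) :
    FAC ((↑) ⁻¹' A : Set Y) ((↑) ⁻¹' B : Set Y) := by
  classical
  intro G _ g hg
  have e : ∀ x : Y, (if h : (x:M) ∈ Y then g ⟨x, h⟩ else 1) = g x := fun x => dif_pos x.2
  obtain ⟨a, b, ha, hb, hab⟩ := h G (fun x => if h : x ∈ Y then g ⟨x, h⟩ else 1) (by
    intro x hx
    have h1 := hg ⟨x, hA hx.1⟩ hx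
    have h2 := hY.isOpenEmbedding_subtypeVal.map_nhds_eq ⟨x, hA hx.1⟩
    rw [show 𝓝 x = _ from h2.symm, Filter.eventually_map]
    filter_upwards [h1] with z hz
    rw [e z, hz]
    exact (e ⟨x, hA hx.1⟩).symm)
  refine ⟨fun x => a x, fun x => b x, ?_, ?_, fun x hx => ?_⟩
  · exact fun x hx => continuous_subtype_val.continuousAt.eventually (ha x hx)
  · exact fun x hx => continuous_subtype_val.continuousAt.eventually (hb x hx)
  · rw [← hab x hx, e x]

theorem Ctr.tv {A Y : Set M} [PathConnectedSpace Y] (hAY : A ⊆ Y) (h : Ctr A Y) (hY : IsPathConnected Y) (q : Y) :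
    ∃ κ : ∀ x : Y, (⟨x⟩ : FundamentalGroupoid Y) ⟶ ⟨q⟩, Tv κ ((↑) ⁻¹' A) := by
  classical
  obtain ⟨H, h1, h2, h3, h4⟩ := h.to hY q.2
  have hm : ∀ p : Y × I, (p.1 : M) ∈ A → H (p.1, p.2) ∈ Y := fun p hp => h4 ⟨hp, p.2.2⟩
  refine tr_of_htpy (fun p => if hp : (p.1 : M) ∈ A then ⟨H (p.1, p.2), hm p hp⟩ else q) ?_ ?_ ?_
  · rw [Topology.IsEmbedding.subtypeVal.continuousOn_iff]
    refine ContinuousOn.congr (f := fun p : Y × I => H (p.1, p.2)) ?_ ?_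
    · exact h1.comp (f := fun p : Y × I => ((p.1 : M), (p.2 : ℝ))) (by fun_prop) fun p hp => ⟨hp.1, p.2.2⟩
    · intro p hp
      have : (p.1 : M) ∈ A := hp.1
      simp [this]
  · intro x hx
    have : (x : M) ∈ A := hx
    simp [this, h2 x this]
  · intro x hx
    have : (x : M) ∈ A := hx
    simp [this, h3 x this]

/-- van Kampen type criterion for simple connectivity -/
theorem sc_of [LocallyPathConnectedSpace M] {A B Y : Set M} (hY : IsOpen Y) (hpc : IsPathConnected Y) (hA : IsOpen A)
    (hB : IsOpen B) (hAB : A ∪ B = Y) (cA : Ctr A Y) (cB : Ctr B Y) (h : CB A B) : SC Y := by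
  intro ω ω' hω hω' mω mω' e0 e1
  haveI : PathConnectedSpace Y := isPathConnected_iff_pathConnectedSpace.1 hpc
  haveI : LocallyPathConnectedSpace Y := hY.locallyPathConnectedSpace
  have hAY : A ⊆ Y := by rw [← hAB]; exact subset_union_left
  have hBY : B ⊆ Y := by rw [← hAB]; exact subset_union_right
  have i0 : (0:ℝ) ∈ Icc (0:ℝ) 1 := by simp
  have i1 : (1:ℝ) ∈ Icc (0:ℝ) 1 := by simp
  let x0 : Y := ⟨ω 0, mω i0⟩
  let x1 : Y := ⟨ω 1, mω i1⟩
  obtain ⟨κ, hκ⟩ := cA.tv hAY hpc x0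
  obtain ⟨ν, hν⟩ := cB.tv hBY hpc x0
  let γ : Path x0 x1 := ⟨⟨fun t => ⟨ω t, mω t.2⟩, (hω.comp_continuous continuous_subtype_val fun t => t.2).subtype_mk _⟩, rfl, rfl⟩
  let δ : Path x0 x1 := ⟨⟨fun t => ⟨ω' t, mω' t.2⟩, (hω'.comp_continuous continuous_subtype_val fun t => t.2).subtype_mk _⟩,
    Subtype.ext e0.symm, Subtype.ext e1.symm⟩
  obtain ⟨F⟩ := vk (hA.preimage continuous_subtype_val) (hB.preimage continuous_subtype_val)
    (by rw [← preimage_union, hAB]; exact Subtype.coe_preimage_self Y) hκ hν ((h.fac hA hB).sub hY hAY) γ δ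
  have pj : ∀ t ∈ Icc (0:ℝ) 1, ((projIcc 0 1 zero_le_one t : I) : ℝ) = t := fun t ht => by rw [projIcc_of_mem _ ht]
  have p0 : projIcc (0:ℝ) 1 zero_le_one 0 = 0 := projIcc_left _
  have p1 : projIcc (0:ℝ) 1 zero_le_one 1 = 1 := projIcc_right _
  refine ⟨fun p => (F (projIcc 0 1 zero_le_one p.1, projIcc 0 1 zero_le_one p.2) : Y), ?_, fun p _ => Subtype.coe_prop _, ?_, ?_, ?_, ?_⟩
  · refine Continuous.continuousOn (continuous_subtype_val.comp (F.continuous.comp ?_))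
    exact (continuous_projIcc.comp continuous_fst).prodMk (continuous_projIcc.comp continuous_snd)
  · intro t ht
    simp only [p0, ContinuousMap.HomotopyWith.apply_zero]
    exact congrArg ω (pj t ht)
  · intro t ht
    simp only [p1, ContinuousMap.HomotopyWith.apply_one]
    exact congrArg ω' (pj t ht)
  · intro t ht
    simp only [p0, Path.Homotopy.source]
    rfl
  · intro t ht
    simp only [p1, Path.Homotopy.target]
    rfl

variable {n : ℕ} {Ψ : OpenPartialHomeomorph (Eu n) M}

theorem cb_on [T2Space M] [CompactSpace M] [ConnectedSpace M] (hM : Mf n M) (hn : 2 ≤ n)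
    {A B : Set M} (hA : IsOpen A) (hB : IsOpen B) (hAB : A ∪ B = univ) (cA : Ctr A univ) (cB : Ctr B univ) : CB A B := by
  classical
  intro E hE hEAB
  have hop : ∀ x, x ∈ A ∨ x ∈ B := fun x => by
    have : x ∈ (univ : Set M) := mem_univ x
    rwa [← hAB] at this
  obtain ⟨w, hw0, hw1, -⟩ := exists_continuous_zero_one_of_isClosed hB.isClosed_compl hA.isClosed_compl
    (Set.disjoint_left.2 fun x hx hx' => (hop x).elim hx' hx)
  set α : Co M := fun v => match v with
    | [z, y] => if w z < 1/2 ∧ w y < 1/2 then ch E z + ch E y else 0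
    | _ => 0 with hα
  have hα2 : ∀ z y, α [z, y] = if w z < 1/2 ∧ w y < 1/2 then ch E z + ch E y else 0 := fun z y => rfl
  have hA1 : ∀ x ∈ B, ∃ O ∈ 𝓝 x, ∀ z ∈ O, ∀ y ∈ O, α [z, y] = 0 := by
    intro x hxB
    by_cases hxA : x ∈ A
    · refine ⟨_, hE x ⟨hxA, hxB⟩, fun z hz y hy => ?_⟩
      rw [hα2]
      have : ch E z = ch E y := by
        have hz' : z ∈ E ↔ x ∈ E := hz
        have hy' : y ∈ E ↔ x ∈ E := hy
        simp only [ch, hz', hy']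
      rw [this, z2, ite_self]
    · refine ⟨{z | 1/2 < w z}, w.continuous.continuousAt.eventually (lt_mem_nhds (by rw [hw1 hxA]; norm_num)), fun z hz y hy => ?_⟩
      rw [hα2, if_neg]
      rintro ⟨h, -⟩
      exact absurd h (not_lt.2 (le_of_lt hz))
  have hB1 : ∀ x, x ∉ B → ∃ O ∈ 𝓝 x, ∀ z ∈ O, ∀ y ∈ O, α [z, y] = ch E z + ch E y := by
    intro x hxB
    refine ⟨{z | w z < 1/2}, w.continuous.continuousAt.eventually (gt_mem_nhds (by rw [hw0 hxB]; norm_num)), fun z hz y hy => ?_⟩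
    rw [hα2, if_pos ⟨hz, hy⟩]
  have hd : dd α ∈ Sp 3 ∅ := by
    rw [mem_Sp]
    intro x _
    have h3 : ∀ O : Set M, (∀ a b c, a ∈ O → b ∈ O → c ∈ O → dd α [a, b, c] = 0) →
        ∀ v : List M, v.length = 3 → (∀ y ∈ v, y ∈ O) → dd α v = 0 := by
      intro O h v hv hvO
      match v, hv with
      | [a, b, c], _ => exact h a b c (hvO a (by simp)) (hvO b (by simp)) (hvO c (by simp))
    by_cases hxB : x ∈ B
    · obtain ⟨O, hO, h⟩ := hA1 x hxB
      refine ⟨O, hO, h3 O fun a b c ha hb hc => ?_⟩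
      rw [dd_three, h b hb c hc, h a ha c hc, h a ha b hb]; simp
    · obtain ⟨O, hO, h⟩ := hB1 x hxB
      refine ⟨O, hO, h3 O fun a b c ha hb hc => ?_⟩
      rw [dd_three, h b hb c hc, h a ha c hc, h a ha b hb]
      linear_combination z2 (ch E a) + z2 (ch E b) + z2 (ch E c)
  obtain ⟨l, hl⟩ := one_exact hn hM hA hB hAB cA cB hd
  have hlr : ∀ x, ∀ᶠ z in 𝓝 x, l z = l x + α [z, x] := by
    intro x
    obtain ⟨O, hO, h⟩ := hl x
    filter_upwards [hO] with z hz
    rw [h _ hz _ (mem_of_mem_nhds hO)]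
    linear_combination -z2 (l x)
  have hz : LC l B := by
    intro x hx
    obtain ⟨O, hO, h⟩ := hA1 x hx
    filter_upwards [hlr x, hO] with z h1 h2
    rw [h1, h z h2 x (mem_of_mem_nhds hO), add_zero]
  refine ⟨l, hz, ?_⟩
  intro x hx
  by_cases hxB : x ∈ B
  · filter_upwards [hz x hxB, hE x ⟨hx, hxB⟩] with z h1 h2
    simp only [h1, ch, h2]
  · obtain ⟨O, hO, h⟩ := hB1 x hxB
    filter_upwards [hlr x, hO] with z h1 h2
    rw [h1, h z h2 x (mem_of_mem_nhds hO)]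
    linear_combination z2 (ch E z)
end
end CS

open scoped Topology
namespace CS
set_option linter.all false
open Set unitInterval

section
universe u
variable {M : Type u} [TopologicalSpace M] {n : ℕ} {Ψ : OpenPartialHomeomorph (Eu n) M}

theorem sw_ne (hs : Ψ.source = Metric.ball 0 2) (i0 : Fin n) (i : ℕ) : Ψ (sw i0 i) ≠ Ψ 0 := by
  intro h
  have h1 : sw i0 i = 0 := Ψ.injOn ((mem_src hs).2 (by rw [norm_sw]; norm_num)) ((mem_src hs).2 (by simp)) h
  have := norm_sw i0 i
  rw [h1] at this
  simp at this

theorem key [T2Space M] [CompactSpace M] [ConnectedSpace M] (hM : Mf n M) (i0 : Fin n)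
    (hi0 : (i0 : ℕ) = 0) (hs : Ψ.source = Metric.ball 0 2)
    {k : ℕ} (hk : 1 ≤ k) (hc : lsCat M ≤ k) :
    ∃ U' : Fin (k+1) → Set M, (∀ i : Fin (k+1), Good Ψ (sR i0 i) (sl (sw i0 i)) (sw i0 i) (U' i) {Ψ 0}ᶜ) ∧ XX Ψ ⊆ ⋃ i, U' i := by
  have hn : 1 ≤ n := by have := i0.2; omega
  have hpc := compl_pc hM hn hs
  have hpu := hM.pc
  haveI := hM.lpc
  rcases Nat.lt_or_ge 1 n with hn2 | hn1
  · obtain ⟨U, u1, u2, u3⟩ := cat_cover hM hc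
    obtain ⟨V, v1, v2⟩ := half_half hs hpu i0 hk u1 u2 u3
    rcases Nat.lt_or_ge 1 k with hk2 | hk1
    · exact swap_all hk2 hM hs hpc v1 (fun i => sw_ne hs i0 i) v2
    · obtain rfl : k = 1 := le_antisymm hk1 hk
      have hUV : U 0 ∪ U 1 = univ := by
        rw [← u2]; ext x; simp [mem_iUnion, Fin.exists_fin_two]
      have sc1 : SC (univ : Set M) := sc_of isOpen_univ hpu (u1 0) (u1 1) hUV (u3 0) (u3 1)
        (cb_on hM hn2 (u1 0) (u1 1) hUV (u3 0) (u3 1))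
      have sc2 : SC ({Ψ 0}ᶜ : Set M) := by
        obtain ⟨A, B, hA, hB, hAB, cA, cB, sA, sB⟩ := two_cover hM hn hs hpu hpc (u1 0) (u1 1) hUV (u3 0) (u3 1)
        exact sc_of isOpen_compl_singleton hpc hA hB hAB cA cB
          (cb_off hM hn2 hs (u1 0) (u1 1) hUV (u3 0) (u3 1) hA hB hAB sA sB)
      have hcv : ∀ x ∈ XX Ψ, x ∈ V 0 ∨ x ∈ V 1 := fun x hx => by
        simpa [mem_iUnion, Fin.exists_fin_two] using v2 hx
      obtain ⟨A, B, gA, gB, hAB⟩ := proc hM hs (v1 0) (v1 1) (sw_ne hs i0 _) (mem_univ _) (subset_univ _) hpu sc1 hcv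
      obtain ⟨C, D, gC, gD, hCD⟩ := proc hM hs gB gA (sw_ne hs i0 _) (sw_ne hs i0 _) subset_rfl hpc sc2
        (fun x hx => (hAB x hx).symm)
      refine ⟨![D, C], ?_, fun x hx => ?_⟩
      · intro i
        fin_cases i
        · exact gD
        · exact gC
      · rcases hCD x hx with h | h
        · exact mem_iUnion.2 ⟨1, h⟩
        · exact mem_iUnion.2 ⟨0, h⟩
  · obtain rfl : n = 1 := le_antisymm hn1 hn
    obtain rfl : i0 = 0 := Subsingleton.elim _ _
    exact one_dim hM hs hpc hk
end
end CS

theorem lsCat_connectedSum_le {n : ℕ} {M N : Type*} [TopologicalSpace M] [TopologicalSpace N]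
    [CompactSpace M] [CompactSpace N] [T2Space M] [T2Space N]
    [ConnectedSpace M] [ConnectedSpace N]
    [ChartedSpace (EuclideanSpace ℝ (Fin n)) M] [ChartedSpace (EuclideanSpace ℝ (Fin n)) N]
    (e : ↥(Metric.ball (0 : EuclideanSpace ℝ (Fin n)) 2) → M)
    (e' : ↥(Metric.ball (0 : EuclideanSpace ℝ (Fin n)) 2) → N)
    (he : Topology.IsOpenEmbedding e) (he' : Topology.IsOpenEmbedding e') :
    lsCat (ConnectedSum e e') ≤ max (lsCat M) (lsCat N) := by
  rcases Nat.eq_zero_or_pos n with rfl | hn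
  · rw [CS.final_zero he he']
    exact Nat.zero_le _
  · have hM : CS.Mf n M := CS.mf_charted
    have hN : CS.Mf n N := CS.mf_charted
    obtain ⟨Ψ, hs, hΨ⟩ := CS.exists_psi he
    obtain ⟨Ψ', hs', hΨ'⟩ := CS.exists_psi he'
    have hk : 1 ≤ max (lsCat M) (lsCat N) := (CS.cat_pos hM hn.ne').trans (le_max_left _ _)
    obtain ⟨U, u1, u2⟩ := CS.key hM ⟨0, hn⟩ rfl hs hk (le_max_left _ _)
    obtain ⟨V, v1, v2⟩ := CS.key hN ⟨0, hn⟩ rfl hs' hk (le_max_right _ _)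
    exact CS.glue hs hΨ hs' hΨ' (fun i => CS.norm_sw _ _)
      (fun i v hv t ht => CS.sl_norm ht.1 hv.le (CS.norm_sw _ _).le) u1 u2 v1 v2
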